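/- Over a field k of characteristic ≠ 2, an even-dimensional quadratic form q of dimension ≥ 4 is an I^3-neighbor of complementary dimension 2 if and only if c(q) = [(a, d_± q / k)] in Br(k) for some a ∈ k^×, where d_± q = (−1)^{(dim q)(dim q − 1)/2}·det q is the signed determinant of q and (a, b / k) denotes the quaternion algebra over k generated by i, j with i² = a, j² = b, ij = −ji. -/

import Mathlib

open scoped Quaternion

/-!  Diagonal quadratic forms over a field of characteristic ≠ 2.
In characteristic ≠ 2 every regular quadratic form is isometric to a diagonal form
`⟨d 1, …, d n⟩`, so we model (regular) quadratic forms by their diagonal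
coefficient functions. -/

/-- The diagonal quadratic form `⟨d i⟩_{i : ι}` over `k`. -/
noncomputable def diagQF (k : Type) [Field k] {ι : Type} [Fintype ι] (d : ι → k) :
    QuadraticForm k (ι → k) :=
  QuadraticMap.weightedSumSquares k d

/-- Isometry of (diagonal) quadratic forms. -/
def FormIsom (k : Type) [Field k] {ι κ : Type} [Fintype ι] [Fintype κ]
    (d : ι → k) (e : κ → k) : Prop :=
  QuadraticMap.Equivalent (diagQF k d) (diagQF k e)

/-- The orthogonal sum of `m` copies of the hyperbolic plane `⟨1, -1⟩`. -/
def hypForm (k : Type) [Field k] (m : ℕ) : Fin (2 * m) → k :=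
  fun j => if j.val % 2 = 0 then 1 else -1

/-- The Witt index of a (diagonal) form: the largest `m` such that the form is isometric
to `m·ℍ ⟂ (rest)` for some diagonal form `rest`. -/
noncomputable def wittIndex (k : Type) [Field k] {ι : Type} [Fintype ι] (d : ι → k) : ℕ :=
  sSup {m : ℕ | ∃ (s : ℕ) (e : Fin s → k), FormIsom k d (Sum.elim (hypForm k m) e)}
/-- Witt equivalence of (diagonal) quadratic forms: the two forms become isometric after
adding suitable numbers of hyperbolic planes. -/
def wittEquiv (k : Type) [Field k] {ι κ : Type} [Fintype ι] [Fintype κ]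
    (d : ι → k) (e : κ → k) : Prop :=
  ∃ a b : ℕ, FormIsom k (Sum.elim d (hypForm k a)) (Sum.elim e (hypForm k b))

/-- The Witt class of a (diagonal) form lies in `I^n(k)`, the `n`-th power of the
fundamental ideal of the Witt ring: equivalently (since `I^n(k)` is additively generated
by the `n`-fold Pfister forms, and `-⟨⟨a₁,…,aₙ⟩⟩ = ⟨-1⟩·⟨⟨a₁,…,aₙ⟩⟩` in the Witt ring),
the form is Witt equivalent to an orthogonal sum of scaled `n`-fold Pfister forms
`c_s · ⟨⟨a_{s,1}, …, a_{s,n}⟩⟩`.  The diagonal entries of `⟨⟨a₁,…,aₙ⟩⟩` are indexed by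
the subsets `S ⊆ {1,…,n}`, with entry `∏_{u ∈ S} a_u`. -/
def inIpow (k : Type) [Field k] (n : ℕ) {ι : Type} [Fintype ι] (d : ι → k) : Prop :=
  ∃ (t : ℕ) (c : Fin t → k) (a : Fin t → Fin n → k),
    (∀ s, c s ≠ 0) ∧ (∀ s u, a s u ≠ 0) ∧
    wittEquiv k d (fun p : Fin t × Finset (Fin n) => c p.1 * ∏ u ∈ p.2, a p.1 u)

/-- `q` is an `I^n`-neighbor of complementary dimension `r`: there exists an
`r`-dimensional (regular) form `σ` with `0 ≤ r < dim q` such that the Witt class of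
`q ⟂ σ` lies in `I^n(k)`. -/
def isIneighbor (k : Type) [Field k] (n : ℕ) {m : ℕ} (d : Fin m → k) (r : ℕ) : Prop :=
  r < m ∧ ∃ σ : Fin r → k, (∀ t, σ t ≠ 0) ∧ inIpow k n (Sum.elim d σ)
/-- Brauer equivalence of two `k`-algebras: they become isomorphic after taking matrix
algebras of suitable (positive) sizes. -/
def brauerEquiv (k : Type) [Field k] (A B : Type) [Ring A] [Algebra k A] [Ring B]
    [Algebra k B] : Prop :=
  ∃ n m : ℕ, 0 < n ∧ 0 < m ∧
    Nonempty (Matrix (Fin n) (Fin n) A ≃ₐ[k] Matrix (Fin m) (Fin m) B)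

namespace Mk

section K2
variable {K : Type} [Field K] {K' : Type} [Field K'] {G : Type*} [AddCommGroup G]

def K2rel (K : Type) [Field K] : Set (FreeAbelianGroup (K × K)) :=
  {z | (∃ x y w : K, x ≠ 0 ∧ y ≠ 0 ∧ z = .of (x * y, w) - .of (x, w) - .of (y, w)) ∨
    (∃ x y w : K, x ≠ 0 ∧ y ≠ 0 ∧ z = .of (w, x * y) - .of (w, x) - .of (w, y)) ∨
    (∃ x y : K, (x = 0 ∨ y = 0 ∨ x + y = 1) ∧ z = .of (x, y))}

def K2 (K : Type) [Field K] : Type :=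
  FreeAbelianGroup (K × K) ⧸ AddSubgroup.closure (K2rel K)

noncomputable instance : AddCommGroup (K2 K) :=
  inferInstanceAs (AddCommGroup (FreeAbelianGroup (K × K) ⧸ AddSubgroup.closure (K2rel K)))

noncomputable def K2.mk : FreeAbelianGroup (K × K) →+ K2 K :=
  QuotientAddGroup.mk' (AddSubgroup.closure (K2rel K))

theorem K2.mk_surj : Function.Surjective (K2.mk (K := K)) := QuotientAddGroup.mk'_surjective _

noncomputable def st (x y : K) : K2 K := K2.mk (.of (x, y))

theorem K2.mk_rel {z : FreeAbelianGroup (K × K)} (h : z ∈ K2rel K) : K2.mk z = 0 :=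
  (QuotientAddGroup.eq_zero_iff _).2 (AddSubgroup.subset_closure h)

theorem st_mul_left {x y : K} (w : K) (hx : x ≠ 0) (hy : y ≠ 0) :
    st (x * y) w = st x w + st y w := by
  have := K2.mk_rel (z := .of (x * y, w) - .of (x, w) - .of (y, w)) (Or.inl ⟨x, y, w, hx, hy, rfl⟩)
  rw [map_sub, map_sub, sub_sub, sub_eq_zero] at this
  exact this

theorem st_mul_right {x y : K} (w : K) (hx : x ≠ 0) (hy : y ≠ 0) :
    st w (x * y) = st w x + st w y := by
  have := K2.mk_rel (z := .of (w, x * y) - .of (w, x) - .of (w, y))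
    (Or.inr (Or.inl ⟨x, y, w, hx, hy, rfl⟩))
  rw [map_sub, map_sub, sub_sub, sub_eq_zero] at this
  exact this

theorem st_stein {x y : K} (h : x + y = 1) : st x y = 0 :=
  K2.mk_rel (Or.inr (Or.inr ⟨x, y, Or.inr (Or.inr h), rfl⟩))
@[simp] theorem st_zero_left (y : K) : st 0 y = 0 :=
  K2.mk_rel (Or.inr (Or.inr ⟨0, y, Or.inl rfl, rfl⟩))
@[simp] theorem st_zero_right (y : K) : st y 0 = 0 :=
  K2.mk_rel (Or.inr (Or.inr ⟨y, 0, Or.inr (Or.inl rfl), rfl⟩))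

structure IsSym (f : K → K → G) : Prop where
  zl : ∀ y, f 0 y = 0
  zr : ∀ y, f y 0 = 0
  ml : ∀ x y w, x ≠ 0 → y ≠ 0 → w ≠ 0 → f (x * y) w = f x w + f y w
  mr : ∀ x y w, x ≠ 0 → y ≠ 0 → w ≠ 0 → f w (x * y) = f w x + f w y
  s : ∀ x y, x ≠ 0 → y ≠ 0 → x + y = 1 → f x y = 0

noncomputable def K2.lift (f : K → K → G) (hf : IsSym f) : K2 K →+ G :=
  QuotientAddGroup.lift _ (FreeAbelianGroup.lift (fun p : K × K => f p.1 p.2)) (by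
    rw [AddSubgroup.closure_le]
    rintro z (⟨x, y, w, hx, hy, rfl⟩ | ⟨x, y, w, hx, hy, rfl⟩ | ⟨x, y, h, rfl⟩)
    · by_cases hw : w = 0
      · simp [hw, hf.zr]
      · simp [hf.ml x y w hx hy hw]
    · by_cases hw : w = 0
      · simp [hw, hf.zl]
      · simp [hf.mr x y w hx hy hw]
    · by_cases hx : x = 0
      · simp [hx, hf.zl]
      by_cases hy : y = 0
      · simp [hy, hf.zr]
      rcases h with h | h | h
      · exact absurd h hx
      · exact absurd h hy
      · simpa using hf.s x y hx hy h)

@[simp] theorem K2.lift_st (f : K → K → G) (hf : IsSym f) (x y : K) :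
    K2.lift f hf (st x y) = f x y := by
  have : K2.lift f hf (st x y) = FreeAbelianGroup.lift (fun p : K × K => f p.1 p.2) (.of (x, y)) := rfl
  rw [this]; simp

@[elab_as_elim]
theorem K2.ind {P : K2 K → Prop} (z : K2 K) (h0 : P 0)
    (h1 : ∀ x y, x ≠ 0 → y ≠ 0 → P (st x y)) (hn : ∀ x, P x → P (-x))
    (ha : ∀ x y, P x → P y → P (x + y)) : P z := by
  have h1' : ∀ x y, P (st x y) := by
    intro x y
    by_cases hx : x = 0
    · simpa [hx] using h0
    by_cases hy : y = 0
    · simpa [hy] using h0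
    exact h1 x y hx hy
  obtain ⟨z, rfl⟩ := K2.mk_surj z
  induction z using FreeAbelianGroup.induction_on with
  | zero => simpa using h0
  | of x => exact h1' x.1 x.2
  | neg x h => rw [map_neg]; exact hn _ h
  | add x y hx hy => rw [map_add]; exact ha _ _ hx hy

theorem K2.hom_ext {f g : K2 K →+ G} (h : ∀ x y, x ≠ 0 → y ≠ 0 → f (st x y) = g (st x y)) :
    f = g := by
  ext z
  induction z using K2.ind with
  | h0 => simp
  | h1 x y hx hy => exact h x y hx hy
  | hn x h => simp [h]
  | ha x y hx hy => simp [hx, hy]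

theorem st_isSym_map (φ : K →+* K') : IsSym (fun x y => st (φ x) (φ y)) where
  zl := by simp
  zr := by simp
  ml x y w hx hy _ := by simp [st_mul_left, hx, hy]
  mr x y w hx hy _ := by simp [st_mul_right, hx, hy]
  s x y _ _ h := st_stein (by rw [← map_add, h, map_one])

noncomputable def K2.map (φ : K →+* K') : K2 K →+ K2 K' := K2.lift _ (st_isSym_map φ)
@[simp] theorem K2.map_st (φ : K →+* K') (x y : K) : K2.map φ (st x y) = st (φ x) (φ y) :=
  K2.lift_st _ _ _ _

theorem K2.map_map {K'' : Type} [Field K''] (φ : K →+* K') (ψ : K' →+* K'') (z : K2 K) :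
    K2.map ψ (K2.map φ z) = K2.map (ψ.comp φ) z := by
  have : (K2.map ψ).comp (K2.map φ) = K2.map (ψ.comp φ) := K2.hom_ext (by simp)
  rw [← this]; rfl

theorem K2.map_id (z : K2 K) : K2.map (RingHom.id K) z = z := by
  have : K2.map (RingHom.id K) = AddMonoidHom.id _ := K2.hom_ext (by simp)
  rw [this]; rfl

@[simp] theorem st_one_left (y : K) : st 1 y = 0 := by
  have := st_mul_left (x := (1 : K)) (y := 1) y one_ne_zero one_ne_zero
  simpa using this
@[simp] theorem st_one_right (y : K) : st y 1 = 0 := by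
  have := st_mul_right (x := (1 : K)) (y := 1) y one_ne_zero one_ne_zero
  simpa using this
theorem st_inv_left (x y : K) : st x⁻¹ y = - st x y := by
  by_cases hx : x = 0
  · simp [hx]
  have := st_mul_left (x := x) (y := x⁻¹) y hx (inv_ne_zero hx)
  rw [mul_inv_cancel₀ hx, st_one_left] at this
  rw [eq_neg_iff_add_eq_zero, add_comm]; exact this.symm
theorem st_inv_right (x y : K) : st y x⁻¹ = - st y x := by
  by_cases hx : x = 0
  · simp [hx]
  have := st_mul_right (x := x) (y := x⁻¹) y hx (inv_ne_zero hx)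
  rw [mul_inv_cancel₀ hx, st_one_right] at this
  rw [eq_neg_iff_add_eq_zero, add_comm]; exact this.symm
theorem st_div_left {x y : K} (w : K) (hx : x ≠ 0) (hy : y ≠ 0) :
    st (x / y) w = st x w - st y w := by
  rw [div_eq_mul_inv, st_mul_left _ hx (inv_ne_zero hy), st_inv_left, sub_eq_add_neg]
theorem st_div_right {x y : K} (w : K) (hx : x ≠ 0) (hy : y ≠ 0) :
    st w (x / y) = st w x - st w y := by
  rw [div_eq_mul_inv, st_mul_right _ hx (inv_ne_zero hy), st_inv_right, sub_eq_add_neg]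

theorem st_self_neg (x : K) : st x (-x) = 0 := by
  by_cases hx : x = 0
  · simp [hx]
  by_cases h1 : x = 1
  · simp [h1]
  have e : -x = (1 - x) / (1 - x⁻¹) := by
    have : 1 - x⁻¹ ≠ 0 := by
      rw [sub_ne_zero]; intro h; exact h1 (by simpa using h.symm)
    have h2 : x - 1 ≠ 0 := sub_ne_zero.2 h1
    field_simp
    ring
  have h3 : (1 - x) ≠ 0 := sub_ne_zero.2 (Ne.symm h1)
  have h4 : (1 - x⁻¹) ≠ 0 := by
    rw [sub_ne_zero]; intro h; exact h1 (by simpa using h.symm)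
  rw [e, st_div_right _ h3 h4, st_stein (by ring), zero_sub, ← st_inv_left, st_stein (by ring)]

theorem st_anti (x y : K) : st x y = - st y x := by
  by_cases hx : x = 0
  · simp [hx]
  by_cases hy : y = 0
  · simp [hy]
  have h := st_self_neg (x * y)
  have hxy : -(x * y) = (-x) * y := by ring
  rw [st_mul_left _ hx hy, hxy, st_mul_right _ (neg_ne_zero.2 hx) hy, st_self_neg x,
    show -x * y = x * -y by ring, st_mul_right _ hx (neg_ne_zero.2 hy), st_self_neg y] at h
  rw [eq_neg_iff_add_eq_zero]; simpa using h

theorem st_self (x : K) : st x x = st x (-1) := by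
  by_cases hx : x = 0
  · simp [hx]
  have := st_mul_right x (x := -1) (y := -x) (by simp) (by simpa using hx)
  simpa [st_self_neg] using this
theorem two_st_neg_one (x : K) : (2 : ℕ) • st x (-1) = 0 := by
  have := st_mul_right x (x := (-1 : K)) (y := -1) (by simp) (by simp)
  rw [two_smul, ← this]; simp
theorem two_st_neg_one' (x : K) : (2 : ℕ) • st (-1) x = 0 := by
  rw [st_anti, smul_neg, two_st_neg_one, neg_zero]
theorem st_pow_left {x : K} (y : K) (hx : x ≠ 0) (n : ℕ) : st (x ^ n) y = n • st x y := by
  induction n with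
  | zero => simp
  | succ n ih => rw [pow_succ, st_mul_left _ (pow_ne_zero _ hx) hx, ih, succ_nsmul]
theorem st_pow_right {x : K} (y : K) (hx : x ≠ 0) (n : ℕ) : st y (x ^ n) = n • st y x := by
  rw [st_anti, st_pow_left _ hx, st_anti x y, smul_neg, neg_neg]

end K2

end Mk

set_option linter.all false
namespace Mk
section Place

def IsCo {R k : Type} [CommRing R] [Field k] (v : R → ℤ) (lc : R → k) (n : ℤ) (x : R) (c : k) : Prop :=
  (x ≠ 0 → n ≤ v x) ∧ (x ≠ 0 → v x = n → c = lc x) ∧ ((x ≠ 0 → v x ≠ n) → c = 0)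

structure Pl (R k : Type) [CommRing R] [Field k] where
  v : R → ℤ
  lc : R →*₀ k
  lc_ne : ∀ x, x ≠ 0 → lc x ≠ 0
  v_mul : ∀ x y, x ≠ 0 → y ≠ 0 → v (x * y) = v x + v y
  add' : ∀ (n : ℤ) (x y : R) (c d : k), IsCo v lc n x c → IsCo v lc n y d → IsCo v lc n (x + y) (c + d)

namespace Pl
variable {R k : Type} [CommRing R] [IsDomain R] [Field k] (p : Pl R k)

def ge (n : ℤ) (x : R) : Prop := x ≠ 0 → n ≤ p.v x
open Classical in
noncomputable def co (n : ℤ) (x : R) : k := if x ≠ 0 ∧ p.v x = n then p.lc x else 0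


variable {p}
theorem ge_zero (n : ℤ) : p.ge n 0 := fun h => absurd rfl h
theorem co_zero (n : ℤ) : p.co n 0 = 0 := by simp [co]
theorem isCo_iff {n x c} : IsCo p.v p.lc n x c ↔ p.ge n x ∧ p.co n x = c := by
  unfold IsCo ge co
  by_cases h : x ≠ 0 ∧ p.v x = n
  · rw [if_pos h]; simp only [ne_eq, h.1, h.2, not_false_eq_true, true_and, forall_const]
    simp; exact eq_comm
  · rw [if_neg h]; push Not at h
    constructor
    · rintro ⟨h1, h2, h3⟩; exact ⟨h1, (h3 h).symm⟩
    · rintro ⟨h1, h2⟩; exact ⟨h1, fun a b => absurd b (h a), fun _ => h2.symm⟩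
theorem ge_add {n x y} (hx : p.ge n x) (hy : p.ge n y) : p.ge n (x + y) :=
  (isCo_iff.1 (p.add' n x y _ _ (isCo_iff.2 ⟨hx, rfl⟩) (isCo_iff.2 ⟨hy, rfl⟩))).1
theorem co_add {n x y} (hx : p.ge n x) (hy : p.ge n y) : p.co n (x + y) = p.co n x + p.co n y :=
  (isCo_iff.1 (p.add' n x y _ _ (isCo_iff.2 ⟨hx, rfl⟩) (isCo_iff.2 ⟨hy, rfl⟩))).2
theorem v_one : p.v 1 = 0 := by
  have := p.v_mul 1 1 one_ne_zero one_ne_zero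
  simp at this; exact this
theorem v_neg_one : p.v (-1) = 0 := by
  have := p.v_mul (-1) (-1) (by simp) (by simp)
  simp [v_one] at this; omega
theorem v_neg (x : R) : p.v (-x) = p.v x := by
  by_cases hx : x = 0
  · simp [hx]
  rw [neg_eq_neg_one_mul, p.v_mul _ _ (by simp) hx, v_neg_one, zero_add]
theorem co_v {x : R} (hx : x ≠ 0) : p.co (p.v x) x = p.lc x := by simp [co, hx]
theorem co_eq {x : R} {n : ℤ} (hx : x ≠ 0) (h : p.v x = n) : p.co n x = p.lc x := by
  subst h; exact co_v hx
theorem ge_v (x : R) : p.ge (p.v x) x := fun _ => le_rfl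
theorem ge_of_eq {x : R} {n : ℤ} (h : p.v x = n) : p.ge n x := fun _ => h.ge
theorem lc_neg_one : p.lc (-1) = -1 := by
  have h := co_add (p := p) (n := 0) (x := 1) (y := -1) (fun _ => v_one.ge) (fun _ => v_neg_one.ge)
  rw [co_eq one_ne_zero v_one, co_eq (by simp) v_neg_one, add_neg_cancel, co_zero, map_one] at h
  linear_combination -h
theorem lc_neg (x : R) : p.lc (-x) = - p.lc x := by
  rw [neg_eq_neg_one_mul, map_mul, lc_neg_one]; ring
theorem ge_neg {n x} (hx : p.ge n x) : p.ge n (-x) := by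
  intro h; rw [v_neg]; exact hx (by simpa using h)
theorem co_neg (n : ℤ) (x : R) : p.co n (-x) = - p.co n x := by
  by_cases h : x ≠ 0 ∧ p.v x = n
  · rw [co, co, if_pos h, if_pos ⟨neg_ne_zero.2 h.1, by rw [v_neg]; exact h.2⟩, lc_neg]
  · rw [co, co, if_neg h, if_neg (by rw [v_neg, neg_ne_zero]; exact h), neg_zero]
theorem co_sub {n x y} (hx : p.ge n x) (hy : p.ge n y) : p.co n (x - y) = p.co n x - p.co n y := by
  rw [sub_eq_add_neg, co_add hx (ge_neg hy), co_neg, sub_eq_add_neg]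
theorem ge_mul {n m x y} (hx : p.ge n x) (hy : p.ge m y) : p.ge (n + m) (x * y) := by
  intro h
  have h1 := left_ne_zero_of_mul h
  have h2 := right_ne_zero_of_mul h
  rw [p.v_mul _ _ h1 h2]; have := hx h1; have := hy h2; omega
theorem co_mul {n m x y} (hx : p.ge n x) (hy : p.ge m y) :
    p.co (n + m) (x * y) = p.co n x * p.co m y := by
  by_cases h1 : x = 0
  · simp [h1, co_zero]
  by_cases h2 : y = 0
  · simp [h2, co_zero]
  have := hx h1
  have := hy h2
  simp only [co, p.v_mul _ _ h1 h2, ne_eq, h1, h2, mul_eq_zero, or_self, not_false_eq_true, true_and]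
  split_ifs <;> first | omega | simp
theorem ge_mono {n m : ℤ} {x : R} (h : m ≤ n) (hx : p.ge n x) : p.ge m x := fun h0 => h.trans (hx h0)
theorem co_lt {n m : ℤ} {x : R} (h : m < n) (hx : p.ge n x) : p.co m x = 0 := by
  by_cases h1 : x = 0
  · simp [h1, co_zero]
  have := hx h1
  rw [co, if_neg]; rintro ⟨_, h⟩; omega
theorem of_co_ne {n : ℤ} {x : R} (h : p.co n x ≠ 0) : x ≠ 0 ∧ p.v x = n ∧ p.lc x = p.co n x := by
  by_cases h1 : x ≠ 0 ∧ p.v x = n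
  · exact ⟨h1.1, h1.2, by simp [co, h1]⟩
  · simp [co, h1] at h
theorem co_eq_zero_iff {n : ℤ} {x : R} (h : p.ge n x) : p.co n x = 0 ↔ p.ge (n + 1) x := by
  constructor
  · intro h0 hx
    have := h hx
    rcases this.lt_or_eq with h2 | h2
    · omega
    · rw [co_eq hx h2.symm] at h0
      exact absurd h0 (p.lc_ne x hx)
  · intro h0; exact co_lt (by omega) h0
theorem v_pow {x : R} (hx : x ≠ 0) (n : ℕ) : p.v (x ^ n) = n * p.v x := by
  induction n with
  | zero => simp [v_one]
  | succ n ih => rw [pow_succ, p.v_mul _ _ (pow_ne_zero _ hx) hx, ih]; push_cast; ring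

section field
variable {K : Type} [Field K] (q : Pl K k)

theorem c1 {x y : K} (h : x + y = 1) (hx : x ≠ 0) (h0 : 0 < q.v x) :
    q.v y = 0 ∧ q.lc y = 1 := by
  have e : y = 1 - x := by linear_combination h
  have h1 : q.co 0 y = 1 := by
    rw [e, co_sub (ge_of_eq v_one) (fun _ => h0.le), co_eq one_ne_zero v_one, map_one,
      co_lt h0 (ge_v x), sub_zero]
  have := of_co_ne (p := q) (n := 0) (x := y) (by simp [h1])
  exact ⟨this.2.1, by rw [this.2.2, h1]⟩
theorem c3 {x y : K} (h : x + y = 1) (hx : x ≠ 0) (h0 : q.v x < 0) :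
    q.v y = q.v x ∧ q.lc y = - q.lc x := by
  have e : y = 1 - x := by linear_combination h
  have h1 : q.co (q.v x) y = - q.lc x := by
    rw [e, co_sub (ge_mono h0.le (ge_of_eq v_one)) (ge_v x), co_v hx,
      co_lt h0 (ge_of_eq v_one), zero_sub]
  have := of_co_ne (p := q) (n := q.v x) (x := y) (by simpa [h1] using q.lc_ne x hx)
  exact ⟨this.2.1, by rw [this.2.2, h1]⟩
theorem c2 {x y : K} (h : x + y = 1) (hx : x ≠ 0) (hy : y ≠ 0) (h0 : q.v x = 0) (h1 : q.v y = 0) :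
    q.lc x + q.lc y = 1 := by
  rw [← co_eq hx h0, ← co_eq hy h1, ← co_add (ge_of_eq h0) (ge_of_eq h1), h,
    co_eq one_ne_zero v_one, map_one]
theorem v_inv {x : K} (hx : x ≠ 0) : q.v x⁻¹ = - q.v x := by
  have := q.v_mul x x⁻¹ hx (inv_ne_zero hx)
  rw [mul_inv_cancel₀ hx, v_one] at this; omega
theorem v_div {x y : K} (hx : x ≠ 0) (hy : y ≠ 0) : q.v (x / y) = q.v x - q.v y := by
  rw [div_eq_mul_inv, q.v_mul _ _ hx (inv_ne_zero hy), v_inv q hy]; ring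

open Classical in
noncomputable def tm (x y : K) : Additive kˣ :=
  if h : x ≠ 0 ∧ y ≠ 0 then
    Additive.ofMul ((-1) ^ (q.v x * q.v y) * (Units.mk0 (q.lc y) (q.lc_ne y h.2)) ^ (q.v x) *
      (Units.mk0 (q.lc x) (q.lc_ne x h.1)) ^ (- q.v y)) else 0

theorem tm_isSym : IsSym (q.tm) where
  zl := by simp [tm]
  zr := by simp [tm]
  ml x y w hx hy hw := by
    simp only [tm, ne_eq, mul_eq_zero, hx, hy, hw, or_self, not_false_eq_true, and_self, dite_true,
      ← ofMul_mul, q.v_mul x y hx hy, map_mul, Units.mk0_mul]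
    congr 1
    rw [add_mul, zpow_add, zpow_add, mul_zpow]
    ac_rfl
  mr x y w hx hy hw := by
    simp only [tm, ne_eq, mul_eq_zero, hx, hy, hw, or_self, not_false_eq_true, and_self, dite_true,
      ← ofMul_mul, q.v_mul x y hx hy, map_mul, Units.mk0_mul]
    congr 1
    rw [mul_add, zpow_add, neg_add, zpow_add, mul_zpow]
    ac_rfl
  s x y hx hy h := by
    simp only [tm, ne_eq, hx, hy, not_false_eq_true, and_self, dite_true]
    rw [ofMul_eq_zero]
    rcases lt_trichotomy (q.v x) 0 with h0 | h0 | h0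
    · obtain ⟨h1, h2⟩ := c3 q h hx h0
      have e : Units.mk0 (q.lc y) (q.lc_ne y hy) = -1 * Units.mk0 (q.lc x) (q.lc_ne x hx) := by
        ext; simp [h2]
      rw [h1, e, mul_zpow, zpow_neg]
      have : ((-1 : kˣ) ^ (q.v x * q.v x)) * (-1) ^ q.v x = 1 := by
        rw [← zpow_add]
        refine Even.neg_one_zpow ?_
        have := Int.even_mul_succ_self (q.v x)
        convert this using 1; ring
      rw [← mul_assoc, this]; simp
    · rcases lt_trichotomy (q.v y) 0 with h1 | h1 | h1
      · have := c3 q (by rw [add_comm]; exact h) hy h1; omega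
      · simp [h0, h1]
      · obtain ⟨h2, h3⟩ := c1 q (by rw [add_comm]; exact h) hy h1
        have e : Units.mk0 (q.lc x) (q.lc_ne x hx) = 1 := by ext; simp [h3]
        simp [h0, e]
    · obtain ⟨h2, h3⟩ := c1 q h hx h0
      have e : Units.mk0 (q.lc y) (q.lc_ne y hy) = 1 := by ext; simp [h3]
      simp [h2, e]

noncomputable def tame : K2 K →+ Additive kˣ := K2.lift _ q.tm_isSym

noncomputable def tv (z : K2 K) : k := ((q.tame z).toMul : kˣ)
theorem tv_st {x y : K} (hx : x ≠ 0) (hy : y ≠ 0) :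
    q.tv (st x y) = (-1) ^ (q.v x * q.v y) * q.lc y ^ q.v x * q.lc x ^ (- q.v y) := by
  simp [tv, tame, tm, hx, hy]
theorem tv_add (x y : K2 K) : q.tv (x + y) = q.tv x * q.tv y := by simp [tv]
theorem tv_neg (x : K2 K) : q.tv (-x) = (q.tv x)⁻¹ := by simp [tv]
theorem tv_sub (x y : K2 K) : q.tv (x - y) = q.tv x / q.tv y := by simp [tv]
theorem tv_zero : q.tv 0 = 1 := by simp [tv]
theorem tv_nsmul (n : ℕ) (x : K2 K) : q.tv (n • x) = q.tv x ^ n := by simp [tv]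
theorem tv_ne (x : K2 K) : q.tv x ≠ 0 := by simp [tv]
theorem tame_eq_zero_iff (x : K2 K) : q.tame x = 0 ↔ q.tv x = 1 := by
  simp [tv, ← toMul_eq_one]
theorem tv_unit {x y : K} (hx : q.v x = 0) (hy : q.v y = 0) : q.tv (st x y) = 1 := by
  by_cases h1 : x = 0
  · simp [h1, tv_zero]
  by_cases h2 : y = 0
  · simp [h2, tv_zero]
  rw [tv_st q h1 h2]; simp [hx, hy]

theorem sp_isSym : IsSym (fun x y : K => st (q.lc x) (q.lc y)) where
  zl := by simp
  zr := by simp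
  ml x y w hx hy _ := by
    rw [map_mul, st_mul_left _ (q.lc_ne x hx) (q.lc_ne y hy)]
  mr x y w hx hy _ := by
    rw [map_mul, st_mul_right _ (q.lc_ne x hx) (q.lc_ne y hy)]
  s x y hx hy h := by
    rcases lt_trichotomy (q.v x) 0 with h0 | h0 | h0
    · rw [(c3 q h hx h0).2, st_self_neg]
    · rcases lt_trichotomy (q.v y) 0 with h1 | h1 | h1
      · have := c3 q (by rw [add_comm]; exact h) hy h1; omega
      · exact st_stein (c2 q h hx hy h0 h1)
      · rw [(c1 q (by rw [add_comm]; exact h) hy h1).2, st_one_left]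
    · rw [(c1 q h hx h0).2, st_one_right]

noncomputable def sp : K2 K →+ K2 k := K2.lift _ q.sp_isSym
@[simp] theorem sp_st (x y : K) : q.sp (st x y) = st (q.lc x) (q.lc y) := K2.lift_st _ _ _ _

end field
end Pl
end Place
end Mk

namespace Mk
namespace Pl
variable {R k : Type} [CommRing R] [IsDomain R] [Field k]

def restr {R' : Type} [CommRing R'] [IsDomain R'] (p : Pl R' k) (j : R →+* R')
    (hj : Function.Injective j) : Pl R k where
  v x := p.v (j x)
  lc := p.lc.comp j.toMonoidWithZeroHom
  lc_ne x hx := p.lc_ne _ ((map_ne_zero_iff j hj).2 hx)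
  v_mul x y hx hy := by
    rw [map_mul, p.v_mul _ _ ((map_ne_zero_iff j hj).2 hx) ((map_ne_zero_iff j hj).2 hy)]
  add' n x y c d hx hy := by
    have e : ∀ z c, IsCo (fun x => p.v (j x)) (p.lc.comp j.toMonoidWithZeroHom) n z c ↔
        IsCo p.v p.lc n (j z) c := by
      intro z c
      unfold IsCo
      simp only [ne_eq, map_eq_zero_iff j hj]
      rfl
    have := p.add' n (j x) (j y) c d ((e _ _).1 hx) ((e _ _).1 hy)
    rw [← map_add] at this
    exact (e _ _).2 this

section ext
variable (p : Pl R k) (K : Type) [Field K] [Algebra R K] [IsFractionRing R K]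

noncomputable def num (x : K) : R := (IsLocalization.sec (nonZeroDivisors R) x).1
noncomputable def den (x : K) : R := (IsLocalization.sec (nonZeroDivisors R) x).2

variable {K}
theorem den_ne (x : K) : den (R := R) K x ≠ 0 :=
  nonZeroDivisors.ne_zero (IsLocalization.sec (nonZeroDivisors R) x).2.2
theorem num_den (x : K) : x * algebraMap R K (den K x) = algebraMap R K (num K x) :=
  IsLocalization.sec_spec _ x
theorem am_ne {a : R} (h : a ≠ 0) : algebraMap R K a ≠ 0 :=
  (map_ne_zero_iff _ (IsFractionRing.injective R K)).2 h
theorem num_ne {x : K} (hx : x ≠ 0) : num (R := R) K x ≠ 0 := by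
  intro h
  have := num_den (R := R) x
  rw [h, map_zero, mul_eq_zero] at this
  exact this.elim hx (am_ne (den_ne x))

theorem ext_aux {x : K} {a s : R} (hs : s ≠ 0) (h : x * algebraMap R K s = algebraMap R K a) :
    p.lc (num K x) / p.lc (den K x) = p.lc a / p.lc s ∧
    (x ≠ 0 → p.v (num K x) - p.v (den K x) = p.v a - p.v s) := by
  have e : num K x * s = a * den K x := by
    apply IsFractionRing.injective R K
    rw [map_mul, map_mul, ← num_den, ← h]; ring
  constructor
  · rw [div_eq_div_iff (p.lc_ne _ (den_ne x)) (p.lc_ne _ hs), ← map_mul, ← map_mul, e]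
  · intro hx
    have ha : a ≠ 0 := by
      rintro rfl
      rw [map_zero, mul_eq_zero] at h
      exact h.elim hx (am_ne hs)
    have := congrArg p.v e
    rw [p.v_mul _ _ (num_ne hx) hs, p.v_mul _ _ ha (den_ne x)] at this
    omega

theorem ext_lc {x : K} {a s : R} (hs : s ≠ 0) (h : x * algebraMap R K s = algebraMap R K a) :
    p.lc (num K x) / p.lc (den K x) = p.lc a / p.lc s := (ext_aux p hs h).1
theorem ext_v {x : K} {a s : R} (hx : x ≠ 0) (hs : s ≠ 0)
    (h : x * algebraMap R K s = algebraMap R K a) :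
    p.v (num K x) - p.v (den K x) = p.v a - p.v s := (ext_aux p hs h).2 hx

theorem ext_isCo {x : K} {a s : R} (hs : s ≠ 0) (h : x * algebraMap R K s = algebraMap R K a)
    (n : ℤ) (c : k) : IsCo (fun x : K => p.v (num K x) - p.v (den K x))
      (fun x : K => p.lc (num K x) / p.lc (den K x)) n x c ↔
      IsCo p.v p.lc (n + p.v s) a (c * p.lc s) := by
  have h0 : x ≠ 0 ↔ a ≠ 0 := by
    constructor
    · intro h' h''
      rw [h'', map_zero, mul_eq_zero] at h
      exact h.elim h' (am_ne hs)
    · intro h' h''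
      rw [h'', zero_mul] at h
      exact am_ne (K := K) h' h.symm
  have ls := p.lc_ne s hs
  unfold IsCo
  simp only [ext_lc p hs h, h0, eq_div_iff ls, mul_eq_zero, ls, or_false]
  by_cases ha : a = 0
  · simp [ha]
  · simp only [ext_v p (h0.2 ha) hs h, ne_eq, ha, not_false_eq_true, forall_const]
    have e1 : n ≤ p.v a - p.v s ↔ n + p.v s ≤ p.v a := by omega
    have e2 : p.v a - p.v s = n ↔ p.v a = n + p.v s := by omega
    rw [e1, e2]

variable (K)
noncomputable def ext : Pl K k where
  v x := p.v (num K x) - p.v (den K x)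
  lc :=
    { toFun := fun x => p.lc (num K x) / p.lc (den K x)
      map_zero' := by rw [ext_lc p (a := 0) (s := 1) one_ne_zero (by simp)]; simp
      map_one' := by rw [ext_lc p (a := 1) (s := 1) one_ne_zero (by simp)]; simp
      map_mul' := fun x y => by
        rw [ext_lc p (x := x * y) (a := num K x * num K y) (s := den K x * den K y)
          (mul_ne_zero (den_ne x) (den_ne y)), map_mul, map_mul, mul_div_mul_comm]
        rw [map_mul, map_mul, ← num_den, ← num_den]; ring }
  lc_ne x hx := div_ne_zero (p.lc_ne _ (num_ne hx)) (p.lc_ne _ (den_ne x))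
  v_mul x y hx hy := by
    rw [ext_v p (x := x * y) (a := num K x * num K y) (s := den K x * den K y) (mul_ne_zero hx hy)
          (mul_ne_zero (den_ne x) (den_ne y)), p.v_mul _ _ (num_ne hx) (num_ne hy),
          p.v_mul _ _ (den_ne x) (den_ne y)]
    · ring
    · rw [map_mul, map_mul, ← num_den, ← num_den]; ring
  add' n x y c d hx hy := by
    have st0 : den (R := R) K x * den (R := R) K y ≠ 0 := mul_ne_zero (den_ne x) (den_ne y)
    have ea : x * algebraMap R K (den K x * den K y) = algebraMap R K (num K x * den K y) := by
      rw [map_mul, map_mul, ← num_den]; ring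
    have eb : y * algebraMap R K (den K x * den K y) = algebraMap R K (num K y * den K x) := by
      rw [map_mul, map_mul, ← num_den]; ring
    have eab : (x + y) * algebraMap R K (den K x * den K y) =
      algebraMap R K (num K x * den K y + num K y * den K x) := by
      rw [map_add, add_mul, ea, eb]
    refine (ext_isCo p st0 eab n (c + d)).2 ?_
    rw [add_mul]
    exact p.add' _ _ _ _ _ ((ext_isCo p st0 ea n c).1 hx) ((ext_isCo p st0 eb n d).1 hy)

variable {K}
@[simp] theorem ext_lc_am (a : R) : (p.ext K).lc (algebraMap R K a) = p.lc a := by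
  change p.lc _ / p.lc _ = _
  rw [ext_lc p (a := a) (s := 1) one_ne_zero (by simp)]; simp
@[simp] theorem ext_v_am {a : R} (ha : a ≠ 0) : (p.ext K).v (algebraMap R K a) = p.v a := by
  change p.v _ - p.v _ = _
  rw [ext_v p (am_ne ha) (a := a) (s := 1) one_ne_zero (by simp), v_one, sub_zero]
end ext

section prime
variable [WfDvdMonoid R] (π : R) (hπ : Prime π) (ρ : R →+* k) (hρ : ∀ a, ρ a = 0 ↔ π ∣ a)

theorem ex_fac {π : R} (hπ : Prime π) {a : R} (ha : a ≠ 0) :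
    ∃ (n : ℕ) (c : R), ¬ π ∣ c ∧ a = π ^ n * c := by
  obtain ⟨n, c, h1, h2⟩ := WfDvdMonoid.max_power_factor ha hπ.irreducible
  exact ⟨n, c, h1, h2⟩

theorem fac_uniq {π : R} (hπ : Prime π) {n m : ℕ} {c d : R} (hc : ¬ π ∣ c) (hd : ¬ π ∣ d)
    (h : π ^ n * c = π ^ m * d) : n = m ∧ c = d := by
  have key : ∀ {n m : ℕ} {c d : R}, ¬ π ∣ c → ¬ π ∣ d → π ^ n * c = π ^ m * d → n ≤ m := by
    intro n m c d hc hd h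
    by_contra hlt
    push Not at hlt
    obtain ⟨e, rfl⟩ := Nat.exists_eq_add_of_lt hlt
    apply hd
    have : π ^ m * d = π ^ m * (π * (π ^ e * c)) := by rw [← h]; ring
    exact ⟨_, mul_left_cancel₀ (pow_ne_zero _ hπ.ne_zero) this⟩
  have e := le_antisymm (key hc hd h) (key hd hc h.symm)
  subst e
  exact ⟨rfl, mul_left_cancel₀ (pow_ne_zero _ hπ.ne_zero) h⟩

open Classical in
noncomputable def pord (hπ : Prime π) (a : R) : ℕ := if h : a = 0 then 0 else (ex_fac hπ h).choose
open Classical in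
noncomputable def pun (hπ : Prime π) (a : R) : R :=
  if h : a = 0 then 0 else (ex_fac hπ h).choose_spec.choose

variable {π}
theorem p_spec {a : R} (h : a ≠ 0) : ¬ π ∣ pun π hπ a ∧ a = π ^ (pord π hπ a) * pun π hπ a := by
  simp only [pun, pord, h, dite_false]
  exact (ex_fac hπ h).choose_spec.choose_spec
theorem p_eq {a c : R} {n : ℕ} (hc : ¬ π ∣ c) (h : a = π ^ n * c) :
    pord π hπ a = n ∧ pun π hπ a = c := by
  have ha : a ≠ 0 := by
    rw [h]; exact mul_ne_zero (pow_ne_zero _ hπ.ne_zero) (by rintro rfl; simp at hc)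
  have := p_spec hπ ha
  exact fac_uniq hπ this.1 hc (by rw [← this.2, h])

theorem prime_isCo {π : R} (hπ : Prime π) (ρ : R →+* k) (hρ : ∀ a, ρ a = 0 ↔ π ∣ a) (n : ℕ) (x : R) (c : k) : IsCo (fun a => (pord π hπ a : ℤ))
    (fun a => ρ (pun π hπ a)) n x c ↔ ∃ e, x = π ^ n * e ∧ ρ e = c := by
  by_cases hx : x = 0
  · subst hx
    simp only [IsCo]
    constructor
    · intro h; exact ⟨0, by simp, by simpa using (h.2.2 (by simp)).symm⟩
    · rintro ⟨e, he, rfl⟩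
      have : e = 0 := by simpa [hπ.ne_zero] using he
      simp [this]
  obtain ⟨h1, h2⟩ := p_spec hπ hx
  simp only [IsCo, ne_eq, hx, not_false_eq_true, forall_const, Nat.cast_le, Nat.cast_inj]
  constructor
  · rintro ⟨h3, h4, h5⟩
    obtain ⟨e, he⟩ := Nat.exists_eq_add_of_le h3
    refine ⟨π ^ e * pun π hπ x, by rw [← mul_assoc, ← pow_add, ← he]; exact h2, ?_⟩
    rcases Nat.eq_zero_or_pos e with h | h
    · subst h; rw [h4 (by omega)]; simp
    · rw [h5 (by omega), map_mul, map_pow, (hρ π).2 dvd_rfl, zero_pow (by omega), zero_mul]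
  · rintro ⟨e, rfl, rfl⟩
    have he : e ≠ 0 := by rintro rfl; simp at hx
    by_cases hc : π ∣ e
    · obtain ⟨d, rfl⟩ := hc
      have hd : d ≠ 0 := by rintro rfl; simp at he
      have := p_eq hπ (a := π ^ n * (π * d)) (c := pun π hπ d) (n := n + 1 + pord π hπ d)
        (p_spec hπ hd).1
        (by conv_lhs => rw [(p_spec hπ hd).2]
            ring)
      refine ⟨by omega, fun h => by omega, fun _ => ?_⟩
      rw [map_mul, (hρ π).2 dvd_rfl, zero_mul]
    · have := p_eq hπ (a := π ^ n * e) (n := n) hc rfl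
      refine ⟨by omega, fun h => by rw [this.2], fun h => absurd this.1 h⟩

noncomputable def prime : Pl R k where
  v a := pord π hπ a
  lc :=
    { toFun := fun a => ρ (pun π hπ a)
      map_zero' := by simp [pun]
      map_one' := by
        rw [(p_eq hπ (a := 1) (c := 1) (n := 0) hπ.not_dvd_one (by simp)).2, map_one]
      map_mul' := fun x y => by
        by_cases hx : x = 0
        · simp [hx, pun]
        by_cases hy : y = 0
        · simp [hy, pun]
        have h1 := p_spec hπ hx
        have h2 := p_spec hπ hy
        rw [(p_eq hπ (a := x * y) (c := pun π hπ x * pun π hπ y)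
          (n := pord π hπ x + pord π hπ y) (hπ.not_dvd_mul h1.1 h2.1)
          (by conv_lhs => rw [h1.2, h2.2]
              ring)).2, map_mul] }
  lc_ne x hx := by
    change ρ _ ≠ 0
    rw [Ne, hρ]; exact (p_spec hπ hx).1
  v_mul x y hx hy := by
    have h1 := p_spec hπ hx
    have h2 := p_spec hπ hy
    rw [(p_eq hπ (a := x * y) (c := pun π hπ x * pun π hπ y)
          (n := pord π hπ x + pord π hπ y) (hπ.not_dvd_mul h1.1 h2.1)
          (by conv_lhs => rw [h1.2, h2.2]
              ring)).1]
    push_cast; rfl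
  add' n x y c d hx hy := by
    rcases lt_or_ge n 0 with hn | hn
    · have g : ∀ z (c : k), IsCo (fun a => (pord π hπ a : ℤ)) (fun a => ρ (pun π hπ a)) n z c ↔ c = 0 := by
        intro z c
        constructor
        · intro h; exact h.2.2 (fun _ => by simp only; omega)
        · intro h
          exact ⟨fun _ => by simp only; omega, fun _ h => by simp only at h; omega, fun _ => h⟩
      refine (g _ _).2 ?_
      rw [(g x c).1 hx, (g y d).1 hy, add_zero]
    obtain ⟨n, rfl⟩ := Int.eq_ofNat_of_zero_le hn
    obtain ⟨e, he, rfl⟩ := (prime_isCo hπ ρ hρ n x c).1 hx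
    obtain ⟨f, hf, rfl⟩ := (prime_isCo hπ ρ hρ n y d).1 hy
    exact (prime_isCo hπ ρ hρ n _ _).2 ⟨e + f, by rw [he, hf]; ring, map_add _ _ _⟩

theorem prime_eq {a c : R} {n : ℕ} (hc : ¬ π ∣ c) (h : a = π ^ n * c) :
    (prime hπ ρ hρ).v a = n ∧ (prime hπ ρ hρ).lc a = ρ c := by
  have := p_eq hπ hc h
  exact ⟨by rw [← this.1]; rfl, by rw [← this.2]; rfl⟩
theorem prime_unit {a : R} (hc : ¬ π ∣ a) :
    (prime hπ ρ hρ).v a = 0 ∧ (prime hπ ρ hρ).lc a = ρ a :=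
  prime_eq hπ ρ hρ (n := 0) hc (by simp)
theorem prime_self : (prime hπ ρ hρ).v π = 1 ∧ (prime hπ ρ hρ).lc π = 1 := by
  have := prime_eq hπ ρ hρ (a := π) (n := 1) (c := 1) hπ.not_dvd_one (by simp)
  simpa using this
theorem prime_nonneg (a : R) : 0 ≤ (prime hπ ρ hρ).v a := Int.natCast_nonneg _
end prime

section deg
open Polynomial
variable (L : Type) [Field L]
noncomputable def deg : Pl L[X] L where
  v f := - (f.natDegree : ℤ)
  lc := { toFun := leadingCoeff, map_zero' := by simp, map_one' := by simp,
          map_mul' := leadingCoeff_mul }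
  lc_ne x hx := leadingCoeff_ne_zero.2 hx
  v_mul x y hx hy := by rw [natDegree_mul hx hy]; push_cast; ring
  add' n x y c d hx hy := by
    have key : ∀ (z : L[X]) (c : L), IsCo (fun f : L[X] => - (f.natDegree : ℤ)) leadingCoeff n z c ↔
        (∀ m : ℕ, n = - (m : ℤ) → z.natDegree ≤ m ∧ z.coeff m = c) ∧ (0 < n → z = 0 ∧ c = 0) := by
      intro z c
      by_cases hz : z = 0
      · subst hz
        simp only [IsCo]
        constructor
        · rintro ⟨-, -, h⟩
          have := h (by simp)
          simp [this]
        · rintro ⟨h1, h2⟩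
          refine ⟨by simp, by simp, fun _ => ?_⟩
          rcases lt_or_ge 0 n with h | h
          · exact (h2 h).2
          · simpa using (h1 (-n).toNat (by omega)).2.symm
      · simp only [IsCo, ne_eq, hz, not_false_eq_true, forall_const]
        constructor
        · rintro ⟨h1, h2, h3⟩
          refine ⟨fun m hm => ⟨by omega, ?_⟩, fun h => by omega⟩
          by_cases h : z.natDegree = m
          · rw [h2 (by omega), ← h]; rfl
          · rw [h3 (by omega), coeff_eq_zero_of_natDegree_lt (by omega)]
        · rintro ⟨h1, h2⟩
          rcases lt_or_ge 0 n with h | h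
          · exact absurd (h2 h).1 (by simp)
          · obtain ⟨h3, h4⟩ := h1 (-n).toNat (by omega)
            refine ⟨by omega, fun h => ?_, fun h => ?_⟩
            · rw [← h4, leadingCoeff, show z.natDegree = (-n).toNat by omega]
            · rw [← h4, coeff_eq_zero_of_natDegree_lt (by omega)]
    refine (key _ _).2 ?_
    have h1 := (key _ _).1 hx
    have h2 := (key _ _).1 hy
    refine ⟨fun m hm => ⟨natDegree_add_le_of_degree_le (h1.1 m hm).1 (h2.1 m hm).1, ?_⟩, fun h => ?_⟩
    · rw [coeff_add, (h1.1 m hm).2, (h2.1 m hm).2]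
    · rw [(h1.2 h).1, (h1.2 h).2, (h2.2 h).1, (h2.2 h).2]; simp
end deg

theorem tame_compat {K K' k' : Type} [Field K] [Field K'] [Field k'] (q : Pl K k) (q' : Pl K' k')
    (j : K →+* K') (ι : k →+* k') (κ : k') (hκ : κ ≠ 0)
    (hv : ∀ x, x ≠ 0 → q'.v (j x) = q.v x)
    (hl : ∀ x, x ≠ 0 → q'.lc (j x) = ι (q.lc x) * κ ^ (q.v x)) (z : K2 K) :
    q'.tv (K2.map j z) = ι (q.tv z) := by
  induction z using K2.ind with
  | h0 => simp [tv_zero]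
  | h1 x y hx hy =>
    rw [K2.map_st, tv_st q' (by simpa) (by simpa), tv_st q hx hy, hv x hx, hv y hy, hl x hx, hl y hy]
    simp only [map_mul, map_zpow₀, map_neg, map_one, mul_zpow]
    have : (κ ^ q.v y) ^ q.v x * (κ ^ q.v x) ^ (- q.v y) = 1 := by
      rw [← zpow_mul, ← zpow_mul, ← zpow_add₀ hκ]
      ring_nf; simp
    linear_combination ((-1) ^ (q.v x * q.v y) * (ι (q.lc y)) ^ q.v x * (ι (q.lc x)) ^ (- q.v y)) * this
  | hn x h => rw [map_neg, tv_neg, tv_neg, h, map_inv₀]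
  | ha x y hx hy => rw [map_add, tv_add, tv_add, hx, hy, map_mul]

end Pl
end Mk

namespace Mk
section S2

structure Dg {F R : Type} [Field F] [CommRing R] (ι : F →+* R) (dg : R → ℕ) : Prop where
  mul : ∀ x y, x ≠ 0 → y ≠ 0 → dg (x * y) = dg x + dg y
  add : ∀ x y, dg (x + y) ≤ max (dg x) (dg y)
  neg : ∀ x, dg (-x) = dg x
  zero : dg 0 = 0
  con : ∀ x, dg x = 0 → ∃ c, ι c = x

def Pr (R : Type) [CommRing R] : Type :=
  {π : R // Prime π ∧ π = Quotient.out (Associates.mk π)}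

variable {F R : Type} [Field F] [CommRing R] [IsDomain R]

theorem Pr.exists_rep {ϖ : R} (h : Prime ϖ) : ∃ π : Pr R, ∃ u : Rˣ, ϖ = u * π.1 := by
  have e : Associates.mk (Quotient.out (Associates.mk ϖ)) = Associates.mk ϖ := Quotient.out_eq _
  obtain ⟨u, hu⟩ := Associates.mk_eq_mk_iff_associated.1 e
  refine ⟨⟨Quotient.out (Associates.mk ϖ), ?_, by rw [e]⟩, u, ?_⟩
  · exact (Associates.mk_eq_mk_iff_associated.1 e).symm.prime h
  · exact hu.symm.trans (mul_comm _ _)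

theorem Pr.eq_of_dvd {π π' : Pr R} (h : π.1 ∣ π'.1) : π = π' := by
  have := π.2.1.associated_of_dvd π'.2.1 h
  have e := Associates.mk_eq_mk_iff_associated.2 this
  refine Subtype.ext ?_
  rw [π.2.2, π'.2.2, e]

def Rk (π : Pr R) : Type := R ⧸ Ideal.span {π.1}

section
variable {ι : F →+* R} {dg : R → ℕ}
theorem Dg.one (D : Dg ι dg) : dg 1 = 0 := by
  have := D.mul 1 1 one_ne_zero one_ne_zero
  simp at this; exact this
theorem Dg.unit (D : Dg ι dg) (u : Rˣ) : dg u = 0 := by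
  have := D.mul u (↑u⁻¹) u.ne_zero (u⁻¹).ne_zero
  rw [Units.mul_inv, D.one] at this; omega
theorem Dg.const (D : Dg ι dg) {c : F} (h : c ≠ 0) : dg (ι c) = 0 :=
  D.unit (Units.map ι.toMonoidHom (Units.mk0 c h))
theorem Dg.sub (D : Dg ι dg) (x y : R) : dg (x - y) ≤ max (dg x) (dg y) := by
  rw [sub_eq_add_neg, ← D.neg y]; exact D.add _ _
theorem Dg.isUnit (D : Dg ι dg) {x : R} (hx : x ≠ 0) (h : dg x = 0) : IsUnit x := by
  obtain ⟨c, rfl⟩ := D.con x h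
  have : c ≠ 0 := by rintro rfl; simp at hx
  exact (IsUnit.mk0 c this).map ι
theorem Dg.not_dvd (D : Dg ι dg) {x y : R} (hx : x ≠ 0) (h : dg x < dg y) : ¬ y ∣ x := by
  rintro ⟨z, rfl⟩
  rw [D.mul _ _ (left_ne_zero_of_mul hx) (right_ne_zero_of_mul hx)] at h; omega

end
variable [IsPrincipalIdealRing R]

noncomputable instance (π : Pr R) : Field (Rk π) :=
  @Ideal.Quotient.field R _ (Ideal.span {π.1})
    (PrincipalIdealRing.isMaximal_of_irreducible π.2.1.irreducible)

noncomputable def rho (π : Pr R) : R →+* Rk π := Ideal.Quotient.mk _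
theorem rho_eq_zero (π : Pr R) (a : R) : rho π a = 0 ↔ π.1 ∣ a := by
  rw [← Ideal.mem_span_singleton]; exact Ideal.Quotient.eq_zero_iff_mem
theorem rho_surj (π : Pr R) : Function.Surjective (rho π) := Ideal.Quotient.mk_surjective

variable (K : Type) [Field K] [Algebra R K] [IsFractionRing R K]
local notation "↟" => algebraMap R K

noncomputable def pl (π : Pr R) : Pl K (Rk π) := (Pl.prime π.2.1 (rho π) (rho_eq_zero π)).ext K

variable {K}
theorem am_ne {a : R} (h : a ≠ 0) : ↟ a ≠ 0 := Pl.am_ne h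
theorem pl_unit {π : Pr R} {a : R} (h : ¬ π.1 ∣ a) : (pl K π).v (↟ a) = 0 := by
  have ha : a ≠ 0 := by rintro rfl; simp at h
  rw [pl, Pl.ext_v_am _ ha]; exact (Pl.prime_unit _ _ _ h).1
theorem pl_unit' {π : Pr R} {a : R} (h : ¬ π.1 ∣ a) : (pl K π).lc (↟ a) = rho π a := by
  rw [pl, Pl.ext_lc_am]; exact (Pl.prime_unit _ _ _ h).2
theorem pl_self (π : Pr R) : (pl K π).v (↟ π.1) = 1 := by
  rw [pl, Pl.ext_v_am _ π.2.1.ne_zero]; exact (Pl.prime_self _ _ _).1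
theorem pl_self' (π : Pr R) : (pl K π).lc (↟ π.1) = 1 := by
  rw [pl, Pl.ext_lc_am]; exact (Pl.prime_self _ _ _).2
theorem pl_nonneg (π : Pr R) {a : R} (h : a ≠ 0) : 0 ≤ (pl K π).v (↟ a) := by
  rw [pl, Pl.ext_v_am _ h]; exact (Pl.prime_nonneg _ _ _ _)
theorem pl_pos (π : Pr R) {a : R} (h : a ≠ 0) (hd : π.1 ∣ a) : 0 < (pl K π).v (↟ a) := by
  obtain ⟨c, rfl⟩ := hd
  have hc : c ≠ 0 := right_ne_zero_of_mul h
  rw [map_mul, Pl.v_mul _ _ _ (am_ne π.2.1.ne_zero) (am_ne hc), pl_self]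
  have := pl_nonneg (K := K) π hc
  omega
theorem tv_self {π : Pr R} {a : R} (h : ¬ π.1 ∣ a) :
    (pl K π).tv (st (↟ π.1) (↟ a)) = rho π a := by
  have ha : a ≠ 0 := by rintro rfl; simp at h
  rw [Pl.tv_st _ (am_ne π.2.1.ne_zero) (am_ne ha), pl_unit h, pl_self, pl_unit' h]; simp
theorem tv_units {π : Pr R} {a b : R} (h : ¬ π.1 ∣ a) (h' : ¬ π.1 ∣ b) :
    (pl K π).tv (st (↟ a) (↟ b)) = 1 := Pl.tv_unit _ (pl_unit h) (pl_unit h')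

variable (K) (ι : F →+* R) (dg : R → ℕ)
noncomputable def CC : AddSubgroup (K2 K) := AddSubgroup.closure {z | ∃ x c, z = st x (↟ (ι c))}
noncomputable def MM (d : ℕ) : AddSubgroup (K2 K) :=
  AddSubgroup.closure {z | ∃ f g : R, dg f ≤ d ∧ dg g ≤ d ∧ z = st (↟ f) (↟ g)}
variable {K ι dg}

theorem cc_mem (x : K) (c : F) : st x (↟ (ι c)) ∈ CC K ι := AddSubgroup.subset_closure ⟨x, c, rfl⟩
theorem mm_mem {d : ℕ} {f g : R} (hf : dg f ≤ d) (hg : dg g ≤ d) : st (↟ f) (↟ g) ∈ MM K dg d :=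
  AddSubgroup.subset_closure ⟨f, g, hf, hg, rfl⟩
theorem mm_mono {d e : ℕ} (h : d ≤ e) : MM K dg d ≤ MM K dg e :=
  AddSubgroup.closure_mono fun _ ⟨f, g, hf, hg, e⟩ => ⟨f, g, hf.trans h, hg.trans h, e⟩

section
variable (D : Dg ι dg)
theorem res_cc (π : Pr R) {z : K2 K} (hz : z ∈ CC K ι) :
    ∃ c, c ≠ 0 ∧ (pl K π).tv z = rho π (ι c) := by
  induction hz using AddSubgroup.closure_induction with
  | mem z h =>
    obtain ⟨x, c, rfl⟩ := h
    by_cases hc : c = 0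
    · exact ⟨1, by simp, by simp [hc, Pl.tv_zero]⟩
    by_cases hx : x = 0
    · exact ⟨1, by simp, by simp [hx, Pl.tv_zero]⟩
    have hu : IsUnit (ι c) := (IsUnit.mk0 c hc).map ι
    have hd : ¬ π.1 ∣ ι c := fun h => π.2.1.not_unit (isUnit_of_dvd_unit h hu)
    refine ⟨c ^ (pl K π).v x, zpow_ne_zero _ hc, ?_⟩
    rw [Pl.tv_st _ hx (am_ne hu.ne_zero), pl_unit hd, pl_unit' hd]
    simp only [mul_zero, zpow_zero, neg_zero, one_mul, mul_one]
    change _ = ((rho π).comp ι) _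
    rw [map_zpow₀]; rfl
  | zero => exact ⟨1, by simp, by simp [Pl.tv_zero]⟩
  | add x y _ _ h1 h2 =>
    obtain ⟨c, hc, h1⟩ := h1
    obtain ⟨d, hd, h2⟩ := h2
    exact ⟨c * d, mul_ne_zero hc hd, by rw [Pl.tv_add, h1, h2]; simp⟩
  | neg x _ h1 =>
    obtain ⟨c, hc, h1⟩ := h1
    refine ⟨c⁻¹, inv_ne_zero hc, ?_⟩
    rw [Pl.tv_neg, h1]
    change _ = ((rho π).comp ι) _
    rw [map_inv₀]; rfl

theorem res_mm (D : Dg ι dg) {d : ℕ} (π : Pr R) (h : d < dg π.1) {z : K2 K} (hz : z ∈ MM K dg d) :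
    (pl K π).tv z = 1 := by
  induction hz using AddSubgroup.closure_induction with
  | mem z h' =>
    obtain ⟨f, g, hf, hg, rfl⟩ := h'
    by_cases hf0 : f = 0
    · simp [hf0, Pl.tv_zero]
    by_cases hg0 : g = 0
    · simp [hg0, Pl.tv_zero]
    exact tv_units (D.not_dvd hf0 (by omega)) (D.not_dvd hg0 (by omega))
  | zero => simp [Pl.tv_zero]
  | add x y _ _ h1 h2 => rw [Pl.tv_add, h1, h2, one_mul]
  | neg x _ h1 => rw [Pl.tv_neg, h1, inv_one]

theorem fac (D : Dg ι dg) {e : ℕ} {f : R} (hf : f ≠ 0) (h : dg f ≤ e + 1) :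
    ∃ a b, f = a * b ∧ a ≠ 0 ∧ b ≠ 0 ∧ dg a ≤ e ∧ (dg b ≤ e ∨ ∃ π : Pr R, b = π.1 ∧ dg b = e + 1) := by
  rcases Nat.lt_or_ge (dg f) (e + 1) with h1 | h1
  · exact ⟨f, 1, by simp, hf, one_ne_zero, by omega, Or.inl (by rw [D.one]; omega)⟩
  have hu : ¬ IsUnit f := by rintro ⟨u, rfl⟩; rw [D.unit] at h1; omega
  by_cases hi : Irreducible f
  · obtain ⟨π, u, rfl⟩ := Pr.exists_rep hi.prime
    refine ⟨u, π.1, rfl, u.ne_zero, π.2.1.ne_zero, by rw [D.unit]; omega, Or.inr ⟨π, rfl, ?_⟩⟩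
    rw [D.mul _ _ u.ne_zero π.2.1.ne_zero, D.unit] at h h1; omega
  · rw [irreducible_iff] at hi
    push Not at hi
    obtain ⟨a, b, rfl, ha, hb⟩ := hi hu
    have ha0 := left_ne_zero_of_mul hf
    have hb0 := right_ne_zero_of_mul hf
    have h1 : dg a ≠ 0 := fun h => ha (D.isUnit ha0 h)
    have h2 : dg b ≠ 0 := fun h => hb (D.isUnit hb0 h)
    rw [D.mul _ _ ha0 hb0] at h
    exact ⟨a, b, rfl, ha0, hb0, by omega, Or.inl (by omega)⟩

section layer
variable {e : ℕ}
theorem psi_wd (D : Dg ι dg) {π : Pr R} (hπ : dg π.1 = e + 1) {g h g' h' : R} (hg : g ≠ 0) (hh : h ≠ 0)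
    (hg' : g' ≠ 0) (hh' : h' ≠ 0) (dg1 : dg g ≤ e) (dh : dg h ≤ e) (dg' : dg g' ≤ e) (dh' : dg h' ≤ e)
    (hd : π.1 ∣ g * h' - g' * h) :
    (st (↟ π.1) (↟ g) - st (↟ π.1) (↟ h)) - (st (↟ π.1) (↟ g') - st (↟ π.1) (↟ h')) ∈
      MM K dg e ⊔ CC K ι := by
  have p0 := am_ne (K := K) π.2.1.ne_zero
  have g0 := am_ne (K := K) hg
  have h0 := am_ne (K := K) hh
  have g0' := am_ne (K := K) hg'
  have h0' := am_ne (K := K) hh'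
  obtain ⟨r, hr⟩ := hd
  by_cases r0 : r = 0
  · have : ↟ g * ↟ h' = ↟ g' * ↟ h := by
      rw [← map_mul, ← map_mul]; congr 1; rw [r0, mul_zero] at hr; linear_combination hr
    have := congrArg (st (↟ π.1)) this
    rw [st_mul_right _ g0 h0', st_mul_right _ g0' h0] at this
    have : (st (↟ π.1) (↟ g) - st (↟ π.1) (↟ h)) - (st (↟ π.1) (↟ g') - st (↟ π.1) (↟ h')) = 0 := by
      rw [sub_eq_zero, sub_eq_sub_iff_add_eq_add, this]
    rw [this]; exact zero_mem _
  have dr : dg r ≤ e := by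
    have h1 := D.mul π.1 r π.2.1.ne_zero r0
    rw [← hr] at h1
    have h2 := D.sub (g * h') (g' * h)
    rw [D.mul _ _ hg hh', D.mul _ _ hg' hh] at h2
    omega
  have r0' := am_ne (K := K) r0
  have S : (↟ π.1 * ↟ r) / (↟ g * ↟ h') + (↟ g' * ↟ h) / (↟ g * ↟ h') = 1 := by
    rw [← add_div, div_eq_one_iff_eq (mul_ne_zero g0 h0')]
    rw [← map_mul, ← map_mul, ← map_mul, ← map_add]; congr 1; linear_combination -hr
  have S := st_stein S
  rw [st_div_left _ (mul_ne_zero p0 r0') (mul_ne_zero g0 h0'), st_div_right _ (mul_ne_zero g0' h0) (mul_ne_zero g0 h0'),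
    st_div_right _ (mul_ne_zero g0' h0) (mul_ne_zero g0 h0')] at S
  simp only [st_mul_left _ p0 r0', st_mul_left _ g0 h0', st_mul_right _ g0' h0, st_mul_right _ g0 h0'] at S
  have m : ∀ {a b : R}, dg a ≤ e → dg b ≤ e → st (↟ a) (↟ b) ∈ MM K dg e ⊔ CC K ι :=
    fun ha hb => AddSubgroup.mem_sup_left (mm_mem ha hb)
  have E : (st (↟ π.1) (↟ g) - st (↟ π.1) (↟ h)) - (st (↟ π.1) (↟ g') - st (↟ π.1) (↟ h')) =
     (st (↟ r) (↟ g') + st (↟ r) (↟ h)) - (st (↟ r) (↟ g) + st (↟ r) (↟ h')) -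
     ((st (↟ g) (↟ g') + st (↟ h') (↟ g') + (st (↟ g) (↟ h) + st (↟ h') (↟ h))) -
     (st (↟ g) (↟ g) + st (↟ h') (↟ g) + (st (↟ g) (↟ h') + st (↟ h') (↟ h')))) := by
    rw [← sub_eq_zero, ← neg_eq_zero, ← S]; abel
  rw [E]
  exact sub_mem (sub_mem (add_mem (m dr dg') (m dr dh)) (add_mem (m dr dg1) (m dr dh')))
    (sub_mem (add_mem (add_mem (m dg1 dg') (m dh' dg')) (add_mem (m dg1 dh) (m dh' dh)))
    (add_mem (add_mem (m dg1 dg1) (m dh' dg1)) (add_mem (m dg1 dh') (m dh' dh'))))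

def HH (dg : R → ℕ) (e : ℕ) : Prop := ∀ π : R, Prime π → dg π = e + 1 → ∀ u v : R, ∃ h g g' : R,
  h ≠ 0 ∧ dg h ≤ e ∧ dg g ≤ e ∧ dg g' ≤ e ∧ π ∣ u * h - g ∧ π ∣ v * h - g'

theorem HH.rep (H : HH dg e) (D : Dg ι dg) {π : Pr R} (hπ : dg π.1 = e + 1) (z w : (Rk π)ˣ) :
    ∃ h g g' : R, h ≠ 0 ∧ g ≠ 0 ∧ g' ≠ 0 ∧ dg h ≤ e ∧ dg g ≤ e ∧ dg g' ≤ e ∧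
      rho π g = z * rho π h ∧ rho π g' = w * rho π h := by
  obtain ⟨u, hu⟩ := rho_surj π z
  obtain ⟨v, hv⟩ := rho_surj π w
  obtain ⟨h, g, g', h0, dh, dg1, dg2, d1, d2⟩ := H π.1 π.2.1 hπ u v
  rw [← rho_eq_zero, map_sub, map_mul, hu, sub_eq_zero] at d1
  rw [← rho_eq_zero, map_sub, map_mul, hv, sub_eq_zero] at d2
  have hn : rho π h ≠ 0 := by rw [Ne, rho_eq_zero]; exact D.not_dvd h0 (by omega)
  refine ⟨h, g, g', h0, ?_, ?_, dh, dg1, dg2, d1.symm, d2.symm⟩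
  · rintro rfl; rw [map_zero] at d1; exact mul_ne_zero z.ne_zero hn d1
  · rintro rfl; rw [map_zero] at d2; exact mul_ne_zero w.ne_zero hn d2

theorem psi_ex (H : HH dg e) (D : Dg ι dg) {π : Pr R} (hπ : dg π.1 = e + 1) (z : (Rk π)ˣ) :
    ∃ x : R × R, x.1 ≠ 0 ∧ x.2 ≠ 0 ∧ dg x.1 ≤ e ∧ dg x.2 ≤ e ∧ rho π x.1 = z * rho π x.2 := by
  obtain ⟨h, g, g', h0, g0, g0', dh, dg1, dg2, d1, d2⟩ := H.rep D hπ z 1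
  exact ⟨(g, h), g0, h0, dg1, dh, d1⟩

variable (K) in
noncomputable def psi0 (H : HH dg e) (D : Dg ι dg) {π : Pr R} (hπ : dg π.1 = e + 1) (z : (Rk π)ˣ) :
    K2 K ⧸ (MM K dg e ⊔ CC K ι) :=
  QuotientAddGroup.mk (st (↟ π.1) (↟ (psi_ex H D hπ z).choose.1) - st (↟ π.1) (↟ (psi_ex H D hπ z).choose.2))

theorem psi0_eq (H : HH dg e) (D : Dg ι dg) {π : Pr R} (hπ : dg π.1 = e + 1) (z : (Rk π)ˣ) {g h : R}
    (g0 : g ≠ 0) (h0 : h ≠ 0) (d1 : dg g ≤ e) (d2 : dg h ≤ e) (hz : rho π g = z * rho π h) :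
    psi0 K H D hπ z = QuotientAddGroup.mk (st (↟ π.1) (↟ g) - st (↟ π.1) (↟ h)) := by
  obtain ⟨a, b, c, d, f⟩ := (psi_ex H D hπ z).choose_spec
  rw [psi0, eq_comm, QuotientAddGroup.eq, neg_add_eq_sub]
  refine psi_wd D hπ a b g0 h0 c d d1 d2 ?_
  rw [← rho_eq_zero, map_sub, map_mul, map_mul, f, hz]; ring

variable (K) in
noncomputable def psi (H : HH dg e) (D : Dg ι dg) (π : {π : Pr R // dg π.1 = e + 1}) :
    Additive (Rk π.1)ˣ →+ K2 K ⧸ (MM K dg e ⊔ CC K ι) :=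
  AddMonoidHom.mk' (fun z => psi0 K H D π.2 z.toMul) (by
    intro z w
    obtain ⟨h, g, g', h0, g0, g0', dh, dg1, dg2, d1, d2⟩ := H.rep D π.2 z.toMul (z.toMul * w.toMul)
    rw [psi0_eq H D π.2 z.toMul g0 h0 dg1 dh d1, psi0_eq H D π.2 w.toMul g0' g0 dg2 dg1 (by
      rw [d2, d1, Units.val_mul]; ring), psi0_eq H D π.2 _ g0' h0 dg2 dh (by rw [d2]; rfl),
      ← QuotientAddGroup.mk_add]
    congr 1; abel)

variable (K ι) in
noncomputable def Fst (π : Pr R) : AddSubgroup (Additive (Rk π)ˣ) :=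
  (Units.map ((rho π).comp ι).toMonoidHom).toAdditive.range

theorem mem_Fst {π : Pr R} {z : Additive (Rk π)ˣ} :
    z ∈ Fst ι π ↔ ∃ c : F, c ≠ 0 ∧ (z.toMul : Rk π) = rho π (ι c) := by
  constructor
  · rintro ⟨c, rfl⟩
    exact ⟨c.toMul, c.toMul.ne_zero, rfl⟩
  · rintro ⟨c, h, e⟩
    exact ⟨Additive.ofMul (Units.mk0 c h), by
      apply Additive.toMul.injective; ext; exact e.symm⟩

variable (K) in
noncomputable def dbar (D : Dg ι dg) (π : {π : Pr R // dg π.1 = e + 1}) :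
    K2 K ⧸ (MM K dg e ⊔ CC K ι) →+ Additive (Rk π.1)ˣ ⧸ Fst ι π.1 :=
  QuotientAddGroup.lift _ ((QuotientAddGroup.mk' (Fst ι π.1)).comp (pl K π.1).tame) (by
    rw [← AddMonoidHom.comap_bot] 
    have : MM K dg e ⊔ CC K ι ≤ AddMonoidHom.ker ((QuotientAddGroup.mk' (Fst ι π.1)).comp (pl K π.1).tame) := by
      rw [sup_le_iff]
      constructor
      · intro z hz
        rw [AddMonoidHom.mem_ker, AddMonoidHom.comp_apply,
          ((pl K π.1).tame_eq_zero_iff z).2 (res_mm D π.1 (by rw [π.2]; omega) hz), map_zero]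
      · intro z hz
        rw [AddMonoidHom.mem_ker, AddMonoidHom.comp_apply, QuotientAddGroup.mk'_apply,
          QuotientAddGroup.eq_zero_iff, mem_Fst]
        exact res_cc π.1 hz
    exact this)

theorem dbar_psi (H : HH dg e) (D : Dg ι dg) (π π' : {π : Pr R // dg π.1 = e + 1}) (z : Additive (Rk π'.1)ˣ) :
    (∀ h : π' = π, dbar K D π (psi K H D π' z) = QuotientAddGroup.mk (h ▸ z)) ∧
    (π' ≠ π → dbar K D π (psi K H D π' z) = 0) := by
  obtain ⟨⟨g, h⟩, g0, h0, d1, d2, hz⟩ := psi_ex H D π'.2 z.toMul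
  have e1 : psi K H D π' z = _ := psi0_eq (K := K) H D π'.2 z.toMul g0 h0 d1 d2 hz
  have nd : ∀ {x : R}, x ≠ 0 → dg x ≤ e → ¬ π.1.1 ∣ x :=
    fun x0 hx => D.not_dvd x0 (by have := π.2; omega)
  rw [e1]
  have e2 : ∀ w, dbar K D π (QuotientAddGroup.mk w) =
      (((pl K π.1).tame w : Additive (Rk π.1)ˣ) : Additive (Rk π.1)ˣ ⧸ Fst ι π.1) := fun _ => rfl
  rw [e2]
  refine ⟨fun hh => ?_, fun hh => ?_⟩
  · subst hh
    congr 1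
    apply Additive.toMul.injective; ext
    change (pl K π'.1).tv _ = _
    rw [Pl.tv_sub, tv_self (nd g0 d1), tv_self (nd h0 d2)]
    simp only at hz
    rw [hz, mul_div_assoc, div_self, mul_one]
    rw [Ne, rho_eq_zero]; exact nd h0 d2
  · have : ¬ π.1.1 ∣ π'.1.1 := fun h => hh (Subtype.ext (Pr.eq_of_dvd h).symm)
    rw [((pl K π.1).tame_eq_zero_iff _).2]
    · rfl
    rw [Pl.tv_sub, tv_units this (nd g0 d1), tv_units this (nd h0 d2), div_one]

theorem psi_F (H : HH dg e) (D : Dg ι dg) (π : {π : Pr R // dg π.1 = e + 1}) {z : Additive (Rk π.1)ˣ}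
    (hz : z ∈ Fst ι π.1) : psi K H D π z = 0 := by
  obtain ⟨c, hc, h⟩ := mem_Fst.1 hz
  have := psi0_eq (K := K) H D π.2 z.toMul (g := ι c) (h := 1) (by simpa using hc) one_ne_zero
    (by rw [D.const hc]; omega) (by rw [D.one]; omega) (by rw [h]; simp)
  refine this.trans ?_
  rw [QuotientAddGroup.eq_zero_iff, map_one, st_one_right, sub_zero]
  exact AddSubgroup.mem_sup_right (cc_mem _ _)

variable (K) in
noncomputable def Th (H : HH dg e) (D : Dg ι dg) :
    DirectSum {π : Pr R // dg π.1 = e + 1} (fun π => Additive (Rk π.1)ˣ) →+ K2 K ⧸ (MM K dg e ⊔ CC K ι) :=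
  open Classical in DirectSum.toAddMonoid (psi K H D)

theorem dbar_Th (H : HH dg e) (D : Dg ι dg) (π : {π : Pr R // dg π.1 = e + 1}) (c) :
    dbar K D π (Th K H D c) = QuotientAddGroup.mk (c π) := by
  classical
  suffices (dbar K D π).comp (Th K H D) = (QuotientAddGroup.mk' (Fst ι π.1)).comp
    (DFinsupp.evalAddMonoidHom π) from DFunLike.congr_fun this c
  refine DirectSum.addHom_ext fun π' z => ?_
  rw [AddMonoidHom.comp_apply, Th, DirectSum.toAddMonoid_of]
  by_cases h : π' = π
  · rw [(dbar_psi H D π π' z).1 h]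
    subst h
    have : (DFinsupp.evalAddMonoidHom π') (DirectSum.of (fun π : {π : Pr R // dg π.1 = e + 1} => Additive (Rk π.1)ˣ) π' z) = z :=
      DirectSum.of_eq_same _ _
    rw [AddMonoidHom.comp_apply, this]; rfl
  · have : (DFinsupp.evalAddMonoidHom π) (DirectSum.of (fun π : {π : Pr R // dg π.1 = e + 1} => Additive (Rk π.1)ˣ) π' z) = 0 :=
      DirectSum.of_eq_of_ne _ _ _ (Ne.symm h)
    rw [(dbar_psi H D π π' z).2 h, AddMonoidHom.comp_apply, this, map_zero]

theorem Th_single (H : HH dg e) (D : Dg ι dg) {π : Pr R} (hπ : dg π.1 = e + 1) {g : R} (g0 : g ≠ 0) (d1 : dg g ≤ e) :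
    (QuotientAddGroup.mk (st (↟ π.1) (↟ g)) : K2 K ⧸ (MM K dg e ⊔ CC K ι)) ∈ (Th K H D).range := by
  classical
  have hn : rho π g ≠ 0 := by rw [Ne, rho_eq_zero]; exact D.not_dvd g0 (by omega)
  refine ⟨DirectSum.of (fun π : {π : Pr R // dg π.1 = e + 1} => Additive (Rk π.1)ˣ) ⟨π, hπ⟩
    (Additive.ofMul (Units.mk0 _ hn)), ?_⟩
  rw [Th, DirectSum.toAddMonoid_of]
  have := psi0_eq (K := K) H D hπ (Units.mk0 _ hn) g0 one_ne_zero d1 (by rw [D.one]; omega) (by simp)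
  refine this.trans ?_
  rw [map_one, st_one_right, sub_zero]

theorem Th_pair (H : HH dg e) (D : Dg ι dg) {π π' : Pr R} (hπ : dg π.1 = e + 1) (hπ' : dg π'.1 = e + 1) :
    (QuotientAddGroup.mk (st (↟ π.1) (↟ π'.1)) : K2 K ⧸ (MM K dg e ⊔ CC K ι)) ∈ (Th K H D).range := by
  have S1 := @Th_single _ _ _ _ _ _ K _ _ _ _ _ _ H D
  have m : ∀ {a b : R}, dg a ≤ e → dg b ≤ e → (QuotientAddGroup.mk (st (↟ a) (↟ b)) : K2 K ⧸ (MM K dg e ⊔ CC K ι)) = 0 :=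
    fun ha hb => (QuotientAddGroup.eq_zero_iff _).2 (AddSubgroup.mem_sup_left (mm_mem ha hb))
  have p0 := am_ne (K := K) π.2.1.ne_zero
  have q0 := am_ne (K := K) π'.2.1.ne_zero
  by_cases hh : π = π'
  · subst hh
    rw [st_self]
    have : (-1 : K) = ↟ (-1) := by simp
    rw [this]
    exact S1 hπ (by simp) (by rw [D.neg, D.one]; omega)
  have nd : ¬ π.1 ∣ π'.1 := fun h => hh (Pr.eq_of_dvd h)
  obtain ⟨h, g, _, h0, dh, dg1, _, hd, _⟩ := H π.1 π.2.1 hπ π'.1 0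
  have g0 : g ≠ 0 := by
    rintro rfl
    rw [sub_zero] at hd
    exact (π.2.1.dvd_or_dvd hd).elim nd (D.not_dvd h0 (by omega))
  obtain ⟨r, hr⟩ := hd
  have r0 : r ≠ 0 := by
    rintro rfl
    have : g = π'.1 * h := by linear_combination -hr
    have h1 := D.mul _ _ π'.2.1.ne_zero h0
    rw [← this] at h1; omega
  have dr : dg r ≤ e := by
    have h1 := D.mul π.1 r π.2.1.ne_zero r0
    rw [← hr] at h1
    have h2 := D.sub (π'.1 * h) g
    rw [D.mul _ _ π'.2.1.ne_zero h0] at h2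
    omega
  have g0' := am_ne (K := K) g0
  have h0' := am_ne (K := K) h0
  have r0' := am_ne (K := K) r0
  have S : (↟ π.1 * ↟ r) / (↟ π'.1 * ↟ h) + (↟ g) / (↟ π'.1 * ↟ h) = 1 := by
    rw [← add_div, div_eq_one_iff_eq (mul_ne_zero q0 h0')]
    rw [← map_mul, ← map_mul, ← map_add]; congr 1; linear_combination -hr
  have S := st_stein S
  rw [st_div_left _ (mul_ne_zero p0 r0') (mul_ne_zero q0 h0'), st_div_right _ g0' (mul_ne_zero q0 h0'),
    st_div_right _ g0' (mul_ne_zero q0 h0')] at S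
  simp only [st_mul_left _ p0 r0', st_mul_left _ q0 h0', st_mul_right _ q0 h0'] at S
  have E : st (↟ π.1) (↟ π'.1) = st (↟ π.1) (↟ g) - st (↟ π.1) (↟ h) + st (↟ π'.1) (↟ r)
     + st (↟ r) (↟ g) - st (↟ r) (↟ h) - st (↟ π'.1) (↟ g) - st (↟ h) (↟ g) + (st (↟ π'.1) (-1) + st (↟ π'.1) (↟ h)
       - st (↟ π'.1) (↟ h) + st (↟ h) (↟ h)) := by
    rw [← st_self, st_anti (↟ π'.1) (↟ r), ← sub_eq_zero, ← neg_eq_zero, ← S, st_anti (↟ h) (↟ π'.1)]; abel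
  have : (-1 : K) = ↟ (-1) := by simp
  rw [E, this]
  simp only [QuotientAddGroup.mk_add, QuotientAddGroup.mk_sub, m dr dg1, m dr dh, m dh dg1, m dh dh, add_zero, sub_zero]
  have d1 : dg (-1) ≤ e := by rw [D.neg, D.one]; omega
  exact add_mem (sub_mem (add_mem (sub_mem (S1 hπ g0 dg1) (S1 hπ h0 dh)) (S1 hπ' r0 dr)) (S1 hπ' g0 dg1))
    (sub_mem (add_mem (S1 hπ' (by simp) d1) (S1 hπ' h0 dh)) (S1 hπ' h0 dh))

theorem layer (H : HH dg e) (D : Dg ι dg) {z : K2 K} (hz : z ∈ MM K dg (e + 1) ⊔ CC K ι)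
    (hr : ∀ π : Pr R, dg π.1 = e + 1 → ∃ c, c ≠ 0 ∧ (pl K π).tv z = rho π (ι c)) :
    z ∈ MM K dg e ⊔ CC K ι := by
  have key : MM K dg (e + 1) ⊔ CC K ι ≤ (Th K H D).range.comap (QuotientAddGroup.mk' (MM K dg e ⊔ CC K ι)) := by
    rw [sup_le_iff]
    constructor
    · rw [MM, AddSubgroup.closure_le]
      rintro _ ⟨f, g, hf, hg, rfl⟩
      change (QuotientAddGroup.mk _ : K2 K ⧸ (MM K dg e ⊔ CC K ι)) ∈ (Th K H D).range
      by_cases f0 : f = 0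
      · simp [f0]
      by_cases g0 : g = 0
      · simp [g0]
      obtain ⟨a, b, rfl, a0, b0, da, hb⟩ := fac D f0 hf
      obtain ⟨a', b', rfl, a0', b0', da', hb'⟩ := fac D g0 hg
      have m : ∀ {a b : R}, dg a ≤ e → dg b ≤ e → (QuotientAddGroup.mk (st (↟ a) (↟ b)) : K2 K ⧸ (MM K dg e ⊔ CC K ι)) ∈ (Th K H D).range := by
        intro a b ha hb
        rw [(QuotientAddGroup.eq_zero_iff _).2 (AddSubgroup.mem_sup_left (mm_mem ha hb))]
        exact zero_mem _
      have S1 := @Th_single _ _ _ _ _ _ K _ _ _ _ _ _ H D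
      have an : ∀ {x y : K}, (QuotientAddGroup.mk (st x y) : K2 K ⧸ (MM K dg e ⊔ CC K ι)) ∈ (Th K H D).range →
          (QuotientAddGroup.mk (st y x) : K2 K ⧸ (MM K dg e ⊔ CC K ι)) ∈ (Th K H D).range := by
        intro x y h
        rw [st_anti, QuotientAddGroup.mk_neg]; exact neg_mem h
      rw [map_mul, map_mul, st_mul_left _ (am_ne a0) (am_ne b0), st_mul_right _ (am_ne a0') (am_ne b0'),
        st_mul_right _ (am_ne a0') (am_ne b0')]
      simp only [QuotientAddGroup.mk_add]
      refine add_mem (add_mem (m da da') ?_) (add_mem ?_ ?_)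
      · rcases hb' with hb' | ⟨π, rfl, h⟩
        · exact m da hb'
        · exact an (S1 h a0 da)
      · rcases hb with hb | ⟨π, rfl, h⟩
        · exact m hb da'
        · exact S1 h a0' da'
      · rcases hb with hb | ⟨π, rfl, h⟩ <;> rcases hb' with hb' | ⟨π', rfl, h'⟩
        · exact m hb hb'
        · exact an (S1 h' b0 hb)
        · exact S1 h b0' hb'
        · exact Th_pair H D h h'
    · intro z hz
      change (QuotientAddGroup.mk _ : K2 K ⧸ (MM K dg e ⊔ CC K ι)) ∈ (Th K H D).range
      rw [(QuotientAddGroup.eq_zero_iff _).2 (AddSubgroup.mem_sup_right hz)]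
      exact zero_mem _
  obtain ⟨c, hc⟩ := key hz
  have hc' : Th K H D c = 0 := by
    classical
    have : ∀ π, c π ∈ Fst ι π.1 := by
      intro π
      rw [← QuotientAddGroup.eq_zero_iff, ← dbar_Th (K := K) H D π c, hc]
      change ((pl K π.1).tame z : Additive (Rk π.1)ˣ ⧸ Fst ι π.1) = 0
      rw [QuotientAddGroup.eq_zero_iff, mem_Fst]
      exact hr π.1 π.2
    rw [Th, DirectSum.toAddMonoid, DFinsupp.liftAddHom_apply, DFinsupp.sumAddHom_apply, DFinsupp.sum]
    exact Finset.sum_eq_zero fun π _ => psi_F H D π (this π)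
  rw [hc', eq_comm] at hc
  exact (QuotientAddGroup.eq_zero_iff _).1 hc

theorem mm_all (D : Dg ι dg) (z : K2 K) : ∃ d, z ∈ MM K dg d := by
  induction z using K2.ind with
  | h0 => exact ⟨0, zero_mem _⟩
  | h1 x y hx hy =>
    obtain ⟨a, b, hb, rfl⟩ := IsFractionRing.div_surjective (A := R) x
    obtain ⟨a', b', hb', rfl⟩ := IsFractionRing.div_surjective (A := R) y
    have b0 := am_ne (K := K) (nonZeroDivisors.ne_zero hb)
    have b0' := am_ne (K := K) (nonZeroDivisors.ne_zero hb')
    have a0 : ↟ a ≠ 0 := by intro h; simp [h] at hx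
    have a0' : ↟ a' ≠ 0 := by intro h; simp [h] at hy
    rw [st_div_left _ a0 b0, st_div_right _ a0' b0', st_div_right _ a0' b0']
    refine ⟨dg a + dg b + dg a' + dg b', ?_⟩
    exact sub_mem (sub_mem (mm_mem (by omega) (by omega)) (mm_mem (by omega) (by omega)))
      (sub_mem (mm_mem (by omega) (by omega)) (mm_mem (by omega) (by omega)))
  | hn x h => obtain ⟨d, h⟩ := h; exact ⟨d, neg_mem h⟩
  | ha x y h h' =>
    obtain ⟨d, h⟩ := h
    obtain ⟨d', h'⟩ := h'
    exact ⟨max d d', add_mem (mm_mono (le_max_left _ _) h) (mm_mono (le_max_right _ _) h')⟩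

theorem layers (D : Dg ι dg) {d0 : ℕ} (H : ∀ e, d0 ≤ e → HH dg e) {z : K2 K}
    (hr : ∀ π : Pr R, d0 < dg π.1 → ∃ c, c ≠ 0 ∧ (pl K π).tv z = rho π (ι c)) :
    z ∈ MM K dg d0 ⊔ CC K ι := by
  obtain ⟨d, hd⟩ := mm_all D z
  have h1 : z ∈ MM K dg (d0 + d) ⊔ CC K ι := AddSubgroup.mem_sup_left (mm_mono (by omega) hd)
  clear hd
  induction d with
  | zero => exact h1
  | succ d ih => exact ih (layer (H _ (by omega)) D h1 (fun π h => hr π (by omega)))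
end layer

section cdec
variable (K ι) in
noncomputable def ThC : DirectSum (Pr R) (fun _ => Additive Fˣ) →+ K2 K :=
  open Classical in DirectSum.toAddMonoid fun π => AddMonoidHom.mk' (fun c => st (↟ π.1) (↟ (ι (c.toMul : Fˣ))))
    (fun c d => by
      rw [toMul_add, Units.val_mul, map_mul, map_mul]
      exact st_mul_right _ (am_ne (by simp)) (am_ne (by simp)))

theorem not_dvd_const (π : Pr R) {c : F} (hc : c ≠ 0) : ¬ π.1 ∣ ι c :=
  fun h => π.2.1.not_unit (isUnit_of_dvd_unit h ((IsUnit.mk0 c hc).map ι))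

theorem tv_ThC (c : DirectSum (Pr R) (fun _ => Additive Fˣ)) (π : Pr R) :
    (pl K π).tv (ThC K ι c) = rho π (ι ((c π).toMul : Fˣ)) := by
  classical
  suffices (pl K π).tame.comp (ThC K ι) = (Units.map ((rho π).comp ι).toMonoidHom).toAdditive.comp
      (DFinsupp.evalAddMonoidHom (β := fun _ => Additive Fˣ) π) by
    have := congrArg (fun z : Additive (Rk π)ˣ => (z.toMul : Rk π)) (DFunLike.congr_fun this c)
    exact this
  refine DirectSum.addHom_ext fun π' z => ?_
  rw [AddMonoidHom.comp_apply, ThC, DirectSum.toAddMonoid_of, AddMonoidHom.comp_apply]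
  apply Additive.toMul.injective; ext
  change (pl K π).tv (st (↟ π'.1) (↟ (ι (z.toMul : Fˣ)))) = rho π (ι ((((DirectSum.of (fun _ : Pr R => Additive Fˣ) π' z) π).toMul : Fˣ)))
  by_cases h : π' = π
  · subst h
    rw [DirectSum.of_eq_same, tv_self (not_dvd_const _ (by simp))]
  · rw [DirectSum.of_eq_of_ne _ _ _ (Ne.symm h), tv_units (fun h' => h (Pr.eq_of_dvd h').symm) (not_dvd_const _ (by simp))]
    simp

theorem cc_decomp (hu : ∀ u : Rˣ, ∃ c, ι c = u) {z : K2 K} (hz : z ∈ CC K ι) :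
    ∃ c y, z = ThC K ι c + K2.map ((↟).comp ι) y := by
  classical
  suffices CC K ι ≤ (ThC K ι).range ⊔ (K2.map ((↟).comp ι)).range by
    obtain ⟨_, ⟨c, rfl⟩, _, ⟨y, rfl⟩, h⟩ := AddSubgroup.mem_sup.1 (this hz)
    exact ⟨c, y, h.symm⟩
  rw [CC, AddSubgroup.closure_le]
  rintro _ ⟨x, c, rfl⟩
  by_cases hc : c = 0
  · simp [hc]
  by_cases hx : x = 0
  · simp [hx]
  have key : ∀ a : R, a ≠ 0 → st (↟ a) (↟ (ι c)) ∈ (ThC K ι).range ⊔ (K2.map ((↟).comp ι)).range := by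
    intro a
    induction a using UniqueFactorizationMonoid.induction_on_prime with
    | h₁ => simp
    | h₂ u hu' =>
      intro _
      obtain ⟨u, rfl⟩ := hu'
      obtain ⟨d, hd⟩ := hu u
      rw [← hd]
      exact AddSubgroup.mem_sup_right ⟨st d c, by simp⟩
    | h₃ a p a0 hp ih =>
      intro _
      obtain ⟨π, u, rfl⟩ := Pr.exists_rep hp
      obtain ⟨d, hd⟩ := hu u
      rw [map_mul, st_mul_left _ (am_ne hp.ne_zero) (am_ne a0), map_mul, st_mul_left _ (am_ne u.ne_zero) (am_ne π.2.1.ne_zero)]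
      refine add_mem (add_mem ?_ ?_) (ih a0)
      · rw [← hd]
        exact AddSubgroup.mem_sup_right ⟨st d c, by simp⟩
      · refine AddSubgroup.mem_sup_left ⟨DirectSum.of (fun _ : Pr R => Additive Fˣ) π (Additive.ofMul (Units.mk0 c hc)), ?_⟩
        rw [ThC, DirectSum.toAddMonoid_of]; rfl
  obtain ⟨a, b, hb, rfl⟩ := IsFractionRing.div_surjective (A := R) x
  have b0 := nonZeroDivisors.ne_zero hb
  have a0 : a ≠ 0 := by rintro rfl; simp at hx
  rw [st_div_left _ (am_ne a0) (am_ne b0)]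
  exact sub_mem (key a a0) (key b b0)

theorem tv_map_const (π : Pr R) (y : K2 F) : (pl K π).tv (K2.map ((↟).comp ι) y) = 1 := by
  induction y using K2.ind with
  | h0 => simp [Pl.tv_zero]
  | h1 x y hx hy => rw [K2.map_st]; exact tv_units (not_dvd_const _ hx) (not_dvd_const _ hy)
  | hn x h => rw [map_neg, Pl.tv_neg, h, inv_one]
  | ha x y h h' => rw [map_add, Pl.tv_add, h, h', one_mul]

theorem cc_two (hu : ∀ u : Rˣ, ∃ c, ι c = u) {z : K2 K} (hz : z ∈ CC K ι)
    (h : ∀ π : Pr R, (pl K π).tv z ^ 2 = 1) : ∃ y, 2 • z = 2 • K2.map ((↟).comp ι) y := by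
  obtain ⟨c, y, rfl⟩ := cc_decomp hu hz
  refine ⟨y, ?_⟩
  have : 2 • c = 0 := by
    refine DFinsupp.ext fun π => ?_
    have := h π
    rw [Pl.tv_add, tv_map_const, mul_one, tv_ThC, ← map_pow, ← map_pow] at this
    have := ((rho π).comp ι).injective (this.trans (map_one ((rho π).comp ι)).symm)
    apply Additive.toMul.injective; ext
    exact this
  rw [smul_add, ← map_nsmul (ThC K ι), this, map_zero, zero_add]

theorem cc_one (hu : ∀ u : Rˣ, ∃ c, ι c = u) {z : K2 K} (hz : z ∈ CC K ι) (π₀ : Pr R)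
    (h : ∀ π : Pr R, π ≠ π₀ → (pl K π).tv z = 1) :
    ∃ e y, e ≠ 0 ∧ z = st (↟ π₀.1) (↟ (ι e)) + K2.map ((↟).comp ι) y := by
  classical
  obtain ⟨c, y, rfl⟩ := cc_decomp hu hz
  refine ⟨((c π₀).toMul : Fˣ), y, by simp, ?_⟩
  congr 1
  have : c = DirectSum.of (fun _ : Pr R => Additive Fˣ) π₀ (c π₀) := by
    refine DFinsupp.ext fun π => ?_
    by_cases hh : π = π₀
    · subst hh; exact (DirectSum.of_eq_same (β := fun _ : Pr R => Additive Fˣ) _ _).symm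
    refine Eq.trans ?_ (DirectSum.of_eq_of_ne (β := fun _ : Pr R => Additive Fˣ) _ _ _ hh).symm
    have := h π hh
    rw [Pl.tv_add, tv_map_const, mul_one, tv_ThC] at this
    have := ((rho π).comp ι).injective (this.trans (map_one ((rho π).comp ι)).symm)
    apply Additive.toMul.injective; ext
    exact this
  conv_lhs => rw [this, ThC, DirectSum.toAddMonoid_of]
  rfl
end cdec
end
end S2
end Mk

namespace Mk
open Polynomial

structure Qd (L : Type) [Field L] where
  σ : L →+* L
  ss : ∀ x, σ (σ x) = x
  r : L
  hr : r ≠ 0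
  sr : σ r = -r
  two : (2 : L) ≠ 0
  b : L
  hb : b ≠ 0
  sb : σ b = b

section st
variable (L : Type) [Field L]
def Om : Type := FractionRing L[X]
noncomputable instance : Field (Om L) := inferInstanceAs (Field (FractionRing L[X]))
noncomputable instance : Algebra L[X] (Om L) := inferInstanceAs (Algebra L[X] (FractionRing L[X]))
instance : IsFractionRing L[X] (Om L) := inferInstanceAs (IsFractionRing L[X] (FractionRing L[X]))
noncomputable def cst : L →+* Om L := (algebraMap L[X] (Om L)).comp C
noncomputable def TT : Om L := algebraMap L[X] (Om L) X
variable {L}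
theorem cst_ne {c : L} (h : c ≠ 0) : cst L c ≠ 0 := by simpa using h
theorem TT_ne : TT L ≠ 0 := am_ne X_ne_zero
noncomputable def inf : Pl (Om L) L := (Pl.deg L).ext (Om L)
noncomputable def pl0 : Pl (Om L) L :=
  (Pl.prime (prime_X (R := L)) (evalRingHom 0) (fun a => by
    rw [X_dvd_iff, coeff_zero_eq_eval_zero]; rfl)).ext (Om L)

theorem inf_am {p : L[X]} (h : p ≠ 0) : inf.v (algebraMap L[X] (Om L) p) = -p.natDegree :=
  Pl.ext_v_am _ h
theorem inf_lc (p : L[X]) : inf.lc (algebraMap L[X] (Om L) p) = p.leadingCoeff :=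
  Pl.ext_lc_am _ p
theorem inf_c {c : L} (h : c ≠ 0) : inf.v (cst L c) = 0 := by
  rw [cst, RingHom.comp_apply, inf_am (by simpa)]; simp
theorem inf_clc (c : L) : inf.lc (cst L c) = c := by
  rw [cst, RingHom.comp_apply, inf_lc]; simp
theorem inf_T : inf.v (TT L) = -1 := by rw [TT, inf_am X_ne_zero]; simp
theorem inf_Tlc : inf.lc (TT L) = 1 := by rw [TT, inf_lc]; simp
theorem pl0_spec {q : L[X]} (n : ℕ) (h : q.coeff 0 ≠ 0) :
    pl0.v (algebraMap L[X] (Om L) (X ^ n * q)) = n ∧ pl0.lc (algebraMap L[X] (Om L) (X ^ n * q)) = q.coeff 0 := by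
  have q0 : q ≠ 0 := by rintro rfl; simp at h
  rw [pl0, Pl.ext_v_am _ (mul_ne_zero (pow_ne_zero _ X_ne_zero) q0), Pl.ext_lc_am]
  have := Pl.prime_eq (prime_X (R := L)) (evalRingHom 0) (fun a => by
    rw [X_dvd_iff, coeff_zero_eq_eval_zero]; rfl) (a := X ^ n * q) (c := q) (n := n) (by rwa [X_dvd_iff]) rfl
  rw [this.1, this.2, coeff_zero_eq_eval_zero]; exact ⟨rfl, rfl⟩
theorem exX {p : L[X]} (h : p ≠ 0) : ∃ n q, q.coeff 0 ≠ 0 ∧ p = X ^ n * q := by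
  obtain ⟨n, q, hq, e⟩ := WfDvdMonoid.max_power_factor h (irreducible_X (R := L))
  exact ⟨n, q, by rwa [X_dvd_iff] at hq, e⟩
end st

namespace Qd
variable {L : Type} [Field L] (Q : Qd L)

def F : Subfield L := Q.σ.eqLocusField (RingHom.id L)
theorem mem_F {x : L} : x ∈ Q.F ↔ Q.σ x = x := Iff.rfl

noncomputable def s0 : L[X] →+* Om L := eval₂RingHom ((cst L).comp Q.σ) (cst L Q.b / TT L)
theorem s0_C (c : L) : Q.s0 (C c) = cst L (Q.σ c) := by simp [s0]
theorem s0_X : Q.s0 X = cst L Q.b / TT L := by simp [s0]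
theorem bT_v : inf.v (cst L Q.b / TT L) = 1 := by
  rw [Pl.v_div _ (cst_ne Q.hb) TT_ne, inf_c Q.hb, inf_T]; rfl
theorem bT_ne : cst L Q.b / TT L ≠ 0 := div_ne_zero (cst_ne Q.hb) TT_ne
theorem inf_c_ge (c : L) : inf.ge 0 (cst L c) := by
  by_cases h : c = 0
  · simp [h, Pl.ge_zero]
  · exact fun _ => (inf_c h).ge
theorem inf_c_co (c : L) : inf.co 0 (cst L c) = c := by
  by_cases h : c = 0
  · simp [h, Pl.co_zero]
  · rw [Pl.co_eq (cst_ne h) (inf_c h), inf_clc]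
theorem s0_ge (p : L[X]) : inf.ge 0 (Q.s0 p) := by
  induction p using Polynomial.induction_on with
  | C a => rw [s0_C]; exact inf_c_ge _
  | add p q hp hq => rw [map_add]; exact Pl.ge_add hp hq
  | monomial n a h =>
    rw [pow_succ, ← mul_assoc, map_mul, s0_X]
    have := Pl.ge_mul (p := inf) (n := 0) (m := 0) h (fun _ => by rw [Q.bT_v]; omega)
    simpa using this
theorem s0_co (p : L[X]) : inf.co 0 (Q.s0 p) = Q.σ (p.coeff 0) := by
  conv_lhs => rw [← divX_mul_X_add p, map_add, map_mul, s0_C, s0_X]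
  have h1 : inf.ge 1 (Q.s0 p.divX * (cst L Q.b / TT L)) := by
    have := Pl.ge_mul (p := inf) (n := 0) (m := 1) (Q.s0_ge p.divX) (Pl.ge_of_eq Q.bT_v)
    simpa using this
  rw [Pl.co_add (Pl.ge_mono (by omega) h1) (inf_c_ge _), inf_c_co, Pl.co_lt (by omega) h1, zero_add]
theorem s0_X_mul {n : ℕ} {q : L[X]} (hq : q.coeff 0 ≠ 0) : Q.s0 (X ^ n * q) ≠ 0 ∧
    inf.v (Q.s0 (X ^ n * q)) = n ∧ inf.lc (Q.s0 (X ^ n * q)) = Q.b ^ n * Q.σ (q.coeff 0) := by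
  have h := Pl.of_co_ne (p := inf) (n := 0) (x := Q.s0 q) (by rw [s0_co]; simpa using hq)
  have h0 := Q.s0_co q
  rw [Pl.co_eq h.1 h.2.1] at h0
  have hb : inf.lc (cst L Q.b / TT L) = Q.b := by rw [map_div₀, inf_clc, inf_Tlc, div_one]
  rw [map_mul, map_pow, s0_X]
  refine ⟨mul_ne_zero (pow_ne_zero _ Q.bT_ne) h.1, ?_, ?_⟩
  · rw [Pl.v_mul _ _ _ (pow_ne_zero _ Q.bT_ne) h.1, Pl.v_pow Q.bT_ne, Q.bT_v, h.2.1]; ring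
  · rw [map_mul, map_pow, hb, h0]
theorem s0_inj : Function.Injective Q.s0 := by
  rw [injective_iff_map_eq_zero]
  intro p hp
  by_contra h
  obtain ⟨n, q, hq, rfl⟩ := exX h
  exact (Q.s0_X_mul hq).1 hp

noncomputable def s : Om L →+* Om L := IsFractionRing.lift Q.s0_inj
theorem s_am (p : L[X]) : Q.s (algebraMap L[X] (Om L) p) = Q.s0 p := IsFractionRing.lift_algebraMap _ _
theorem s_c (c : L) : Q.s (cst L c) = cst L (Q.σ c) := (Q.s_am _).trans (Q.s0_C c)
theorem s_T : Q.s (TT L) = cst L Q.b / TT L := (Q.s_am _).trans Q.s0_X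
theorem om_ext {f g : Om L →+* Om L} (h : ∀ c, f (cst L c) = g (cst L c)) (hT : f (TT L) = g (TT L)) : f = g := by
  refine IsLocalization.ringHom_ext (nonZeroDivisors L[X]) ?_
  exact Polynomial.ringHom_ext h hT
theorem s_s (x : Om L) : Q.s (Q.s x) = x := by
  suffices Q.s.comp Q.s = RingHom.id _ from DFunLike.congr_fun this x
  refine om_ext (fun c => ?_) ?_
  · simp [s_c, Q.ss]
  · have := cst_ne Q.hb
    have := TT_ne (L := L)
    simp only [RingHom.comp_apply, s_T, map_div₀, s_c, Q.sb, RingHom.id_apply]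
    field_simp
theorem s_place {x : Om L} (hx : x ≠ 0) : inf.v (Q.s x) = pl0.v x ∧
    inf.lc (Q.s x) = Q.σ (pl0.lc x) * Q.b ^ pl0.v x := by
  obtain ⟨p, q, hq, rfl⟩ := IsFractionRing.div_surjective (A := L[X]) x
  have q0 := nonZeroDivisors.ne_zero hq
  have p0 : p ≠ 0 := by rintro rfl; simp at hx
  obtain ⟨n, p, hp, rfl⟩ := exX p0
  clear hq
  obtain ⟨m, q, hq, rfl⟩ := exX q0
  have := Q.hb
  obtain ⟨a1, a2, a3⟩ := Q.s0_X_mul (n := n) hp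
  obtain ⟨b1, b2, b3⟩ := Q.s0_X_mul (n := m) hq
  obtain ⟨c1, c2⟩ := pl0_spec n hp
  obtain ⟨d1, d2⟩ := pl0_spec m hq
  rw [map_div₀, map_div₀, map_div₀, s_am, s_am, Pl.v_div _ a1 b1, Pl.v_div _ (am_ne p0) (am_ne q0), a2, b2, a3, b3, c1, c2, d1, d2]
  refine ⟨rfl, ?_⟩
  rw [map_div₀, zpow_sub₀ Q.hb, zpow_natCast, zpow_natCast]
  have : Q.σ (q.coeff 0) ≠ 0 := by simpa using hq
  field_simp

noncomputable def K : Subfield (Om L) := Q.s.eqLocusField (RingHom.id _)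
theorem K_fix (x : Q.K) : Q.s x = x := x.2
theorem K_v (x : Q.K) (hx : x ≠ 0) : inf.v (x : Om L) = pl0.v (x : Om L) := by
  have := (Q.s_place (x := (x : Om L)) (by simpa using hx)).1
  rwa [K_fix] at this
noncomputable def PP : Pl Q.K L := inf.restr Q.K.subtype Subtype.val_injective

def IsLau (x : Om L) : Prop := ∃ (n : ℕ) (p : L[X]), x * TT L ^ n = algebraMap L[X] (Om L) p
theorem IsLau.cst (c : L) : IsLau (cst L c) := ⟨0, C c, by simp [Mk.cst]⟩
theorem IsLau.add {x y : Om L} : IsLau x → IsLau y → IsLau (x + y) := by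
  rintro ⟨n, p, h⟩ ⟨m, q, h'⟩
  refine ⟨n + m, p * X ^ m + q * X ^ n, ?_⟩
  rw [map_add, map_mul, map_mul, ← h, ← h', map_pow, map_pow]; change _ = _ * TT L ^ m + _ * TT L ^ n
  ring
theorem IsLau.mul {x y : Om L} : IsLau x → IsLau y → IsLau (x * y) := by
  rintro ⟨n, p, h⟩ ⟨m, q, h'⟩
  exact ⟨n + m, p * q, by rw [map_mul, ← h, ← h']; ring⟩
theorem IsLau.T : IsLau (TT L) := ⟨0, X, by simp [TT]⟩
theorem IsLau.Ti : IsLau (TT L)⁻¹ := ⟨1, 1, by simp [TT_ne]⟩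
theorem IsLau.pow {x : Om L} (h : IsLau x) (n : ℕ) : IsLau (x ^ n) := by
  induction n with
  | zero => simpa using IsLau.cst (1 : L)
  | succ n ih => rw [pow_succ]; exact ih.mul h
theorem IsLau.am (p : L[X]) : IsLau (algebraMap L[X] (Om L) p) := ⟨0, p, by simp⟩
theorem IsLau.s {x : Om L} (h : IsLau x) : IsLau (Q.s x) := by
  obtain ⟨n, p, h⟩ := h
  have e : Q.s x = Q.s0 p * (TT L / Mk.cst L Q.b) ^ n := by
    rw [← s_am, ← h, map_mul, map_pow, s_T, mul_assoc, ← mul_pow]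
    have := cst_ne Q.hb
    have := TT_ne (L := L)
    field_simp
    simp
  rw [e]
  have hb : IsLau (TT L / Mk.cst L Q.b) := by rw [div_eq_mul_inv, ← map_inv₀]; exact .mul .T (.cst _)
  refine .mul ?_ (hb.pow n)
  clear e h
  induction p using Polynomial.induction_on' with
  | add p q hp hq => rw [map_add]; exact hp.add hq
  | monomial n a =>
    rw [← C_mul_X_pow_eq_monomial, map_mul, map_pow, s0_C, s0_X, div_eq_mul_inv]
    exact .mul (.cst _) (.pow (.mul (.cst _) .Ti) n)

noncomputable def A : Subring Q.K where
  carrier := {x | IsLau (x : Om L)}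
  mul_mem' := IsLau.mul
  one_mem' := by simpa using IsLau.cst (1 : L)
  add_mem' := IsLau.add
  zero_mem' := by simpa using IsLau.cst (0 : L)
  neg_mem' := fun {x} h => by
    have := (IsLau.cst (-1 : L)).mul h
    simpa using this

theorem A_ext {x y : Q.A} (h : ((x : Q.K) : Om L) = ((y : Q.K) : Om L)) : x = y := Subtype.ext (Subtype.ext h)
noncomputable def mkA (x : Om L) (h : Q.s x = x) (h' : IsLau x) : Q.A := ⟨⟨x, h⟩, h'⟩

instance : IsFractionRing Q.A Q.K := by
  haveI : FaithfulSMul Q.A Q.K := (faithfulSMul_iff_algebraMap_injective _ _).2 Subtype.val_injective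
  refine IsFractionRing.of_field _ _ fun z => ?_
  obtain ⟨p, q, hq, e⟩ := IsFractionRing.div_surjective (A := L[X]) (z : Om L)
  have q0 := am_ne (K := Om L) (nonZeroDivisors.ne_zero hq)
  set P := algebraMap L[X] (Om L) p
  set D := algebraMap L[X] (Om L) q
  have D0 : Q.s D ≠ 0 := by simpa using q0
  have hd : Q.s (D * Q.s D) = D * Q.s D := by rw [map_mul, s_s, mul_comm]
  have hn : P * Q.s D = z * (D * Q.s D) := by rw [← e]; field_simp
  have hn' : Q.s (P * Q.s D) = P * Q.s D := by rw [hn, map_mul, hd, K_fix]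
  refine ⟨Q.mkA _ hn' ((IsLau.am p).mul (IsLau.s Q (.am q))), Q.mkA _ hd ((IsLau.am q).mul (IsLau.s Q (.am q))), ?_⟩
  apply Subtype.ext
  change (z : Om L) = P * Q.s D / (D * Q.s D)
  rw [hn]
  field_simp

noncomputable def vl : Q.A →+* Om L := Q.K.subtype.comp Q.A.subtype
theorem vl_inj {x y : Q.A} (h : Q.vl x = Q.vl y) : x = y := Q.A_ext h
theorem vl_ne {x : Q.A} (h : x ≠ 0) : Q.vl x ≠ 0 := fun e => h (Q.vl_inj (e.trans (map_zero _).symm))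
theorem vl_s (x : Q.A) : Q.s (Q.vl x) = Q.vl x := (x : Q.K).2
noncomputable def ι : Q.F →+* Q.A :=
  (((cst L).comp Q.F.subtype).codRestrict Q.K (fun c => by
    change Q.s (cst L c) = cst L c
    rw [s_c, Q.mem_F.1 c.2])).codRestrict Q.A (fun c => IsLau.cst (c : L))
theorem vl_ι (c : Q.F) : Q.vl (Q.ι c) = cst L c := rfl

theorem v_nonpos (x : Q.A) (hx : x ≠ 0) : inf.v (Q.vl x) ≤ 0 ∧ (inf.v (Q.vl x) = 0 → ∃ c, Q.ι c = x) := by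
  have hx' := Q.vl_ne hx
  have e1 : inf.v (Q.vl x) = pl0.v (Q.vl x) := Q.K_v x (by simpa using hx)
  obtain ⟨n, p, hp⟩ := x.2
  change Q.vl x * _ = _ at hp
  have p0 : p ≠ 0 := by rintro rfl; rw [map_zero] at hp; exact mul_ne_zero hx' (pow_ne_zero _ TT_ne) hp
  obtain ⟨m, q, hq, rfl⟩ := exX p0
  have q0 : q ≠ 0 := by rintro rfl; simp at hq
  have T0 : pl0.v (TT L) = 1 := by
    have := (pl0_spec (L := L) (q := 1) 1 (by simp)).1
    simpa [TT] using this
  have h1 := congrArg inf.v hp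
  have h2 := congrArg pl0.v hp
  rw [Pl.v_mul _ _ _ hx' (pow_ne_zero _ TT_ne), Pl.v_pow TT_ne] at h1 h2
  rw [inf_T, inf_am p0, natDegree_mul (pow_ne_zero _ X_ne_zero) q0, natDegree_X_pow] at h1
  rw [T0, (pl0_spec m hq).1] at h2
  push_cast at h1
  refine ⟨by omega, fun h0 => ?_⟩
  have hd : q.natDegree = 0 := by omega
  have hmn : m = n := by omega
  subst hmn
  rw [natDegree_eq_zero] at hd
  obtain ⟨c, rfl⟩ := hd
  have hv : Q.vl x = cst L c := by
    have T1 := TT_ne (L := L)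
    have : Q.vl x * TT L ^ m = cst L c * TT L ^ m := by
      rw [hp, map_mul, map_pow, mul_comm]; rfl
    exact mul_right_cancel₀ (pow_ne_zero _ T1) this
  have hs := Q.vl_s x
  rw [hv, s_c] at hs
  exact ⟨⟨c, (cst L).injective hs⟩, Q.vl_inj hv.symm⟩

open Classical in
noncomputable def dg (x : Q.A) : ℕ := if x = 0 then 0 else (-inf.v (Q.vl x)).toNat
theorem dg_ne {x : Q.A} (hx : x ≠ 0) : (Q.dg x : ℤ) = -inf.v (Q.vl x) := by
  rw [dg, if_neg hx]; have := (Q.v_nonpos x hx).1; omega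
theorem dg_le {x : Q.A} {d : ℕ} : Q.dg x ≤ d ↔ inf.ge (-d) (Q.vl x) := by
  by_cases hx : x = 0
  · simp [hx, dg, Pl.ge_zero]
  · have := Q.dg_ne hx
    exact ⟨fun h _ => by omega, fun h => by have := h (Q.vl_ne hx); omega⟩
theorem dgD : Dg Q.ι Q.dg where
  mul x y hx hy := by
    have h := Q.dg_ne (mul_ne_zero hx hy)
    have h1 := Q.dg_ne hx
    have h2 := Q.dg_ne hy
    rw [map_mul, Pl.v_mul _ _ _ (Q.vl_ne hx) (Q.vl_ne hy)] at h
    omega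
  add x y := by
    rw [dg_le, map_add]
    exact Pl.ge_add (Q.dg_le.1 (le_max_left _ _)) (Q.dg_le.1 (le_max_right _ _))
  neg x := by
    by_cases hx : x = 0
    · simp [hx]
    · have h := Q.dg_ne (neg_ne_zero.2 hx)
      rw [map_neg, Pl.v_neg, ← Q.dg_ne hx] at h
      omega
  zero := by simp [dg]
  con x h := by
    by_cases hx : x = 0
    · exact ⟨0, by simp [hx]⟩
    · have := Q.dg_ne hx
      exact (Q.v_nonpos x hx).2 (by omega)
noncomputable def cf (d : ℕ) (x : Q.A) : L := inf.co (-d) (Q.vl x)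
variable {Q}
theorem cf_add {d : ℕ} {x y : Q.A} (hx : Q.dg x ≤ d) (hy : Q.dg y ≤ d) : Q.cf d (x + y) = Q.cf d x + Q.cf d y := by
  rw [cf, map_add]; exact Pl.co_add (Q.dg_le.1 hx) (Q.dg_le.1 hy)
theorem cf_sub {d : ℕ} {x y : Q.A} (hx : Q.dg x ≤ d) (hy : Q.dg y ≤ d) : Q.cf d (x - y) = Q.cf d x - Q.cf d y := by
  rw [cf, map_sub]; exact Pl.co_sub (Q.dg_le.1 hx) (Q.dg_le.1 hy)
theorem cf_mul {d e : ℕ} {x y : Q.A} (hx : Q.dg x ≤ d) (hy : Q.dg y ≤ e) : Q.cf (d + e) (x * y) = Q.cf d x * Q.cf e y := by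
  have := Pl.co_mul (Q.dg_le.1 hx) (Q.dg_le.1 hy)
  rw [cf, map_mul, cf, cf, ← this]; congr 1; push_cast; ring
theorem cf_zero {d : ℕ} {x : Q.A} (hx : Q.dg x ≤ d + 1) (h : Q.cf (d + 1) x = 0) : Q.dg x ≤ d := by
  rw [cf, Pl.co_eq_zero_iff (Q.dg_le.1 hx)] at h
  rw [dg_le]; convert h using 1; push_cast; ring
theorem cf_ne {x : Q.A} (hx : x ≠ 0) : Q.cf (Q.dg x) x ≠ 0 := by
  rw [cf, Q.dg_ne hx, neg_neg, Pl.co_v (Q.vl_ne hx)]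
  exact Pl.lc_ne _ _ (Q.vl_ne hx)
theorem dg_ι (c : Q.F) : Q.dg (Q.ι c) ≤ 0 := by
  by_cases h : c = 0
  · simp [h, Q.dgD.zero]
  · exact (Q.dgD.const h).le
theorem cf_ι (c : Q.F) : Q.cf 0 (Q.ι c) = c := by
  rw [cf, vl_ι]; simpa using inf_c_co (c : L)
theorem dg_ιmul (c : Q.F) (x : Q.A) : Q.dg (Q.ι c * x) ≤ Q.dg x := by
  by_cases h : c = 0
  · simp [h, Q.dgD.zero]
  by_cases hx : x = 0
  · simp [hx]
  · rw [Q.dgD.mul _ _ (by simpa using h) hx]; have := dg_ι c; omega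
theorem cf_ιmul {d : ℕ} (c : Q.F) {x : Q.A} (hx : Q.dg x ≤ d) : Q.cf d (Q.ι c * x) = c * Q.cf d x := by
  have := cf_mul (dg_ι c) hx
  rwa [zero_add, cf_ι] at this

variable (Q)
noncomputable def el (d : ℕ) (α : L) : Q.A := Q.mkA (cst L α * TT L ^ d + cst L (Q.σ α) * (cst L Q.b / TT L) ^ d)
  (by
    have := cst_ne Q.hb
    have := TT_ne (L := L)
    simp only [map_add, map_mul, map_pow, s_c, s_T, map_div₀, Q.ss, Q.sb]
    rw [add_comm, div_div_cancel₀ ‹cst L Q.b ≠ 0›]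
    )
  (by
    refine .add (.mul (.cst _) (.pow .T _)) (.mul (.cst _) (.pow ?_ _))
    rw [div_eq_mul_inv]; exact .mul (.cst _) .Ti)
theorem el_spec (d : ℕ) (α : L) : Q.dg (Q.el (d + 1) α) ≤ d + 1 ∧ Q.cf (d + 1) (Q.el (d + 1) α) = α := by
  have h1 : inf.ge (-((d + 1 : ℕ) : ℤ)) (cst L α * TT L ^ (d + 1)) := by
    have := Pl.ge_mul (inf_c_ge α) (Pl.ge_v (p := inf) (TT L ^ (d + 1)))
    rw [Pl.v_pow TT_ne, inf_T] at this
    refine Pl.ge_mono ?_ this; push_cast; omega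
  have h2 : inf.ge 0 (cst L (Q.σ α) * (cst L Q.b / TT L) ^ (d + 1)) := by
    have := Pl.ge_mul (inf_c_ge (Q.σ α)) (Pl.ge_v (p := inf) ((cst L Q.b / TT L) ^ (d + 1)))
    rw [Pl.v_pow Q.bT_ne, Q.bT_v] at this
    refine Pl.ge_mono ?_ this; push_cast; omega
  have h2' : inf.ge (-((d + 1 : ℕ) : ℤ)) (cst L (Q.σ α) * (cst L Q.b / TT L) ^ (d + 1)) :=
    Pl.ge_mono (by push_cast; omega) h2
  constructor
  · rw [dg_le]; exact Pl.ge_add h1 h2'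
  · change inf.co _ (cst L α * TT L ^ (d + 1) + _) = α
    rw [Pl.co_add h1 h2', Pl.co_lt (by push_cast; omega) h2, add_zero]
    have := Pl.co_mul (p := inf) (inf_c_ge α) (Pl.ge_v (p := inf) (TT L ^ (d + 1)))
    rw [inf_c_co, Pl.co_v (pow_ne_zero _ TT_ne), map_pow, inf_Tlc, one_pow, mul_one, Pl.v_pow TT_ne, inf_T] at this
    convert this using 2; ring

theorem span2 {m : L} (hm : Q.σ m ≠ m) (w : L) : ∃ c1 c2 : Q.F, w = c1 + c2 * m := by
  have h : m - Q.σ m ≠ 0 := sub_ne_zero.2 (Ne.symm hm)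
  have h2 : Q.σ ((w - Q.σ w) / (m - Q.σ m)) = (w - Q.σ w) / (m - Q.σ m) := by
    rw [map_div₀, map_sub, map_sub, Q.ss, Q.ss, ← neg_sub, ← neg_sub m, neg_div_neg_eq]
  refine ⟨⟨w - (w - Q.σ w) / (m - Q.σ m) * m, ?_⟩, ⟨_, h2⟩, by simp⟩
  rw [mem_F, map_sub, map_mul, h2]
  field_simp
  ring
theorem r_ne : Q.σ Q.r ≠ Q.r := by
  rw [Q.sr]; intro h
  have : 2 * Q.r = 0 := by linear_combination -h
  exact mul_ne_zero Q.two Q.hr this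

noncomputable def y : Q.A := Q.el 1 2⁻¹
noncomputable def t : Q.A := Q.el 1 (2⁻¹ * Q.r⁻¹)
noncomputable def a : Q.F := ⟨Q.r ^ 2, by rw [mem_F, map_pow, Q.sr, neg_sq]⟩
noncomputable def bF : Q.F := ⟨Q.b, Q.sb⟩
theorem vl_y : Q.vl Q.y = cst L 2⁻¹ * (TT L + cst L Q.b / TT L) := by
  change cst L 2⁻¹ * TT L ^ 1 + cst L (Q.σ 2⁻¹) * (cst L Q.b / TT L) ^ 1 = _
  rw [map_inv₀ Q.σ, map_ofNat]; ring
theorem vl_t : Q.vl Q.t = cst L (2⁻¹ * Q.r⁻¹) * (TT L - cst L Q.b / TT L) := by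
  change cst L (2⁻¹ * Q.r⁻¹) * TT L ^ 1 + cst L (Q.σ _) * (cst L Q.b / TT L) ^ 1 = _
  rw [map_mul Q.σ, map_inv₀ Q.σ, map_ofNat, map_inv₀, Q.sr, inv_neg, mul_neg, map_neg]; ring
theorem yt : Q.y ^ 2 - Q.ι Q.a * Q.t ^ 2 = Q.ι Q.bF := by
  apply Q.vl_inj
  rw [map_sub, map_mul, map_pow, map_pow, vl_ι, vl_ι, vl_y, vl_t]
  have h2 : (2 : Om L) ≠ 0 := by rw [← map_ofNat (cst L)]; exact cst_ne Q.two
  have h3 := cst_ne Q.hr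
  have h4 := TT_ne (L := L)
  simp only [a, bF, map_mul, map_inv₀, map_pow, map_ofNat]
  field_simp
  ring

theorem red {g : Q.A} (g0 : g ≠ 0) {d : ℕ} (hd : Q.dg g = d) (x : Q.A) :
    ∃ q, Q.dg (x - q * g) ≤ d := by
  induction hn : Q.dg x using Nat.strong_induction_on generalizing x with
  | _ n ih =>
    by_cases h : n ≤ d
    · exact ⟨0, by simpa [hn]⟩
    obtain ⟨m, rfl⟩ : ∃ m, n = m + 1 + d := ⟨n - d - 1, by omega⟩
    obtain ⟨e1, e2⟩ := Q.el_spec m (Q.cf (m + 1 + d) x / Q.cf d g)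
    set q := Q.el (m + 1) (Q.cf (m + 1 + d) x / Q.cf d g)
    have hg : Q.cf d g ≠ 0 := by rw [← hd]; exact cf_ne g0
    have hq : Q.dg (q * g) ≤ m + 1 + d := by
      by_cases h0 : q = 0
      · simp [h0, Q.dgD.zero]
      · rw [Q.dgD.mul _ _ h0 g0]; omega
    have hx : Q.dg (x - q * g) ≤ m + d := by
      have e : m + 1 + d = m + d + 1 := by ring
      refine cf_zero ?_ ?_
      · rw [← e]; exact (Q.dgD.sub _ _).trans (max_le hn.le hq)
      · rw [← e, cf_sub hn.le hq, cf_mul e1 hd.le, e2]; field_simp; simp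
    obtain ⟨q', h'⟩ := ih _ (by omega) (x - q * g) rfl
    exact ⟨q + q', by convert h' using 2; ring⟩

theorem red2 {g w : Q.A} (g0 : g ≠ 0) {d : ℕ} (hd : Q.dg g = d + 1) (hw : Q.dg w ≤ d + 1)
    (hi : Q.σ (Q.cf (d + 1) w / Q.cf (d + 1) g) ≠ Q.cf (d + 1) w / Q.cf (d + 1) g) (x : Q.A) :
    ∃ q, ∃ c : Q.F, Q.dg (x - q * g - Q.ι c * w) ≤ d := by
  obtain ⟨q, hq⟩ := Q.red g0 hd x
  obtain ⟨c1, c2, h⟩ := Q.span2 hi (Q.cf (d + 1) (x - q * g) / Q.cf (d + 1) g)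
  have hg : Q.cf (d + 1) g ≠ 0 := by rw [← hd]; exact cf_ne g0
  refine ⟨q + Q.ι c1, c2, ?_⟩
  have e : x - (q + Q.ι c1) * g - Q.ι c2 * w = x - q * g - Q.ι c1 * g - Q.ι c2 * w := by ring
  have k1 := (dg_ιmul c1 g).trans hd.le
  have k2 := (dg_ιmul c2 w).trans hw
  have k3 := (Q.dgD.sub (x - q * g) (Q.ι c1 * g)).trans (max_le hq k1)
  rw [e]
  refine cf_zero ((Q.dgD.sub _ _).trans (max_le k3 k2)) ?_
  rw [cf_sub k3 k2, cf_sub hq k1, cf_ιmul _ hd.le, cf_ιmul _ hw]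
  field_simp at h
  rw [h]; ring

def NN : Prop := ∀ x : L, x * Q.σ x ≠ Q.b
theorem pid (hN : Q.NN) : IsPrincipalIdealRing Q.A := by
  refine ⟨fun I => ?_⟩
  by_cases hI : I = ⊥
  · rw [hI]; exact bot_isPrincipal
  obtain ⟨g1, hg1, g10⟩ := Submodule.exists_mem_ne_zero_of_ne_bot hI
  classical
  have hex : ∃ n, ∃ g ∈ I, g ≠ 0 ∧ Q.dg g = n := ⟨_, g1, hg1, g10, rfl⟩
  obtain ⟨g, hg, g0, hd⟩ := Nat.find_spec hex
  have hmin : ∀ x ∈ I, Q.dg x < Q.dg g → x = 0 := fun x hx hlt => by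
    by_contra h0
    exact Nat.find_min hex (hlt.trans_eq hd) ⟨x, hx, h0, rfl⟩
  clear hd
  rcases hdd : Q.dg g with _ | d
  · have : I = ⊤ := Ideal.eq_top_of_isUnit_mem _ hg (Q.dgD.isUnit g0 hdd)
    rw [this]; exact top_isPrincipal
  refine ⟨⟨g, le_antisymm (fun h0 hh0 => ?_) ((Ideal.span_singleton_le_iff_mem _).2 hg)⟩⟩
  change h0 ∈ Ideal.span {g}
  by_contra hc
  obtain ⟨q0, hq0⟩ := Q.red g0 hdd h0
  set h := h0 - q0 * g with hh
  have hhI : h ∈ I := I.sub_mem hh0 (I.mul_mem_left _ hg)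
  have hhg : ∀ q, h ≠ q * g := fun q e => hc (Ideal.mem_span_singleton.2 ⟨q + q0, by linear_combination e - hh⟩)
  have hg' : Q.cf (d + 1) g ≠ 0 := by rw [← hdd]; exact cf_ne g0
  have hi : Q.σ (Q.cf (d + 1) h / Q.cf (d + 1) g) ≠ Q.cf (d + 1) h / Q.cf (d + 1) g := by
    intro e
    set c : Q.F := ⟨_, e⟩
    refine hhg (Q.ι c) (sub_eq_zero.1 (hmin _ (I.sub_mem hhI (I.mul_mem_left _ hg)) ?_))
    have k1 := (dg_ιmul c g).trans hdd.le
    rw [hdd, Nat.lt_succ_iff]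
    refine cf_zero ((Q.dgD.sub _ _).trans (max_le hq0 k1)) ?_
    rw [cf_sub hq0 k1, cf_ιmul _ hdd.le]
    simp only [c]; field_simp; simp
  have key : ∀ x ∈ I, ∃ q, ∃ c : Q.F, x = q * g + Q.ι c * h := fun x hx => by
    obtain ⟨q, c, e⟩ := Q.red2 g0 hdd hq0 hi x
    refine ⟨q, c, ?_⟩
    have := hmin _ (I.sub_mem (I.sub_mem hx (I.mul_mem_left q hg)) (I.mul_mem_left (Q.ι c) hhI)) (by omega)
    linear_combination this
  obtain ⟨qy, cy, ey⟩ := key (Q.y * h) (I.mul_mem_left _ hhI)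
  obtain ⟨qt, ct, et⟩ := key (Q.t * h) (I.mul_mem_left _ hhI)
  set f : Q.F := Q.bF - (cy ^ 2 - Q.a * ct ^ 2) with hf
  have hfh : Q.ι f * h = ((Q.y + Q.ι cy) * qy - Q.ι Q.a * (Q.t + Q.ι ct) * qt) * g := by
    simp only [hf, map_sub, map_mul, map_pow, ← yt]
    linear_combination (Q.y + Q.ι cy) * ey - Q.ι Q.a * (Q.t + Q.ι ct) * et
  by_cases f0 : f = 0
  · refine hN (cy + Q.r * ct) ?_
    have e1 := congrArg Subtype.val f0
    have e2 : Q.σ cy = cy := cy.2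
    have e3 : Q.σ ct = ct := ct.2
    change Q.b - ((cy : L) ^ 2 - Q.r ^ 2 * (ct : L) ^ 2) = 0 at e1
    rw [map_add, map_mul, e2, e3, Q.sr]
    linear_combination -e1
  · apply hhg (Q.ι f⁻¹ * ((Q.y + Q.ι cy) * qy - Q.ι Q.a * (Q.t + Q.ι ct) * qt))
    rw [mul_assoc, ← hfh, ← mul_assoc, ← map_mul, inv_mul_cancel₀ f0]; simp

theorem ortho {F : Type} [Field F] (u v : Fin 3 → F) : ∃ α : Fin 3 → F, α ≠ 0 ∧
    α 0 * u 0 + α 1 * u 1 + α 2 * u 2 = 0 ∧ α 0 * v 0 + α 1 * v 1 + α 2 * v 2 = 0 := by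
  let f : (Fin 3 → F) →ₗ[F] (Fin 2 → F) := Matrix.mulVecLin (Matrix.of ![u, v])
  have h : LinearMap.ker f ≠ ⊥ := LinearMap.ker_ne_bot_of_finrank_lt (by simp)
  obtain ⟨α, h1, h2⟩ := Submodule.exists_mem_ne_zero_of_ne_bot h
  rw [LinearMap.mem_ker] at h1
  refine ⟨α, h2, ?_, ?_⟩
  · have := congrFun h1 0
    simp [f, Matrix.mulVec, dotProduct, Fin.sum_univ_three] at this
    linear_combination this
  · have := congrFun h1 1
    simp [f, Matrix.mulVec, dotProduct, Fin.sum_univ_three] at this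
    linear_combination this
theorem dg_y : Q.dg Q.y ≤ 1 ∧ Q.cf 1 Q.y = 2⁻¹ := Q.el_spec 0 _
theorem dg_t : Q.dg Q.t ≤ 1 ∧ Q.cf 1 Q.t = 2⁻¹ * Q.r⁻¹ := Q.el_spec 0 _
noncomputable def lin (α : Fin 3 → Q.F) : Q.A := Q.ι (α 0) + Q.ι (α 1) * Q.y + Q.ι (α 2) * Q.t
theorem dg_lin (α : Fin 3 → Q.F) : Q.dg (Q.lin α) ≤ 1 ∧ Q.cf 1 (Q.lin α) = 2⁻¹ * (α 1 + α 2 * Q.r⁻¹) := by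
  have k0 : Q.dg (Q.ι (α 0)) ≤ 1 := (dg_ι _).trans (by omega)
  have k1 := (dg_ιmul (α 1) Q.y).trans Q.dg_y.1
  have k2 := (dg_ιmul (α 2) Q.t).trans Q.dg_t.1
  have k3 := (Q.dgD.add (Q.ι (α 0)) _).trans (max_le k0 k1)
  refine ⟨(Q.dgD.add _ _).trans (max_le k3 k2), ?_⟩
  rw [lin, cf_add k3 k2, cf_add k0 k1, cf_ιmul _ Q.dg_y.1, cf_ιmul _ Q.dg_t.1, Q.dg_y.2, Q.dg_t.2]
  have : Q.cf 1 (Q.ι (α 0)) = 0 := by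
    refine Pl.co_lt ?_ (Q.dg_le.1 (dg_ι (α 0))); simp
  rw [this]; ring
theorem lin_ne {α : Fin 3 → Q.F} (h : α ≠ 0) : Q.lin α ≠ 0 := by
  contrapose! h
  have h1 := (Q.dg_lin α).2
  have : Q.cf 1 0 = 0 := by rw [cf, map_zero, Pl.co_zero]
  rw [h, this] at h1
  have two := Q.two
  have hr := Q.hr
  have h2 : α 1 + α 2 * Q.r⁻¹ = (0 : L) := by
    rcases mul_eq_zero.1 h1.symm with h | h
    · exact absurd h (inv_ne_zero two)
    · exact h
  have h3 := congrArg Q.σ h2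
  have e1 : Q.σ (α 1) = α 1 := (α 1).2
  have e2 : Q.σ (α 2) = α 2 := (α 2).2
  rw [map_add, map_mul, e1, e2, map_inv₀, Q.sr, map_zero] at h3
  have a1 : (α 1 : L) = 0 := by
    have : 2 * (α 1 : L) = 0 := by rw [inv_neg] at h3; linear_combination h2 + h3
    exact (mul_eq_zero.1 this).resolve_left two
  have a2 : (α 2 : L) = 0 := by
    rw [a1, zero_add] at h2
    exact (mul_eq_zero.1 h2).resolve_right (inv_ne_zero hr)
  have a1' : α 1 = 0 := Subtype.ext a1
  have a2' : α 2 = 0 := Subtype.ext a2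
  have a0 : α 0 = 0 := by
    rw [lin, a1', a2'] at h; simpa using h
  funext i; fin_cases i
  · exact a0
  · exact a1'
  · exact a2'

theorem hh {e : ℕ} (he : 1 ≤ e) : HH Q.dg e := by
  intro π hπ hd u v
  have p0 : Q.cf (e + 1) π ≠ 0 := by rw [← hd]; exact cf_ne hπ.ne_zero
  obtain ⟨w1, w2⟩ := Q.el_spec e (Q.r * Q.cf (e + 1) π)
  set w := Q.el (e + 1) (Q.r * Q.cf (e + 1) π)
  have key : ∀ x, ∃ l, ∃ c : Q.F, Q.dg l ≤ e ∧ π ∣ x - l - Q.ι c * w := fun x => by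
    obtain ⟨q, c, h⟩ := Q.red2 hπ.ne_zero hd w1 (by rw [w2, mul_div_cancel_right₀ _ p0]; exact Q.r_ne) x
    exact ⟨_, c, h, q, by ring⟩
  let B : Fin 3 → Q.A := ![1, Q.y, Q.t]
  choose l c hl hc using fun i => key (u * B i)
  choose l' c' hl' hc' using fun i => key (v * B i)
  obtain ⟨α, h0, h1, h2⟩ := ortho c c'
  have sm : ∀ l : Fin 3 → Q.A, (∀ i, Q.dg (l i) ≤ e) → Q.dg (Q.ι (α 0) * l 0 + Q.ι (α 1) * l 1 + Q.ι (α 2) * l 2) ≤ e :=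
    fun l hl => (Q.dgD.add _ _).trans (max_le ((Q.dgD.add _ _).trans (max_le ((dg_ιmul _ _).trans (hl _)) ((dg_ιmul _ _).trans (hl _)))) ((dg_ιmul _ _).trans (hl _)))
  have dv : ∀ (u : Q.A) (l : Fin 3 → Q.A) (c : Fin 3 → Q.F), (∀ i, π ∣ u * B i - l i - Q.ι (c i) * w) →
      α 0 * c 0 + α 1 * c 1 + α 2 * c 2 = 0 →
      π ∣ u * Q.lin α - (Q.ι (α 0) * l 0 + Q.ι (α 1) * l 1 + Q.ι (α 2) * l 2) := fun u l c hc h1 => by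
    have := dvd_add (dvd_add ((hc 0).mul_left (Q.ι (α 0))) ((hc 1).mul_left (Q.ι (α 1)))) ((hc 2).mul_left (Q.ι (α 2)))
    convert this using 1
    have h1' := congrArg Q.ι h1
    simp only [map_add, map_mul, map_zero] at h1'
    simp only [B, lin, Matrix.cons_val_zero, Matrix.cons_val_one, Matrix.cons_val]
    linear_combination w * h1'
  exact ⟨Q.lin α, _, _, Q.lin_ne h0, (Q.dg_lin α).1.trans he, sm l hl, sm l' hl', dv u l c hc h1, dv v l' c' hc' h2⟩
end Qd
end Mk

namespace Mk
open scoped Quaternion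

section nrm
variable {F : Type} [Field F] {a b : F}
def nq (w : ℍ[F,a,b]) : F := w.re ^ 2 - a * w.imI ^ 2 - b * w.imJ ^ 2 + a * b * w.imK ^ 2
theorem nq_mul (w v : ℍ[F,a,b]) : nq (w * v) = nq w * nq v := by
  simp [nq]; ring
theorem mul_star_nq (w : ℍ[F,a,b]) : w * star w = ((nq w : F) : ℍ[F,a,b]) := by
  ext
  · simp; rw [nq]; ring
  all_goals simp; try ring
theorem star_mul_nq (w : ℍ[F,a,b]) : star w * w = ((nq w : F) : ℍ[F,a,b]) := by
  ext
  · simp; rw [nq]; ring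
  all_goals simp; try ring
theorem re_comm (w v : ℍ[F,a,b]) : (w * v).re = (v * w).re := by simp; ring
end nrm

structure Cn {F : Type} (K : Type) [Field F] [Field K] (a b : F) where
  ι : F →+* K
  y : K
  t : K
  h : y ^ 2 - ι a * t ^ 2 = ι b
  ha : a ≠ 0
  hb : b ≠ 0
  two : (2 : F) ≠ 0
  nz : ∀ w : ℍ[F,a,b], nq w = 0 → w = 0
  li : ∀ x1 x2 x3, ι x2 * t - ι x3 * y - ι x1 = 0 → x1 = 0 ∧ x2 = 0 ∧ x3 = 0

namespace Cn
variable {F K : Type} [Field F] [Field K] {a b : F} (c : Cn K a b)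
local notation "Q" => ℍ[F,a,b]

def ell (w : Q) : K := c.ι w.imJ * c.t - c.ι w.imK * c.y - c.ι w.imI
theorem ell_add (w v : Q) : c.ell (w + v) = c.ell w + c.ell v := by simp [ell]; ring
theorem ell_sub (w v : Q) : c.ell (w - v) = c.ell w - c.ell v := by simp [ell]; ring
theorem ell_neg (w : Q) : c.ell (-w) = - c.ell w := by simp [ell]; ring
theorem ell_smul (x : F) (w : Q) : c.ell (x • w) = c.ι x * c.ell w := by simp [ell]; ring
theorem ell_coe (x : F) : c.ell (x : Q) = 0 := by simp [ell]
theorem ell_coe_mul (x : F) (w : Q) : c.ell (x * w) = c.ι x * c.ell w := by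
  rw [QuaternionAlgebra.coe_mul_eq_smul, ell_smul]
theorem ell_mul_coe (x : F) (w : Q) : c.ell (w * x) = c.ι x * c.ell w := by
  rw [QuaternionAlgebra.mul_coe_eq_smul, ell_smul]
theorem ell_star (w : Q) : c.ell (star w) = - c.ell w := by simp [ell]; ring
theorem plucker (w1 w2 w3 : Q) : c.ι (nq w2) * c.ell w1 * c.ell w3 + c.ell (w1 * w2 * w3) * c.ell w2 =
    c.ell (w1 * w2) * c.ell (w2 * w3) := by
  simp [ell, nq]
  rw [← c.h]
  ring
theorem epsId (w w1 w2 : Q) : c.ell (w1 * w) * c.ell w2 - c.ell w1 * c.ell (w2 * w) =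
    -(c.ell w * c.ell (w1 * star w2)) := by
  simp [ell, nq]
  rw [← c.h]
  ring

theorem cen {w : Q} (h : c.ell w = 0) : w = (w.re : Q) := by
  obtain ⟨h1, h2, h3⟩ := c.li _ _ _ h
  ext <;> simp [h1, h2, h3]
theorem nq_ne (c : Cn K a b) {w : Q} (h : w ≠ 0) : nq w ≠ 0 := fun h' => h (c.nz w h')
theorem ne_nq {w : Q} (h : nq w ≠ 0) : w ≠ 0 := by rintro rfl; simp [nq] at h
theorem ne_of_ell {w : Q} (h : c.ell w ≠ 0) : w ≠ 0 := by
  rintro rfl; simp [ell] at h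
theorem mul_ne (c : Cn K a b) {w v : Q} (h : w ≠ 0) (h' : v ≠ 0) : w * v ≠ 0 := by
  apply ne_nq; rw [nq_mul]; exact mul_ne_zero (c.nq_ne h) (c.nq_ne h')
noncomputable def un (c : Cn K a b) {w : Q} (h : w ≠ 0) : Qˣ where
  val := w
  inv := (nq w)⁻¹ • star w
  val_inv := by
    rw [mul_smul_comm, mul_star_nq, QuaternionAlgebra.smul_coe, inv_mul_cancel₀ (c.nq_ne h)]; rfl
  inv_val := by
    rw [smul_mul_assoc, star_mul_nq, QuaternionAlgebra.smul_coe, inv_mul_cancel₀ (c.nq_ne h)]; rfl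
theorem un_val (c : Cn K a b) {w : Q} (h : w ≠ 0) : (c.un h : Q) = w := rfl
theorem comm_span {w v : Q} (h : w * v = v * w) (hw : c.ell w ≠ 0) : ∃ α β : F, v = (α : Q) + β • w := by
  have two := c.two
  have ha := c.ha
  have hb := c.hb
  have e1 := congrArg QuaternionAlgebra.imI h
  have e2 := congrArg QuaternionAlgebra.imJ h
  have e3 := congrArg QuaternionAlgebra.imK h
  simp at e1 e2 e3
  have k1 : w.imJ * v.imK = w.imK * v.imJ :=
    mul_left_cancel₀ (mul_ne_zero two hb) (by linear_combination -e1)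
  have k2 : w.imI * v.imK = w.imK * v.imI :=
    mul_left_cancel₀ (mul_ne_zero two ha) (by linear_combination e2)
  have k3 : w.imI * v.imJ = w.imJ * v.imI :=
    mul_left_cancel₀ two (by linear_combination e3)
  have key : ∀ β : F, v.imI = β * w.imI → v.imJ = β * w.imJ → v.imK = β * w.imK → ∃ α β : F, v = (α : Q) + β • w := by
    intro β h1 h2 h3
    refine ⟨v.re - β * w.re, β, ?_⟩
    ext <;> simp [h1, h2, h3]
  by_cases h1 : w.imI = 0
  · by_cases h2 : w.imJ = 0
    · by_cases h3 : w.imK = 0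
      · exact absurd (by simp [ell, h1, h2, h3]) hw
      · refine key (v.imK / w.imK) ?_ ?_ ?_ <;> field_simp
        · linear_combination -k2
        · linear_combination -k1
    · refine key (v.imJ / w.imJ) ?_ ?_ ?_ <;> field_simp
      · linear_combination -k3
      · linear_combination k1
  · refine key (v.imI / w.imI) ?_ ?_ ?_ <;> field_simp
    · linear_combination k3
    · linear_combination k2
theorem comm_coe (c : Cn K a b) (x : F) (w : Q) : (x : Q) * w = w * x := QuaternionAlgebra.coe_commutes _ _
theorem comm_trans {w v v' : Q} (hw : c.ell w ≠ 0) (h : w * v = v * w) (h' : w * v' = v' * w) : v * v' = v' * v := by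
  obtain ⟨α, β, rfl⟩ := c.comm_span h hw
  rw [add_mul, mul_add, smul_mul_assoc, mul_smul_comm, h', c.comm_coe]

noncomputable def CF : AddSubgroup (K2 K) := AddSubgroup.closure {z | ∃ x d, z = st x (c.ι d)}
def G : Type := K2 K ⧸ c.CF
noncomputable instance : AddCommGroup c.G := inferInstanceAs (AddCommGroup (K2 K ⧸ c.CF))
noncomputable def qm : K2 K →+ c.G := QuotientAddGroup.mk' c.CF
theorem qm_eq_zero {z : K2 K} : c.qm z = 0 ↔ z ∈ c.CF := QuotientAddGroup.eq_zero_iff z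
noncomputable def br (x y : K) : c.G := c.qm (st x y)
theorem br_z (y : K) : c.br 0 y = 0 := by simp [br]
theorem br_z' (y : K) : c.br y 0 = 0 := by simp [br]
theorem br_const (x : K) (d : F) : c.br x (c.ι d) = 0 := c.qm_eq_zero.2 (AddSubgroup.subset_closure ⟨x, d, rfl⟩)
theorem br_anti (x y : K) : c.br x y = - c.br y x := by rw [br, st_anti, map_neg]; rfl
theorem br_const' (x : K) (d : F) : c.br (c.ι d) x = 0 := by rw [br_anti, br_const, neg_zero]
theorem br_self (x : K) : c.br x x = 0 := by
  rw [br, st_self, show (-1 : K) = c.ι (-1) by simp]; exact c.br_const _ _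
theorem br_mul {x y : K} (w : K) (hx : x ≠ 0) (hy : y ≠ 0) : c.br (x * y) w = c.br x w + c.br y w := by
  rw [br, st_mul_left _ hx hy, map_add]; rfl
theorem br_mul' {x y : K} (w : K) (hx : x ≠ 0) (hy : y ≠ 0) : c.br w (x * y) = c.br w x + c.br w y := by
  rw [br, st_mul_right _ hx hy, map_add]; rfl
theorem br_c {d : F} (hd : d ≠ 0) (x y : K) : c.br (c.ι d * x) y = c.br x y := by
  by_cases hx : x = 0
  · simp [hx]
  · rw [br_mul _ _ (by simpa using hd) hx, br_const', zero_add]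
theorem br_c' {d : F} (hd : d ≠ 0) (x y : K) : c.br x (c.ι d * y) = c.br x y := by
  rw [br_anti, br_c _ hd, ← br_anti]
theorem br_n (x y : K) : c.br (-x) y = c.br x y := by
  have := c.br_c (d := -1) (by simp) x y; simpa using this
theorem br_n' (x y : K) : c.br x (-y) = c.br x y := by rw [br_anti, br_n, ← br_anti]
theorem br_prop (d e : F) (x : K) : c.br (c.ι d * x) (c.ι e * x) = 0 := by
  by_cases hd : d = 0
  · simp [hd, br_z]
  by_cases he : e = 0
  · simp [he, br_z']
  rw [br_c _ hd, br_c' _ he, br_self]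
theorem br_div (x y : K) {z : K} (hx : x ≠ 0) (hy : y ≠ 0) (hz : z ≠ 0) :
    c.br (x / z) (y / z) = c.br x y + c.br y z + c.br z x := by
  rw [br, st_div_left _ hx hz, st_div_right _ hy hz, st_div_right _ hy hz, map_sub, map_sub, map_sub]
  change c.br x y - c.br x z - (c.br z y - c.br z z) = _
  rw [br_self, c.br_anti z x, c.br_anti z y]; abel

noncomputable def tri (u v w : Q) : c.G := c.br (c.ell u) (c.ell v) + c.br (c.ell v) (c.ell w) + c.br (c.ell w) (c.ell u)
noncomputable def sg (u v : Q) : c.G := c.tri u v (u * v)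
theorem tri_prop {u v w : Q} (x : K) (h : ∃ d e f, c.ell u = c.ι d * x ∧ c.ell v = c.ι e * x ∧ c.ell w = c.ι f * x) :
    c.tri u v w = 0 := by
  obtain ⟨d, e, f, h1, h2, h3⟩ := h
  rw [tri, h1, h2, h3, br_prop, br_prop, br_prop]; simp
theorem sg_comm {u v : Q} (h : u * v = v * u) : c.sg u v = 0 := by
  by_cases hu : c.ell u = 0
  · refine c.tri_prop (c.ell v) ⟨0, 1, u.re, by simp [hu], by simp, ?_⟩
    conv_lhs => rw [c.cen hu, ell_coe_mul]
  · obtain ⟨α, β, rfl⟩ := c.comm_span h hu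
    have e : u * u = (-nq u : F) + (2 * u.re) • u := by
      ext
      · simp; rw [nq]; ring
      all_goals simp; try ring
    refine c.tri_prop (c.ell u) ⟨1, β, α + β * (2 * u.re), by simp, by simp [ell_add, ell_smul, ell_coe], ?_⟩
    rw [mul_add, mul_smul_comm, e, ell_add, ell_smul, ell_add, ell_coe, ell_smul, ell_mul_coe]
    simp; ring
theorem sg_coe_mul {d : F} (hd : d ≠ 0) (u v : Q) : c.sg (d * u) v = c.sg u v := by
  rw [sg, sg, tri, tri, mul_assoc, ell_coe_mul, ell_coe_mul]
  simp only [c.br_c hd, c.br_c' hd]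
theorem sg_mul_coe {d : F} (hd : d ≠ 0) (u v : Q) : c.sg u (d * v) = c.sg u v := by
  rw [sg, sg, tri, tri, ← mul_assoc, ← c.comm_coe, mul_assoc, ell_coe_mul, ell_coe_mul]
  simp only [c.br_c hd, c.br_c' hd]

theorem abs12 {G : Type} [AddCommGroup G] {AT AB DT DB TAB TBD BAB BBD ABA ABD BDA BDD : G}
    (S : AT + AB + (DT + DB) + (TAB + TBD + (BAB + BBD)) + (ABA + ABD + (BDA + BDD)) = 0) :
    AB + BAB + ABA + (ABD + DT + TAB) = -BDA + -TBD + -AT + (-DB + -BDD + -BBD) := by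
  rw [← sub_eq_zero, ← S]; abel
theorem coc_gen {A B D AB BD T : K} {n : F} (v1 : n ≠ 0) (hu : A ≠ 0) (hv : B ≠ 0) (hw : D ≠ 0) (huv : AB ≠ 0) (hvw : BD ≠ 0)
    (h3 : T ≠ 0) (P : c.ι n * A * D + T * B = AB * BD) :
    (c.br A B + c.br B AB + c.br AB A) + (c.br AB D + c.br D T + c.br T AB) =
    (c.br A BD + c.br BD T + c.br T A) + (c.br B D + c.br D BD + c.br BD B) := by
  have hn : c.ι n ≠ 0 := by simpa using v1
  have S : c.br ((c.ι n * A * D) / (AB * BD)) ((T * B) / (AB * BD)) = 0 := by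
    rw [br, st_stein, map_zero]
    rw [← add_div, P, div_self (mul_ne_zero huv hvw)]
  rw [c.br_div _ _ (mul_ne_zero (mul_ne_zero hn hu) hw) (mul_ne_zero h3 hv) (mul_ne_zero huv hvw),
    mul_assoc, c.br_c v1, c.br_c' v1, c.br_mul _ hu hw, c.br_mul _ huv hvw, c.br_mul _ h3 hv, c.br_mul' _ h3 hv, c.br_mul' _ h3 hv,
    c.br_mul' _ huv hvw, c.br_mul' _ huv hvw, c.br_mul' _ hu hw, c.br_mul' _ hu hw] at S
  rw [c.br_anti T A, c.br_anti B D, c.br_anti A BD, c.br_anti BD T, c.br_anti BD B, c.br_anti D BD]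
  exact abs12 S
theorem coc {u v w : Q} (u0 : u ≠ 0) (v0 : v ≠ 0) (w0 : w ≠ 0) :
    c.sg u v + c.sg (u * v) w = c.sg u (v * w) + c.sg v w := by
  have cn : ∀ {x : Q}, c.ell x = 0 → x ≠ 0 → ∃ d : F, d ≠ 0 ∧ x = d := fun {x} h h0 =>
    ⟨x.re, fun e => h0 (by rw [c.cen h, e]; simp), c.cen h⟩
  by_cases hu : c.ell u = 0
  · obtain ⟨d, hd, rfl⟩ := cn hu u0
    rw [sg_coe_mul _ hd, c.sg_comm (c.comm_coe d v), c.sg_comm (c.comm_coe d _)]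
  by_cases hv : c.ell v = 0
  · obtain ⟨d, hd, rfl⟩ := cn hv v0
    rw [← c.comm_coe, sg_coe_mul _ hd, sg_mul_coe _ hd, c.sg_comm (c.comm_coe d u).symm, c.sg_comm (c.comm_coe d _)]; abel
  by_cases hw : c.ell w = 0
  · obtain ⟨d, hd, rfl⟩ := cn hw w0
    rw [← c.comm_coe, sg_mul_coe _ hd, c.sg_comm (c.comm_coe d v).symm, c.sg_comm (c.comm_coe d (u * v)).symm]
  have u1 := c.nq_ne u0
  have v1 := c.nq_ne v0
  have w1 := c.nq_ne w0
  by_cases huv : c.ell (u * v) = 0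
  · obtain ⟨d, hd, e⟩ := cn huv (c.mul_ne u0 v0)
    have e1 : c.ι (nq u) * c.ell v = c.ι (-d) * c.ell u := by
      have := congrArg (fun x => c.ell (star u * x)) e
      simp only [← mul_assoc, star_mul_nq, ell_coe_mul, ell_mul_coe, ell_star] at this
      rw [this, map_neg]; ring
    have hvv : ∀ x, c.br (c.ell v) x = c.br (c.ell u) x := fun x => by
      rw [← c.br_c u1, e1, c.br_c (neg_ne_zero.2 hd)]
    have hvv' : ∀ x, c.br x (c.ell v) = c.br x (c.ell u) := fun x => by rw [br_anti, hvv, ← br_anti]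
    rw [e, c.sg_comm (c.comm_coe d _), sg, sg, sg, tri, tri, tri, ← mul_assoc, e, ell_coe, ell_coe_mul]
    simp only [c.br_c hd, c.br_c' hd, hvv, hvv', br_self, br_z, br_z']
    rw [c.br_anti (c.ell w), c.br_anti (c.ell (v * w)), c.br_anti (c.ell (v * w))]; abel
  by_cases hvw : c.ell (v * w) = 0
  · obtain ⟨d, hd, e⟩ := cn hvw (c.mul_ne v0 w0)
    have e1 : c.ι (nq w) * c.ell v = c.ι (-d) * c.ell w := by
      have := congrArg (fun x => c.ell (x * star w)) e
      simp only [mul_assoc, mul_star_nq, ell_coe_mul, ell_mul_coe, ell_star] at this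
      rw [this, map_neg]; ring
    have hvv : ∀ x, c.br (c.ell v) x = c.br (c.ell w) x := fun x => by
      rw [← c.br_c w1, e1, c.br_c (neg_ne_zero.2 hd)]
    have hvv' : ∀ x, c.br x (c.ell v) = c.br x (c.ell w) := fun x => by rw [br_anti, hvv, ← br_anti]
    rw [e, c.sg_comm (c.comm_coe d _).symm, sg, sg, sg, tri, tri, tri, mul_assoc, e, ell_coe, ell_mul_coe]
    simp only [c.br_c hd, c.br_c' hd, hvv, hvv', br_self, br_z, br_z']
    rw [c.br_anti (c.ell (u * v)) (c.ell u), c.br_anti (c.ell (u * v)) (c.ell w), c.br_anti (c.ell w) (c.ell u)]; abel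
  by_cases h3 : c.ell (u * v * w) = 0
  · obtain ⟨d, hd, e⟩ := cn h3 (c.mul_ne (c.mul_ne u0 v0) w0)
    have e1 : c.ι (nq w) * c.ell (u * v) = c.ι (-d) * c.ell w := by
      have := congrArg (fun x => c.ell (x * star w)) e
      simp only [mul_assoc, mul_star_nq, ell_coe_mul, ell_mul_coe, ell_star] at this
      rw [← mul_assoc, ell_mul_coe] at this
      rw [this, map_neg]; ring
    have e2 : c.ι (nq u) * c.ell (v * w) = c.ι (-d) * c.ell u := by
      rw [mul_assoc] at e
      have := congrArg (fun x => c.ell (star u * x)) e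
      simp only [← mul_assoc, star_mul_nq, ell_coe_mul, ell_mul_coe, ell_star] at this
      rw [mul_assoc, ell_coe_mul] at this
      rw [this, map_neg]; ring
    have k1 : ∀ x, c.br (c.ell (u * v)) x = c.br (c.ell w) x := fun x => by
      rw [← c.br_c w1, e1, c.br_c (neg_ne_zero.2 hd)]
    have k1' : ∀ x, c.br x (c.ell (u * v)) = c.br x (c.ell w) := fun x => by rw [br_anti, k1, ← br_anti]
    have k2 : ∀ x, c.br (c.ell (v * w)) x = c.br (c.ell u) x := fun x => by
      rw [← c.br_c u1, e2, c.br_c (neg_ne_zero.2 hd)]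
    have k2' : ∀ x, c.br x (c.ell (v * w)) = c.br x (c.ell u) := fun x => by rw [br_anti, k2, ← br_anti]
    rw [sg, sg, sg, sg, tri, tri, tri, tri, ← mul_assoc, e, ell_coe]
    simp only [k1, k1', k2, k2', br_self, br_z, br_z']
    abel
  rw [sg, sg, sg, sg, tri, tri, tri, tri, ← mul_assoc u v w]
  exact c.coc_gen v1 hu hv hw huv hvw h3 (c.plucker u v w)
end Cn
end Mk

namespace Mk
open scoped Quaternion
namespace Cn
variable {F K : Type} [Field F] [Field K] {a b : F} (c : Cn K a b)
local notation "Q" => ℍ[F,a,b]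

noncomputable def HS : AddSubgroup c.G := AddSubgroup.closure {g | ∃ u v : Q, u ≠ 0 ∧ v ≠ 0 ∧ g = c.sg u v}
theorem sg_mem (u v : Q) : c.sg u v ∈ c.HS := by
  by_cases hu : u = 0
  · subst hu; rw [c.sg_comm (by simp)]; exact zero_mem _
  by_cases hv : v = 0
  · subst hv; rw [c.sg_comm (by simp)]; exact zero_mem _
  exact AddSubgroup.subset_closure ⟨u, v, hu, hv, rfl⟩
theorem tri_swap (u v w : Q) : c.tri v u w = - c.tri u v w := by
  rw [tri, tri, c.br_anti (c.ell v) (c.ell u), c.br_anti (c.ell u) (c.ell w), c.br_anti (c.ell w) (c.ell v)]; abel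
theorem tri_A (u v p : Q) {x0 x1 x2 κ : F} (hκ : κ ≠ 0) (hp : p = (x0 : Q) + x1 • u + x2 • v + κ • (u * v)) :
    c.tri u v p ∈ c.HS := by
  have e : c.tri u v p = c.sg (u + (κ⁻¹ * x2 : F)) (v + (κ⁻¹ * x1 : F)) := by
    rw [sg, tri, tri]
    have h : c.ell p = c.ι κ * c.ell ((u + (κ⁻¹ * x2 : F)) * (v + (κ⁻¹ * x1 : F))) := by
      subst hp
      simp only [mul_add, add_mul, ell_add, ell_coe, ell_smul, ell_coe_mul, ell_mul_coe, map_mul, map_inv₀]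
      have : c.ι κ ≠ 0 := by simpa using hκ
      field_simp; ring
    rw [h, c.br_c hκ, c.br_c' hκ, ell_add, ell_add, ell_coe, ell_coe, add_zero, add_zero]
  rw [e]; exact c.sg_mem _ _
theorem basis4 (c : Cn K a b) {u v : Q} (h : u * v ≠ v * u) (p : Q) : ∃ x0 x1 x2 κ : F, p = (x0 : Q) + x1 • u + x2 • v + κ • (u * v) := by
  have li : LinearIndependent F ![(1 : Q), u, v, u * v] := by
    rw [Fintype.linearIndependent_iff]
    intro g hg
    have hc : ∀ x : F, (x : Q) = x • 1 := fun x => by rw [← QuaternionAlgebra.coe_mul_eq_smul, mul_one]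
    simp only [Fin.sum_univ_four, Matrix.cons_val_zero, Matrix.cons_val_one, Matrix.cons_val] at hg
    have h3 : g 3 = 0 := by
      by_contra h3
      set u' := u + ((g 3)⁻¹ * g 2 : F) with hu'
      set v' := v + ((g 3)⁻¹ * g 1 : F) with hv'
      have e : g 3 • (u' * v') = (((g 3)⁻¹ * g 2 * g 1 - g 0 : F) : Q) := by
        have e1 : g 3 • (u' * v') = g 3 • (u * v) + g 1 • u + g 2 • v + (((g 3)⁻¹ * g 2 * g 1 : F) : Q) := by
          rw [hu', hv', hc, hc, hc]
          simp only [mul_add, add_mul, smul_add, mul_smul_comm, smul_mul_assoc, mul_one, one_mul, smul_smul]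
          have : g 3 * ((g 3)⁻¹ * g 2 * ((g 3)⁻¹ * g 1)) = (g 3)⁻¹ * g 2 * g 1 := by field_simp
          have k1 : g 3 * ((g 3)⁻¹ * g 1) = g 1 := by field_simp
          have k2 : g 3 * ((g 3)⁻¹ * g 2) = g 2 := by field_simp
          have k3 : g 3 * ((g 3)⁻¹ * g 1 * ((g 3)⁻¹ * g 2)) = (g 3)⁻¹ * g 2 * g 1 := by field_simp
          rw [k1, k2]; first | rw [this] | rw [k3]
          abel
        rw [e1, sub_eq_add_neg, QuaternionAlgebra.coe_add, hc (-g 0), ← sub_eq_zero, ← hg, neg_smul]; abel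
      have e2 : u' * v' = (((g 3)⁻¹ * ((g 3)⁻¹ * g 2 * g 1 - g 0) : F) : Q) := by
        rw [← QuaternionAlgebra.smul_coe, ← e, smul_smul, inv_mul_cancel₀ h3, one_smul]
      have e3 : u' * (u' * v' - v' * u') = 0 := by
        rw [mul_sub, ← mul_assoc u' v' u', e2, c.comm_coe, sub_self]
      have h4 : u' * v' - v' * u' = u * v - v * u := by
        rw [hu', hv', mul_add, add_mul, add_mul, mul_add, add_mul, add_mul, ← c.comm_coe _ u, ← c.comm_coe _ v, ← c.comm_coe]; abel
      have h5 : u' ≠ 0 := by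
        intro h5; rw [h5] at h4; simp at h4; exact h (sub_eq_zero.1 h4.symm)
      exact c.mul_ne h5 (by rw [h4]; exact sub_ne_zero.2 h) e3
    rw [h3, zero_smul, add_zero] at hg
    have h2 : g 2 = 0 := by
      by_contra h2
      have e : v = (-(g 2)⁻¹ * g 0) • 1 + (-(g 2)⁻¹ * g 1) • u := by
        have := congrArg (fun x => (g 2)⁻¹ • x) hg
        simp only [smul_add, smul_smul, inv_mul_cancel₀ h2, one_smul, smul_zero] at this
        rw [← sub_eq_zero, ← this]; simp only [neg_mul, neg_smul]; abel
      apply h; rw [e]; simp [mul_add, add_mul]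
    rw [h2, zero_smul, add_zero] at hg
    have h1 : g 1 = 0 := by
      by_contra h1
      have e : u = (-(g 1)⁻¹ * g 0) • 1 := by
        have := congrArg (fun x => (g 1)⁻¹ • x) hg
        simp only [smul_add, smul_smul, inv_mul_cancel₀ h1, one_smul, smul_zero] at this
        rw [← sub_eq_zero, ← this]; simp only [neg_mul, neg_smul]; abel
      apply h; rw [e]; simp
    rw [h1, zero_smul, add_zero] at hg
    have h0 : g 0 = 0 := by
      have := congrArg QuaternionAlgebra.re hg; simpa using this
    intro i; fin_cases i <;> assumption
  have sp := li.span_eq_top_of_card_eq_finrank' (by simp [QuaternionAlgebra.finrank_eq_four])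
  have hp : p ∈ Submodule.span F (Set.range ![(1 : Q), u, v, u * v]) := by rw [sp]; trivial
  obtain ⟨x, hx⟩ := (Submodule.mem_span_range_iff_exists_fun F).1 hp
  refine ⟨x 0, x 1, x 2, x 3, ?_⟩
  rw [← hx, Fin.sum_univ_four, ← QuaternionAlgebra.coe_mul_eq_smul (x 0)]
  simp
theorem sq_eq (c : Cn K a b) (u : Q) : u * u = (-nq u : F) + (2 * u.re) • u := by
  ext
  · simp; rw [nq]; ring
  all_goals simp; try ring
theorem gen (u v : Q) : c.br (c.ell u) (c.ell v) ∈ c.HS := by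
  by_cases h : u * v = v * u
  · by_cases hu : c.ell u = 0
    · rw [hu, br_z]; exact zero_mem _
    · obtain ⟨α, β, rfl⟩ := c.comm_span h hu
      have := c.br_prop 1 β (c.ell u)
      rw [ell_add, ell_coe, ell_smul, zero_add]
      rw [map_one, one_mul] at this; rw [this]; exact zero_mem _
  set p : Q := ⟨0, 1, 0, 0⟩ with hp
  have lp : c.ell p = c.ι (-1) := by simp [ell, hp]
  have e : c.br (c.ell u) (c.ell v) = c.tri u v p := by
    rw [tri, lp, br_const, br_const', add_zero, add_zero]
  have hpn : c.ell p ≠ 0 := by rw [lp]; simp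
  rw [e]
  obtain ⟨x0, x1, x2, κ, hx⟩ := c.basis4 h p
  by_cases hκ : κ = 0
  swap
  · exact c.tri_A u v p hκ hx
  rw [hκ, zero_smul, add_zero] at hx
  have e2 : c.tri u v p = c.tri u v (u * v) + c.tri v p (u * v) + c.tri p u (u * v) := by
    simp only [tri]
    rw [c.br_anti (c.ell (u * v)) (c.ell u), c.br_anti (c.ell (u * v)) (c.ell v), c.br_anti (c.ell (u * v)) (c.ell p)]; abel
  have lpe : c.ell p = c.ι x1 * c.ell u + c.ι x2 * c.ell v := by
    rw [hx, ell_add, ell_add, ell_coe, ell_smul, ell_smul, zero_add]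
  rw [e2]
  refine add_mem (add_mem (c.sg_mem _ _) ?_) ?_
  · by_cases h1 : x1 = 0
    · have h2 : x2 ≠ 0 := by
        rintro rfl; rw [h1] at lpe; simp at lpe; exact hpn lpe
      have : c.tri v p (u * v) = 0 := by
        rw [tri, lpe, h1, map_zero, zero_mul, zero_add, c.br_c h2, c.br_c' h2, br_self, zero_add, c.br_anti (c.ell v)]; abel
      rw [this]; exact zero_mem _
    · rw [tri_swap]; apply neg_mem
      refine c.tri_A p v (u * v) (x0 := x1⁻¹ * (x2 * nq v)) (x1 := 0) (x2 := -(x1⁻¹ * (x0 + x2 * (2 * v.re)))) (κ := x1⁻¹) (inv_ne_zero h1) ?_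
      have hn : nq v = v.re ^ 2 - a * v.imI ^ 2 - b * v.imJ ^ 2 + a * b * v.imK ^ 2 := rfl
      rw [hx]; ext <;> simp <;> (try rw [hn]) <;> field_simp <;> ring
  · by_cases h2 : x2 = 0
    · have h1 : x1 ≠ 0 := by
        rintro rfl; rw [h2] at lpe; simp at lpe; exact hpn lpe
      have : c.tri p u (u * v) = 0 := by
        rw [tri, lpe, h2, map_zero, zero_mul, add_zero, c.br_c h1, c.br_c' h1, br_self, zero_add, c.br_anti (c.ell u)]; abel
      rw [this]; exact zero_mem _
    · rw [tri_swap]; apply neg_mem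
      refine c.tri_A u p (u * v) (x0 := x2⁻¹ * (x1 * nq u)) (x2 := 0) (x1 := -(x2⁻¹ * (x0 + x1 * (2 * u.re)))) (κ := x2⁻¹) (inv_ne_zero h2) ?_
      have hn : nq u = u.re ^ 2 - a * u.imI ^ 2 - b * u.imJ ^ 2 + a * b * u.imK ^ 2 := rfl
      rw [hx]; ext <;> simp <;> (try rw [hn]) <;> field_simp <;> ring
end Cn
end Mk

namespace Mk
open scoped Quaternion
namespace Cn
variable {F K : Type} [Field F] [Field K] {a b : F} (c : Cn K a b)
local notation "Q" => ℍ[F,a,b]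

structure LP {κ : Type} [Field κ] (p : Pl K κ) (N : ℤ) (w : Q) : Prop where
  vc : ∀ d, d ≠ 0 → p.v (c.ι d) = 0
  ge : ∀ x : Q, p.ge N (c.ell x)
  co : ∀ x : Q, p.co N (c.ell x) = 0 → w * x = x * w
  vw : p.v (c.ell w) = N + 1
  hw : c.ell w ≠ 0

noncomputable def FS {κ : Type} [Field κ] (p : Pl K κ) : Subgroup κˣ :=
  (Units.map ((p.lc.toMonoidHom).comp c.ι.toMonoidHom)).range
def Rq {κ : Type} [Field κ] (p : Pl K κ) : Type := Additive (κˣ ⧸ c.FS p)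
noncomputable instance {κ : Type} [Field κ] (p : Pl K κ) : AddCommGroup (c.Rq p) :=
  inferInstanceAs (AddCommGroup (Additive (κˣ ⧸ c.FS p)))
noncomputable def rqm {κ : Type} [Field κ] (p : Pl K κ) : Additive κˣ →+ c.Rq p :=
  MonoidHom.toAdditive (QuotientGroup.mk' (c.FS p))
theorem rqm_zero {κ : Type} [Field κ] (p : Pl K κ) (x : κˣ) :
    c.rqm p (Additive.ofMul x) = 0 ↔ ∃ d, d ≠ 0 ∧ (x : κ) = p.lc (c.ι d) := by
  have : c.rqm p (Additive.ofMul x) = 0 ↔ x ∈ c.FS p := QuotientGroup.eq_one_iff x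
  rw [this]
  constructor
  · rintro ⟨d, rfl⟩; exact ⟨d, d.ne_zero, rfl⟩
  · rintro ⟨d, hd, h⟩; exact ⟨Units.mk0 d hd, Units.ext h.symm⟩
open Classical in
noncomputable def cl {κ : Type} [Field κ] (p : Pl K κ) (x : κ) : c.Rq p :=
  if h : x = 0 then 0 else c.rqm p (Additive.ofMul (Units.mk0 x h))

namespace LP
variable {c} {κ : Type} [Field κ] {p : Pl K κ} {N : ℤ} {w : ℍ[F,a,b]}
theorem cl_mul {x y : κ} (hx : x ≠ 0) (hy : y ≠ 0) : c.cl p (x * y) = c.cl p x + c.cl p y := by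
  rw [cl, cl, cl, dif_neg hx, dif_neg hy, dif_neg (mul_ne_zero hx hy), ← map_add, ← ofMul_mul]
  congr 2; ext; rfl
theorem cl_eq_zero {x : κ} (hx : x ≠ 0) : c.cl p x = 0 ↔ ∃ d, d ≠ 0 ∧ x = p.lc (c.ι d) := by
  rw [cl, dif_neg hx, rqm_zero]; rfl
theorem cl_const {d : F} (hd : d ≠ 0) : c.cl p (p.lc (c.ι d)) = 0 :=
  (cl_eq_zero (p.lc_ne _ (by simpa using hd))).2 ⟨d, hd, rfl⟩
theorem cl_inv {x : κ} : c.cl p (x⁻¹) = - c.cl p x := by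
  by_cases hx : x = 0
  · simp [hx, cl]
  · rw [eq_neg_iff_add_eq_zero, ← cl_mul (inv_ne_zero hx) hx, inv_mul_cancel₀ hx]
    have := cl_const (c := c) (p := p) (one_ne_zero (α := F)); simpa using this
theorem cl_neg_one : c.cl p (-1) = 0 := by
  have := cl_const (c := c) (p := p) (d := -1) (by simp)
  rwa [map_neg, map_one, p.lc_neg_one] at this
theorem cl_pow {x : κ} (hx : x ≠ 0) (n : ℕ) : c.cl p (x ^ n) = n • c.cl p x := by
  induction n with
  | zero => have := cl_const (c := c) (p := p) (one_ne_zero (α := F)); simpa using this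
  | succ n ih => rw [pow_succ, cl_mul (pow_ne_zero _ hx) hx, ih, succ_nsmul]
theorem cl_zpow {x : κ} (hx : x ≠ 0) (n : ℤ) : c.cl p (x ^ n) = n • c.cl p x := by
  rcases Int.eq_nat_or_neg n with ⟨m, rfl | rfl⟩
  · simp [cl_pow hx]
  · rw [zpow_neg, cl_inv, zpow_natCast, cl_pow hx]; simp

theorem tame_cc (h : c.LP p N w) {z : K2 K} (hz : z ∈ c.CF) : c.rqm p (p.tame z) = 0 := by
  unfold CF at hz
  induction hz using AddSubgroup.closure_induction with
  | mem x hx =>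
    obtain ⟨x, d, rfl⟩ := hx
    by_cases hx : x = 0
    · simp [hx]
    by_cases hd : d = 0
    · simp [hd]
    have hd' : c.ι d ≠ 0 := by simpa using hd
    have : c.rqm p (p.tame (st x (c.ι d))) = c.cl p (p.tv (st x (c.ι d))) := by
      rw [cl, dif_neg (p.tv_ne _)]; congr 1; 
      apply congrArg Additive.ofMul (a₁ := (p.tame (st x (c.ι d))).toMul); ext; rfl
    rw [this, p.tv_st hx hd', h.vc d hd, mul_zero, zpow_zero, neg_zero, zpow_zero, one_mul, mul_one,
      cl_zpow (p.lc_ne _ hd'), cl_const hd, smul_zero]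
  | zero => simp
  | add x y _ _ hx hy => rw [map_add, map_add, hx, hy, add_zero]
  | neg x _ hx => rw [map_neg, map_neg, hx, neg_zero]
noncomputable def R (h : c.LP p N w) : c.G →+ c.Rq p :=
  QuotientAddGroup.lift c.CF ((c.rqm p).comp p.tame) (fun z hz => h.tame_cc hz)
theorem R_qm (h : c.LP p N w) (z : K2 K) : h.R (c.qm z) = c.cl p (p.tv z) := by
  change c.rqm p (p.tame z) = _
  rw [cl, dif_neg (p.tv_ne _)]; congr 1
  apply congrArg Additive.ofMul (a₁ := (p.tame z).toMul); ext; rfl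
theorem R_br (h : c.LP p N w) {x y : K} (hx : x ≠ 0) (hy : y ≠ 0) :
    h.R (c.br x y) = p.v x • c.cl p (p.lc y) - p.v y • c.cl p (p.lc x) := by
  have h1 := p.lc_ne x hx
  have h2 := p.lc_ne y hy
  rw [br, R_qm, p.tv_st hx hy, cl_mul (mul_ne_zero (zpow_ne_zero _ (by simp)) (zpow_ne_zero _ h2)) (zpow_ne_zero _ h1),
    cl_mul (zpow_ne_zero _ (by simp)) (zpow_ne_zero _ h2), cl_zpow (by simp), cl_zpow h1, cl_zpow h2, cl_neg_one]
  simp [sub_eq_add_neg]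

theorem com (h : c.LP p N w) {x : Q} : w * x = x * w ↔ p.co N (c.ell x) = 0 := by
  refine ⟨fun e => ?_, h.co x⟩
  obtain ⟨α, β, rfl⟩ := c.comm_span e h.hw
  rw [ell_add, ell_coe, zero_add, ell_smul]
  by_cases hβ : β = 0
  · simp [hβ, Pl.co_zero]
  have : c.ι β ≠ 0 := by simpa using hβ
  apply Pl.co_lt (n := N + 1) (by omega)
  apply Pl.ge_of_eq
  rw [p.v_mul _ _ this h.hw, h.vc _ hβ, h.vw, zero_add]
theorem v_in (h : c.LP p N w) {x : Q} (hx : c.ell x ≠ 0) (e : w * x = x * w) : p.v (c.ell x) = N + 1 := by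
  obtain ⟨α, β, rfl⟩ := c.comm_span e h.hw
  rw [ell_add, ell_coe, zero_add, ell_smul] at hx ⊢
  have hβ : β ≠ 0 := by rintro rfl; simp at hx
  have : c.ι β ≠ 0 := by simpa using hβ
  rw [p.v_mul _ _ this h.hw, h.vc _ hβ, h.vw, zero_add]
theorem v_out (h : c.LP p N w) {x : Q} (e : w * x ≠ x * w) : c.ell x ≠ 0 ∧ p.v (c.ell x) = N ∧ p.lc (c.ell x) = p.co N (c.ell x) :=
  Pl.of_co_ne (fun e' => e (h.com.2 e'))
theorem ex0 (h : c.LP p N w) : ∃ x : Q, w * x ≠ x * w := by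
  by_contra! H
  have h1 := H ⟨0, 1, 0, 0⟩
  have h2 := H ⟨0, 0, 1, 0⟩
  have two := c.two
  have ha := c.ha
  have hb := c.hb
  have e3 := congrArg QuaternionAlgebra.imK h1
  have e2 := congrArg QuaternionAlgebra.imJ h1
  have e1 := congrArg QuaternionAlgebra.imK h2
  simp at e1 e2 e3
  have k1 : w.imI = 0 := mul_left_cancel₀ two (by linear_combination e1)
  have k2 : w.imJ = 0 := mul_left_cancel₀ two (by linear_combination -e3)
  have k3 : w.imK = 0 := mul_left_cancel₀ (mul_ne_zero two ha) (by linear_combination -e2)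
  exact h.hw (by simp [ell, k1, k2, k3])
noncomputable def w0 (h : c.LP p N w) : Q := h.ex0.choose
theorem w0_ne (h : c.LP p N w) : w * h.w0 ≠ h.w0 * w := h.ex0.choose_spec
noncomputable def e (h : c.LP p N w) (x : Q) : κ := p.co N (c.ell x)
theorem e_w0 (h : c.LP p N w) : h.e h.w0 ≠ 0 := fun e => h.w0_ne (h.com.2 e)
noncomputable def ε (h : c.LP p N w) (z : Q) : κ := h.e (h.w0 * z) / h.e h.w0
theorem e_mul (h : c.LP p N w) {z : Q} (hz : w * z = z * w) (x : Q) : h.e (x * z) = h.ε z * h.e x := by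
  have k := c.epsId z h.w0 x
  have g1 : p.co (N + N) (-(c.ell z * c.ell (h.w0 * star x))) = 0 := by
    have : p.ge (N + 1) (c.ell z) := fun h0 => (h.v_in h0 hz).ge
    apply Pl.co_lt (n := (N + 1) + N) (by omega)
    exact Pl.ge_neg (Pl.ge_mul this (h.ge _))
  rw [← k, Pl.co_sub (Pl.ge_mul (h.ge _) (h.ge _)) (Pl.ge_mul (h.ge _) (h.ge _)), Pl.co_mul (h.ge _) (h.ge _),
    Pl.co_mul (h.ge _) (h.ge _)] at g1
  change h.e (h.w0 * z) * h.e x - h.e h.w0 * h.e (x * z) = 0 at g1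
  have := h.e_w0
  rw [ε]; field_simp; linear_combination -g1
theorem star_com {w z : Q} (hz : w * z = z * w) : w * star z = star z * w := by
  have : star z = ((2 * z.re : F) : Q) - z := by ext <;> simp [QuaternionAlgebra.re_coe, -QuaternionAlgebra.coe_mul]; ring
  rw [this, mul_sub, sub_mul, hz, QuaternionAlgebra.coe_commutes]
theorem e_star (h : c.LP p N w) (x : Q) : h.e (star x) = - h.e x := by
  rw [e, ell_star, Pl.co_neg]; rfl
theorem mul_e (h : c.LP p N w) {z : Q} (hz : w * z = z * w) (x : Q) : h.e (z * x) = h.ε (star z) * h.e x := by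
  have := h.e_mul (star_com hz) (star x)
  rw [← star_mul, e_star, e_star] at this
  linear_combination -this
theorem can (h : c.LP p N w) {z x : Q} (hz : w * z = z * w) (z0 : z ≠ 0) (hx : w * x ≠ x * w) : w * (x * z) ≠ (x * z) * w := by
  intro e
  have : (w * x - x * w) * z = 0 := by rw [sub_mul, mul_assoc, e, mul_assoc, mul_assoc, hz, sub_self]
  exact c.mul_ne (sub_ne_zero.2 hx) z0 this
theorem ε_ne (h : c.LP p N w) {z : Q} (hz : w * z = z * w) (z0 : z ≠ 0) : h.ε z ≠ 0 :=
  div_ne_zero (fun e => h.can hz z0 h.w0_ne (h.com.2 e)) h.e_w0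
theorem ε_mul (h : c.LP p N w) {z z' : Q} (hz' : w * z' = z' * w) : h.ε (z * z') = h.ε z * h.ε z' := by
  rw [ε, ← mul_assoc, h.e_mul hz', show h.ε z = h.e (h.w0 * z) / h.e h.w0 from rfl]; ring
theorem e_coe (h : c.LP p N w) {d : F} (hd : d ≠ 0) (x : Q) : h.e (x * d) = p.lc (c.ι d) * h.e x := by
  have h1 : p.ge 0 (c.ι d) := Pl.ge_of_eq (h.vc d hd)
  rw [e, ell_mul_coe]
  have := Pl.co_mul h1 (h.ge x)
  rw [zero_add] at this
  rw [this, Pl.co_eq (by simpa using hd) (h.vc d hd)]; rfl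
theorem ε_coe (h : c.LP p N w) {d : F} (hd : d ≠ 0) : h.ε (d : Q) = p.lc (c.ι d) := by
  rw [ε, h.e_coe hd, mul_div_assoc, div_self h.e_w0, mul_one]
theorem ε_const (h : c.LP p N w) {z : Q} (hz : w * z = z * w) {d : F} (hd : d ≠ 0) (e' : h.ε z = p.lc (c.ι d)) : z = d := by
  by_contra H
  have hz' : w * (z - d) = (z - d) * w := by rw [mul_sub, sub_mul, hz, QuaternionAlgebra.coe_commutes]
  apply h.can hz' (sub_ne_zero.2 H) h.w0_ne
  rw [h.com, mul_sub, ell_sub, Pl.co_sub (h.ge _) (h.ge _)]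
  change h.e _ - h.e _ = 0
  rw [h.e_coe hd, ← e', h.e_mul hz, sub_self]
open Classical in
noncomputable def D (h : c.LP p N w) (z : Q) : c.Rq p := if w * z = z * w then c.cl p (h.ε z) else 0
theorem D_in (h : c.LP p N w) {z : Q} (hz : w * z = z * w) : h.D z = c.cl p (h.ε z) := if_pos hz
theorem D_out (h : c.LP p N w) {z : Q} (hz : w * z ≠ z * w) : h.D z = 0 := if_neg hz
theorem D_mul (h : c.LP p N w) {z z' : Q} (hz : w * z = z * w) (hz' : w * z' = z' * w) (z0 : z ≠ 0) (z0' : z' ≠ 0) :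
    h.D (z * z') = h.D z + h.D z' := by
  rw [D_in, D_in _ hz, D_in _ hz', h.ε_mul hz', cl_mul (h.ε_ne hz z0) (h.ε_ne hz' z0')]
  rw [← mul_assoc, hz, mul_assoc, hz', mul_assoc]
theorem D_coe (h : c.LP p N w) {d : F} (hd : d ≠ 0) : h.D (d : Q) = 0 := by
  rw [D_in _ (c.comm_coe _ _).symm, h.ε_coe hd, cl_const hd]
theorem D_zero (h : c.LP p N w) {z : Q} (hz : w * z = z * w) (z0 : z ≠ 0) (h0 : h.D z = 0) : c.ell z = 0 := by
  rw [D_in _ hz, cl_eq_zero (h.ε_ne hz z0)] at h0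
  obtain ⟨d, hd, e⟩ := h0
  rw [h.ε_const hz hd e, ell_coe]
theorem cl_star (h : c.LP p N w) {z : Q} (hz : w * z = z * w) (z0 : z ≠ 0) : c.cl p (h.ε (star z)) = - c.cl p (h.ε z) := by
  have s0 : star z ≠ 0 := fun e => z0 (by simpa using congrArg star e)
  rw [eq_neg_iff_add_eq_zero, ← cl_mul (h.ε_ne (star_com hz) s0) (h.ε_ne hz z0), ← h.ε_mul hz, star_mul_nq,
    h.ε_coe (c.nq_ne z0), cl_const (c.nq_ne z0)]
theorem Dc {z : Q} (h : c.LP p N w) (h0 : c.ell z = 0) (z0 : z ≠ 0) : ∃ d : F, d ≠ 0 ∧ z = d :=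
  ⟨z.re, fun e => z0 (by rw [c.cen h0, e]; simp), c.cen h0⟩
theorem D_comm (h : c.LP p N w) {u v : Q} (u0 : u ≠ 0) (v0 : v ≠ 0) (e : u * v = v * u) : h.D (u * v) = h.D u + h.D v := by
  by_cases hu : w * u = u * w
  · by_cases hv : w * v = v * w
    · exact h.D_mul hu hv u0 v0
    · have : c.ell u = 0 := by
        by_contra h1
        exact hv (c.comm_trans h1 hu.symm e)
      obtain ⟨d, hd, rfl⟩ := h.Dc this u0
      rw [h.D_coe hd, h.D_out hv, h.D_out, add_zero]
      rw [c.comm_coe]; exact h.can (c.comm_coe d w).symm u0 hv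
  · by_cases hv : w * v = v * w
    · have : c.ell v = 0 := by
        by_contra h1
        exact hu (c.comm_trans h1 hv.symm e.symm)
      obtain ⟨d, hd, rfl⟩ := h.Dc this v0
      rw [h.D_coe hd, h.D_out hu, h.D_out, add_zero]
      exact h.can (c.comm_coe d w).symm v0 hu
    · rw [h.D_out hu, h.D_out hv, add_zero]
      by_cases huv : w * (u * v) = (u * v) * w
      · have : c.ell (u * v) = 0 := by
          by_contra h1
          refine hu (c.comm_trans h1 huv.symm ?_)
          rw [mul_assoc, e]
        obtain ⟨d, hd, e'⟩ := h.Dc this (c.mul_ne u0 v0)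
        rw [e', h.D_coe hd]
      · rw [h.D_out huv]
theorem R_sg (h : c.LP p N w) {u v : Q} (u0 : u ≠ 0) (v0 : v ≠ 0) : h.R (c.sg u v) = h.D u + h.D v - h.D (u * v) := by
  by_cases e : u * v = v * u
  · rw [c.sg_comm e, map_zero, h.D_comm u0 v0 e, sub_self]
  have lu : c.ell u ≠ 0 := fun h0 => by
    obtain ⟨d, hd, rfl⟩ := h.Dc h0 u0; exact e (c.comm_coe _ _)
  have lv : c.ell v ≠ 0 := fun h0 => by
    obtain ⟨d, hd, rfl⟩ := h.Dc h0 v0; exact e (c.comm_coe _ _).symm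
  have luv : c.ell (u * v) ≠ 0 := fun h0 => by
    obtain ⟨d, hd, e1⟩ := h.Dc h0 (c.mul_ne u0 v0)
    have : u * (u * v - v * u) = 0 := by rw [mul_sub, ← mul_assoc u v u, e1, c.comm_coe, sub_self]
    exact c.mul_ne u0 (sub_ne_zero.2 e) this
  rw [sg, tri, map_add, map_add, h.R_br lu lv, h.R_br lv luv, h.R_br luv lu]
  have cu : ∀ x : Q, w * x ≠ x * w → h.e x ≠ 0 := fun x hx e' => hx (h.com.2 e')
  by_cases hu : w * u = u * w
  · have hv : w * v ≠ v * w := fun hv => e (c.comm_trans h.hw hu hv)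
    have huv : w * (u * v) ≠ (u * v) * w := fun huv => by
      apply hv
      have : u * (w * v - v * w) = 0 := by rw [mul_sub, ← mul_assoc, ← hu, mul_assoc, huv, mul_assoc, sub_self]
      by_contra H
      exact c.mul_ne u0 (sub_ne_zero.2 H) this
    obtain ⟨-, v1, v2⟩ := h.v_out hv
    obtain ⟨-, w1, w2⟩ := h.v_out huv
    rw [h.v_in lu hu, v1, w1, h.D_in hu, h.D_out hv, h.D_out huv]
    have e3 : c.cl p (p.lc (c.ell (u * v))) = - c.cl p (h.ε u) + c.cl p (p.lc (c.ell v)) := by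
      rw [w2, v2]; change c.cl p (h.e _) = _ + c.cl p (h.e _)
      rw [h.mul_e hu, cl_mul _ (cu _ hv), h.cl_star hu u0]
      exact h.ε_ne (star_com hu) (fun e => u0 (by simpa using congrArg star e))
    rw [e3]; simp only [add_smul, one_smul, smul_add, smul_neg]; abel
  by_cases hv : w * v = v * w
  · have huv : w * (u * v) ≠ (u * v) * w := h.can hv v0 hu
    obtain ⟨-, v1, v2⟩ := h.v_out hu
    obtain ⟨-, w1, w2⟩ := h.v_out huv
    rw [h.v_in lv hv, v1, w1, h.D_in hv, h.D_out hu, h.D_out huv]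
    have e3 : c.cl p (p.lc (c.ell (u * v))) = c.cl p (h.ε v) + c.cl p (p.lc (c.ell u)) := by
      rw [w2, v2]; change c.cl p (h.e _) = _ + c.cl p (h.e _)
      rw [h.e_mul hv, cl_mul (h.ε_ne hv v0) (cu _ hu)]
    rw [e3]; simp only [add_smul, one_smul, smul_add, smul_neg]; abel
  obtain ⟨-, u1, u2⟩ := h.v_out hu
  obtain ⟨-, v1, v2⟩ := h.v_out hv
  by_cases huv : w * (u * v) = (u * v) * w
  · rw [h.v_in luv huv, u1, v1, h.D_out hu, h.D_out hv, h.D_in huv]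
    have uv0 := c.mul_ne u0 v0
    have e3 : c.cl p (p.lc (c.ell u)) = - c.cl p (h.ε (u * v)) + c.cl p (p.lc (c.ell v)) := by
      rw [u2, v2]; change c.cl p (h.e _) = _ + c.cl p (h.e _)
      have e4 : c.cl p (h.e u) = c.cl p (h.e (u * nq v)) := by
        rw [h.e_coe (c.nq_ne v0), cl_mul (p.lc_ne _ (by simpa using c.nq_ne v0)) (cu _ hu), cl_const (c.nq_ne v0), zero_add]
      rw [e4, ← mul_star_nq, ← mul_assoc, h.mul_e huv, e_star, cl_mul _ (neg_ne_zero.2 (cu _ hv)), h.cl_star huv uv0,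
        ← neg_one_mul (h.e v), cl_mul (by simp) (cu _ hv), cl_neg_one, zero_add]
      exact h.ε_ne (star_com huv) (fun e => uv0 (by simpa using congrArg star e))
    rw [e3]; simp only [add_smul, one_smul, smul_add, smul_neg]; abel
  · obtain ⟨-, w1, w2⟩ := h.v_out huv
    rw [u1, v1, w1, h.D_out hu, h.D_out hv, h.D_out huv]; abel
end LP
end Cn
end Mk

namespace Mk
open scoped Quaternion
namespace Cn
variable {F K : Type} [Field F] [Field K] {a b : F} (c : Cn K a b)
local notation "Q" => ℍ[F,a,b]

theorem norm_sum {X : Type} [AddCommGroup X] (Φ : Q → X) (hF : ∀ d : F, d ≠ 0 → Φ d = 0)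
    (hm : ∀ u v : Q, u ≠ 0 → v ≠ 0 → u * v = v * u → Φ (u * v) = Φ u + Φ v) {z : X}
    (hz : z ∈ AddSubgroup.closure {x | ∃ u : Q, u ≠ 0 ∧ x = Φ u}) :
    ∃ S : Finset Q, (∀ x ∈ S, c.ell x ≠ 0) ∧ (∀ x ∈ S, ∀ y ∈ S, x ≠ y → x * y ≠ y * x) ∧ z = ∑ x ∈ S, Φ x := by
  classical
  have cn : ∀ {x : Q}, c.ell x = 0 → x ≠ 0 → ∃ d : F, d ≠ 0 ∧ x = d := fun {x} h h0 =>
    ⟨x.re, fun e => h0 (by rw [c.cen h, e]; simp), c.cen h⟩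
  have ins : ∀ (S : Finset Q) (u : Q), u ≠ 0 → (∀ x ∈ S, c.ell x ≠ 0) → (∀ x ∈ S, ∀ y ∈ S, x ≠ y → x * y ≠ y * x) →
      ∃ S' : Finset Q, (∀ x ∈ S', c.ell x ≠ 0) ∧ (∀ x ∈ S', ∀ y ∈ S', x ≠ y → x * y ≠ y * x) ∧ ∑ x ∈ S', Φ x = (∑ x ∈ S, Φ x) + Φ u := by
    intro S u u0 h1 h2
    by_cases hu : c.ell u = 0
    · obtain ⟨d, hd, rfl⟩ := cn hu u0
      exact ⟨S, h1, h2, by rw [hF d hd, add_zero]⟩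
    by_cases hx : ∃ x ∈ S, x * u = u * x
    · obtain ⟨x, hxS, hxu⟩ := hx
      have x0 := c.ne_of_ell (h1 x hxS)
      have hs : ∑ y ∈ S, Φ y = ∑ y ∈ S.erase x, Φ y + Φ x := (Finset.sum_erase_add _ _ hxS).symm
      by_cases hl : c.ell (x * u) = 0
      · obtain ⟨d, hd, e⟩ := cn hl (c.mul_ne x0 u0)
        refine ⟨S.erase x, fun y hy => h1 y (Finset.mem_of_mem_erase hy),
          fun y hy z hz => h2 y (Finset.mem_of_mem_erase hy) z (Finset.mem_of_mem_erase hz), ?_⟩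
        rw [hs, add_assoc, ← hm x u x0 u0 hxu, e, hF d hd, add_zero]
      · have nc : ∀ y ∈ S.erase x, y * (x * u) ≠ (x * u) * y := by
          intro y hy e
          refine h2 x hxS y (Finset.mem_of_mem_erase hy) (Finset.ne_of_mem_erase hy).symm ?_
          exact c.comm_trans hl (by rw [mul_assoc, hxu]) e.symm
        have ni : x * u ∉ S.erase x := fun h => nc _ h rfl
        refine ⟨insert (x * u) (S.erase x), ?_, ?_, ?_⟩
        · intro y hy
          rcases Finset.mem_insert.1 hy with rfl | hy
          · exact hl
          · exact h1 y (Finset.mem_of_mem_erase hy)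
        · intro y hy z hz hyz
          rcases Finset.mem_insert.1 hy with rfl | hy
          · rcases Finset.mem_insert.1 hz with rfl | hz
            · exact absurd rfl hyz
            · exact (nc z hz).symm
          · rcases Finset.mem_insert.1 hz with h | hz
            · rw [h]; exact nc y hy
            · exact h2 y (Finset.mem_of_mem_erase hy) z (Finset.mem_of_mem_erase hz) hyz
        · rw [Finset.sum_insert ni, hm x u x0 u0 hxu, hs]; abel
    · push Not at hx
      have ni : u ∉ S := fun h => hx u h rfl
      refine ⟨insert u S, ?_, ?_, by rw [Finset.sum_insert ni, add_comm]⟩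
      · intro y hy
        rcases Finset.mem_insert.1 hy with rfl | hy
        · exact hu
        · exact h1 y hy
      · intro y hy z hz hyz
        rcases Finset.mem_insert.1 hy with rfl | hy
        · rcases Finset.mem_insert.1 hz with rfl | hz
          · exact absurd rfl hyz
          · exact (hx z hz).symm
        · rcases Finset.mem_insert.1 hz with h | hz
          · rw [h]; exact hx y hy
          · exact h2 y hy z hz hyz
  have neg : ∀ u : Q, u ≠ 0 → Φ (star u) = - Φ u := fun u u0 => by
    have s0 : star u ≠ 0 := fun e => u0 (by simpa using congrArg star e)
    rw [eq_neg_iff_add_eq_zero, ← hm _ _ s0 u0 (by rw [star_mul_nq, mul_star_nq]), star_mul_nq, hF _ (c.nq_ne u0)]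
  induction hz using AddSubgroup.closure_induction_left with
  | zero => exact ⟨∅, by simp, by simp, by simp⟩
  | add_left x hx y _ ih =>
    obtain ⟨u, u0, rfl⟩ := hx
    obtain ⟨S, h1, h2, rfl⟩ := ih
    obtain ⟨S', h1', h2', e⟩ := ins S u u0 h1 h2
    exact ⟨S', h1', h2', by rw [e, add_comm]⟩
  | neg_add_cancel x hx y _ ih =>
    obtain ⟨u, u0, rfl⟩ := hx
    obtain ⟨S, h1, h2, rfl⟩ := ih
    obtain ⟨S', h1', h2', e⟩ := ins S (star u) (fun e => u0 (by simpa using congrArg star e)) h1 h2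
    exact ⟨S', h1', h2', by rw [e, neg u u0, add_comm]⟩

section comm
theorem conj_of_tr (c : Cn K a b) {w v : Q} (h1 : v.re = 0) (h2 : (v * w).re = 0) : v * w = star w * v := by
  have e1 : star v = -v := by ext <;> simp [h1]
  have e2 : star (v * w) = - (v * w) := by
    have : ∀ x : Q, x.re = 0 → star x = -x := fun x hx => by ext <;> simp [hx]
    exact this _ h2
  rw [star_mul, e1, mul_neg, neg_inj] at e2
  exact e2.symm
open scoped commutatorElement
variable {E : Type} [Group E] (p : E →* ℍ[F,a,b]ˣ)
structure CE : Prop where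
  surj : Function.Surjective p
  com : ∀ x y, p x * p y = p y * p x → x * y = y * x
variable {p}
theorem comm_left (h : CE p) {x y e : E} (he : p x * p e = p e * p x) : ⁅x, y * e⁆ = ⁅x, y⁆ := by
  have := h.com _ _ he
  rw [commutatorElement_def, commutatorElement_def, mul_inv_rev]
  have h2 : e * x⁻¹ * e⁻¹ = x⁻¹ := by
    rw [mul_inv_eq_iff_eq_mul]; exact (Commute.inv_left (show Commute x e from this)).symm.eq.symm ▸ rfl
  calc x * (y * e) * x⁻¹ * (e⁻¹ * y⁻¹) = x * y * (e * x⁻¹ * e⁻¹) * y⁻¹ := by group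
    _ = _ := by rw [h2]
theorem comm_right (h : CE p) {x y e : E} (he : p y * p e = p e * p y) : ⁅x * e, y⁆ = ⁅x, y⁆ := by
  rw [← commutatorElement_inv, comm_left h he, commutatorElement_inv]
theorem comm_plane (c : Cn K a b) (h : CE p) {w v v' : E} (h1 : (p v : Q).re = 0) (h2 : ((p v : Q) * p w).re = 0)
    (h1' : (p v' : Q).re = 0) (h2' : ((p v' : Q) * p w).re = 0) : ⁅w, v⁆ = ⁅w, v'⁆ := by
  have e1 := c.conj_of_tr h1 h2
  have e2 := c.conj_of_tr h1' h2'
  have : v' = v * (v⁻¹ * v') := by group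
  rw [this, comm_left h]
  have k1 : p w * (p v)⁻¹ = (p v)⁻¹ * (p v * p w * (p v)⁻¹) := by group
  have k2 : p v * p w * (p v)⁻¹ = p v' * p w * (p v')⁻¹ := by
    ext1; simp only [Units.val_mul]; rw [e1, e2, mul_assoc, mul_assoc]; simp
  rw [map_mul, map_inv, ← mul_assoc, k1, k2]; group
theorem exists_nrm (c : Cn K a b) (h : CE p) (x y : E) :
    ∃ w v, (p v : Q).re = 0 ∧ ((p v : Q) * p w).re = 0 ∧ ⁅x, y⁆ = ⁅w, v⁆ := by
  have tr : ∀ u v : Q, c.ell u ≠ 0 → ∃ e : Q, e ≠ 0 ∧ u * e = e * u ∧ (v * e).re = 0 := by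
    intro u v hu
    by_cases h0 : v.re = 0 ∧ (v * u).re = 0
    · exact ⟨1, one_ne_zero, by simp, by simpa using h0.1⟩
    · refine ⟨((v * u).re : Q) - (v.re : F) • u, ?_, ?_, ?_⟩
      · intro e
        by_cases h1 : v.re = 0
        · rw [h1, zero_smul, sub_zero] at e
          apply h0; refine ⟨h1, ?_⟩
          have := congrArg QuaternionAlgebra.re e; simpa using this
        · have := congrArg c.ell e
          rw [ell_sub, ell_smul, ell_coe, zero_sub, show (0 : Q) = ((0 : F) : Q) by simp, ell_coe, neg_eq_zero, mul_eq_zero] at this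
          rcases this with h | h
          · exact h1 (by simpa using h)
          · exact hu h
      · rw [mul_sub, sub_mul, c.comm_coe, mul_smul_comm, smul_mul_assoc]
      · rw [mul_sub, mul_smul_comm, QuaternionAlgebra.mul_coe_eq_smul]
        simp only [QuaternionAlgebra.re_sub, QuaternionAlgebra.re_smul, smul_eq_mul]; ring
  by_cases hxy : x * y = y * x
  · have i0 : (⟨0, 1, 0, 0⟩ : Q) ≠ 0 := fun e => by simpa using congrArg QuaternionAlgebra.imI e
    obtain ⟨v, hv⟩ := h.surj (c.un i0)
    have hv' : (p v : Q) = ⟨0, 1, 0, 0⟩ := by rw [hv]; rfl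
    refine ⟨1, v, by rw [hv'], by rw [hv', map_one, Units.val_one, mul_one], ?_⟩
    rw [commutatorElement_eq_one_iff_mul_comm.2 hxy, commutatorElement_eq_one_iff_mul_comm.2 (by simp)]
  have hxl : c.ell (p x) ≠ 0 := fun h0 => hxy (h.com _ _ (by
    ext1; rw [Units.val_mul, Units.val_mul, c.cen h0, c.comm_coe]))
  obtain ⟨e, e0, e1, e2⟩ := tr (p x) (p y) hxl
  obtain ⟨e', he'⟩ := h.surj (c.un e0)
  have E' : (p e' : Q) = e := by rw [he']; rfl
  have c1 : ⁅x, y * e'⁆ = ⁅x, y⁆ := comm_left h (by ext1; rw [Units.val_mul, Units.val_mul, E', e1])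
  obtain ⟨v, hv⟩ : ∃ v, v = y * e' := ⟨_, rfl⟩
  rw [← hv] at c1
  have v1 : (p v : Q).re = 0 := by rw [hv, map_mul, Units.val_mul, E', e2]
  have hxv : x * v ≠ v * x := fun h' => hxy (commutatorElement_eq_one_iff_mul_comm.1 (by
    rw [← c1]; exact commutatorElement_eq_one_iff_mul_comm.2 h'))
  have hvl : c.ell (p v) ≠ 0 := fun h0 => hxv (h.com _ _ (by
    ext1; rw [Units.val_mul, Units.val_mul, c.cen h0, c.comm_coe]))
  obtain ⟨f, f0, f1, f2⟩ := tr (p v) (p x) hvl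
  obtain ⟨f', hf'⟩ := h.surj (c.un f0)
  have F' : (p f' : Q) = f := by rw [hf']; rfl
  have c2 : ⁅x * f', v⁆ = ⁅x, v⁆ := comm_right h (by ext1; rw [Units.val_mul, Units.val_mul, F', f1])
  refine ⟨x * f' * v, v, v1, ?_, ?_⟩
  · rw [map_mul, map_mul, Units.val_mul, Units.val_mul, F', re_comm, mul_assoc _ (p v : Q), c.sq_eq, v1, mul_zero, zero_smul, add_zero,
      QuaternionAlgebra.mul_coe_eq_smul, QuaternionAlgebra.re_smul, f2, smul_zero]
  · rw [comm_right h (by rfl), c2, c1]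
theorem exists_v (y1 y2 : Q) : ∃ v : Q, v ≠ 0 ∧ v.re = 0 ∧ (v * y1).re = 0 ∧ (v * y2).re = 0 := by
  let f : Q →ₗ[F] (Fin 3 → F) :=
    { toFun := fun v => ![v.re, (v * y1).re, (v * y2).re]
      map_add' := fun x y => by
        ext i; fin_cases i <;> simp [add_mul] <;> ring
      map_smul' := fun r x => by
        ext i; fin_cases i <;> simp <;> ring }
  have : f.ker ≠ ⊥ := by
    intro hk
    have := LinearMap.finrank_le_finrank_of_injective (LinearMap.ker_eq_bot.1 hk)
    rw [QuaternionAlgebra.finrank_eq_four] at this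
    simp at this
  obtain ⟨v, hv, v0⟩ := Submodule.exists_mem_ne_zero_of_ne_bot this
  have e : ![v.re, (v * y1).re, (v * y2).re] = 0 := hv
  exact ⟨v, v0, congrFun e 0, congrFun e 1, congrFun e 2⟩
theorem re_conj (w : Qˣ) (x : Q) : ((w : Q) * x * (w⁻¹ : Qˣ)).re = x.re := by
  rw [re_comm, ← mul_assoc]; simp
theorem comm_mul (c : Cn K a b) (h : CE p) (x y x' y' : E) : ∃ z t : E, ⁅x, y⁆ * ⁅x', y'⁆ = ⁅z, t⁆ := by
  obtain ⟨w2, v2, a1, a2, e1⟩ := exists_nrm c h x y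
  obtain ⟨w1, v1, b1, b2, e2⟩ := exists_nrm c h x' y'
  rw [e1, e2]
  set u := w1⁻¹ * w2 * w1 with hu
  obtain ⟨v, v0, k0, k1, k2⟩ := exists_v (p w1 : Q) (p u : Q)
  obtain ⟨v', hv'⟩ := h.surj (c.un v0)
  have V : (p v' : Q) = v := by rw [hv']; rfl
  have r1 : ⁅w1, v1⁆ = ⁅w1, v'⁆ := comm_plane c h b1 b2 (by rw [V, k0]) (by rw [V, k1])
  have r2 : ⁅w2, v2⁆ = ⁅w2, w1 * v' * w1⁻¹⁆ := by
    refine comm_plane c h a1 a2 ?_ ?_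
    · rw [map_mul, map_mul, map_inv, Units.val_mul, Units.val_mul, re_conj, V, k0]
    · rw [← Units.val_mul, ← map_mul, show w1 * v' * w1⁻¹ * w2 = w1 * (v' * u) * w1⁻¹ by rw [hu]; group]
      rw [map_mul, map_mul, map_inv, Units.val_mul, Units.val_mul, re_conj, map_mul, Units.val_mul, V, k2]
  refine ⟨w1 * u, v', ?_⟩
  rw [r1, r2, hu]; simp only [commutatorElement_def]; group
theorem comm_all (c : Cn K a b) (h : CE p) {g : E} (hg : g ∈ commutator E) : ∃ x y : E, g = ⁅x, y⁆ := by
  rw [commutator_eq_closure] at hg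
  induction hg using Subgroup.closure_induction with
  | mem x hx => obtain ⟨u, v, rfl⟩ := hx; exact ⟨u, v, rfl⟩
  | one => exact ⟨1, 1, by simp⟩
  | mul x y _ _ hx hy =>
    obtain ⟨u, v, rfl⟩ := hx
    obtain ⟨u', v', rfl⟩ := hy
    exact comm_mul c h u v u' v'
  | inv x _ hx => obtain ⟨u, v, rfl⟩ := hx; exact ⟨v, u, by rw [commutatorElement_inv]⟩
end comm
end Cn
end Mk

namespace Mk
open scoped Quaternion commutatorElement
namespace Cn
variable {F K : Type} [Field F] [Field K] {a b : F} (c : Cn K a b)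
local notation "Q" => ℍ[F,a,b]

@[ext] structure Ex where
  u : Qˣ
  g : c.G
theorem sg_c (d : F) (u : Q) : c.sg d u = 0 := c.sg_comm (c.comm_coe d u)
noncomputable instance : Group c.Ex where
  mul x y := ⟨x.u * y.u, x.g + y.g + c.sg x.u y.u⟩
  one := ⟨1, 0⟩
  inv x := ⟨x.u⁻¹, -x.g⟩
  mul_assoc x y z := by
    refine Ex.ext (mul_assoc _ _ _) ?_
    change x.g + y.g + c.sg x.u y.u + z.g + c.sg (x.u * y.u : Qˣ) z.u = x.g + (y.g + z.g + c.sg y.u z.u) + c.sg x.u (y.u * z.u : Qˣ)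
    have := c.coc x.u.ne_zero y.u.ne_zero z.u.ne_zero
    rw [Units.val_mul, Units.val_mul]
    calc _ = (x.g + y.g + z.g) + (c.sg x.u y.u + c.sg (x.u * y.u) z.u) := by abel
      _ = _ := by rw [this]; abel
  one_mul x := by
    refine Ex.ext (one_mul _) ?_
    change 0 + x.g + c.sg ((1 : Qˣ) : Q) x.u = x.g
    rw [c.sg_comm (by simp)]; simp
  mul_one x := by
    refine Ex.ext (mul_one _) ?_
    change x.g + 0 + c.sg x.u ((1 : Qˣ) : Q) = x.g
    rw [c.sg_comm (by simp)]; simp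
  inv_mul_cancel x := by
    refine Ex.ext (inv_mul_cancel _) ?_
    change -x.g + x.g + c.sg (x.u⁻¹ : Qˣ) x.u = 0
    rw [c.sg_comm (by simp)]; simp
theorem ex_u (x y : c.Ex) : (x * y).u = x.u * y.u := rfl
theorem ex_g (x y : c.Ex) : (x * y).g = x.g + y.g + c.sg x.u y.u := rfl
noncomputable def pr : c.Ex →* Qˣ where
  toFun x := x.u
  map_one' := rfl
  map_mul' _ _ := rfl
theorem ce : CE c.pr where
  surj u := ⟨⟨u, 0⟩, rfl⟩
  com x y h := by
    refine Ex.ext h ?_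
    have h' : (x.u : Q) * y.u = y.u * x.u := congrArg Units.val h
    rw [ex_g, ex_g, c.sg_comm h', c.sg_comm h'.symm, add_comm x.g]
noncomputable def fh : Fˣ →* c.Ex where
  toFun d := ⟨Units.map (algebraMap F Q).toMonoidHom d, 0⟩
  map_one' := Ex.ext (map_one _) rfl
  map_mul' x y := by
    refine Ex.ext (map_mul _ _ _) ?_
    rw [ex_g]
    have h2 : c.sg ((x : F) : Q) ((y : F) : Q) = 0 := c.sg_c _ _
    simp [h2]
noncomputable def FA : AddSubgroup (Additive (Abelianization c.Ex)) := (MonoidHom.toAdditive (Abelianization.of.comp c.fh)).range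
def Ab : Type := Additive (Abelianization c.Ex) ⧸ c.FA
noncomputable instance : AddCommGroup c.Ab := inferInstanceAs (AddCommGroup (_ ⧸ c.FA))
noncomputable def ab (x : c.Ex) : c.Ab := QuotientAddGroup.mk' c.FA (Additive.ofMul (Abelianization.of x))
theorem ab_mul (x y : c.Ex) : c.ab (x * y) = c.ab x + c.ab y := by
  rw [ab, map_mul]; rfl
theorem ab_fh (d : Fˣ) : c.ab (c.fh d) = 0 := (QuotientAddGroup.eq_zero_iff _).2 ⟨Additive.ofMul d, rfl⟩
theorem ab_zero {x : c.Ex} (h : c.ab x = 0) : ∃ d, x * c.fh d ∈ commutator c.Ex := by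
  obtain ⟨d, hd⟩ := (QuotientAddGroup.eq_zero_iff _).1 h
  have hd' : Abelianization.of (c.fh (Additive.toMul d)) = Abelianization.of x := hd
  refine ⟨(Additive.toMul d)⁻¹, ?_⟩
  rw [← Abelianization.ker_of, MonoidHom.mem_ker, map_mul, map_inv, map_inv, hd', mul_inv_cancel]
noncomputable def nu : c.G →+ c.Ab where
  toFun g := c.ab ⟨1, g⟩
  map_zero' := by
    have : c.ab 1 = 0 := by have := c.ab_mul 1 1; simpa using this
    exact this
  map_add' g h := by
    rw [← ab_mul]; congr 1
    refine Ex.ext (mul_one _).symm ?_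
    rw [ex_g]; simp only; rw [c.sg_comm (by simp), add_zero]
open Classical in
noncomputable def nv (u : Q) : c.Ab := if h : u = 0 then 0 else c.ab ⟨c.un h, 0⟩
theorem nv_mul {u v : Q} (u0 : u ≠ 0) (v0 : v ≠ 0) : c.nu (c.sg u v) + c.nv (u * v) = c.nv u + c.nv v := by
  rw [nv, nv, nv, dif_neg u0, dif_neg v0, dif_neg (c.mul_ne u0 v0)]
  change c.ab _ + _ = _
  rw [← ab_mul, ← ab_mul]; congr 1
  refine Ex.ext ?_ ?_
  · rw [ex_u, ex_u]; ext1; simp [un_val]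
  · rw [ex_g, ex_g]; simp only; rw [c.sg_comm (u := ((1 : Qˣ) : Q)) (by simp)]; simp [un_val]
theorem nv_coe (d : F) (hd : d ≠ 0) : c.nv d = 0 := by
  have h : (d : Q) ≠ 0 := fun e => hd (by simpa using congrArg QuaternionAlgebra.re e)
  rw [nv, dif_neg h, ← c.ab_fh (Units.mk0 d hd)]
  congr 1; refine Ex.ext ?_ rfl
  ext1; rfl

theorem kill {I : Type} {κ : I → Type} [∀ i, Field (κ i)] {p : ∀ i, Pl K (κ i)} {N : I → ℤ} {w : I → Q}
    (h : ∀ i, c.LP (p i) (N i) (w i)) (cov : ∀ x, c.ell x ≠ 0 → ∃ i, w i * x = x * w i) {g : c.G} (hg : g ∈ c.HS)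
    (hR : ∀ i, (h i).R g = 0) : ∃ u v : Q, u ≠ 0 ∧ v ≠ 0 ∧ (∃ d : F, u * v = d * (v * u)) ∧ g = c.sg u v - c.sg v u := by
  let Φ : Q → c.Ab × (∀ i, c.Rq (p i)) := fun u => (c.nv u, fun i => (h i).D u)
  let Ψ : c.G →+ c.Ab × (∀ i, c.Rq (p i)) := c.nu.prod (AddMonoidHom.pi fun i => (h i).R)
  have hs : ∀ u v : Q, u ≠ 0 → v ≠ 0 → Ψ (c.sg u v) + Φ (u * v) = Φ u + Φ v := fun u v u0 v0 => by
    refine Prod.ext (c.nv_mul u0 v0) ?_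
    funext i
    change (h i).R (c.sg u v) + (h i).D (u * v) = (h i).D u + (h i).D v
    rw [(h i).R_sg u0 v0]; abel
  have hz : Ψ g ∈ AddSubgroup.closure {x | ∃ u : Q, u ≠ 0 ∧ x = Φ u} := by
    rw [← AddSubgroup.mem_comap]
    revert hg
    refine fun hg => (AddSubgroup.closure_le _).2 ?_ hg
    rintro _ ⟨u, v, u0, v0, rfl⟩
    rw [SetLike.mem_coe, AddSubgroup.mem_comap, eq_sub_of_add_eq (hs u v u0 v0)]
    exact sub_mem (add_mem (AddSubgroup.subset_closure ⟨u, u0, rfl⟩) (AddSubgroup.subset_closure ⟨v, v0, rfl⟩))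
      (AddSubgroup.subset_closure ⟨_, c.mul_ne u0 v0, rfl⟩)
  obtain ⟨S, h1, h2, h3⟩ := c.norm_sum Φ (fun d hd => Prod.ext (c.nv_coe d hd) (funext fun i => (h i).D_coe hd))
    (fun u v u0 v0 e => by rw [← hs u v u0 v0, c.sg_comm e, map_zero, zero_add]) hz
  have hS : S = ∅ := by
    by_contra hne
    obtain ⟨x, hx⟩ := Finset.nonempty_iff_ne_empty.2 hne
    obtain ⟨i, hi⟩ := cov x (h1 x hx)
    have e1 : (h i).R g = ∑ y ∈ S, (h i).D y := by
      have := congrArg (fun z => z.2 i) h3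
      simp only [Prod.snd_sum, Finset.sum_apply] at this
      exact this
    rw [hR i, Finset.sum_eq_single x ?_ (fun h => absurd hx h)] at e1
    · exact h1 x hx ((h i).D_zero hi (c.ne_of_ell (h1 x hx)) e1.symm)
    · intro y hy hyx
      exact (h i).D_out fun e => h2 y hy x hx hyx (c.comm_trans (h i).hw e hi)
  rw [hS, Finset.sum_empty] at h3
  obtain ⟨d, hd⟩ := c.ab_zero (congrArg Prod.fst h3)
  obtain ⟨x, y, e⟩ := comm_all c c.ce hd
  rw [commutatorElement_def, eq_mul_inv_iff_mul_eq, eq_mul_inv_iff_mul_eq, mul_assoc] at e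
  refine ⟨x.u, y.u, x.u.ne_zero, y.u.ne_zero, ⟨d, ?_⟩, ?_⟩
  · have := congrArg (fun z : c.Ex => (z.u : Q)) e
    simp only [ex_u, one_mul, Units.val_mul] at this
    exact this.symm
  · have := congrArg Ex.g e
    simp only [ex_g, ex_u, one_mul, Units.val_mul, Units.val_one] at this
    have k : (c.fh d).g = 0 := rfl
    have k2 : ((c.fh d).u : Q) = ((d : F) : Q) := rfl
    rw [k, k2, c.sg_c, c.sg_comm (u := 1) (by simp)] at this
    rw [eq_sub_iff_add_eq]
    have k3 : x.g + y.g + (g + c.sg y.u x.u) = x.g + y.g + c.sg x.u y.u := by rw [← this]; abel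
    exact add_left_cancel k3
end Cn
end Mk

namespace Mk
open scoped Quaternion commutatorElement
namespace Cn
variable {F K : Type} [Field F] [Field K] {a b : F} (c : Cn K a b)
local notation "Q" => ℍ[F,a,b]

theorem anti_re (c : Cn K a b) {u v : Q} (u0 : u ≠ 0) (h : u * v = -(v * u)) : v.re = 0 := by
  have e : u * v * star u = (-(nq u) : F) • v := by
    rw [h, neg_mul, mul_assoc, mul_star_nq, QuaternionAlgebra.mul_coe_eq_smul, neg_smul]
  have e2 := congrArg QuaternionAlgebra.re e
  rw [re_comm, ← mul_assoc, star_mul_nq, QuaternionAlgebra.coe_mul_eq_smul] at e2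
  simp only [QuaternionAlgebra.re_smul, smul_eq_mul] at e2
  have e3 : 2 * nq u * v.re = 0 := by linear_combination e2
  exact (mul_eq_zero.1 e3).resolve_left (mul_ne_zero c.two (c.nq_ne u0))
theorem pure_ne {u : Q} (u0 : u ≠ 0) (h : u.re = 0) : c.ell u ≠ 0 := fun e => u0 (by rw [c.cen e, h]; simp)

theorem kill2 {I : Type} {κ : I → Type} [∀ i, Field (κ i)] {p : ∀ i, Pl K (κ i)} {N : I → ℤ} {w : I → Q}
    (h : ∀ i, c.LP (p i) (N i) (w i)) (cov : ∀ x, c.ell x ≠ 0 → ∃ i, w i * x = x * w i) {γ : K2 K} (hg : c.qm γ ∈ c.HS)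
    (hR : ∀ i, (h i).R (c.qm γ) = 0) : γ ∈ c.CF ∨ ∃ U V : F, U ≠ 0 ∧ V ≠ 0 ∧ ∃ δ, γ - δ ∈ c.CF ∧ 2 • δ = - st (c.ι V) (c.ι U) := by
  obtain ⟨u, v, u0, v0, ⟨d, hd⟩, e⟩ := c.kill h cov hg hR
  have hd2 : (d - 1) * (d + 1) = 0 := by
    have := congrArg nq hd
    rw [nq_mul, nq_mul, nq_mul, show nq (d : Q) = d ^ 2 by simp [nq]] at this
    have n0 : nq v * nq u ≠ 0 := mul_ne_zero (c.nq_ne v0) (c.nq_ne u0)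
    exact mul_right_cancel₀ n0 (by linear_combination -this)
  rcases mul_eq_zero.1 hd2 with h1 | h1
  · left
    rw [sub_eq_zero.1 h1, QuaternionAlgebra.coe_one, one_mul] at hd
    rw [← qm_eq_zero, e, c.sg_comm hd, c.sg_comm hd.symm, sub_zero]
  right
  rw [eq_neg_of_add_eq_zero_left h1, QuaternionAlgebra.coe_neg, QuaternionAlgebra.coe_one, neg_one_mul] at hd
  have hd' : v * u = -(u * v) := by rw [hd, neg_neg]
  have rv := c.anti_re u0 hd
  have ru := c.anti_re v0 hd'
  have hu := c.pure_ne u0 ru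
  have hv := c.pure_ne v0 rv
  have huv : c.ell (u * v) ≠ 0 := c.pure_ne (c.mul_ne u0 v0) (by
    have := re_comm u v
    rw [hd'] at this
    have h2 : 2 * (u * v).re = 0 := by
      have h3 : (-(u * v)).re = -(u*v).re := rfl
      rw [h3] at this; linear_combination this
    exact (mul_eq_zero.1 h2).resolve_left c.two)
  have U0 : -nq u ≠ 0 := neg_ne_zero.2 (c.nq_ne u0)
  have V0 : -nq v ≠ 0 := neg_ne_zero.2 (c.nq_ne v0)
  have sw : c.sg v u = - c.sg u v := by
    rw [sg, hd', ← neg_neg (c.tri v u _), ← c.tri_swap, neg_inj, sg, tri, tri, ell_neg, br_n, br_n']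
  have key : c.ι (-nq v) * (c.ell u / c.ell (u * v)) ^ 2 + c.ι (-nq u) * (c.ell v / c.ell (u * v)) ^ 2 = 1 := by
    have pl := c.plucker u v u
    have k : u * v * u = -((-nq u : F) • v) := by
      rw [hd, neg_mul, mul_assoc, c.sq_eq, ru, mul_zero, zero_smul, add_zero, QuaternionAlgebra.mul_coe_eq_smul]
    rw [k, hd', ell_neg, ell_neg, ell_smul] at pl
    rw [map_neg] at pl ⊢; rw [map_neg]
    field_simp
    linear_combination -pl
  obtain ⟨α, hα⟩ : ∃ α, α = c.ell u / c.ell (u * v) := ⟨_, rfl⟩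
  obtain ⟨β, hβ⟩ : ∃ β, β = c.ell v / c.ell (u * v) := ⟨_, rfl⟩
  have α0 : α ≠ 0 := by rw [hα]; exact div_ne_zero hu huv
  have β0 : β ≠ 0 := by rw [hβ]; exact div_ne_zero hv huv
  have V1 : c.ι (-nq v) ≠ 0 := by simpa using V0
  have U1 : c.ι (-nq u) ≠ 0 := by simpa using U0
  rw [← hα, ← hβ] at key
  refine ⟨-nq u, -nq v, U0, V0, 2 • st α β + st (c.ι (-nq v)) β + st α (c.ι (-nq u)), ?_, ?_⟩
  · rw [← qm_eq_zero, map_sub, map_add, map_add, map_nsmul, e, sw, sub_neg_eq_add]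
    change _ - (2 • c.br α β + c.br _ _ + c.br _ _) = _
    rw [br_const, br_const', add_zero, add_zero, hα, hβ, c.br_div _ _ hu hv huv, two_smul]
    rw [sub_eq_zero]; rfl
  · have s := st_stein key
    rw [st_mul_left _ V1 (pow_ne_zero _ α0), st_mul_right _ U1 (pow_ne_zero _ β0), st_mul_right _ U1 (pow_ne_zero _ β0),
      st_pow_left _ α0, st_pow_left _ α0, st_pow_right _ β0, st_pow_right _ β0] at s
    rw [eq_neg_iff_add_eq_zero, ← s]
    simp only [smul_add, smul_smul]
    abel
end Cn
end Mk

namespace Mk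
open scoped Quaternion
namespace Qd
variable {L : Type} [Field L] (Q : Qd L)
theorem nrep (x y : Q.F) : ((x : L) + y * Q.r) * Q.σ (x + y * Q.r) = ((x ^ 2 - Q.a * y ^ 2 : Q.F) : L) := by
  rw [map_add, map_mul, Q.sr, Q.mem_F.1 x.2, Q.mem_F.1 y.2]
  simp [a]; ring
theorem rep0 {x y : Q.F} (h : (x : L) + y * Q.r = 0) : x = 0 ∧ y = 0 := by
  have h2 := congrArg Q.σ h
  rw [map_add, map_mul, Q.sr, Q.mem_F.1 x.2, Q.mem_F.1 y.2, map_zero] at h2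
  have h3 : 2 * (y * Q.r) = 0 := by linear_combination h - h2
  have h4 : (y : L) = 0 := by simpa [Q.two, Q.hr] using h3
  rw [h4] at h
  exact ⟨Subtype.ext (by simpa using h), Subtype.ext h4⟩
theorem twoF : (2 : Q.F) ≠ 0 := fun h => Q.two (congrArg Subtype.val h)
theorem aF : Q.a ≠ 0 := fun h => Q.hr (pow_eq_zero_iff two_ne_zero |>.1 (congrArg Subtype.val h))
noncomputable def cn (hN : Q.NN) : Cn Q.K Q.a Q.bF where
  ι := (algebraMap Q.A Q.K).comp Q.ι
  y := algebraMap Q.A Q.K Q.y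
  t := algebraMap Q.A Q.K Q.t
  h := by
    have := congrArg (algebraMap Q.A Q.K) Q.yt
    rwa [map_sub, map_pow, map_mul, map_pow] at this
  ha := Q.aF
  hb := fun h => Q.hb (congrArg Subtype.val h)
  two := Q.twoF
  nz w h := by
    have e : ((w.re : L) + w.imI * Q.r) * Q.σ (w.re + w.imI * Q.r) = Q.b * (((w.imJ : L) + w.imK * Q.r) * Q.σ (w.imJ + w.imK * Q.r)) := by
      have := congrArg (Subtype.val) h
      rw [nrep, nrep]
      simp only [nq] at this
      push_cast at this ⊢
      have hb : (Q.bF : L) = Q.b := rfl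
      rw [hb] at this
      linear_combination this
    by_cases h2 : (w.imJ : L) + w.imK * Q.r = 0
    · rw [h2] at e
      simp only [zero_mul, mul_zero, mul_eq_zero, map_eq_zero, or_self] at e
      obtain ⟨h3, h4⟩ := Q.rep0 e
      obtain ⟨h5, h6⟩ := Q.rep0 h2
      ext <;> simp [*]
    · refine absurd ?_ (hN (((w.re : L) + w.imI * Q.r) / (w.imJ + w.imK * Q.r)))
      have h3 : Q.σ ((w.imJ : L) + w.imK * Q.r) ≠ 0 := by rwa [ne_eq, map_eq_zero]
      rw [map_div₀, div_mul_div_comm, e, mul_div_assoc, div_self (mul_ne_zero h2 h3), mul_one]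
  li x1 x2 x3 h := by
    by_contra hc
    refine Q.lin_ne (α := ![-x1, -x3, x2]) (fun e => hc ?_) (IsFractionRing.injective Q.A Q.K ?_)
    · have e0 := congrFun e 0
      have e1 := congrFun e 1
      have e2 := congrFun e 2
      simp at e0 e1 e2
      exact ⟨e0, e2, e1⟩
    · rw [lin, map_zero, ← h]
      simp; ring
noncomputable def lw (w : ℍ[Q.F, Q.a, Q.bF]) : Q.A := Q.lin ![-w.imI, -w.imK, w.imJ]
variable (hN : Q.NN)
theorem ell_lw (w : ℍ[Q.F, Q.a, Q.bF]) : (Q.cn hN).ell w = algebraMap Q.A Q.K (Q.lw w) := by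
  simp [Cn.ell, lw, lin, cn]; ring
theorem lw_deg (w : ℍ[Q.F, Q.a, Q.bF]) : Q.dg (Q.lw w) ≤ 1 ∧ (Q.cf 1 (Q.lw w) = 0 → w.imJ = 0 ∧ w.imK = 0) := by
  obtain ⟨h1, h2⟩ := Q.dg_lin ![-w.imI, -w.imK, w.imJ]
  refine ⟨h1, fun h => ?_⟩
  rw [lw, h2] at h
  have h3 : (w.imJ : L) + (-w.imK : Q.F) * Q.r = 0 := by
    have := congrArg (fun z => z * 2 * Q.r) h
    have hr := Q.hr
    have ht := Q.two
    field_simp at this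
    simp at this ⊢
    linear_combination this
  obtain ⟨h4, h5⟩ := Q.rep0 h3
  exact ⟨h4, neg_eq_zero.1 h5⟩
theorem lw_surj {x : Q.A} (h : Q.dg x ≤ 1) : ∃ w : ℍ[Q.F, Q.a, Q.bF], x = Q.lw w := by
  obtain ⟨c1, c2, e⟩ := Q.span2 (m := Q.r⁻¹) (by rw [map_inv₀, Q.sr]; intro h'; exact Q.r_ne (by rw [Q.sr]; simpa using congrArg Inv.inv h')) (2 * Q.cf 1 x)
  obtain ⟨h1, h2⟩ := Q.dg_lin ![0, c1, c2]
  have h3 : Q.dg (x - Q.lin ![0, c1, c2]) ≤ 0 := by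
    refine Q.cf_zero ((Q.dgD.sub _ _).trans (max_le h h1)) ?_
    rw [zero_add, Q.cf_sub h h1, h2]
    simp only [Matrix.cons_val_one, Matrix.cons_val, Matrix.cons_val_zero]
    rw [← e, inv_mul_cancel_left₀ Q.two, sub_self]
  obtain ⟨c, hc⟩ := Q.dgD.con _ (Nat.le_zero.1 h3)
  refine ⟨⟨0, -c, c2, -c1⟩, ?_⟩
  rw [lw, ← sub_add_cancel x (Q.lin ![0, c1, c2]), ← hc]
  simp [lin]; ring
def W : Type := {w : ℍ[Q.F, Q.a, Q.bF] // ¬ (w.imJ = 0 ∧ w.imK = 0)}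
theorem lw_add (w v : ℍ[Q.F, Q.a, Q.bF]) : Q.lw (w - v) = Q.lw w - Q.lw v := by simp [lw, lin]; ring
theorem lw_smul (x : Q.F) (v : ℍ[Q.F, Q.a, Q.bF]) : Q.lw (x • v) = Q.ι x * Q.lw v := by simp [lw, lin]; ring
theorem lw_dg (w : Q.W) : Q.dg (Q.lw w.1) = 1 := by
  refine le_antisymm (Q.lw_deg _).1 (Nat.one_le_iff_ne_zero.2 fun h => w.2 ((Q.lw_deg _).2 ?_))
  rw [cf]; exact Pl.co_lt (by norm_num) (Q.dg_le.1 h.le)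
theorem lw_ne (w : Q.W) : Q.lw w.1 ≠ 0 := fun h => by have := Q.lw_dg w; rw [h, Q.dgD.zero] at this; omega
theorem lw_prime [IsPrincipalIdealRing Q.A] (w : Q.W) : Prime (Q.lw w.1) := by
  refine Irreducible.prime ⟨fun h => ?_, fun x y e => ?_⟩
  · obtain ⟨u, hu⟩ := h
    have := Q.lw_dg w; rw [← hu, Q.dgD.unit] at this; omega
  · have h0 := Q.lw_ne w
    rw [e] at h0
    have hx := left_ne_zero_of_mul h0
    have hy := right_ne_zero_of_mul h0
    have := Q.lw_dg w
    rw [e, Q.dgD.mul _ _ hx hy] at this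
    rcases Nat.eq_zero_or_pos (Q.dg x) with h | h
    · exact .inl (Q.dgD.isUnit hx h)
    · exact .inr (Q.dgD.isUnit hy (by omega))
section
variable [IsPrincipalIdealRing Q.A]
noncomputable def pw (w : Q.W) : Pr Q.A := (Pr.exists_rep (Q.lw_prime w)).choose
theorem pw_spec (w : Q.W) : ∃ u : (Q.A)ˣ, Q.lw w.1 = u * (Q.pw w).1 := (Pr.exists_rep (Q.lw_prime w)).choose_spec
theorem comm_i (x : ℍ[Q.F, Q.a, Q.bF]) (h : x.imJ = 0 ∧ x.imK = 0) : (⟨0, 1, 0, 0⟩ : ℍ[Q.F, Q.a, Q.bF]) * x = x * ⟨0, 1, 0, 0⟩ := by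
  ext <;> simp [h.1, h.2]
theorem lpw (w : Q.W) : (Q.cn hN).LP (pl Q.K (Q.pw w)) 0 w.1 := by
  obtain ⟨u, hu⟩ := Q.pw_spec w
  refine ⟨fun d hd => pl_unit (not_dvd_const _ hd), fun x => ?_, fun x hx => ?_, ?_, ?_⟩
  · rw [ell_lw]; intro h
    exact pl_nonneg _ (by rintro h'; simp [h'] at h)
  · rw [ell_lw] at hx
    have hd : (Q.pw w).1 ∣ Q.lw x := by
      by_contra hd
      have h0 : Q.lw x ≠ 0 := fun e => hd (e ▸ dvd_zero _)
      rw [Pl.co_eq (am_ne h0) (pl_unit hd)] at hx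
      exact Pl.lc_ne _ _ (am_ne h0) hx
    have hd' : Q.lw w.1 ∣ Q.lw x := by rw [hu]; exact (Units.mul_left_dvd).2 hd
    obtain ⟨q, hq⟩ := hd'
    have : ∃ c, q = Q.ι c := by
      by_cases q0 : q = 0
      · exact ⟨0, by simp [q0]⟩
      have h1 := (Q.lw_deg x).1
      rw [hq, Q.dgD.mul _ _ (Q.lw_ne w) q0, Q.lw_dg] at h1
      obtain ⟨c, hc⟩ := Q.dgD.con q (by omega)
      exact ⟨c, hc.symm⟩
    obtain ⟨d, rfl⟩ := this
    have h0 : (Q.cn hN).ell (x - d • w.1) = 0 := by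
      rw [ell_lw, lw_add, lw_smul, hq, mul_comm, sub_self, map_zero]
    have e := (Q.cn hN).cen h0
    rw [sub_eq_iff_eq_add.1 e, mul_add, add_mul, (Q.cn hN).comm_coe, mul_smul_comm, smul_mul_assoc]
  · rw [ell_lw, hu, map_mul, Pl.v_mul _ _ _ (am_ne u.ne_zero) (am_ne (Q.pw w).2.1.ne_zero), pl_self,
      pl_unit fun h => (Q.pw w).2.1.not_unit (isUnit_of_dvd_unit h u.isUnit)]
  · rw [ell_lw]; exact am_ne (Q.lw_ne w)
theorem PP_ge {n : ℤ} {x : Q.K} (h : inf.ge n (x : Om L)) : Q.PP.ge n x := fun hx => h (by simpa using hx)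
theorem PP_co (n : ℤ) (x : Q.K) : Q.PP.co n x = inf.co n (x : Om L) := by
  unfold Pl.co
  have : (x ≠ 0 ∧ Q.PP.v x = n) ↔ ((x : Om L) ≠ 0 ∧ inf.v (x : Om L) = n) := and_congr (by simp) Iff.rfl
  by_cases h : x ≠ 0 ∧ Q.PP.v x = n
  · rw [if_pos h, if_pos (this.1 h)]; rfl
  · rw [if_neg h, if_neg (this.not.1 h)]
theorem lpP : (Q.cn hN).LP Q.PP (-1) ⟨0, 1, 0, 0⟩ := by
  have e : (Q.cn hN).ell ⟨0, 1, 0, 0⟩ = -1 := by simp [Cn.ell, cn]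
  refine ⟨fun d hd => inf_c (c := (d : L)) (by simpa using hd), fun x => ?_, fun x hx => ?_, ?_, ?_⟩
  · rw [ell_lw]; exact Q.PP_ge (x := algebraMap Q.A Q.K (Q.lw x)) (Q.dg_le.1 (Q.lw_deg x).1)
  · rw [ell_lw, PP_co] at hx
    exact Q.comm_i x ((Q.lw_deg x).2 hx)
  · rw [e, Pl.v_neg, Pl.v_one]; rfl
  · rw [e]; simp
def ka : Option Q.W → Type
  | none => L
  | some w => Rk (Q.pw w)
noncomputable instance kaF : ∀ i, Field (Q.ka i)
  | none => inferInstanceAs (Field L)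
  | some w => inferInstanceAs (Field (Rk (Q.pw w)))
noncomputable def kp : ∀ i, Pl Q.K (Q.ka i)
  | none => Q.PP
  | some w => pl Q.K (Q.pw w)
def kN : Option Q.W → ℤ
  | none => -1
  | some w => 0
noncomputable def kw : Option Q.W → ℍ[Q.F, Q.a, Q.bF]
  | none => ⟨0, 1, 0, 0⟩
  | some w => w.1
theorem klp : ∀ i, (Q.cn hN).LP (Q.kp i) (Q.kN i) (Q.kw i)
  | none => Q.lpP hN
  | some w => Q.lpw hN w
noncomputable abbrev jF : Q.F →+* Q.K := (algebraMap Q.A Q.K).comp Q.ι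
theorem PP_const (y : K2 Q.F) : Q.PP.tv (K2.map Q.jF y) = 1 := by
  induction y using K2.ind with
  | h0 => simp [Pl.tv_zero]
  | h1 x y hx hy =>
    rw [K2.map_st]
    exact Pl.tv_unit _ (inf_c (c := (x : L)) (by simpa using hx)) (inf_c (c := (y : L)) (by simpa using hy))
  | hn x h => rw [map_neg, Pl.tv_neg, h, inv_one]
  | ha x y h h' => rw [map_add, Pl.tv_add, h, h', one_mul]
theorem units (u : (Q.A)ˣ) : ∃ c, Q.ι c = u := Q.dgD.con _ (Q.dgD.unit u)
theorem mm_hs {z : K2 Q.K} (hz : z ∈ MM Q.K Q.dg 1) : (Q.cn hN).qm z ∈ (Q.cn hN).HS := by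
  rw [← AddSubgroup.mem_comap]
  refine (AddSubgroup.closure_le _).2 ?_ hz
  rintro _ ⟨f, g, hf, hg, rfl⟩
  obtain ⟨w, rfl⟩ := Q.lw_surj hf
  obtain ⟨v, rfl⟩ := Q.lw_surj hg
  have := (Q.cn hN).gen w v
  rwa [ell_lw, ell_lw] at this
theorem caseK (hN : Q.NN) {α : K2 Q.F} {γ : K2 Q.K} (h : K2.map Q.jF α = 2 • γ) :
    ∃ y : K2 Q.F, K2.map Q.jF α = K2.map Q.jF (2 • y) ∨
      ∃ U V : Q.F, U ≠ 0 ∧ V ≠ 0 ∧ K2.map Q.jF α = K2.map Q.jF (2 • y - st V U) := by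
  have hr : ∀ π : Pr Q.A, (pl Q.K π).tv γ ^ 2 = 1 := fun π => by
    rw [← Pl.tv_nsmul, ← h, tv_map_const]
  have hP : Q.PP.tv γ ^ 2 = 1 := by rw [← Pl.tv_nsmul, ← h, PP_const]
  have hl : γ ∈ MM Q.K Q.dg 1 ⊔ CC Q.K Q.ι := layers Q.dgD (fun e he => Q.hh he) fun π _ => by
    rcases mul_self_eq_one_iff.1 (pow_two ((pl Q.K π).tv γ) ▸ hr π) with e | e
    · exact ⟨1, one_ne_zero, by rw [e]; simp⟩
    · exact ⟨-1, by simp, by rw [e]; simp⟩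
  obtain ⟨m, hm, e, he, rfl⟩ := AddSubgroup.mem_sup.1 hl
  have hH : (Q.cn hN).qm (m + e) ∈ (Q.cn hN).HS := by
    rw [map_add, (Q.cn hN).qm_eq_zero.2 he, add_zero]; exact Q.mm_hs hN hm
  have cl1 : ∀ {κ : Type} [Field κ] {p : Pl Q.K κ} {N : ℤ} {w : ℍ[Q.F, Q.a, Q.bF]} (lp : (Q.cn hN).LP p N w),
      p.tv (m + e) ^ 2 = 1 → lp.R ((Q.cn hN).qm (m + e)) = 0 := by
    intro κ _ p N w lp h2
    rw [lp.R_qm]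
    rcases mul_self_eq_one_iff.1 (pow_two (p.tv (m + e)) ▸ h2) with e | e
    · rw [e]; have := Cn.LP.cl_const (c := Q.cn hN) (p := p) (one_ne_zero (α := Q.F)); simpa using this
    · rw [e, Cn.LP.cl_neg_one]
  have cov : ∀ x, (Q.cn hN).ell x ≠ 0 → ∃ i, Q.kw i * x = x * Q.kw i := fun x _ => by
    by_cases hx : x.imJ = 0 ∧ x.imK = 0
    · exact ⟨none, Q.comm_i x hx⟩
    · exact ⟨some ⟨x, hx⟩, rfl⟩
  rcases (Q.cn hN).kill2 (Q.klp hN) cov hH (fun i => match i with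
    | none => cl1 (Q.lpP hN) hP
    | some w => cl1 (Q.lpw hN w) (hr _)) with h1 | ⟨U, V, hU, hV, δ, h1, h2⟩
  · obtain ⟨y, hy⟩ := cc_two Q.units h1 hr
    exact ⟨y, .inl (by rw [h, hy, map_nsmul])⟩
  · obtain ⟨y, hy⟩ := cc_two Q.units h1 (fun π => by
      have h3 : (pl Q.K π).tv (2 • δ) = 1 := by
        have := tv_map_const (K := Q.K) (ι := Q.ι) π (- st V U)
        rw [map_neg, K2.map_st] at this
        rw [h2]; exact this
      rw [← Pl.tv_nsmul, smul_sub, Pl.tv_sub, h3, Pl.tv_nsmul, hr]; simp)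
    refine ⟨y, .inr ⟨U, V, hU, hV, ?_⟩⟩
    rw [map_sub, map_nsmul, ← hy, smul_sub, h2, h, K2.map_st]
    change _ = _ - -(st _ _) - st _ _
    rw [sub_neg_eq_add]; exact (add_sub_cancel_right _ _).symm
end
end Qd
end Mk

namespace Mk
section nf
variable {F : Type} [Field F] {T n : F}
open Classical in
noncomputable def nf (T n α β : F) : K2 F :=
  if α = 0 then st (-β) n else st α n - st (1 + β / α * T + (β / α) ^ 2 * n) (-(β / α))
theorem nf_smul (T n : F) {c α β : F} (hc : c ≠ 0) (h : α ≠ 0 ∨ β ≠ 0) :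
    nf T n (c * α) (c * β) = st c n + nf T n α β := by
  by_cases ha : α = 0
  · subst ha
    have hb : β ≠ 0 := by simpa using h
    simp only [nf, mul_zero, if_true]
    rw [← mul_neg, st_mul_left _ hc (neg_ne_zero.2 hb)]
  · simp only [nf, mul_eq_zero, hc, ha, or_self, if_false]
    rw [mul_div_mul_left _ _ hc, st_mul_left _ hc ha, add_sub_assoc]
theorem nf_g (g : F) : nf T n 1 (-g) = - st (1 - g * T + g ^ 2 * n) g := by
  simp only [nf, one_ne_zero, if_false, st_one_left, div_one, neg_neg, zero_sub]
  congr 2; ring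
theorem st_gg (g y : F) (hg : g ≠ 0) : st (g ^ 2) y = st g y + st g y := by rw [pow_two, st_mul_left _ hg hg]
theorem nf_yg (hn : n ≠ 0) {g : F} (hm : 1 - g * T + g ^ 2 * n ≠ 0) :
    nf T n (g * n) (1 - g * T) = st (-1) n - st (1 - g * T + g ^ 2 * n) g := by
  by_cases hg : g = 0
  · subst hg; simp [nf]
  have hgn : g * n ≠ 0 := mul_ne_zero hg hn
  have hg2 : g ^ 2 * n ≠ 0 := mul_ne_zero (pow_ne_zero 2 hg) hn
  simp only [nf, hgn, if_false]
  set m := 1 - g * T + g ^ 2 * n with hmd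
  have e1 : 1 + (1 - g * T) / (g * n) * T + ((1 - g * T) / (g * n)) ^ 2 * n = m / (g ^ 2 * n) := by
    field_simp; rw [hmd]; ring
  have e2 : -((1 - g * T) / (g * n)) = g * (1 - m / (g ^ 2 * n)) := by
    field_simp; rw [hmd]; ring
  rw [e1, e2]
  have a1 : st (g ^ 2 * n) g = st n g + (st g (-1) + st g (-1)) := by
    rw [st_mul_left _ (pow_ne_zero 2 hg) hn, st_gg _ _ hg, st_self]; abel
  have a2 : st g (-1) + st g (-1) = 0 := by rw [← st_mul_right _ (by simp) (by simp)]; simp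
  rw [st_mul_left _ hg hn, st_self n, st_anti n (-1)]
  have a3' : -(st (-1) n + st (-1) n) = 0 := by rw [← st_mul_left _ (by simp) (by simp)]; simp
  by_cases h : 1 - m / (g ^ 2 * n) = 0
  · rw [h, mul_zero, st_zero_right, sub_zero]
    have : m = g ^ 2 * n := by rw [sub_eq_zero, eq_div_iff hg2, one_mul] at h; exact h.symm
    rw [this, a1, a2, st_anti n g]
    linear_combination (norm := abel) a3'
  · rw [st_mul_right _ hg h, st_stein (x := m / (g ^ 2 * n)) (add_sub_cancel _ _), st_div_left _ hm hg2, a1, a2, st_anti n g]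
    linear_combination (norm := abel) a3'
theorem nf_gg (hn : n ≠ 0) {g h : F} (hm : 1 - g * T + g ^ 2 * n ≠ 0) (hk : 1 - h * T + h ^ 2 * n ≠ 0) :
    nf T n (1 - g * h * n) (-(g + h - g * h * T)) = - st (1 - g * T + g ^ 2 * n) g - st (1 - h * T + h ^ 2 * n) h := by
  by_cases hg : g = 0
  · subst hg; have := nf_g (T := T) (n := n) h; simpa using this
  by_cases hh : h = 0
  · subst hh; have := nf_g (T := T) (n := n) g; simpa using this
  set m := 1 - g * T + g ^ 2 * n with hmd
  set k := 1 - h * T + h ^ 2 * n with hkd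
  set e := 1 - g * h * n with hed
  set S := g + h - g * h * T with hSd
  have r1 : S - g * e = h * m := by rw [hSd, hed, hmd]; ring
  have r2 : S - h * e = g * k := by rw [hSd, hed, hkd]; ring
  by_cases he : e = 0
  · rw [he, mul_zero, sub_zero] at r1 r2
    have hS : S ≠ 0 := r1 ▸ mul_ne_zero hh hm
    rw [he]; simp only [nf, if_true, neg_neg]
    have en : n = (g * h)⁻¹ := by rw [hed] at he; field_simp; linear_combination -he
    have em : m = S / h := by rw [r1]; field_simp
    have ek : k = S / g := by rw [r2]; field_simp
    rw [en, em, ek, st_inv_right, st_mul_right _ hg hh, st_div_left _ hS hh, st_div_left _ hS hg, st_anti h g]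
    abel
  · have en : st e n = - st e g - st e h := by
      have := st_stein (x := e) (y := g * h * n) (by rw [hed]; ring)
      rw [st_mul_right _ (mul_ne_zero hg hh) hn, st_mul_right _ hg hh] at this
      linear_combination (norm := abel) this
    have e1 : 1 + -S / e * T + (-S / e) ^ 2 * n = m * k / e ^ 2 := by
      field_simp; rw [hSd, hed, hmd, hkd]; ring
    simp only [nf, he, if_false]
    rw [e1, neg_div, neg_neg, en]
    by_cases hS : S = 0
    · rw [hS] at r1 r2 ⊢
      rw [zero_div, st_zero_right, sub_zero]
      have em : m = -g * e / h := by field_simp; linear_combination -r1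
      have ek : k = -h * e / g := by field_simp; linear_combination -r2
      have hg' : -g ≠ 0 := neg_ne_zero.2 hg
      have hh' : -h ≠ 0 := neg_ne_zero.2 hh
      have q1 : st (-g) g = 0 := by rw [st_anti, st_self_neg, neg_zero]
      have q2 : st (-h) h = 0 := by rw [st_anti, st_self_neg, neg_zero]
      rw [em, ek, st_div_left _ (mul_ne_zero hg' he) hh, st_div_left _ (mul_ne_zero hh' he) hg, st_mul_left _ hg' he,
        st_mul_left _ hh' he, q1, q2, st_anti h g]
      abel
    · have s1 := st_stein (x := g * e / S) (y := h * m / S) (by rw [← add_div, ← r1]; field_simp; ring)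
      have s2 := st_stein (x := h * e / S) (y := g * k / S) (by rw [← add_div, ← r2]; field_simp; ring)
      rw [st_div_left _ (mul_ne_zero ‹_› ‹_›) hS, st_div_right _ (mul_ne_zero ‹_› ‹_›) hS, st_div_right _ (mul_ne_zero ‹_› ‹_›) hS,
        st_mul_left _ ‹_› ‹_›, st_mul_right _ ‹_› ‹_›, st_mul_right _ ‹_› ‹_›, st_mul_left _ ‹_› ‹_›] at s1 s2
      rw [st_div_left _ (mul_ne_zero hm hk) (pow_ne_zero 2 he), st_gg _ _ he, st_mul_left _ hm hk, st_div_right _ hS he,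
        st_div_right _ hS he, st_div_right _ hS he]
      have t1 : st e e + st e e = 0 := by rw [st_self, ← st_mul_right _ (by simp) (by simp)]; simp
      have t2 : st S S + st S S = 0 := by rw [st_self, ← st_mul_right _ (by simp) (by simp)]; simp
      rw [st_mul_right _ ‹_› ‹_›, st_anti g m, st_anti e m, st_anti S m, st_anti S h] at s1
      rw [st_mul_right _ ‹_› ‹_›, st_anti h k, st_anti e k, st_anti S k, st_anti S g, st_anti h g] at s2
      linear_combination (norm := abel) t2 - s1 - s2 - t1
theorem nf_yy (hn : n ≠ 0) : nf T n (-n) T = 0 := by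
  simp only [nf, neg_eq_zero, hn, if_false]
  have : 1 + T / -n * T + (T / -n) ^ 2 * n = 1 := by field_simp; ring
  rw [this, st_one_left, sub_zero, st_anti, st_self_neg, neg_zero]
theorem nf_mul (hn : n ≠ 0) (an : ∀ α β : F, α ^ 2 + α * β * T + β ^ 2 * n = 0 → α = 0 ∧ β = 0) {α β γ δ : F}
    (h1 : α ≠ 0 ∨ β ≠ 0) (h2 : γ ≠ 0 ∨ δ ≠ 0) :
    nf T n (α * γ - β * δ * n) (α * δ + β * γ + β * δ * T) = nf T n α β + nf T n γ δ := by
  have two1 : st (-1) n + st (-1) n = 0 := by rw [← st_mul_left _ (by simp) (by simp)]; simp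
  have nz : ∀ g, 1 - g * T + g ^ 2 * n ≠ 0 := fun g h => one_ne_zero (an 1 (-g) (by linear_combination h)).1
  have ny : nf T n 0 1 = st (-1) n := by simp [nf]
  have red : ∀ α β : F, (α ≠ 0 ∨ β ≠ 0) → ∃ c g, c ≠ 0 ∧ (α = c * 1 ∧ β = c * -g ∨ α = c * 0 ∧ β = c * 1) := by
    intro α β h
    by_cases ha : α = 0
    · exact ⟨β, 0, by simpa [ha] using h, .inr ⟨by simp [ha], by simp⟩⟩
    · exact ⟨α, -(β / α), ha, .inl ⟨by simp, by field_simp⟩⟩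
  obtain ⟨c, g, hc, h1'⟩ := red α β h1
  obtain ⟨d, h, hd, h2'⟩ := red γ δ h2
  have key : ∀ α β γ δ : F, α ≠ 0 ∨ β ≠ 0 → γ ≠ 0 ∨ δ ≠ 0 → (α * γ - β * δ * n ≠ 0 ∨ α * δ + β * γ + β * δ * T ≠ 0) := by
    intro α β γ δ h1 h2
    by_contra hc
    push Not at hc
    have : (α ^ 2 + α * β * T + β ^ 2 * n) * (γ ^ 2 + γ * δ * T + δ ^ 2 * n) = 0 := by
      linear_combination (α * γ - β * δ * n) * hc.1 + (α * δ + β * γ + β * δ * T) * n * hc.2 + (α * γ - β * δ * n) * T * hc.2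
    rcases mul_eq_zero.1 this with h | h
    · exact absurd (an _ _ h) (by tauto)
    · exact absurd (an _ _ h) (by tauto)
  have fin : ∀ α' β' γ' δ' : F, α = c * α' → β = c * β' → γ = d * γ' → δ = d * δ' → α' ≠ 0 ∨ β' ≠ 0 → γ' ≠ 0 ∨ δ' ≠ 0 →
      nf T n (α' * γ' - β' * δ' * n) (α' * δ' + β' * γ' + β' * δ' * T) = nf T n α' β' + nf T n γ' δ' →
      nf T n (α * γ - β * δ * n) (α * δ + β * γ + β * δ * T) = nf T n α β + nf T n γ δ := by
    rintro α' β' γ' δ' rfl rfl rfl rfl q1 q2 e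
    have x1 : c * α' * (d * γ') - c * β' * (d * δ') * n = c * d * (α' * γ' - β' * δ' * n) := by ring
    have x2 : c * α' * (d * δ') + c * β' * (d * γ') + c * β' * (d * δ') * T = c * d * (α' * δ' + β' * γ' + β' * δ' * T) := by ring
    rw [x1, x2, nf_smul T n (mul_ne_zero hc hd) (key _ _ _ _ q1 q2), nf_smul T n hc q1, nf_smul T n hd q2, e, st_mul_left _ hc hd]
    abel
  rcases h1' with ⟨e1, e2⟩ | ⟨e1, e2⟩ <;> rcases h2' with ⟨e3, e4⟩ | ⟨e3, e4⟩
  · refine fin _ _ _ _ e1 e2 e3 e4 (by simp) (by simp) ?_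
    rw [nf_g, nf_g, ← sub_eq_add_neg, ← nf_gg hn (nz g) (nz h)]; congr 1 <;> ring
  · refine fin _ _ _ _ e1 e2 e3 e4 (by simp) (by simp) ?_
    rw [nf_g, ny, neg_add_eq_sub, ← nf_yg hn (nz g)]; congr 1 <;> ring
  · refine fin _ _ _ _ e1 e2 e3 e4 (by simp) (by simp) ?_
    rw [nf_g, ny, ← sub_eq_add_neg, ← nf_yg hn (nz h)]; congr 1 <;> ring
  · refine fin _ _ _ _ e1 e2 e3 e4 (by simp) (by simp) ?_
    rw [ny, two1, ← nf_yy (T := T) hn]; congr 1 <;> ring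
end nf
namespace Qd
variable {L : Type} [Field L] (Q : Qd L)
def nm (x : L) : Q.F := ⟨x * Q.σ x, by rw [mem_F, map_mul, Q.ss, mul_comm]⟩
def tr (x : L) : Q.F := ⟨x + Q.σ x, by rw [mem_F, map_add, Q.ss, add_comm]⟩
theorem nm_mul (x y : L) : Q.nm (x * y) = Q.nm x * Q.nm y := Subtype.ext (by simp [nm]; ring)
theorem nm_ne {x : L} (h : x ≠ 0) : Q.nm x ≠ 0 := fun e => by
  have := congrArg Subtype.val e; simp [nm, h] at this
theorem nm_F (x : Q.F) : Q.nm x = x * x := Subtype.ext (by simp [nm, Q.mem_F.1 x.2])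
noncomputable def bt (y x : L) : L := (x - Q.σ x) / (y - Q.σ y)
theorem bt_eq {y x : L} (hy : Q.σ y ≠ y) {α β : Q.F} (h : x = α + β * y) : Q.bt y x = β := by
  rw [bt, div_eq_iff (sub_ne_zero.2 hy.symm), h, map_add, map_mul, Q.mem_F.1 α.2, Q.mem_F.1 β.2]; ring
open Classical in
noncomputable def cof (y x : L) : Q.F × Q.F := if h : ∃ p : Q.F × Q.F, x = p.1 + p.2 * y then h.choose else 0
theorem cof_eq {y x : L} (hy : Q.σ y ≠ y) {α β : Q.F} (h : x = α + β * y) : Q.cof y x = (α, β) := by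
  have h' : ∃ p : Q.F × Q.F, x = p.1 + p.2 * y := ⟨(α, β), h⟩
  rw [cof, dif_pos h']
  have h2 := h'.choose_spec
  have e1 : h'.choose.2 = β := Subtype.ext ((Q.bt_eq hy h2).symm.trans (Q.bt_eq hy h))
  rw [e1] at h2
  exact Prod.ext (Subtype.ext (add_right_cancel (h2.symm.trans h))) e1
open Classical in
noncomputable def N2 (x y : L) : K2 Q.F :=
  if x = 0 then 0 else if h : Q.σ y = y then st (Q.nm x) ⟨y, h⟩ else nf (Q.tr y) (Q.nm y) (Q.cof y x).1 (Q.cof y x).2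
theorem N2_F (x : L) (y : Q.F) : Q.N2 x y = st (Q.nm x) y := by
  by_cases hx : x = 0
  · subst hx; simp [N2, nm]; rw [show (⟨0, _⟩ : Q.F) = 0 from rfl, st_zero_left]
  · rw [N2, if_neg hx, dif_pos (Q.mem_F.1 y.2)]
theorem N2_eq {y : L} (hy : Q.σ y ≠ y) {α β : Q.F} (h : α ≠ 0 ∨ β ≠ 0) : Q.N2 (α + β * y) y = nf (Q.tr y) (Q.nm y) α β := by
  rw [N2, dif_neg hy, Q.cof_eq hy rfl, if_neg]
  intro e
  have e2 : Q.bt y 0 = (0 : Q.F) := by simp [bt]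
  rw [← e, Q.bt_eq hy rfl] at e2
  have e3 : β = 0 := Subtype.ext e2
  rw [e3] at e
  exact h.elim (fun q => q (Subtype.ext (by simpa using e))) (fun q => q e3)
theorem ex {y x : L} (hy : Q.σ y ≠ y) (hx : x ≠ 0) : ∃ α β : Q.F, (α ≠ 0 ∨ β ≠ 0) ∧ x = α + β * y := by
  obtain ⟨α, β, e⟩ := Q.span2 hy x
  refine ⟨α, β, ?_, e⟩
  by_contra h; push Not at h
  rw [h.1, h.2] at e; simp at e; exact hx e
theorem nm_ab (α β : Q.F) (y : L) : Q.nm (α + β * y) = α ^ 2 + α * β * Q.tr y + β ^ 2 * Q.nm y :=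
  Subtype.ext (by simp [nm, tr, Q.mem_F.1 α.2, Q.mem_F.1 β.2]; ring)
theorem N2_ml (x x' y : L) (hx : x ≠ 0) (hx' : x' ≠ 0) (hy : y ≠ 0) : Q.N2 (x * x') y = Q.N2 x y + Q.N2 x' y := by
  by_cases h : Q.σ y = y
  · have := Q.N2_F (y := ⟨y, h⟩)
    simp only at this
    rw [this, this, this, nm_mul, st_mul_left _ (Q.nm_ne hx) (Q.nm_ne hx')]
  · obtain ⟨α, β, h1, rfl⟩ := Q.ex h hx
    obtain ⟨γ, δ, h2, rfl⟩ := Q.ex h hx'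
    have e : ((α : L) + β * y) * (γ + δ * y) = ((α * γ - β * δ * Q.nm y : Q.F) : L) + ((α * δ + β * γ + β * δ * Q.tr y : Q.F) : L) * y := by
      simp [nm, tr]; ring
    have key := mul_ne_zero hx hx'
    rw [e] at key ⊢
    rw [Q.N2_eq h h1, Q.N2_eq h h2, Q.N2_eq h, nf_mul (Q.nm_ne hy) _ h1 h2]
    · intro α β e
      rw [← nm_ab] at e
      by_contra hc
      have : (α : L) + β * y = 0 := by by_contra h'; exact Q.nm_ne h' e
      have e2 := Q.bt_eq h this.symm
      have e3 : β = 0 := Subtype.ext (e2.symm.trans (by simp [bt]))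
      rw [e3] at this
      exact hc ⟨Subtype.ext (by simpa using this), e3⟩
    · by_contra hc; push Not at hc
      rw [hc.1, hc.2] at key; simp at key
theorem N2_anti (x y : L) (hx : x ≠ 0) (hy : y ≠ 0) : Q.N2 x y = - Q.N2 y x := by
  have base : ∀ (x : Q.F) (y : L), (x : L) ≠ 0 → y ≠ 0 → Q.N2 x y = - Q.N2 y x := by
    intro x y hx hy
    have hx0 : x ≠ 0 := fun h => hx (by simp [h])
    rw [Q.N2_F, ← st_anti]
    by_cases h : Q.σ y = y
    · have hy0 : (⟨y, h⟩ : Q.F) ≠ 0 := fun h => hy (congrArg Subtype.val h)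
      have := Q.N2_F x ⟨y, h⟩
      rw [Q.nm_F, st_mul_left _ hx0 hx0] at this
      rw [this, show Q.nm y = ⟨y, h⟩ * ⟨y, h⟩ from Q.nm_F ⟨y, h⟩, st_mul_right _ hy0 hy0]
    · have := Q.N2_eq h (α := x) (β := 0) (.inl hx0)
      rw [show (x : L) = x + (0 : Q.F) * y by simp, this]
      simp [nf, hx0]
  by_cases hxF : Q.σ x = x
  · exact base ⟨x, hxF⟩ y hx hy
  by_cases hyF : Q.σ y = y
  · rw [base ⟨y, hyF⟩ x hy hx, neg_neg]
  obtain ⟨α, β, h1, rfl⟩ := Q.ex hyF hx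
  have hb : β ≠ 0 := by rintro rfl; simp [Q.mem_F.1 α.2] at hxF
  have hb' : (β : L) ≠ 0 := by simpa using hb
  have e : y = ((-α / β : Q.F) : L) + ((1 / β : Q.F) : L) * (α + β * y) := by push_cast; field_simp; ring
  have hn := Q.nm_ne hy
  have hn' := Q.nm_ne hx
  have hx2 := Q.N2_eq hxF (α := -α / β) (β := 1 / β) (.inr (by simp [hb]))
  rw [← e] at hx2
  rw [Q.N2_eq hyF h1, hx2]
  by_cases ha : α = 0
  · subst ha
    simp only [nf, neg_zero, zero_div, if_true]
    have h0 : Q.nm ((0 : Q.F) + β * y) = β * β * Q.nm y := by simp [nm_mul, nm_F]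
    have q1 : st (-β) β = 0 := by rw [st_anti, st_self_neg, neg_zero]
    rw [h0, one_div, ← inv_neg, st_inv_left, neg_neg, st_mul_right _ (mul_ne_zero hb hb) hn, st_mul_right _ hb hb, q1]; simp
  · have q0 : -α / β ≠ 0 := div_ne_zero (neg_ne_zero.2 ha) hb
    simp only [nf, ha, q0, if_false]
    have f1 : 1 + β / α * Q.tr y + (β / α) ^ 2 * Q.nm y = Q.nm (α + β * y) / (α * α) := by
      rw [nm_ab]; field_simp
    have f2 : 1 + 1 / β / (-α / β) * Q.tr (α + β * y) + (1 / β / (-α / β)) ^ 2 * Q.nm (α + β * y) = (β * β) * Q.nm y / (α * α) := by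
      have : Q.tr (α + β * y) = α + α + β * Q.tr y := Subtype.ext (by simp [tr, Q.mem_F.1 α.2, Q.mem_F.1 β.2]; ring)
      rw [nm_ab, this]; field_simp; ring
    have f3 : -(1 / β / (-α / β)) = α⁻¹ := by field_simp
    set g := -(β / α) with hg
    have f4 : -α / β = g⁻¹ := by rw [hg]; field_simp
    have hg0 : g ≠ 0 := neg_ne_zero.2 (div_ne_zero hb ha)
    have f5 : β * β = (g * g) * (α * α) := by rw [hg]; field_simp
    rw [f1, f2, f3, f4, f5, st_inv_left, st_inv_right, mul_right_comm, mul_div_cancel_right₀ _ (mul_ne_zero ha ha),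
      st_div_left _ hn' (mul_ne_zero ha ha), st_mul_left _ (mul_ne_zero hg0 hg0) hn, st_mul_left _ hg0 hg0, st_mul_left _ ha ha,
      st_anti g α, st_anti (Q.nm y) α, st_anti g]
    abel
noncomputable def Nr : K2 L →+ K2 Q.F := K2.lift Q.N2
  { zl := fun y => by simp [N2]
    zr := fun x => by have := Q.N2_F x 0; simpa using this
    ml := Q.N2_ml
    mr := fun x y w hx hy hw => by
      rw [Q.N2_anti _ _ hw (mul_ne_zero hx hy), Q.N2_ml _ _ _ hx hy hw, Q.N2_anti _ _ hw hx, Q.N2_anti _ _ hw hy]; abel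
    s := fun x y hx hy h => by
      by_cases hF : Q.σ y = y
      · obtain rfl : x = ((1 - ⟨y, hF⟩ : Q.F) : L) := by simp [← h]
        have hx0 : (1 - ⟨y, hF⟩ : Q.F) ≠ 0 := fun e => hx (by rw [e]; rfl)
        have := Q.N2_F ((1 - ⟨y, hF⟩ : Q.F) : L) ⟨y, hF⟩
        rw [Q.nm_F, st_mul_left _ hx0 hx0, st_stein (by simp), add_zero] at this
        exact this
      · have := Q.N2_eq hF (α := 1) (β := -1) (.inl one_ne_zero)
        rw [show x = (1 : Q.F) + (-1 : Q.F) * y by push_cast; linear_combination h, this]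
        simp [nf] }
theorem Nr_map (z : K2 Q.F) : Q.Nr (K2.map Q.F.subtype z) = 2 • z := by
  induction z using K2.ind with
  | h0 => simp
  | h1 x y hx hy =>
    rw [K2.map_st, Nr, K2.lift_st]
    exact (Q.N2_F _ _).trans (by rw [Subfield.subtype_apply, nm_F, st_mul_left _ hx hx, two_nsmul])
  | hn x h => rw [map_neg, map_neg, h, smul_neg]
  | ha x y h h' => rw [map_add, map_add, h, h', smul_add]
theorem kr [IsPrincipalIdealRing Q.A] {z : K2 Q.F} (h : K2.map Q.jF z = 0) : 2 • z = 0 := by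
  have e : ∀ z, Q.PP.sp (K2.map Q.jF z) = K2.map Q.F.subtype z := by
    intro z
    induction z using K2.ind with
    | h0 => simp
    | h1 x y hx hy =>
      rw [K2.map_st, K2.map_st, Pl.sp_st]
      exact congrArg₂ st (inf_clc _) (inf_clc _)
    | hn x h => rw [map_neg, map_neg, h, map_neg]
    | ha x y h h' => rw [map_add, map_add, h, h', map_add]
  rw [← Nr_map, ← e, h]; simp
end Qd
end Mk

namespace Mk
section ov
variable {R R' : Type} [CommRing R] [IsDomain R] [IsPrincipalIdealRing R] [CommRing R'] [IsDomain R'] [IsPrincipalIdealRing R']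
  {K K' : Type} [Field K] [Algebra R K] [IsFractionRing R K] [Field K'] [Algebra R' K'] [IsFractionRing R' K']
structure Ov (j : R →+* R') (π : Pr R) (ϖ : Pr R') : Prop where
  d : ∀ a, π.1 ∣ a ↔ ϖ.1 ∣ j a
  sq : ¬ ϖ.1 ^ 2 ∣ j π.1
variable {j : R →+* R'} {π : Pr R} {ϖ : Pr R'}
noncomputable def Ov.m (h : Ov j π ϖ) : Rk π →+* Rk ϖ :=
  Ideal.Quotient.lift _ ((rho ϖ).comp j) fun a ha => by
    rw [RingHom.comp_apply, rho_eq_zero, ← h.d]; exact Ideal.mem_span_singleton.1 ha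
theorem Ov.m_rho (h : Ov j π ϖ) (a : R) : h.m (rho π a) = rho ϖ (j a) := rfl
theorem pl_pow {π : Pr R} {c : R} (n : ℕ) (h : ¬ π.1 ∣ c) : (pl K π).v (algebraMap R K (π.1 ^ n * c)) = n ∧ (pl K π).lc (algebraMap R K (π.1 ^ n * c)) = rho π c := by
  have hc : c ≠ 0 := by rintro rfl; simp at h
  have hp := am_ne (K := K) π.2.1.ne_zero
  rw [map_mul, map_pow, Pl.v_mul _ _ _ (pow_ne_zero _ hp) (am_ne hc), Pl.v_pow hp, pl_self, pl_unit h, map_mul, map_pow, pl_self', pl_unit' h]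
  simp
theorem Ov.tv (h : Ov j π ϖ) (J : K →+* K') (hJ : ∀ a, J (algebraMap R K a) = algebraMap R' K' (j a)) {z : K2 K} {a : R}
    (e : (pl K π).tv z = rho π a) : (pl K' ϖ).tv (K2.map J z) = rho ϖ (j a) := by
  obtain ⟨b, hb⟩ := (h.d π.1).1 dvd_rfl
  have hb' : ¬ ϖ.1 ∣ b := fun h' => h.sq (by rw [hb, pow_two]; exact mul_dvd_mul_left _ h')
  have k0 : rho ϖ b ≠ 0 := by rwa [Ne, rho_eq_zero]
  have key : ∀ a, a ≠ 0 → (pl K' ϖ).v (J (algebraMap R K a)) = (pl K π).v (algebraMap R K a) ∧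
      (pl K' ϖ).lc (J (algebraMap R K a)) = h.m ((pl K π).lc (algebraMap R K a)) * rho ϖ b ^ (pl K π).v (algebraMap R K a) := fun a ha => by
    obtain ⟨n, c, hc, rfl⟩ := WfDvdMonoid.max_power_factor ha π.2.1.irreducible
    have h1 : ¬ ϖ.1 ∣ b ^ n * j c := fun h' => (ϖ.2.1.dvd_mul.1 h').elim (fun h' => hb' (ϖ.2.1.dvd_of_dvd_pow h')) (fun h' => hc ((h.d c).2 h'))
    have h2 : j (π.1 ^ n * c) = ϖ.1 ^ n * (b ^ n * j c) := by rw [map_mul, map_pow, hb]; ring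
    rw [hJ, h2, (pl_pow n h1).1, (pl_pow n h1).2, (pl_pow n hc).1, (pl_pow n hc).2, h.m_rho, map_mul, map_pow, zpow_natCast]
    exact ⟨rfl, mul_comm _ _⟩
  have key2 : ∀ x, x ≠ 0 → (pl K' ϖ).v (J x) = (pl K π).v x ∧ (pl K' ϖ).lc (J x) = h.m ((pl K π).lc x) * rho ϖ b ^ (pl K π).v x := fun x hx => by
    obtain ⟨p, q, hq, rfl⟩ := IsFractionRing.div_surjective (A := R) x
    have q0 := nonZeroDivisors.ne_zero hq
    have p0 : p ≠ 0 := by rintro rfl; simp at hx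
    have a1 := am_ne (K := K) p0
    have a2 := am_ne (K := K) q0
    rw [map_div₀, map_div₀, map_div₀, Pl.v_div _ (by simpa using a1) (by simpa using a2), Pl.v_div _ a1 a2, (key p p0).1, (key p p0).2, (key q q0).1, (key q q0).2]
    refine ⟨rfl, ?_⟩
    rw [zpow_sub₀ k0, map_div₀, mul_div_mul_comm]
  rw [Pl.tame_compat (pl K π) (pl K' ϖ) J h.m (rho ϖ b) k0 (fun x hx => (key2 x hx).1) (fun x hx => (key2 x hx).2), e, h.m_rho]
theorem dvd_fin {f : R} (hf : f ≠ 0) : {π : Pr R | π.1 ∣ f}.Finite := by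
  induction f using WfDvdMonoid.induction_on_irreducible with
  | zero => exact absurd rfl hf
  | unit u hu => exact Set.Finite.subset Set.finite_empty fun π h => π.2.1.not_unit (isUnit_of_dvd_unit h hu)
  | mul a i ha hi ih =>
    obtain ⟨ϖ, u, hu⟩ := Pr.exists_rep hi.prime
    refine Set.Finite.subset ((ih ha).insert ϖ) fun π h => ?_
    rcases π.2.1.dvd_mul.1 h with h | h
    · rw [hu] at h; exact .inl (Pr.eq_of_dvd (Units.dvd_mul_left.1 h))
    · exact .inr h
theorem tv_fin (v : K2 K) : {π : Pr R | (pl K π).tv v ≠ 1}.Finite := by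
  induction v using K2.ind with
  | h0 => simp [Pl.tv_zero]
  | h1 x y hx hy =>
    obtain ⟨p, q, hq, rfl⟩ := IsFractionRing.div_surjective (A := R) x
    obtain ⟨p', q', hq', rfl⟩ := IsFractionRing.div_surjective (A := R) y
    have q0 := nonZeroDivisors.ne_zero hq
    have q0' := nonZeroDivisors.ne_zero hq'
    have p0 : p ≠ 0 := by rintro rfl; simp at hx
    have p0' : p' ≠ 0 := by rintro rfl; simp at hy
    refine (dvd_fin (mul_ne_zero (mul_ne_zero p0 q0) (mul_ne_zero p0' q0'))).subset fun π h => ?_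
    by_contra h'
    refine h (Pl.tv_unit _ ?_ ?_)
    · rw [Pl.v_div _ (am_ne p0) (am_ne q0), pl_unit fun d => h' ((d.mul_right _).mul_right _), pl_unit fun d => h' ((d.mul_left _).mul_right _), sub_zero]
    · rw [Pl.v_div _ (am_ne p0') (am_ne q0'), pl_unit fun d => h' ((d.mul_right _).mul_left _), pl_unit fun d => h' ((d.mul_left _).mul_left _), sub_zero]
  | hn x h => simpa [Pl.tv_neg] using h
  | ha x y h h' =>
    refine (h.union h').subset fun π hn => ?_
    by_contra hc
    simp only [Set.mem_union, Set.mem_setOf_eq, not_or, not_not] at hc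
    exact hn (by rw [Pl.tv_add, hc.1, hc.2, one_mul])
structure Iv (j : R →+* R') (τ : R' →+* R') (r : R') : Prop where
  t : ∀ x, τ (τ x) = x
  f : ∀ a, τ (j a) = j a
  s : ∀ x, τ x = x → ∃ a, j a = x
  hr : IsUnit r
  sr : τ r = -r
  two : IsUnit (2 : R)
section inv
variable {τ : R' →+* R'} {r : R'}
theorem ov_norm (V : Iv j τ r) (ϖ : R') : ∃ n, j n = ϖ * τ ϖ :=
  V.s _ (by rw [map_mul, V.t, mul_comm])
theorem ov_ex (V : Iv j τ r) (ϖ : Pr R') : ∃ π, Ov j π ϖ := by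
  obtain ⟨n, hn⟩ := ov_norm V ϖ.1
  have t0 : τ ϖ.1 ≠ 0 := fun h => ϖ.2.1.ne_zero (by rw [← V.t ϖ.1, h, map_zero])
  have n0 : n ≠ 0 := by rintro rfl; rw [map_zero] at hn; exact mul_ne_zero ϖ.2.1.ne_zero t0 hn.symm
  let I : Ideal R := (Ideal.span {ϖ.1}).comap j
  haveI : (Ideal.span {ϖ.1}).IsPrime := (Ideal.span_singleton_prime ϖ.2.1.ne_zero).2 ϖ.2.1
  have hI : I.IsPrime := Ideal.IsPrime.comap j
  obtain ⟨p, hp⟩ := (IsPrincipalIdealRing.principal I).principal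
  have hp : I = Ideal.span {p} := hp
  have hd : ∀ a, p ∣ a ↔ ϖ.1 ∣ j a := fun a => by
    rw [← Ideal.mem_span_singleton, ← hp, Ideal.mem_comap, Ideal.mem_span_singleton]
  have p0 : p ≠ 0 := by
    rintro rfl
    exact n0 (zero_dvd_iff.1 ((hd n).2 (hn ▸ dvd_mul_right _ _)))
  rw [hp, Ideal.span_singleton_prime p0] at hI
  obtain ⟨π, u, hu⟩ := Pr.exists_rep hI
  have hd : ∀ a, π.1 ∣ a ↔ ϖ.1 ∣ j a := fun a => by rw [← hd, hu, Units.mul_left_dvd]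
  refine ⟨π, hd, fun hq => ?_⟩
  have up : ∀ x, τ x = x → ϖ.1 ∣ x → ϖ.1 ^ 2 ∣ x := fun x hx h => by
    obtain ⟨a, rfl⟩ := V.s x hx
    exact hq.trans (map_dvd j ((hd a).2 h))
  have h1 : ϖ.1 ∣ τ ϖ.1 := by
    have := up (ϖ.1 * τ ϖ.1) (by rw [map_mul, V.t, mul_comm]) (dvd_mul_right _ _)
    rw [pow_two] at this
    exact (mul_dvd_mul_iff_left ϖ.2.1.ne_zero).1 this
  have h3 := up (ϖ.1 + τ ϖ.1) (by rw [map_add, V.t, add_comm]) (dvd_add dvd_rfl h1)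
  have h4 := up (r * (ϖ.1 - τ ϖ.1)) (by rw [map_mul, map_sub, V.t, V.sr]; ring) ((dvd_sub dvd_rfl h1).mul_left _)
  rw [V.hr.dvd_mul_left] at h4
  have h5 : ϖ.1 ^ 2 ∣ j 2 * ϖ.1 := by
    rw [map_ofNat]; convert dvd_add h3 h4 using 1; ring
  rw [(V.two.map j).dvd_mul_left, pow_two] at h5
  have := (mul_dvd_mul_iff_left ϖ.2.1.ne_zero).1 (h5.trans (mul_one ϖ.1).symm.dvd)
  exact ϖ.2.1.not_unit (isUnit_of_dvd_one this)
theorem ov_res (V : Iv j τ r) (S : K' →+* K') (hS : ∀ a, S (algebraMap R' K' a) = algebraMap R' K' (τ a)) {v : K2 K'}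
    (hv : ∀ ϖ : Pr R', (pl K' ϖ).tv (K2.map S v) = (pl K' ϖ).tv v) (π : Pr R) :
    ∃ a, ¬ π.1 ∣ a ∧ ∀ ϖ, Ov j π ϖ → (pl K' ϖ).tv v = rho ϖ (j a) := by
  by_cases hex : ∃ ϖ, Ov j π ϖ
  swap
  · exact ⟨1, fun h => π.2.1.not_unit (isUnit_of_dvd_one h), fun ϖ h => absurd ⟨ϖ, h⟩ hex⟩
  obtain ⟨ϖ, ho⟩ := hex
  obtain ⟨f, hf'⟩ := rho_surj ϖ ((pl K' ϖ).tv v)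
  have dv : ∀ x, ϖ.1 ∣ x ↔ τ ϖ.1 ∣ τ x := fun x => ⟨fun h => map_dvd τ h, fun h => by simpa [V.t] using map_dvd τ h⟩
  have tp : Prime (τ ϖ.1) := (MulEquiv.prime_iff (RingEquiv.ofRingHom τ τ (RingHom.ext V.t) (RingHom.ext V.t))).2 ϖ.2.1
  obtain ⟨ϖ2, u, hu⟩ := Pr.exists_rep tp
  have d2 : ∀ x, τ ϖ.1 ∣ x ↔ ϖ2.1 ∣ x := fun x => by rw [hu, Units.mul_left_dvd]
  have ho2 : Ov τ ϖ ϖ2 := ⟨fun a => by rw [dv, d2], fun h => by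
    rw [hu, Units.dvd_mul_left, pow_two] at h
    exact ϖ2.2.1.not_unit (isUnit_of_dvd_one ((mul_dvd_mul_iff_left ϖ2.2.1.ne_zero).1 (h.trans (mul_one _).symm.dvd)))⟩
  have t2 := ho2.tv S hS hf'.symm
  rw [hv] at t2
  have main : ∀ a, ϖ.1 ∣ j a - f → ∃ a, ¬ π.1 ∣ a ∧ ∀ ϖ, Ov j π ϖ → (pl K' ϖ).tv v = rho ϖ (j a) := fun a ha => by
    have e1 : rho ϖ (j a) = rho ϖ f := by rwa [← sub_eq_zero, ← map_sub, rho_eq_zero]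
    have e2 : rho ϖ2 (j a) = rho ϖ2 (τ f) := by
      rw [← sub_eq_zero, ← map_sub, rho_eq_zero, ← d2]
      simpa [V.f] using (dv _).1 ha
    refine ⟨a, fun h => ?_, fun ϖ' h' => ?_⟩
    · rw [ho.d, ← rho_eq_zero, e1, hf'] at h; exact Pl.tv_ne _ _ h
    · obtain ⟨n, hn⟩ := ov_norm V ϖ.1
      have : ϖ'.1 ∣ ϖ.1 * τ ϖ.1 := by
        rw [← hn, ← h'.d, ho.d, hn]; exact dvd_mul_right _ _
      rcases ϖ'.2.1.dvd_mul.1 this with h | h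
      · rw [Pr.eq_of_dvd h, e1, hf']
      · rw [hu, Units.dvd_mul_left] at h
        rw [Pr.eq_of_dvd h, e2, t2]
  by_cases hin : ϖ.1 ∣ τ ϖ.1
  · have : ϖ = ϖ2 := Pr.eq_of_dvd (by rwa [hu, Units.dvd_mul_left] at hin)
    subst this
    obtain ⟨w, hw⟩ := V.two
    obtain ⟨a, ha⟩ := V.s (f + τ f) (by rw [map_add, V.t, add_comm])
    refine main (a * ↑w⁻¹) ?_
    have e : rho ϖ (j a) = rho ϖ (j 2) * rho ϖ f := by
      rw [ha, map_add, ← t2, ← hf', map_ofNat, map_ofNat, two_mul]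
    rw [← rho_eq_zero, map_sub, map_mul, map_mul, e, ← hw, mul_right_comm, ← map_mul (rho ϖ), ← map_mul j, Units.mul_inv]; simp
  · rw [← rho_eq_zero] at hin
    obtain ⟨g, hg⟩ := rho_surj ϖ (rho ϖ f / rho ϖ (τ ϖ.1))
    obtain ⟨a, ha⟩ := V.s (g * τ ϖ.1 + τ (g * τ ϖ.1)) (by rw [map_add, V.t, add_comm])
    refine main a ?_
    rw [← rho_eq_zero, ha, map_mul τ, V.t, map_sub, map_add, map_mul, map_mul, hg, (rho_eq_zero ϖ ϖ.1).2 dvd_rfl, div_mul_cancel₀ _ hin]; simp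
end inv
end ov
end Mk

namespace Mk
open Polynomial
section B
variable (L : Type) [Field L]
noncomputable def BB : Subring (Om L) where
  carrier := {x | Qd.IsLau x}
  mul_mem' := Qd.IsLau.mul
  one_mem' := by simpa using Qd.IsLau.cst (1 : L)
  add_mem' := Qd.IsLau.add
  zero_mem' := by simpa using Qd.IsLau.cst (0 : L)
  neg_mem' := fun {x} h => by simpa using (Qd.IsLau.cst (-1 : L)).mul h
instance : IsFractionRing (BB L) (Om L) := by
  haveI : FaithfulSMul (BB L) (Om L) := (faithfulSMul_iff_algebraMap_injective _ _).2 Subtype.val_injective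
  refine IsFractionRing.of_field _ _ fun z => ?_
  obtain ⟨p, q, hq, e⟩ := IsFractionRing.div_surjective (A := L[X]) z
  exact ⟨⟨_, .am p⟩, ⟨_, .am q⟩, e.symm⟩
noncomputable def jP : L[X] →+* BB L := (algebraMap L[X] (Om L)).codRestrict _ fun p => .am p
variable {L}
noncomputable def TB (n : ℕ) (p : L[X]) : BB L := ⟨algebraMap L[X] (Om L) p * (TT L)⁻¹ ^ n, (Qd.IsLau.am p).mul (Qd.IsLau.Ti.pow n)⟩
theorem TB_ex (x : BB L) : ∃ n p, x * jP L (X ^ n) = jP L p ∧ x = TB n p := by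
  obtain ⟨n, p, h⟩ := x.2
  refine ⟨n, p, Subtype.ext ?_, Subtype.ext ?_⟩
  · change (x : Om L) * algebraMap L[X] (Om L) (X ^ n) = _; rw [map_pow]; exact h
  · change (x : Om L) = algebraMap L[X] (Om L) p * _
    rw [← h, mul_assoc, ← mul_pow, mul_inv_cancel₀ TT_ne, one_pow, mul_one]
theorem jP_inj : Function.Injective (jP L) := fun p q h => IsFractionRing.injective L[X] (Om L) (congrArg Subtype.val h)
theorem jP_X (n : ℕ) : IsUnit (jP L (X ^ n)) :=
  IsUnit.of_mul_eq_one (TB n 1) (Subtype.ext (by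
    change algebraMap L[X] (Om L) (X ^ n) * (algebraMap L[X] (Om L) 1 * _) = 1
    rw [map_pow, map_one, one_mul, ← mul_pow]; change (TT L * _) ^ n = 1; rw [mul_inv_cancel₀ TT_ne, one_pow]))
instance : IsPrincipalIdealRing (BB L) := ⟨fun I => by
  obtain ⟨p, hp⟩ := (IsPrincipalIdealRing.principal (I.comap (jP L))).principal
  have hp : I.comap (jP L) = Ideal.span {p} := hp
  refine ⟨jP L p, le_antisymm (fun x hx => ?_) ?_⟩
  · obtain ⟨n, q, h, -⟩ := TB_ex x
    have : q ∈ I.comap (jP L) := by rw [Ideal.mem_comap, ← h]; exact I.mul_mem_right _ hx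
    rw [hp, Ideal.mem_span_singleton] at this
    refine Ideal.mem_span_singleton.2 (((jP_X n).dvd_mul_right).1 ?_)
    rw [h]; exact map_dvd _ this
  · refine (Ideal.span_singleton_le_iff_mem _).2 ?_
    change p ∈ I.comap (jP L)
    rw [hp]; exact Ideal.mem_span_singleton_self p⟩
theorem jP_dvd {π : L[X]} (hπ : Prime π) (h : ¬ π ∣ X) {x : BB L} {n : ℕ} {p : L[X]} (e : x * jP L (X ^ n) = jP L p) :
    jP L π ∣ x ↔ π ∣ p := by
  rw [← (jP_X n).dvd_mul_right, e]
  refine ⟨?_, fun h => map_dvd (jP L) h⟩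
  rintro ⟨c, hc⟩
  obtain ⟨m, q, h', -⟩ := TB_ex c
  have : p * X ^ m = π * q := jP_inj (by rw [map_mul, hc, mul_assoc, h', map_mul])
  have hd : π ∣ p * X ^ m := ⟨q, this⟩
  exact (hπ.dvd_mul.1 hd).resolve_right fun d => h (hπ.dvd_of_dvd_pow d)
theorem jP_ov (π : Pr L[X]) (h : ¬ π.1 ∣ X) : ∃ ϖ, Ov (jP L) π ϖ := by
  have e0 : ∀ p : L[X], jP L p * jP L (X ^ 0) = jP L p := fun p => by rw [pow_zero, map_one, mul_one]
  have hp : Prime (jP L π.1) := by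
    refine ⟨fun h0 => π.2.1.ne_zero (jP_inj (h0.trans (map_zero _).symm)), fun hu => ?_, fun x y hd => ?_⟩
    · exact π.2.1.not_unit (isUnit_of_dvd_one ((jP_dvd π.2.1 h (e0 1)).1 (hu.dvd)))
    · obtain ⟨n, p, hx, -⟩ := TB_ex x
      obtain ⟨m, q, hy, -⟩ := TB_ex y
      rw [jP_dvd π.2.1 h hx, jP_dvd π.2.1 h hy]
      refine π.2.1.dvd_mul.1 ((jP_dvd π.2.1 h (n := n + m) ?_).1 hd)
      rw [map_mul, ← hx, ← hy, pow_add, map_mul]; ring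
  obtain ⟨ϖ, u, hu⟩ := Pr.exists_rep hp
  refine ⟨ϖ, fun a => ?_, fun d => ?_⟩
  · rw [← jP_dvd π.2.1 h (e0 a), hu, Units.mul_left_dvd]
  · rw [hu, Units.dvd_mul_left, pow_two] at d
    exact ϖ.2.1.not_unit (isUnit_of_dvd_one ((mul_dvd_mul_iff_left ϖ.2.1.ne_zero).1 (d.trans (mul_one _).symm.dvd)))
theorem fin {v : K2 (Om L)} (hv : ∀ ϖ : Pr (BB L), (pl (Om L) ϖ).tv v = 1) :
    ∃ e y, e ≠ 0 ∧ v = st (TT L) (cst L e) + K2.map (cst L) y := by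
  have D : Dg (C : L →+* L[X]) natDegree := ⟨fun x y hx hy => natDegree_mul hx hy, natDegree_add_le, natDegree_neg, natDegree_zero,
    fun x h => by obtain ⟨c, hc⟩ := natDegree_eq_zero.1 h; exact ⟨c, hc⟩⟩
  have hu : ∀ u : L[X]ˣ, ∃ c, C c = (u : L[X]) := fun u => D.con _ (D.unit u)
  have H : ∀ e, 0 ≤ e → HH (R := L[X]) natDegree e := fun e _ π hπ hd u v =>
    ⟨1, u % π, v % π, one_ne_zero, by simp, by have := natDegree_mod_lt u (q := π) (by omega); omega,
      by have := natDegree_mod_lt v (q := π) (by omega); omega,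
      by rw [mul_one, EuclideanDomain.mod_eq_sub_mul_div]; simp, by rw [mul_one, EuclideanDomain.mod_eq_sub_mul_div]; simp⟩
  have h1 : ∀ π : Pr L[X], ¬ π.1 ∣ X → (pl (Om L) π).tv v = 1 := fun π h => by
    obtain ⟨ϖ, ho⟩ := jP_ov π h
    obtain ⟨a, ha⟩ := rho_surj π ((pl (Om L) π).tv v)
    have := ho.tv (K' := Om L) (RingHom.id _) (fun _ => rfl) ha.symm
    rw [K2.map_id, hv] at this
    rw [← ha, ← sub_eq_zero, ← map_one (rho π), ← map_sub, rho_eq_zero, ho.d, ← rho_eq_zero, map_sub, map_sub, ← this]; simp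
  have h2 : v ∈ MM (Om L) natDegree 0 ⊔ CC (Om L) C := layers D H fun π _ => by
    by_cases h : π.1 ∣ X
    · obtain ⟨a, ha⟩ := rho_surj π ((pl (Om L) π).tv v)
      have e : rho π a = rho π (C (a.coeff 0)) := by
        rw [← sub_eq_zero, ← map_sub, rho_eq_zero]
        exact h.trans (by rw [X_dvd_iff]; simp)
      refine ⟨a.coeff 0, fun h0 => Pl.tv_ne _ _ (ha.symm.trans (by rw [e, h0]; simp)), by rw [← ha, e]⟩
    · exact ⟨1, one_ne_zero, by rw [h1 π h]; simp⟩
  have h3 : MM (Om L) natDegree 0 ≤ CC (R := L[X]) (Om L) C := (AddSubgroup.closure_le _).2 (by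
    rintro _ ⟨f, g, hf, hg, rfl⟩
    obtain ⟨c, rfl⟩ := D.con _ (Nat.le_zero.1 hg)
    exact cc_mem _ _)
  rw [sup_eq_right.2 h3] at h2
  obtain ⟨π₀, u, hX⟩ := Pr.exists_rep (prime_X (R := L))
  obtain ⟨e, y, he, hz⟩ := cc_one hu h2 π₀ fun π hn => h1 π fun hd => hn (Pr.eq_of_dvd (by rwa [hX, Units.dvd_mul_left] at hd))
  obtain ⟨c, hc⟩ := hu u
  refine ⟨e, y - st c e, he, ?_⟩
  rw [hz, map_sub, K2.map_st, TT, hX, map_mul, st_mul_left _ (am_ne u.ne_zero) (am_ne π₀.2.1.ne_zero), ← hc]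
  change st _ (cst L e) + _ = st (cst L c) (cst L e) + st _ _ + _
  abel
end B
namespace Qd
variable {L : Type} [Field L] (Q : Qd L)
noncomputable def sB : BB L →+* BB L := (Q.s.comp (BB L).subtype).codRestrict _ fun x => IsLau.s Q x.2
noncomputable def jB : Q.A →+* BB L := Q.vl.codRestrict _ fun x => x.2
noncomputable def cB : L →+* BB L := (cst L).codRestrict _ fun c => .cst c
theorem iv : Iv Q.jB Q.sB (cB Q.r) where
  t x := Subtype.ext (Q.s_s _)
  f a := Subtype.ext (Q.vl_s a)
  s x h := ⟨Q.mkA x (congrArg Subtype.val h) x.2, rfl⟩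
  hr := (IsUnit.mk0 _ Q.hr).map _
  sr := Subtype.ext ((Q.s_c _).trans (by rw [Q.sr, map_neg]; rfl))
  two := by have := (IsUnit.mk0 _ Q.twoF).map Q.ι; rwa [map_ofNat] at this
end Qd
end Mk

namespace Mk
open scoped Quaternion
namespace Cn.LP
theorem D_eq {F K κ : Type} [Field F] [Field K] [Field κ] {a b : F} {c : Cn K a b} {p : Pl K κ} {N : ℤ} {w w' : ℍ[F,a,b]}
    (h : c.LP p N w) (h' : c.LP p N w') (z : ℍ[F,a,b]) : h.D z = h'.D z := by
  by_cases hz : w * z = z * w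
  · have hz' := h'.com.2 (h.com.1 hz)
    rw [D_in _ hz, D_in _ hz']
    congr 1
    exact mul_right_cancel₀ h.e_w0 ((h.e_mul hz _).symm.trans (h'.e_mul hz' _))
  · rw [D_out _ hz, D_out _ fun e => hz (h.com.2 (h'.com.1 e))]
end Cn.LP
theorem co_rho {R K : Type} [CommRing R] [IsDomain R] [IsPrincipalIdealRing R] [Field K] [Algebra R K] [IsFractionRing R K]
    (π : Pr R) (a : R) : (pl K π).co 0 (algebraMap R K a) = rho π a := by
  by_cases h : π.1 ∣ a
  · rw [(rho_eq_zero π a).2 h]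
    by_cases h0 : a = 0
    · simp [h0, Pl.co_zero]
    · rw [Pl.co, if_neg]; exact fun h' => (pl_pos π h0 h).ne' h'.2
  · rw [Pl.co_eq (am_ne (by rintro rfl; exact h (dvd_zero _))) (pl_unit h), pl_unit' h]
namespace Qd
variable {L : Type} [Field L] (Q : Qd L) [IsPrincipalIdealRing Q.A] (hN : Q.NN)
theorem sgl (u v : ℍ[Q.F, Q.a, Q.bF]) : ∃ κ, κ ∈ MM Q.K Q.dg 1 ∧ (Q.cn hN).qm κ = (Q.cn hN).sg u v := by
  have m : ∀ x y : ℍ[Q.F, Q.a, Q.bF], st ((Q.cn hN).ell x) ((Q.cn hN).ell y) ∈ MM Q.K Q.dg 1 := fun x y => by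
    rw [ell_lw, ell_lw]; exact mm_mem (Q.lw_deg x).1 (Q.lw_deg y).1
  exact ⟨_, add_mem (add_mem (m u v) (m v (u * v))) (m (u * v) u), by rw [map_add, map_add]; rfl⟩
variable {Q} {hN} {π : Pr Q.A} {w : ℍ[Q.F, Q.a, Q.bF]}
theorem e_rho (lp : (Q.cn hN).LP (pl Q.K π) 0 w) (x : ℍ[Q.F, Q.a, Q.bF]) : lp.e x = rho π (Q.lw x) := by
  rw [Cn.LP.e, ell_lw, co_rho]
theorem lp_com (lp : (Q.cn hN).LP (pl Q.K π) 0 w) {x : ℍ[Q.F, Q.a, Q.bF]} : w * x = x * w ↔ π.1 ∣ Q.lw x := by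
  rw [lp.com, ell_lw, co_rho, rho_eq_zero]
theorem pr_dg (π : Pr Q.A) : 1 ≤ Q.dg π.1 := Nat.one_le_iff_ne_zero.2 fun h => π.2.1.not_unit (Q.dgD.isUnit π.2.1.ne_zero h)
theorem pw_ex (h : Q.dg π.1 = 1) : ∃ w : Q.W, Q.pw w = π := by
  obtain ⟨w, hw⟩ := Q.lw_surj h.le
  have : ¬ (w.imJ = 0 ∧ w.imK = 0) := fun e => by
    have : π.1 = Q.ι (-w.imI) := by rw [hw, lw]; simp [lin, e.1, e.2]
    have h2 := Q.dg_ι (-w.imI); rw [← this] at h2; omega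
  refine ⟨⟨w, this⟩, ?_⟩
  obtain ⟨u, hu⟩ := Q.pw_spec ⟨w, this⟩
  exact Pr.eq_of_dvd (by rw [hw]; exact ⟨u, by rw [mul_comm]; exact hu⟩)
theorem lp_ex (hN : Q.NN) (h : Q.dg π.1 = 1) : ∃ w, (Q.cn hN).LP (pl Q.K π) 0 w := by
  obtain ⟨w, rfl⟩ := pw_ex h
  exact ⟨_, Q.lpw hN w⟩
theorem eps (lp : (Q.cn hN).LP (pl Q.K π) 0 w) (h : Q.dg π.1 = 1) {x : Rk π} (hx : x ≠ 0) :
    ∃ z, z ≠ 0 ∧ w * z = z * w ∧ lp.ε z = x := by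
  obtain ⟨a, ha⟩ := rho_surj π (x * lp.e lp.w0)
  obtain ⟨q, hq⟩ := Q.red π.2.1.ne_zero h a
  obtain ⟨v, hv⟩ := Q.lw_surj hq
  have ev : lp.e v = x * lp.e lp.w0 := by
    rw [e_rho, ← hv, map_sub, map_mul, (rho_eq_zero π _).2 dvd_rfl, mul_zero, sub_zero, ha]
  have hA : w * lp.w0 - lp.w0 * w ≠ 0 := sub_ne_zero.2 lp.w0_ne
  have cj : ∀ u, (w * u - u * w) * w = star w * (w * u - u * w) := fun u =>
    (Q.cn hN).conj_of_tr (by rw [QuaternionAlgebra.re_sub, re_comm, sub_self]) (by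
      rw [sub_mul, QuaternionAlgebra.re_sub, re_comm (u * w), ← mul_assoc, mul_assoc, sub_self])
  obtain ⟨z, hz⟩ : ∃ z, (w * lp.w0 - lp.w0 * w) * z = w * v - v * w :=
    ⟨((Q.cn hN).un hA)⁻¹.1 * (w * v - v * w), ((Q.cn hN).un hA).mul_inv_cancel_left _⟩
  have wz : w * z = z * w := by
    refine ((Q.cn hN).un hA).isUnit.mul_left_cancel ?_
    rw [Cn.un_val, ← mul_assoc, cj, mul_assoc, hz, ← mul_assoc, hz, cj]
  have e0 : lp.e (lp.w0 * z) = lp.e v := by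
    rw [e_rho, e_rho, ← sub_eq_zero, ← map_sub, ← lw_add, rho_eq_zero, ← lp_com lp, ← sub_eq_zero]
    rw [← sub_eq_zero] at hz
    rw [← hz]; simp only [mul_sub, sub_mul, mul_assoc, wz]; abel
  have ez : lp.ε z = x := by rw [Cn.LP.ε, e0, ev, mul_div_cancel_right₀ _ lp.e_w0]
  refine ⟨z, ?_, wz, ez⟩
  rintro rfl
  rw [Cn.LP.ε, e_rho, mul_zero] at ez
  exact hx (by rw [← ez]; simp [lw, lin])
variable (hN)
structure ND (c : ∀ π : Pr Q.A, (Rk π)ˣ) (κ : K2 Q.K) (z : ℍ[Q.F, Q.a, Q.bF]) : Prop where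
  z0 : z ≠ 0
  hi : ∀ π, 1 < Q.dg π.1 → (pl Q.K π).tv κ = c π
  lo : ∀ π w (lp : (Q.cn hN).LP (pl Q.K π) 0 w), (Q.cn hN).cl (pl Q.K π) ((pl Q.K π).tv κ) + lp.D z = (Q.cn hN).cl (pl Q.K π) (c π)
variable {hN} {c c' : ∀ π : Pr Q.A, (Rk π)ˣ} {κ κ' : K2 Q.K} {z z' : ℍ[Q.F, Q.a, Q.bF]}
theorem ND.lift (h : ND hN c κ z) (h' : ND hN c' κ' z') : ∃ κ, ND hN (c * c') κ (z * z') := by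
  obtain ⟨μ, hμ, e⟩ := Q.sgl hN z z'
  refine ⟨κ + κ' + μ, (Q.cn hN).mul_ne h.z0 h'.z0, fun π hπ => ?_, fun π w lp => ?_⟩
  · rw [Pl.tv_add, Pl.tv_add, h.hi π hπ, h'.hi π hπ, res_mm Q.dgD π hπ hμ]; simp
  · have e2 := lp.R_qm μ
    rw [e, lp.R_sg h.z0 h'.z0] at e2
    rw [Pl.tv_add, Pl.tv_add, Cn.LP.cl_mul (mul_ne_zero (Pl.tv_ne _ _) (Pl.tv_ne _ _)) (Pl.tv_ne _ _), Cn.LP.cl_mul (Pl.tv_ne _ _) (Pl.tv_ne _ _),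
      ← e2, Pi.mul_apply, Units.val_mul, Cn.LP.cl_mul (Units.ne_zero _) (Units.ne_zero _), ← h.lo π w lp, ← h'.lo π w lp]
    abel
theorem D_one (lp : (Q.cn hN).LP (pl Q.K π) 0 w) : lp.D 1 = 0 := lp.D_coe (one_ne_zero (α := Q.F))
theorem ND.tv (κ : K2 Q.K) : ND hN (fun π => ((pl Q.K π).tame κ).toMul) κ 1 :=
  ⟨one_ne_zero, fun π _ => rfl, fun π w lp => by rw [D_one, add_zero]; rfl⟩
open Classical in
theorem ND.single (h : Q.dg π.1 = 1) (x : (Rk π)ˣ) : ∃ z, ND hN (Pi.mulSingle π x) 0 z := by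
  obtain ⟨w, lp⟩ := lp_ex hN h
  obtain ⟨z, z0, wz, ez⟩ := eps lp h x.ne_zero
  refine ⟨z, z0, fun π' hπ => ?_, fun π' w' lp' => ?_⟩
  · rw [Pl.tv_zero, Pi.mulSingle_eq_of_ne (by rintro rfl; omega)]; rfl
  have c1 : ∀ π : Pr Q.A, (Q.cn hN).cl (pl Q.K π) 1 = 0 := fun π => by
    have := Cn.LP.cl_const (c := Q.cn hN) (p := pl Q.K π) (one_ne_zero (α := Q.F)); simpa using this
  rw [Pl.tv_zero, c1, zero_add]
  by_cases e : π' = π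
  · subst e
    rw [Pi.mulSingle_eq_same, ← ez, lp'.D_eq lp, lp.D_in wz]
  rw [Pi.mulSingle_eq_of_ne e, Units.val_one, c1]
  by_cases e2 : w' * z = z * w'
  swap
  · exact lp'.D_out e2
  by_cases e3 : (Q.cn hN).ell z = 0
  · obtain ⟨d, hd, rfl⟩ := lp.Dc e3 z0
    exact lp'.D_coe hd
  refine absurd ?_ e
  have h1 := (lp_com lp).1 ((Q.cn hN).comm_trans e3 wz.symm e2.symm)
  have h2 := (lp_com lp').1 rfl
  obtain ⟨q, hq⟩ := h1
  have h3 : Q.lw w' ≠ 0 := fun h0 => lp'.hw (by rw [ell_lw, h0, map_zero])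
  have q0 : q ≠ 0 := by rintro rfl; exact h3 (by rw [hq, mul_zero])
  have h4 := (Q.lw_deg w').1
  rw [hq, Q.dgD.mul _ _ π.2.1.ne_zero q0, h] at h4
  rw [hq] at h2
  exact Pr.eq_of_dvd ((Units.dvd_mul_right (u := (Q.dgD.isUnit q0 (by omega)).unit)).1 h2)
open Classical in
theorem ND.ex (hN : Q.NN) (n : ℕ) : ∀ (T : Finset (Pr Q.A)) (c : ∀ π : Pr Q.A, (Rk π)ˣ), (∀ π, c π ≠ 1 → π ∈ T ∧ Q.dg π.1 ≤ n) → ∃ κ z, ND hN c κ z := by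
  have triv : ∀ c : ∀ π : Pr Q.A, (Rk π)ˣ, (∀ π, c π = 1) → ∃ κ z, ND hN c κ z := fun c hc =>
    ⟨0, 1, one_ne_zero, fun π _ => by rw [Pl.tv_zero, hc]; rfl, fun π w lp => by rw [Pl.tv_zero, hc, D_one, add_zero]; rfl⟩
  induction n with
  | zero =>
    refine fun T c h => triv c fun π => ?_
    by_contra e; have := (h π e).2; have := pr_dg π; omega
  | succ n ih =>
    intro T
    induction T using Finset.induction_on with
    | empty => exact fun c h => triv c fun π => by by_contra e; simpa using (h π e).1
    | insert π T hT ihT =>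
      intro c h
      obtain ⟨κ, z, h1⟩ := ihT (Function.update c π 1) (fun π' h' => by
        by_cases e : π' = π
        · subst e; simp at h'
        · rw [Function.update_of_ne e] at h'
          have := h π' h'
          exact ⟨(Finset.mem_insert.1 this.1).resolve_left e, this.2⟩)
      have e1 : Function.update c π 1 * Pi.mulSingle π (c π) = c := by
        funext π'
        by_cases e : π' = π
        · subst e; simp
        · simp [Function.update_of_ne e, Pi.mulSingle_eq_of_ne e]
      suffices ∃ κ z, ND hN (Pi.mulSingle π (c π)) κ z by
        obtain ⟨κ', z', h2⟩ := this
        obtain ⟨κ'', h3⟩ := h1.lift h2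
        rw [e1] at h3
        exact ⟨_, _, h3⟩
      by_cases c1 : c π = 1
      · rw [c1, Pi.mulSingle_one]; exact triv _ fun _ => rfl
      rcases (pr_dg π).eq_or_lt with e | e
      · exact ⟨0, ND.single e.symm _⟩
      obtain ⟨m, hm⟩ : ∃ m, Q.dg π.1 = m + 1 + 1 := ⟨Q.dg π.1 - 2, by omega⟩
      obtain ⟨f, g, g', f0, g0, -, fd, gd, -, eg, -⟩ := (Q.hh (e := m + 1) (by omega)).rep Q.dgD hm (c π) 1
      have nf := Q.dgD.not_dvd f0 (show Q.dg f < Q.dg π.1 by omega)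
      have ng := Q.dgD.not_dvd g0 (show Q.dg g < Q.dg π.1 by omega)
      let μ : K2 Q.K := st (algebraMap Q.A Q.K π.1) (algebraMap Q.A Q.K g) - st (algebraMap Q.A Q.K π.1) (algebraMap Q.A Q.K f)
      have hμ : (pl Q.K π).tv μ = c π := by
        rw [Pl.tv_sub, tv_self ng, tv_self nf, eg, mul_div_cancel_right₀]; rwa [ne_eq, rho_eq_zero]
      obtain ⟨κ', z', h2⟩ := ih ((tv_fin (R := Q.A) μ).toFinset) (fun π' => (Pi.mulSingle π (c π) : ∀ π : Pr Q.A, (Rk π)ˣ) π' / ((pl Q.K π').tame μ).toMul) (fun π' h' => by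
        by_cases e' : π' = π
        · subst e'; rw [Pi.mulSingle_eq_same, ne_eq, div_eq_one, eq_comm] at h'; exact absurd (Units.ext hμ) h'
        rw [Pi.mulSingle_eq_of_ne e', ne_eq, one_div, inv_eq_one] at h'
        have h'' : (pl Q.K π').tv μ ≠ 1 := fun e => h' (Units.ext e)
        refine ⟨by simpa using h'', ?_⟩
        by_contra hc
        have := (h π c1).2
        refine h'' ?_
        have hp : ¬ π'.1 ∣ π.1 := fun hd => e' (Pr.eq_of_dvd hd)
        rw [Pl.tv_sub, tv_units hp (Q.dgD.not_dvd g0 (by omega)), tv_units hp (Q.dgD.not_dvd f0 (by omega)), div_one])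
      obtain ⟨κ'', h3⟩ := (ND.tv μ).lift h2
      refine ⟨κ'', 1 * z', ?_⟩
      convert h3 using 1
      funext π'; exact (mul_div_cancel _ _).symm
theorem ND.norm (h : ND hN c κ z) {x y : Q.F} (e : nq z = x ^ 2 - Q.a * y ^ 2) : ∃ κ', ND hN c κ' 1 := by
  have n0 := (Q.cn hN).nq_ne h.z0
  let u : ℍ[Q.F, Q.a, Q.bF] := ⟨x, y, 0, 0⟩
  have nu : nq u = nq z := by rw [e]; simp [nq, u]
  have u0 : u ≠ 0 := Cn.ne_nq (nu ▸ n0)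
  have uD : ∀ (π : Pr Q.A) w (lp : (Q.cn hN).LP (pl Q.K π) 0 w), lp.D u = 0 := fun π w lp => by
    by_cases hw : w * u = u * w
    swap
    · exact lp.D_out hw
    by_cases hu : (Q.cn hN).ell u = 0
    · obtain ⟨d, hd, e⟩ := lp.Dc hu u0
      rw [e]; exact lp.D_coe hd
    have := (lp_com lp).1 hw
    have e2 : Q.lw u = Q.ι (-y) := by rw [lw]; simp [lin, u]
    rw [e2] at this
    exact absurd this (not_dvd_const _ fun e3 => hu (by rw [ell_lw, e2, e3]; simp))
  obtain ⟨z1, hz⟩ : ∃ z1, u * z1 = z := ⟨((Q.cn hN).un u0)⁻¹.1 * z, ((Q.cn hN).un u0).mul_inv_cancel_left _⟩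
  have n1 : nq z1 = 1 := by
    have := nq_mul u z1; rw [hz, nu] at this
    exact mul_left_cancel₀ n0 (this.symm.trans (mul_one _).symm)
  have z10 : z1 ≠ 0 := Cn.ne_nq (by rw [n1]; exact one_ne_zero)
  obtain ⟨ν, hν, hD⟩ : ∃ ν ∈ MM Q.K Q.dg 1, ∀ (π : Pr Q.A) w (lp : (Q.cn hN).LP (pl Q.K π) 0 w), lp.D z1 = (Q.cn hN).cl (pl Q.K π) ((pl Q.K π).tv ν) := by
    by_cases p0 : 1 + z1 = 0
    · refine ⟨0, zero_mem _, fun π w lp => ?_⟩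
      have : z1 = ((-1 : Q.F) : ℍ[Q.F, Q.a, Q.bF]) := by
        rw [← neg_eq_of_add_eq_zero_right p0]; ext <;> simp
      rw [this, lp.D_coe (by simp), ← lp.R_qm, map_zero, map_zero]
    obtain ⟨v, v0, v1, v2, -⟩ := Cn.exists_v (1 + z1) 0
    have hv := (Q.cn hN).conj_of_tr v1 v2
    have e1 : z1 * star (1 + z1) = 1 + z1 := by
      rw [star_add, mul_add, mul_star_nq, n1, star_one, mul_one, add_comm]; rfl
    have s0 : star (1 + z1) ≠ 0 := star_ne_zero.2 p0
    obtain ⟨a, ha, ea⟩ := Q.sgl hN z1 (star (1 + z1))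
    obtain ⟨b, hb, eb⟩ := Q.sgl hN v (1 + z1)
    obtain ⟨d, hd, ed⟩ := Q.sgl hN (star (1 + z1)) v
    refine ⟨a + b - d, sub_mem (add_mem ha hb) hd, fun π w lp => ?_⟩
    rw [← lp.R_qm, map_sub, map_add, ea, eb, ed, map_sub, map_add, lp.R_sg z10 s0, lp.R_sg v0 p0, lp.R_sg s0 v0, e1, hv]
    abel
  obtain ⟨μ, hμ, e3⟩ := Q.sgl hN u z1
  refine ⟨κ + ν - μ, one_ne_zero, fun π hπ => ?_, fun π w lp => ?_⟩
  · rw [Pl.tv_sub, Pl.tv_add, res_mm Q.dgD π hπ hμ, res_mm Q.dgD π hπ hν, h.hi π hπ]; simp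
  · have e4 := lp.R_sg u0 z10
    rw [← h.lo π w lp, ← lp.R_qm, ← lp.R_qm, map_sub, map_add, map_sub, map_add, e3, e4, hz, uD π w lp, D_one, lp.R_qm ν, ← hD π w lp]
    abel
open Classical in
theorem ND.fin (h : ND hN c κ z) (hc : {π | c π ≠ 1}.Finite) : ∃ κ', (∀ π, (Q.lw z = 0 ∨ ¬ π.1 ∣ Q.lw z) → (pl Q.K π).tv κ' = c π) ∧
    (Q.lw z ≠ 0 → ∀ π, π.1 ∣ Q.lw z → ∀ x, rho π (Q.lw (x * z)) * (pl Q.K π).tv κ' = c π * rho π (Q.lw x)) := by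
  let S : Set (Pr Q.A) := {π | c π ≠ 1} ∪ {π | (pl Q.K π).tv κ ≠ 1} ∪ {π | Q.lw z ≠ 0 ∧ π.1 ∣ Q.lw z}
  have hS : S.Finite := (hc.union (tv_fin κ)).union (by
    by_cases h : Q.lw z = 0
    · simp [h]
    · exact (dvd_fin h).subset fun π h => h.2)
  have key : ∀ π, ∃ d : Q.Fˣ, (π ∉ S → d = 1) ∧ ((Q.lw z = 0 ∨ ¬ π.1 ∣ Q.lw z) → (pl Q.K π).tv κ * rho π (Q.ι d) = c π) ∧
      (Q.lw z ≠ 0 → π.1 ∣ Q.lw z → ∀ x, rho π (Q.lw (x * z)) * ((pl Q.K π).tv κ * rho π (Q.ι d)) = c π * rho π (Q.lw x)) := by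
    intro π
    by_cases hπ : π ∈ S
    swap
    · simp only [S, Set.mem_union, Set.mem_setOf_eq, not_or, not_not, not_and] at hπ
      exact ⟨1, fun _ => rfl, fun _ => by rw [hπ.1.1, hπ.1.2]; simp, fun h h' => absurd h' (hπ.2 h)⟩
    rcases (pr_dg π).eq_or_lt with e | e
    swap
    · refine ⟨1, fun h => absurd hπ h, fun _ => by rw [h.hi π e]; simp, fun h0 h1 => ?_⟩
      exact absurd h1 (Q.dgD.not_dvd h0 ((Q.lw_deg z).1.trans_lt e))
    obtain ⟨w, lp⟩ := lp_ex hN e.symm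
    have hl := h.lo π w lp
    have fn : ∀ t : Rk π, t ≠ 0 → (Q.cn hN).cl (pl Q.K π) t = (Q.cn hN).cl (pl Q.K π) (c π) → ∃ d : Q.Fˣ, t * rho π (Q.ι d) = c π := fun t ht et => by
      have : (Q.cn hN).cl (pl Q.K π) (c π * t⁻¹) = 0 := by
        rw [Cn.LP.cl_mul (Units.ne_zero _) (inv_ne_zero ht), Cn.LP.cl_inv, et, add_neg_cancel]
      obtain ⟨d, hd, e⟩ := (Cn.LP.cl_eq_zero (mul_ne_zero (Units.ne_zero _) (inv_ne_zero ht))).1 this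
      refine ⟨Units.mk0 d hd, ?_⟩
      have e2 : (pl Q.K π).lc ((Q.cn hN).ι d) = rho π (Q.ι d) := pl_unit' (not_dvd_const _ hd)
      rw [Units.val_mk0, ← e2, ← e, mul_comm (c π : Rk π), mul_inv_cancel_left₀ ht]
    by_cases h0 : Q.lw z = 0 ∨ ¬ π.1 ∣ Q.lw z
    · have : lp.D z = 0 := by
        rcases h0 with h0 | h0
        · obtain ⟨d, hd, e⟩ := lp.Dc (by rw [ell_lw, h0, map_zero]) h.z0
          rw [e]; exact lp.D_coe hd
        · exact lp.D_out fun e => h0 ((lp_com lp).1 e)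
      rw [this, add_zero] at hl
      obtain ⟨d, hd⟩ := fn _ (Pl.tv_ne _ _) hl
      exact ⟨d, fun h => absurd hπ h, fun _ => hd, fun h1 h2 => (h0.elim h1 fun h => h h2).elim⟩
    · push Not at h0
      have wz := (lp_com lp).2 h0.2
      rw [lp.D_in wz, ← Cn.LP.cl_mul (Pl.tv_ne _ _) (lp.ε_ne wz h.z0)] at hl
      obtain ⟨d, hd⟩ := fn _ (mul_ne_zero (Pl.tv_ne _ _) (lp.ε_ne wz h.z0)) hl
      refine ⟨d, fun h => absurd hπ h, fun h => (h.elim h0.1 fun h => h h0.2).elim, fun _ _ x => ?_⟩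
      rw [← hd, ← e_rho lp, ← e_rho lp, lp.e_mul wz]; ring
  choose d d1 d2 d3 using key
  refine ⟨κ + ThC Q.K Q.ι (DFinsupp.mk hS.toFinset fun π => Additive.ofMul (d π)), ?_⟩
  have ht : ∀ π, (pl Q.K π).tv (κ + ThC Q.K Q.ι (DFinsupp.mk hS.toFinset fun π => Additive.ofMul (d π))) = (pl Q.K π).tv κ * rho π (Q.ι (d π)) := fun π => by
    rw [Pl.tv_add, tv_ThC]
    congr 3
    by_cases hπ : π ∈ S
    · erw [DFinsupp.mk_apply]; rw [dif_pos (by simpa using hπ)]; rfl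
    · erw [DFinsupp.mk_apply]; rw [dif_neg (by simpa using hπ), d1 π hπ]; rfl
  exact ⟨fun π h => by rw [ht]; exact d2 π h, fun h0 π h x => by rw [ht]; exact d3 π h0 h x⟩
end Qd
end Mk

namespace Mk
open scoped Quaternion
open Polynomial
namespace Qd
variable {L : Type} [Field L] (Q : Qd L)
theorem vl_lw (z : ℍ[Q.F, Q.a, Q.bF]) : Q.vl (Q.lw z) = cst L (-z.imI) + cst L (-z.imK) * (cst L 2⁻¹ * (TT L + cst L Q.b / TT L)) +
    cst L z.imJ * (cst L (2⁻¹ * Q.r⁻¹) * (TT L - cst L Q.b / TT L)) := by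
  rw [lw, lin, ← vl_y, ← vl_t]
  simp [vl_ι]
theorem v3 {z : ℍ[Q.F, Q.a, Q.bF]} (hz : ¬(z.imJ = 0 ∧ z.imK = 0)) (n0 : nq z ≠ 0) : ∃ v : K2 (Om L),
    (∀ ϖ : Pr (BB L), ¬ ϖ.1 ∣ Q.jB (Q.lw z) → (pl (Om L) ϖ).tv v = 1) ∧
    (∀ ϖ : Pr (BB L), ϖ.1 ∣ Q.jB (Q.lw z) → ¬ ϖ.1 ^ 2 ∣ Q.jB (Q.lw z) →
      (pl (Om L) ϖ).tv v = - rho ϖ (Q.jB (Q.lw ((⟨0, 1, 0, 0⟩ : ℍ[Q.F, Q.a, Q.bF]) * z)))) ∧ pl0.tv v = 1 ∧ inf.tv v = ((nq z : Q.F) : L)⁻¹ := by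
  obtain ⟨X0, hX0⟩ : ∃ x : L, x = z.re + z.imI * Q.r := ⟨_, rfl⟩
  obtain ⟨Y0, hY0⟩ : ∃ x : L, x = z.imJ + z.imK * Q.r := ⟨_, rfl⟩
  obtain ⟨X1, hX1⟩ : ∃ x : L, x = z.re - z.imI * Q.r := ⟨_, rfl⟩
  obtain ⟨Y1, hY1⟩ : ∃ x : L, x = z.imJ - z.imK * Q.r := ⟨_, rfl⟩
  obtain ⟨N, hN⟩ : ∃ x : L, x = ((nq z : Q.F) : L) := ⟨_, rfl⟩
  have hr := Q.hr
  have h2 := Q.two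
  have hb := Q.hb
  have y0 : Y0 ≠ 0 := fun h => hz (Q.rep0 (hY0 ▸ h))
  have y1 : Y1 ≠ 0 := fun h => hz (by
    have := Q.rep0 (x := z.imJ) (y := -z.imK) (by push_cast; rw [hY1] at h; linear_combination h)
    exact ⟨this.1, neg_eq_zero.1 this.2⟩)
  have nN : N = X0 * X1 - Q.b * Y0 * Y1 := by
    rw [hN, nq, hX0, hX1, hY0, hY1]; push_cast
    have e1 : (Q.a : L) = Q.r ^ 2 := rfl
    have e2 : (Q.bF : L) = Q.b := rfl
    rw [e1, e2]; ring
  have n1 : N ≠ 0 := by rw [hN]; simpa using n0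
  rw [← hN]
  let G : L[X] := C Y1 * X + C X1
  let A : L := Y1 * Y1 * N⁻¹
  let D : L := 1 - X0 * X1 * N⁻¹
  let P : L[X] := C A * X ^ 2 + C (Y1 * (X1 - X0) * N⁻¹) * X + C D
  have hP : P = 1 + G * (C (Y1 * N⁻¹) * X - C (X0 * N⁻¹)) := by
    simp only [P, G, A, D, C_mul, C_sub, C_1]; ring
  have hD : D = - (Q.b * Y0 * Y1) * N⁻¹ := by
    have : X0 * X1 = N + Q.b * Y0 * Y1 := by rw [nN]; ring
    simp only [D]; rw [this]; field_simp; ring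
  have D0 : D ≠ 0 := by rw [hD]; simp [hb, y0, y1, n1]
  have A0 : A ≠ 0 := by simp [A, y1, n1]
  have G0 : G ≠ 0 := fun h => by have := congrArg (coeff · 1) h; simp [G, y1] at this
  have P0 : P ≠ 0 := fun h => by have := congrArg (coeff · 0) h; simp [P, D0] at this
  have aP := am_ne (K := Om L) P0
  have aG := am_ne (K := Om L) G0
  have aP' : algebraMap (BB L) (Om L) (jP L P) ≠ 0 := aP
  have aG' : algebraMap (BB L) (Om L) (jP L G) ≠ 0 := aG
  have T0 := TT_ne (L := L)
  have c2 : (2 : Om L) ≠ 0 := by have := cst_ne h2; rwa [map_ofNat] at this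
  have cr := cst_ne hr
  have cN := cst_ne n1
  have hC : ∀ c, algebraMap L[X] (Om L) (C c) = cst L c := fun _ => rfl
  have hX : algebraMap L[X] (Om L) X = TT L := rfl
  have e1 : jP L P = jP L (C (2 * Q.r * Y1 * N⁻¹) * X) * Q.jB (Q.lw z) := by
    apply Subtype.ext
    change algebraMap L[X] (Om L) P = algebraMap L[X] (Om L) _ * Q.vl (Q.lw z)
    rw [vl_lw]
    simp only [P, hD, A, map_add, map_mul, map_pow, hC, hX]
    generalize cst L = f, TT L = t at *
    simp only [hY0, hX0, hX1, map_sub, map_add, map_mul, map_inv₀, map_neg, map_ofNat]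
    have gY : f Y1 = f z.imJ - f z.imK * f Q.r := by rw [hY1, map_sub, map_mul]
    simp only [gY]
    field_simp
    ring
  have uu : IsUnit (jP L (C (2 * Q.r * Y1 * N⁻¹) * X)) := by
    rw [map_mul]
    refine IsUnit.mul (IsUnit.map (jP L) (isUnit_C.2 (isUnit_iff_ne_zero.2 (by simp [h2, hr, y1, n1])))) (by simpa using jP_X (L := L) 1)
  have e2 : Q.jB (Q.lw ((⟨0, 1, 0, 0⟩ : ℍ[Q.F, Q.a, Q.bF]) * z)) = cB Q.r * Q.jB (Q.lw z) - jP L G := by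
    apply Subtype.ext
    change Q.vl (Q.lw _) = cst L Q.r * Q.vl (Q.lw z) - algebraMap L[X] (Om L) G
    rw [vl_lw, vl_lw]
    simp only [G, hX1, map_add, map_mul, hC, hX]
    have e1 : cst L (Q.a : L) = cst L Q.r ^ 2 := by rw [← map_pow]; rfl
    have e2 : cst L 2 = 2 := map_ofNat _ 2
    simp [hY1, e1, e2]
    field_simp
    ring
  refine ⟨st (algebraMap (BB L) (Om L) (jP L P)) (algebraMap (BB L) (Om L) (jP L G)), fun ϖ h => ?_, fun ϖ h h' => ?_, ?_, ?_⟩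
  · have hp : ¬ ϖ.1 ∣ jP L P := by rwa [e1, uu.dvd_mul_left]
    by_cases hg : ϖ.1 ∣ jP L G
    · have : rho ϖ (jP L P) = 1 := by
        rw [hP, map_add (jP L), map_add (rho ϖ), map_mul (jP L), map_mul (rho ϖ), (rho_eq_zero ϖ _).2 hg]
        simp
      rw [Pl.tv_st _ aP' aG', pl_unit hp, pl_unit' hp, this]
      simp
    · exact tv_units hp hg
  · have hp : ϖ.1 ∣ jP L P := by rwa [e1, uu.dvd_mul_left]
    have hp2 : ¬ ϖ.1 ^ 2 ∣ jP L P := by rwa [e1, uu.dvd_mul_left]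
    obtain ⟨q, hq⟩ := hp
    have hg : ¬ ϖ.1 ∣ jP L G := fun hg => ϖ.2.1.not_unit (isUnit_of_dvd_one (by
      have : jP L P - jP L G * jP L (C (Y1 * N⁻¹) * X - C (X0 * N⁻¹)) = 1 := by
        rw [hP, map_add, map_mul, map_one, add_sub_cancel_right]
      rw [← this]; exact dvd_sub ⟨q, hq⟩ (hg.mul_right _)))
    have hv := pl_pow (K := Om L) 1 (fun h : ϖ.1 ∣ q => hp2 (by rw [hq, pow_two]; exact mul_dvd_mul_left _ h))
    rw [pow_one, ← hq] at hv
    rw [Pl.tv_st _ aP' aG', hv.1, pl_unit hg, pl_unit' hg, e2, map_sub, map_mul, (rho_eq_zero ϖ _).2 h]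
    simp
  · change pl0.tv (st (algebraMap L[X] (Om L) P) (algebraMap L[X] (Om L) G)) = 1
    have cP : P.coeff 0 = D := by simp [P]
    have hp := pl0_spec (q := P) 0 (by rwa [cP])
    rw [pow_zero, one_mul, cP] at hp
    by_cases x1 : X1 = 0
    · rw [Pl.tv_st _ aP aG, hp.1, hp.2]; simp [D, x1]
    · have hg := pl0_spec (q := G) 0 (by simpa [G])
      rw [pow_zero, one_mul] at hg
      exact Pl.tv_unit _ hp.1 hg.1
  · change inf.tv (st (algebraMap L[X] (Om L) P) (algebraMap L[X] (Om L) G)) = N⁻¹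
    rw [Pl.tv_st _ aP aG, inf_am P0, inf_am G0, inf_lc, inf_lc]
    rw [natDegree_quadratic A0, leadingCoeff_quadratic A0, natDegree_linear y1, leadingCoeff_linear y1]
    have : (((-1 : L)) ^ (-((2 : ℕ) : ℤ) * -((1 : ℕ) : ℤ))) = 1 := by norm_num
    rw [this]
    simp only [A]; simp; field_simp
theorem h90 {e : L} (h : e * Q.σ e = 1) : ∃ z, z ≠ 0 ∧ e * Q.σ z = z := by
  by_cases h1 : 1 + e = 0
  · exact ⟨Q.r, Q.hr, by rw [Q.sr, eq_neg_of_add_eq_zero_right h1]; ring⟩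
  · exact ⟨1 + e, h1, by rw [map_add, map_one]; linear_combination h⟩
theorem cst_sp (u : K2 L) : inf.sp (K2.map (cst L) u) = u := by
  suffices inf.sp.comp (K2.map (cst L)) = AddMonoidHom.id _ from DFunLike.congr_fun this u
  refine K2.hom_ext fun x y _ _ => ?_
  rw [AddMonoidHom.comp_apply, K2.map_st, Pl.sp_st, inf_clc, inf_clc]; rfl
theorem inf_cst (u : K2 L) : inf.tv (K2.map (cst L) u) = 1 := by
  induction u using K2.ind with
  | h0 => simp [Pl.tv_zero]
  | h1 x y hx hy => rw [K2.map_st]; exact Pl.tv_unit _ (inf_c hx) (inf_c hy)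
  | hn x h => rw [map_neg, Pl.tv_neg, h, inv_one]
  | ha x y h h' => rw [map_add, Pl.tv_add, h, h', one_mul]
theorem s_cst (u : K2 L) : K2.map Q.s (K2.map (cst L) u) = K2.map (cst L) (K2.map Q.σ u) := by
  rw [K2.map_map, K2.map_map]; congr 2; ext c; exact Q.s_c c
theorem s_K (κ : K2 Q.K) : K2.map Q.s (K2.map Q.K.subtype κ) = K2.map Q.K.subtype κ := by
  rw [K2.map_map]; congr 2; ext c; exact Q.K_fix c
theorem desc (hN : Q.NN) {u : K2 L} {v : K2 (Om L)} (h : K2.map (cst L) u = v - K2.map Q.s v) : ∃ w, u = w - K2.map Q.σ w := by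
  haveI := Q.pid hN
  have hcB : (algebraMap (BB L) (Om L)).comp cB = cst L := rfl
  have key : ∀ π : Pr Q.A, ∃ a : Q.A, ¬ π.1 ∣ a ∧ (∀ ϖ, Ov Q.jB π ϖ → (pl (Om L) ϖ).tv v = rho ϖ (Q.jB a)) ∧
      ((∀ ϖ, Ov Q.jB π ϖ → (pl (Om L) ϖ).tv v = 1) → a = 1) := fun π => by
    by_cases h1 : ∀ ϖ, Ov Q.jB π ϖ → (pl (Om L) ϖ).tv v = 1
    · exact ⟨1, fun h => π.2.1.not_unit (isUnit_of_dvd_one h), fun ϖ hϖ => by rw [h1 ϖ hϖ]; simp, fun _ => rfl⟩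
    · obtain ⟨a, ha, hb⟩ := ov_res Q.iv Q.s (fun a => rfl) (v := v) (fun ϖ => by
        have := tv_map_const (K := Om L) (ι := cB) ϖ u
        rw [hcB, h, Pl.tv_sub, div_eq_one_iff_eq (Pl.tv_ne _ _)] at this
        exact this.symm) π
      exact ⟨a, ha, hb, fun h => absurd h h1⟩
  choose a ha using key
  let c : ∀ π : Pr Q.A, (Rk π)ˣ := fun π => Units.mk0 (rho π (a π)) (by rw [ne_eq, rho_eq_zero]; exact (ha π).1)
  choose p hp using ov_ex Q.iv
  have pu : ∀ π ϖ, Ov Q.jB π ϖ → p ϖ = π := fun π ϖ o => Pr.eq_of_dvd (((hp ϖ).d _).2 ((o.d _).1 dvd_rfl))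
  have hc : {π | c π ≠ 1}.Finite := by
    refine ((tv_fin (R := BB L) v).image p).subset fun π hπ => ?_
    by_contra hn
    refine hπ (Units.ext ?_)
    rw [Units.val_mk0, (ha π).2.2 fun ϖ o => ?_, map_one, Units.val_one]
    by_contra h'
    exact hn ⟨ϖ, h', pu π ϖ o⟩
  have v2 : ∀ {ϖ κ} {b : Q.A}, (pl Q.K (p ϖ)).tv κ = rho (p ϖ) b →
      (pl (Om L) ϖ).tv (v - K2.map Q.K.subtype κ) = rho ϖ (Q.jB (a (p ϖ))) / rho ϖ (Q.jB b) := fun {ϖ κ b} e => by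
    rw [Pl.tv_sub, (hp ϖ).tv (K' := Om L) Q.K.subtype (fun _ => rfl) e, (ha _).2.1 ϖ (hp ϖ)]
  have jn : ∀ ϖ, rho ϖ (Q.jB (a (p ϖ))) ≠ 0 := fun ϖ h => (ha (p ϖ)).1 (((hp ϖ).d _).2 ((rho_eq_zero _ _).1 h))
  have v2' : ∀ {ϖ κ}, (pl Q.K (p ϖ)).tv κ = c (p ϖ) → (pl (Om L) ϖ).tv (v - K2.map Q.K.subtype κ) = 1 := fun {ϖ κ} e => by
    rw [v2 (b := a (p ϖ)) (by rw [e]; rfl), div_self (jn ϖ)]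
  have hfix : ∀ κ, K2.map (cst L) u = (v - K2.map Q.K.subtype κ) - K2.map Q.s (v - K2.map Q.K.subtype κ) := fun κ => by
    rw [h, map_sub, s_K]; abel
  have main : ∀ κ : K2 Q.K, (∀ π, (pl Q.K π).tv κ = c π) → ∃ w, u = w - K2.map Q.σ w := fun κ hκ => by
    obtain ⟨e, y, e0, hy⟩ := fin (v := v - K2.map Q.K.subtype κ) fun ϖ => v2' (hκ _)
    have se : Q.σ e ≠ 0 := by simpa using e0
    have h1 := hfix κ
    rw [hy, map_add, s_cst, K2.map_st, s_T, s_c, st_div_left _ (cst_ne Q.hb) TT_ne] at h1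
    have h2 : K2.map (cst L) u = st (TT L) (cst L (e * Q.σ e)) + K2.map (cst L) (y - K2.map Q.σ y - st Q.b (Q.σ e)) := by
      rw [h1, map_mul, st_mul_right _ (cst_ne e0) (cst_ne se), map_sub, map_sub, K2.map_st]; abel
    have h3 := congrArg inf.tv h2
    rw [inf_cst, Pl.tv_add, inf_cst, Pl.tv_st _ TT_ne (cst_ne (mul_ne_zero e0 se)), inf_T, inf_Tlc, inf_c (mul_ne_zero e0 se), inf_clc] at h3
    have h4 : e * Q.σ e = 1 := by
      simp at h3
      field_simp at h3
      linear_combination h3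
    rw [h4, map_one, st_one_right, zero_add] at h2
    have h5 := congrArg inf.sp h2
    rw [cst_sp, cst_sp] at h5
    obtain ⟨z, z0, hz⟩ := Q.h90 h4
    have h6 : Q.σ e = Q.σ z / z := by
      have := congrArg Q.σ hz
      rw [map_mul, Q.ss] at this
      rw [← this, mul_div_cancel_right₀ _ z0]
    refine ⟨y + st Q.b z, ?_⟩
    rw [h5, h6, st_div_right _ (by simpa using z0) z0, map_add, K2.map_st, Q.sb]; abel
  obtain ⟨n, hn⟩ : ∃ n, ∀ π, c π ≠ 1 → π ∈ hc.toFinset ∧ Q.dg π.1 ≤ n := by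
    refine ⟨hc.toFinset.sup fun π => Q.dg π.1, fun π hπ => ?_⟩
    have : π ∈ hc.toFinset := by simpa using hπ
    exact ⟨this, Finset.le_sup (f := fun π : Pr Q.A => Q.dg π.1) this⟩
  obtain ⟨κ, z, nd⟩ := ND.ex hN n _ c hn
  obtain ⟨κ', k1, k2⟩ := nd.fin hc
  by_cases hz : z.imJ = 0 ∧ z.imK = 0
  · refine main κ' fun π => k1 π ?_
    have e2 : Q.lw z = Q.ι (-z.imI) := by rw [lw]; simp [lin, hz.1, hz.2]
    rw [e2]
    by_cases e : z.imI = 0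
    · left; simp [e]
    · exact .inr (not_dvd_const _ (by simpa using e))
  have n0 := (Q.cn hN).nq_ne nd.z0
  have l0 := Q.lw_ne ⟨z, hz⟩
  obtain ⟨w3, w1, w2, w4, w5⟩ := Q.v3 hz n0
  obtain ⟨e, y, e0, hy⟩ := fin (v := v - K2.map Q.K.subtype κ' - w3) fun ϖ => by
    rw [Pl.tv_sub]
    by_cases hd : ϖ.1 ∣ Q.jB (Q.lw z)
    · have hd' := ((hp ϖ).d _).2 hd
      obtain ⟨b, hb⟩ := rho_surj (p ϖ) ((pl Q.K (p ϖ)).tv κ')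
      have k3 := k2 l0 _ hd' ⟨0, 1, 0, 0⟩
      have li : Q.lw ⟨0, 1, 0, 0⟩ = -1 := by rw [lw]; simp [lin]
      rw [← hb, li, map_neg, map_one, Units.val_mk0, ← map_mul (rho (p ϖ)), mul_neg_one] at k3
      have k4 := congrArg (hp ϖ).m k3
      rw [map_neg, Ov.m_rho, Ov.m_rho, map_mul Q.jB, map_mul (rho ϖ)] at k4
      have hd2 : ¬ ϖ.1 ^ 2 ∣ Q.jB (Q.lw z) := fun h2 => by
        obtain ⟨q, hq⟩ := hd'
        have q0 : q ≠ 0 := by rintro rfl; exact l0 (by rw [hq, mul_zero])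
        have h4 := (Q.lw_deg z).1
        have := pr_dg (p ϖ)
        rw [hq, Q.dgD.mul _ _ (p ϖ).2.1.ne_zero q0] at h4
        rw [hq, map_mul, ((Q.dgD.isUnit q0 (by omega)).map Q.jB).dvd_mul_right] at h2
        exact (hp ϖ).sq h2
      rw [v2 hb.symm, w2 ϖ hd hd2]
      have b0 : rho ϖ (Q.jB b) ≠ 0 := fun h => jn ϖ (by rw [h, mul_zero] at k4; simpa using k4.symm)
      have := jn ϖ
      rw [eq_neg_iff_add_eq_zero] at k4
      have g0 : rho ϖ (Q.jB (Q.lw ((⟨0, 1, 0, 0⟩ : ℍ[Q.F, Q.a, Q.bF]) * z))) ≠ 0 := fun h => jn ϖ (by rw [h] at k4; simpa using k4)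
      rw [div_div, div_eq_one_iff_eq (mul_ne_zero b0 (neg_ne_zero.2 g0))]
      linear_combination k4
    · rw [v2' (k1 _ (.inr fun h => hd (((hp ϖ).d _).1 h))), w1 ϖ hd, div_one]
  rw [sub_eq_iff_eq_add] at hy
  have t1 := congrArg inf.tv (hfix κ')
  rw [inf_cst, Pl.tv_sub, Pl.tame_compat pl0 inf Q.s Q.σ Q.b Q.hb (fun x hx => (Q.s_place hx).1) (fun x hx => (Q.s_place hx).2)] at t1
  have t2 : pl0.tv (v - K2.map Q.K.subtype κ') = e := by
    have c0 : ∀ {c : L}, c ≠ 0 → pl0.v (cst L c) = 0 ∧ pl0.lc (cst L c) = c := fun {c} hc => by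
      have := pl0_spec (q := C c) 0 (by simpa)
      simpa [cst] using this
    have cT : pl0.v (TT L) = 1 := by
      have := (pl0_spec (q := (1 : L[X])) 1 (by simp)).1
      simpa [TT] using this
    have cy : ∀ y, pl0.tv (K2.map (cst L) y) = 1 := fun y => by
      clear hy
      induction y using K2.ind with
      | h0 => simp [Pl.tv_zero]
      | h1 x y hx hy => rw [K2.map_st]; exact Pl.tv_unit _ (c0 hx).1 (c0 hy).1
      | hn x h => rw [map_neg, Pl.tv_neg, h, inv_one]
      | ha x y h h' => rw [map_add, Pl.tv_add, h, h', one_mul]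
    rw [hy, Pl.tv_add, Pl.tv_add, cy, w4, Pl.tv_st _ TT_ne (cst_ne e0), cT, (c0 e0).1, (c0 e0).2]; simp
  have t3 : inf.tv (v - K2.map Q.K.subtype κ') = e⁻¹ * ((nq z : Q.F) : L)⁻¹ := by
    rw [hy, Pl.tv_add, Pl.tv_add, inf_cst, w5, Pl.tv_st _ TT_ne (cst_ne e0), inf_T, inf_c e0, inf_clc]; simp
  have n0' : ((nq z : Q.F) : L) ≠ 0 := by simpa using n0
  have se : Q.σ e ≠ 0 := by simpa using e0
  rw [t2, t3] at t1
  have t4 : ((nq z : Q.F) : L) = e⁻¹ * Q.σ e⁻¹ := by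
    rw [map_inv₀]; field_simp at t1 ⊢; linear_combination t1
  obtain ⟨x1, x2, hx⟩ := Q.span2 (m := Q.r) Q.r_ne e⁻¹
  rw [hx, nrep] at t4
  obtain ⟨κ2, nd2⟩ := nd.norm (Subtype.ext t4)
  obtain ⟨κ3, k3, -⟩ := nd2.fin hc
  exact main κ3 fun π => k3 π (.inl (by rw [lw]; simp [lin]))
end Qd
end Mk

namespace Mk
open Polynomial
structure Ex (F : Type) [Field F] (P : K2 F → Prop) where
  L : Type
  [fld : Field L]
  σ : L →+* L
  ss : ∀ x, σ (σ x) = x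
  r : L
  hr : r ≠ 0
  sr : σ r = -r
  two : (2 : L) ≠ 0
  i : F →+* L
  fx : ∀ x, σ (i x) = i x
  D : ∀ u w, K2.map i u = w - K2.map σ w → P u
attribute [instance] Ex.fld
namespace Ex
variable {F : Type} [Field F] {P : K2 F → Prop}
theorem step (E : Ex F P) (b : F) (hb : b ≠ 0) : ∃ E' : Ex F P, (∃ x, x * E'.σ x = E'.i b) ∧
    ∀ c, (∃ x, x * E.σ x = E.i c) → ∃ x, x * E'.σ x = E'.i c := by
  by_cases h : ∃ x, x * E.σ x = E.i b
  · exact ⟨E, h, fun _ h => h⟩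
  let Q : Qd E.L := ⟨E.σ, E.ss, E.r, E.hr, E.sr, E.two, E.i b, by simpa using hb, E.fx b⟩
  have hQ : Q.NN := by push Not at h; exact h
  have sc : ∀ x, Q.s (cst E.L x) = cst E.L (E.σ x) := Q.s_c
  refine ⟨⟨Om E.L, Q.s, Q.s_s, cst E.L E.r, cst_ne E.hr, by rw [sc, E.sr, map_neg],
    by have := cst_ne E.two; rwa [map_ofNat] at this, (cst E.L).comp E.i, fun x => by simp [sc, E.fx], fun u w h => ?_⟩, ?_, ?_⟩
  · rw [← K2.map_map] at h
    obtain ⟨w, hw⟩ := Q.desc hQ h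
    exact E.D u w hw
  · refine ⟨TT E.L, ?_⟩
    change _ * Q.s _ = _
    rw [Q.s_T, mul_div_cancel₀ _ TT_ne]; rfl
  · rintro c ⟨x, hx⟩
    refine ⟨cst E.L x, ?_⟩
    change _ * Q.s _ = _
    rw [sc, ← map_mul, hx]; rfl
theorem tow (E : Ex F P) (S : Finset F) : ∃ E' : Ex F P, ∀ x ∈ S, x ≠ 0 → ∃ p, p * E'.σ p = E'.i x := by
  classical
  induction S using Finset.induction_on with
  | empty => exact ⟨E, by simp⟩
  | insert a S _ ih =>
    obtain ⟨E1, h1⟩ := ih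
    by_cases ha : a = 0
    · refine ⟨E1, fun x hx h0 => h1 x (Finset.mem_of_mem_insert_of_ne hx (ha ▸ h0)) h0⟩
    obtain ⟨E2, h2, h3⟩ := E1.step a ha
    refine ⟨E2, fun x hx h0 => ?_⟩
    rcases Finset.mem_insert.1 hx with rfl | hx
    · exact h2
    · exact h3 x (h1 x hx h0)
variable (E : Ex F P)
noncomputable def B : AddSubgroup (K2 E.L) := (AddMonoidHom.id _ - K2.map E.σ).range
theorem mem_B {z : K2 E.L} : z ∈ E.B ↔ ∃ w, z = w - K2.map E.σ w := by
  simp only [B, AddMonoidHom.mem_range, eq_comm]; rfl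
theorem fB {p q : E.L} {y : F} (hp : p ≠ 0) (h : p * E.σ p = q * E.σ q) : st p (E.i y) - st q (E.i y) ∈ E.B := by
  have sp : E.σ p ≠ 0 := by simpa using hp
  have hq : q ≠ 0 := by rintro rfl; simp [hp] at h
  have sq : E.σ q ≠ 0 := by simpa using hq
  let Q : Qd E.L := ⟨E.σ, E.ss, E.r, E.hr, E.sr, E.two, 1, one_ne_zero, map_one _⟩
  obtain ⟨z, z0, hz⟩ := Q.h90 (e := p / q) (by change _ * E.σ _ = 1; rw [map_div₀]; field_simp; exact h)
  change p / q * E.σ z = z at hz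
  have sz : E.σ z ≠ 0 := by simpa using z0
  refine (mem_B _).2 ⟨st z (E.i y), ?_⟩
  rw [K2.map_st, E.fx, ← st_div_left _ hp hq, ← st_div_left _ z0 sz]
  congr 1
  field_simp at hz ⊢; exact hz
theorem sB {p : E.L} {x y : F} (hx : x ≠ 0) (hy : y ≠ 0) (h : x + y = 1) (hp : p * E.σ p = E.i x) : st p (E.i y) ∈ E.B := by
  obtain ⟨q, hq⟩ : ∃ q, q = E.σ p := ⟨_, rfl⟩
  have sq : E.σ q = p := by rw [hq, E.ss]
  rw [← hq] at hp
  have ix : E.i x ≠ 0 := by simpa using hx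
  have p0 : p ≠ 0 := fun h => ix (by rw [← hp, h, zero_mul])
  have q0 : q ≠ 0 := fun h => ix (by rw [← hp, h, mul_zero])
  have hy' : E.i y = 1 - p * q := by rw [hp, ← map_one E.i, ← h, map_add]; ring
  have yf := E.fx y
  have y0 : E.i y ≠ 0 := by simpa using hy
  rw [hy'] at yf y0 ⊢
  have np : 1 + p ≠ 0 := fun h => y0 (by
    have e : p = -1 := by linear_combination h
    rw [hq, e]; simp)
  have nq : 1 + q ≠ 0 := fun h => np (by
    have := congrArg E.σ h
    rwa [map_add, map_one, sq, map_zero] at this)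
  have s1 : ∀ t : E.L, 1 + t ≠ 0 → st t (1 + t) = st (-1) (1 + t) := fun t ht => by
    by_cases t0 : t = 0
    · simp [t0]
    have h1 : st (-t) (1 + t) = 0 := st_stein (by ring)
    rw [neg_eq_neg_one_mul, st_mul_left _ (by simp) t0] at h1
    have h2 := two_st_neg_one' (1 + t)
    rw [two_nsmul] at h2
    linear_combination (norm := abel) h1 - h2
  refine (mem_B _).2 ?_
  by_cases e : p = q
  · refine ⟨-st E.r (1 + p), ?_⟩
    have e1 : 1 - p * q = (1 - p) * (1 + p) := by rw [← e]; ring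
    rw [e1] at y0 ⊢
    have h2 := two_st_neg_one' (1 + p)
    rw [two_nsmul] at h2
    rw [st_mul_right _ (left_ne_zero_of_mul y0) np, st_stein (by ring), s1 p np, map_neg, K2.map_st, E.sr, map_add, map_one, ← hq, ← e,
      neg_eq_neg_one_mul E.r, st_mul_left _ (by simp) E.hr]
    abel
  · have d : q - p ≠ 0 := sub_ne_zero.2 (Ne.symm e)
    refine ⟨st (q - p) (1 + p) + st (1 + p) (1 - p * q), ?_⟩
    rw [map_add, K2.map_st, K2.map_st, yf, map_sub, map_add, map_one, ← hq, sq]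
    have h1 : st ((1 + p) / (1 + q)) ((q - p) / (1 + q)) = 0 := st_stein (by field_simp; ring)
    have h2 : st (p * (1 + q) / (1 + p)) ((1 - p * q) / (1 + p)) = 0 := st_stein (by field_simp; ring)
    have h3 : st (p - q) (1 + q) = st (-1) (1 + q) + st (q - p) (1 + q) := by
      rw [← st_mul_left _ (by simp) d]; congr 1; ring
    rw [st_div_left _ np nq, st_div_right _ d nq, st_div_right _ d nq] at h1
    rw [st_div_left _ (mul_ne_zero p0 nq) np, st_div_right _ y0 np, st_div_right _ y0 np, st_mul_left _ p0 nq, st_mul_left _ p0 nq,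
      s1 p np, st_self (1 + p), st_anti (1 + p) (-1)] at h2
    rw [h3]
    have a1 := two_st_neg_one' (1 + p)
    have a2 := two_st_neg_one' (1 + q)
    have a3 := st_anti (1 + p) (q - p)
    have a4 := st_anti (1 + q) (q - p)
    have a5 := st_anti (1 + p) (1 + q)
    have a6 := st_self (1 + q)
    have a7 := st_anti (1 + q) (-1)
    rw [two_nsmul] at a1 a2
    rw [a3, a4, a6, a7] at h1
    rw [a5] at h1
    linear_combination (norm := abel) h2 + h1 + a1 + a2
theorem tors (E : Ex F P) {u : K2 F} (h : 2 • u = 0) : P u := by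
  classical
  choose T hT using E.tow
  let H : AddSubgroup (∀ S, K2 (T S).L) :=
    { carrier := {f | ∀ᶠ S in Filter.atTop, f S ∈ (T S).B}
      zero_mem' := .of_forall fun S => zero_mem _
      add_mem' := fun h h' => h.mp (h'.mono fun S a b => add_mem b a)
      neg_mem' := fun h => h.mono fun S a => neg_mem a }
  have fin : ∀ x y : F, ∀ᶠ S : Finset F in Filter.atTop, x ∈ S ∧ y ∈ S ∧ x * y ∈ S := fun x y =>
    (Filter.eventually_ge_atTop {x, y, x * y}).mono fun S h =>
      ⟨h (by simp), h (by simp), h (by simp)⟩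
  have hp : ∀ (S : Finset F) (x : F), ∃ p : (T S).L, (x = 0 → p = 0) ∧ (x ∈ S → p * (T S).σ p = (T S).i x) := fun S x => by
    by_cases h0 : x = 0
    · exact ⟨0, by simp [h0]⟩
    by_cases hx : x ∈ S
    · obtain ⟨p, hp⟩ := hT S x hx h0
      exact ⟨p, fun h => absurd h h0, fun _ => hp⟩
    · exact ⟨0, fun h => rfl, fun h => absurd h hx⟩
  choose p p0 hp using hp
  have pn : ∀ {S x}, x ∈ S → x ≠ 0 → p S x ≠ 0 := fun {S x} hS hx h => by
    have := hp S x hS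
    rw [h, zero_mul] at this
    exact hx (by simpa using this.symm)
  let q := QuotientAddGroup.mk' H
  have q0 : ∀ f, q f = 0 ↔ ∀ᶠ S in Filter.atTop, f S ∈ (T S).B := fun f => QuotientAddGroup.eq_zero_iff f
  let ψ := K2.lift (fun x y => q fun S => st (p S x) ((T S).i y)) {
    zl := fun y => (q0 _).2 (.of_forall fun S => by rw [p0 S 0 rfl, st_zero_left]; exact zero_mem _)
    zr := fun y => (q0 _).2 (.of_forall fun S => by rw [map_zero, st_zero_right]; exact zero_mem _)
    ml := fun x y w hx hy hw => by
      rw [← map_add, ← sub_eq_zero, ← map_sub, q0]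
      refine (fin x y).mono fun S ⟨h1, h2, h3⟩ => ?_
      have := (T S).fB (y := w) (pn h3 (mul_ne_zero hx hy)) (q := p S x * p S y) (by
        rw [hp S _ h3, map_mul, map_mul, ← hp S x h1, ← hp S y h2]; ring)
      rw [st_mul_left _ (pn h1 hx) (pn h2 hy)] at this
      exact this
    mr := fun x y w hx hy hw => by
      rw [← map_add]
      congr 1; funext S
      rw [map_mul, st_mul_right _ (by simpa) (by simpa)]; rfl
    s := fun x y hx hy h => (q0 _).2 ((fin x y).mono fun S hS => (T S).sB hx hy h (hp S x hS.1)) }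
  have key : ∀ z, ψ z + ψ z = q fun S => K2.map (T S).i z := fun z => by
    induction z using K2.ind with
    | h0 => simp only [map_zero, add_zero]; exact (map_zero q).symm
    | hn x h => rw [map_neg, ← neg_add, h]; simp only [map_neg]; exact (map_neg q _).symm
    | ha x y h h' => rw [map_add, add_add_add_comm, h, h']; simp only [map_add]; exact (map_add q _ _).symm
    | h1 x y hx hy =>
      rw [K2.lift_st, ← map_add, ← sub_eq_zero, ← map_sub, q0]
      refine (fin x y).mono fun S hS => ((T S).mem_B).2 ⟨st (p S x) ((T S).i y), ?_⟩
      have n := pn hS.1 hx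
      change st (p S x) _ + st (p S x) _ - K2.map _ _ = _
      rw [K2.map_st, K2.map_st, (T S).fx, ← hp S x hS.1, st_mul_left _ n (by simpa using n)]
      abel
  have := key u
  rw [← map_add, ← two_nsmul, h, map_zero, eq_comm, q0] at this
  obtain ⟨S, hS⟩ := this.exists
  obtain ⟨w, hw⟩ := ((T S).mem_B).1 hS
  exact (T S).D u w hw
end Ex
theorem torsion {F : Type} [Field F] (h2 : (2 : F) ≠ 0) {u : K2 F} (h : 2 • u = 0) : ∃ c : F, c ≠ 0 ∧ u = st (-1) c := by
  let f : F[X] →+* Om F := (algebraMap F[X] (Om F)).comp (compRingHom (-X))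
  have fi : Function.Injective f := by
    refine (IsFractionRing.injective F[X] (Om F)).comp (Function.LeftInverse.injective (g := fun p => p.comp (-X)) fun p => ?_)
    simp [comp_assoc]
  let σ : Om F →+* Om F := IsFractionRing.lift fi
  have sa : ∀ p, σ (algebraMap F[X] (Om F) p) = algebraMap F[X] (Om F) (p.comp (-X)) := fun p => IsFractionRing.lift_algebraMap _ _
  have sc : ∀ c, σ (cst F c) = cst F c := fun c => (sa (C c)).trans (by rw [C_comp]; rfl)
  have sT : σ (TT F) = -TT F := (sa _).trans (by rw [X_comp, map_neg]; rfl)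
  let H : AddSubgroup (K2 F) :=
    { carrier := {u | ∃ c : F, c ≠ 0 ∧ u = st (-1) c}
      zero_mem' := ⟨1, one_ne_zero, by simp⟩
      add_mem' := by
        rintro _ _ ⟨c, hc, rfl⟩ ⟨d, hd, rfl⟩
        exact ⟨c * d, mul_ne_zero hc hd, (st_mul_right _ hc hd).symm⟩
      neg_mem' := by
        rintro _ ⟨c, hc, rfl⟩
        exact ⟨c⁻¹, inv_ne_zero hc, (st_inv_right _ _).symm⟩ }
  have pm : ∀ p : F[X], inf.lc (σ (algebraMap F[X] (Om F) p)) = inf.lc (algebraMap F[X] (Om F) p) ∨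
      inf.lc (σ (algebraMap F[X] (Om F) p)) = -inf.lc (algebraMap F[X] (Om F) p) := fun p => by
    rw [sa, inf_lc, inf_lc, leadingCoeff_comp (by simp), leadingCoeff_neg, leadingCoeff_X]
    rcases neg_one_pow_eq_or F p.natDegree with e | e <;> simp [e]
  have pm : ∀ x, inf.lc (σ x) = inf.lc x ∨ inf.lc (σ x) = -inf.lc x := fun x => by
    obtain ⟨p, q, -, rfl⟩ := IsFractionRing.div_surjective (A := F[X]) x
    rw [map_div₀, map_div₀, map_div₀]
    rcases pm p with e | e <;> rcases pm q with e' | e' <;> simp [e, e', neg_div, div_neg]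
  let E : Ex F (· ∈ H) := ⟨Om F, σ, fun x => ?_, TT F, TT_ne, sT, by have := cst_ne h2; rwa [map_ofNat] at this, cst F, sc, fun u w h => ?_⟩
  · exact E.tors h
  · suffices σ.comp σ = RingHom.id _ from DFunLike.congr_fun this x
    exact Qd.om_ext (fun c => by simp [sc]) (by simp [sT])
  · have := congrArg inf.sp h
    rw [Qd.cst_sp, map_sub] at this
    rw [this]
    clear this h
    induction w using K2.ind with
    | h0 => simp only [map_zero, sub_zero]; exact zero_mem _
    | hn x h => rw [map_neg, map_neg, map_neg, ← neg_sub']; exact neg_mem h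
    | ha x y h h' => rw [map_add, map_add, map_add, add_sub_add_comm]; exact add_mem h h'
    | h1 x y hx hy =>
      rw [K2.map_st, Pl.sp_st, Pl.sp_st]
      have a := inf.lc_ne _ hx
      have b := inf.lc_ne _ hy
      have m : ∀ c, c ≠ 0 → st (-1) c ∈ H := fun c hc => ⟨c, hc, rfl⟩
      rcases pm x with e | e <;> rcases pm y with e' | e' <;> rw [e, e']
      · rw [sub_self]; exact zero_mem _
      · rw [neg_eq_neg_one_mul (inf.lc y), st_mul_right _ (by simp) b, st_anti _ (-1)]
        convert m _ a using 1; abel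
      · rw [neg_eq_neg_one_mul (inf.lc x), st_mul_left _ (by simp) a]
        convert neg_mem (m _ b) using 1; abel
      · rw [neg_eq_neg_one_mul (inf.lc x), st_mul_left _ (by simp) a, neg_eq_neg_one_mul (inf.lc y), st_mul_right _ (by simp) b, st_mul_right _ (by simp) b, st_anti (inf.lc x) (-1), st_anti (-1) (-1)]
        convert sub_mem (sub_mem (m _ a) (m _ b)) (neg_mem (m (-1) (by simp))) using 1; abel
end Mk

namespace Mk
open scoped TensorProduct Quaternion
section B
variable {F : Type} [Field F]
theorem bq {A C ι κ : Type} [Ring A] [Algebra F A] [Ring C] [Algebra F C] [Fintype ι] [DecidableEq ι] [Nonempty ι] [Fintype κ] [DecidableEq κ] [Nonempty κ]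
    (e : Matrix ι ι A ≃ₐ[F] Matrix κ κ C) : brauerEquiv F A C :=
  ⟨_, _, Fintype.card_pos (α := ι), Fintype.card_pos (α := κ),
    ⟨((Matrix.reindexAlgEquiv F A (Fintype.equivFin ι)).symm.trans e).trans (Matrix.reindexAlgEquiv F C (Fintype.equivFin κ))⟩⟩
theorem bi {A C : Type} [Ring A] [Algebra F A] [Ring C] [Algebra F C] (e : A ≃ₐ[F] C) : brauerEquiv F A C :=
  bq (ι := Fin 1) (κ := Fin 1) e.mapMatrix
variable (F) in
structure Al where
  A : Type
  [r : Ring A]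
  [g : Algebra F A]
attribute [instance] Al.r Al.g
theorem b_symm {A C : Type} [Ring A] [Algebra F A] [Ring C] [Algebra F C] (h : brauerEquiv F A C) : brauerEquiv F C A := by
  obtain ⟨n, m, hn, hm, ⟨e⟩⟩ := h
  exact ⟨m, n, hm, hn, ⟨e.symm⟩⟩
theorem b_trans {A C D : Type} [Ring A] [Algebra F A] [Ring C] [Algebra F C] [Ring D] [Algebra F D]
    (h : brauerEquiv F A C) (h' : brauerEquiv F C D) : brauerEquiv F A D := by
  obtain ⟨n, m, hn, hm, ⟨e⟩⟩ := h
  obtain ⟨p, q, hp, hq, ⟨f⟩⟩ := h'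
  haveI : NeZero n := ⟨hn.ne'⟩
  haveI : NeZero m := ⟨hm.ne'⟩
  haveI : NeZero p := ⟨hp.ne'⟩
  haveI : NeZero q := ⟨hq.ne'⟩
  let c := fun (I J : ℕ) (R : Type) [Ring R] [Algebra F R] => Matrix.compAlgEquiv (Fin I) (Fin J) R F
  exact bq ((c p n A).symm.trans (e.mapMatrix.trans ((c p m C).trans ((Matrix.reindexAlgEquiv F C (Equiv.prodComm _ _)).trans ((c m p C).symm.trans (f.mapMatrix.trans (c m q D)))))))
theorem b_ten {A C A' C' : Type} [Ring A] [Algebra F A] [Ring C] [Algebra F C] [Ring A'] [Algebra F A'] [Ring C'] [Algebra F C']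
    (h : brauerEquiv F A C) (h' : brauerEquiv F A' C') : brauerEquiv F (A ⊗[F] A') (C ⊗[F] C') := by
  obtain ⟨n, m, hn, hm, ⟨e⟩⟩ := h
  obtain ⟨p, q, hp, hq, ⟨f⟩⟩ := h'
  haveI : NeZero n := ⟨hn.ne'⟩
  haveI : NeZero m := ⟨hm.ne'⟩
  haveI : NeZero p := ⟨hp.ne'⟩
  haveI : NeZero q := ⟨hq.ne'⟩
  exact bq (((Matrix.kroneckerTMulAlgEquiv (Fin n) (Fin p) F F A A').symm.trans (Algebra.TensorProduct.congr e f)).trans (Matrix.kroneckerTMulAlgEquiv (Fin m) (Fin q) F F C C'))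
variable (F) in
def Bs : Setoid (Al F) := ⟨fun a b => brauerEquiv F a.A b.A, fun a => bi AlgEquiv.refl, b_symm, b_trans⟩
variable (F) in
def B : Type 1 := Quotient (Bs F)
def br (A : Type) [Ring A] [Algebra F A] : B F := Quotient.mk (Bs F) ⟨A⟩
theorem br_eq {A C : Type} [Ring A] [Algebra F A] [Ring C] [Algebra F C] : br A = (br C : B F) ↔ brauerEquiv F A C := Quotient.eq (r := Bs F)
theorem br_i {A C : Type} [Ring A] [Algebra F A] [Ring C] [Algebra F C] (e : A ≃ₐ[F] C) : br A = (br C : B F) := br_eq.2 (bi e)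
theorem B.ind {P : B F → Prop} (h : ∀ (A : Type) [Ring A] [Algebra F A], P (br A)) (x) : P x := Quotient.ind (s := Bs F) (fun a => h a.A) x
instance : CommMonoid (B F) where
  mul := Quotient.map₂ (sa := Bs F) (sb := Bs F) (sc := Bs F) (fun a b => ⟨a.A ⊗[F] b.A⟩) fun a a' h b b' h' => b_ten h h'
  one := br F
  mul_assoc a b c := by
    induction a using B.ind; induction b using B.ind; induction c using B.ind
    exact br_i (Algebra.TensorProduct.assoc F F F _ _ _)
  mul_comm a b := by
    induction a using B.ind; induction b using B.ind
    exact br_i (Algebra.TensorProduct.comm F _ _)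
  one_mul a := by
    induction a using B.ind
    exact br_i (Algebra.TensorProduct.lid F _)
  mul_one a := by
    induction a using B.ind
    exact br_i (Algebra.TensorProduct.rid F F _)
theorem br_mul (A C : Type) [Ring A] [Algebra F A] [Ring C] [Algebra F C] : br (A ⊗[F] C) = (br A * br C : B F) := rfl
theorem br_one : br F = (1 : B F) := rfl
end B
section bc
variable (F K : Type) [Field F] [Field K] [Algebra F K]
theorem b_bc {A C : Type} [Ring A] [Algebra F A] [Ring C] [Algebra F C]
    (h : brauerEquiv F A C) : brauerEquiv K (K ⊗[F] A) (K ⊗[F] C) := by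
  obtain ⟨n, m, hn, hm, ⟨e⟩⟩ := h
  haveI : NeZero n := ⟨hn.ne'⟩
  haveI : NeZero m := ⟨hm.ne'⟩
  let c := fun (I : ℕ) (R : Type) [Ring R] [Algebra F R] => Matrix.kroneckerTMulAlgEquiv (Fin 1) (Fin I) F K K R
  let u : Matrix (Fin 1) (Fin 1) K ≃ₐ[K] Matrix (Fin 1) (Fin 1) K := AlgEquiv.refl
  exact bq (((c n A).symm.trans (Algebra.TensorProduct.congr u e)).trans (c m C))
def bch : B F →* B K where
  toFun := Quotient.map (sa := Bs F) (sb := Bs K) (fun a => ⟨K ⊗[F] a.A⟩) fun a b h => b_bc F K h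
  map_one' := br_i (Algebra.TensorProduct.rid F K K)
  map_mul' a b := by
    induction a using B.ind with | h A
    induction b using B.ind with | h C
    refine br_i ?_
    exact ((Algebra.TensorProduct.tensorTensorTensorComm F F K K K A K C).trans (Algebra.TensorProduct.congr (Algebra.TensorProduct.lid K K) AlgEquiv.refl)).symm
theorem bch_br (A : Type) [Ring A] [Algebra F A] : bch F K (br A) = br (K ⊗[F] A) := rfl
end bc
end Mk

namespace Mk
open scoped TensorProduct Quaternion
section B
variable {F : Type} [Field F] {a b : F}
def qi : ℍ[F,a,b] := ⟨0, 1, 0, 0⟩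
def qj : ℍ[F,a,b] := ⟨0, 0, 1, 0⟩
theorem qii : (qi * qi : ℍ[F,a,b]) = algebraMap F _ a := by ext <;> simp [qi]
theorem qjj : (qj * qj : ℍ[F,a,b]) = algebraMap F _ b := by ext <;> simp [qj]
theorem qji : (qj * qi : ℍ[F,a,b]) = -(qi * qj) := by ext <;> simp [qi, qj]
def ql {A : Type} [Ring A] [Algebra F A] {i j : A} (hi : i * i = algebraMap F A a) (hj : j * j = algebraMap F A b) (h : j * i = -(i * j)) : ℍ[F,a,b] →ₐ[F] A :=
  QuaternionAlgebra.lift ⟨i, j, i * j, by rw [hi, Algebra.algebraMap_eq_smul_one]; simp, by rw [hj, Algebra.algebraMap_eq_smul_one], rfl, by rw [h]; simp⟩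
section
variable {A : Type} [Ring A] [Algebra F A] {i j : A} (hi : i * i = algebraMap F A a) (hj : j * j = algebraMap F A b) (h : j * i = -(i * j))
theorem ql_i : ql hi hj h qi = i := by simp [ql, qi, QuaternionAlgebra.lift, QuaternionAlgebra.Basis.liftHom, QuaternionAlgebra.Basis.lift]
theorem ql_j : ql hi hj h qj = j := by simp [ql, qj, QuaternionAlgebra.lift, QuaternionAlgebra.Basis.liftHom, QuaternionAlgebra.Basis.lift]
theorem q_dec (q : ℍ[F,a,b]) : q = algebraMap F _ q.re + q.imI • qi + q.imJ • qj + q.imK • (qi * qj) := by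
  ext <;> simp [qi, qj]
theorem q_mem (f : ℍ[F,a,b] →ₐ[F] A) (S : Subalgebra F A) (hi : f qi ∈ S) (hj : f qj ∈ S) (q) : f q ∈ S := by
  rw [q_dec q]
  simp only [map_add, map_smul, map_mul f, AlgHom.commutes]
  exact S.add_mem (S.add_mem (S.add_mem (S.algebraMap_mem _) (S.smul_mem hi _)) (S.smul_mem hj _)) (S.smul_mem (S.mul_mem hi hj) _)
theorem q_com (f : ℍ[F,a,b] →ₐ[F] A) {c : A} (hi : Commute (f qi) c) (hj : Commute (f qj) c) (q) : Commute (f q) c := by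
  have := q_mem f (Subalgebra.centralizer F {c}) (by simpa [Subalgebra.mem_centralizer_iff] using hi.symm.eq) (by simpa [Subalgebra.mem_centralizer_iff] using hj.symm.eq) q
  rw [Subalgebra.mem_centralizer_iff] at this
  exact ((this c rfl) : c * _ = _ * c).symm
end
instance : FiniteDimensional F ℍ[F,a,b] := Module.finite_of_finrank_pos (by rw [QuaternionAlgebra.finrank_eq_four]; omega)
theorem q_split {x y : F} (h2 : (2:F) ≠ 0) (ha : a ≠ 0) (hb : b ≠ 0) (h : b = x ^ 2 - a * y ^ 2) : br ℍ[F,a,b] = (1 : B F) := by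
  let f : ℍ[F,a,b] →ₐ[F] Matrix (Fin 2) (Fin 2) F := ql (i := !![0, a; 1, 0]) (j := !![x, -(a*y); y, -x])
    (by ext i j; fin_cases i <;> fin_cases j <;> simp [Matrix.algebraMap_matrix_apply])
    (by ext i j; fin_cases i <;> fin_cases j <;> simp [Matrix.algebraMap_matrix_apply, h] <;> ring)
    (by ext i j; fin_cases i <;> fin_cases j <;> simp <;> ring)
  have inj : Function.Injective f := by
    rw [injective_iff_map_eq_zero]
    intro q hq
    rw [q_dec q] at hq
    simp only [map_add, map_smul, map_mul f, AlgHom.commutes, f, ql_i, ql_j] at hq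
    have e1 := congrFun (congrFun hq 0) 0
    have e2 := congrFun (congrFun hq 0) 1
    have e3 := congrFun (congrFun hq 1) 0
    have e4 := congrFun (congrFun hq 1) 1
    simp [Matrix.algebraMap_matrix_apply] at e1 e2 e3 e4
    have w : q.re = 0 := by
      have : (2:F) * q.re = 0 := by linear_combination e1 + e4
      simpa [h2] using this
    have v : q.imI = 0 := by
      have : (2:F) * a * q.imI = 0 := by linear_combination e2 + a * e3
      simpa [h2, ha] using this
    have z1 : q.imJ = 0 := by
      have : b * q.imJ = 0 := by linear_combination q.imJ * h + x * e1 - x * w - a * y * (e3 - v)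
      simpa [hb] using this
    have z2 : q.imK = 0 := by
      have : b * q.imK = 0 := by linear_combination q.imK * h + x * (e3 - v) - y * (e1 - w)
      simpa [hb] using this
    ext <;> simp [w, v, z1, z2]
  have fr : Module.finrank F ℍ[F,a,b] = Module.finrank F (Matrix (Fin 2) (Fin 2) F) := by
    rw [QuaternionAlgebra.finrank_eq_four, Module.finrank_matrix]; simp
  have bij : Function.Bijective f := ⟨inj, (LinearMap.injective_iff_surjective_of_finrank_eq_finrank (f := f.toLinearMap) fr).1 inj⟩
  exact (br_eq.2 (b_trans (bi (AlgEquiv.ofBijective f bij)) (b_symm (bq (ι := Fin 2) (κ := Unit) (Matrix.uniqueAlgEquiv (R := F) (A := Matrix (Fin 2) (Fin 2) F)).symm))))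
theorem q_swap : br ℍ[F,a,b] = (br ℍ[F,b,a] : B F) := br_i (QuaternionAlgebra.swapEquiv _ _)
theorem q_mul {c : F} (ha : a ≠ 0) (hc : c ≠ 0) : (br ℍ[F,a,b*c] * br ℍ[F,c,a^2] : B F) = br ℍ[F,a,b] * br ℍ[F,a,c] := by
  have cm : ∀ (x : ℍ[F,a,b]) (y : ℍ[F,a,c]), (x ⊗ₜ[F] (1 : ℍ[F,a,c])) * ((1 : ℍ[F,a,b]) ⊗ₜ[F] y) = x ⊗ₜ[F] y := fun x y => by simp
  have sm : ∀ r : F, algebraMap F (ℍ[F,a,b] ⊗[F] ℍ[F,a,c]) r = r • (1 : ℍ[F,a,b]) ⊗ₜ[F] (1 : ℍ[F,a,c]) := fun r => Algebra.algebraMap_eq_smul_one r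
  let f : ℍ[F,a,b*c] →ₐ[F] ℍ[F,a,b] ⊗[F] ℍ[F,a,c] := ql (i := qi ⊗ₜ 1) (j := qj ⊗ₜ qj) (by simp [qii, sm, Algebra.algebraMap_eq_smul_one, TensorProduct.smul_tmul'])
    (by simp [qjj, sm, Algebra.algebraMap_eq_smul_one, TensorProduct.smul_tmul', smul_smul, mul_comm]) (by simp [qji, TensorProduct.neg_tmul])
  let g : ℍ[F,c,a^2] →ₐ[F] ℍ[F,a,b] ⊗[F] ℍ[F,a,c] := ql (i := 1 ⊗ₜ qj) (j := qi ⊗ₜ qi) (by simp [qjj, sm, Algebra.algebraMap_eq_smul_one, TensorProduct.smul_tmul'])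
    (by simp [qii, sm, Algebra.algebraMap_eq_smul_one, TensorProduct.smul_tmul', smul_smul, pow_two]) (by simp [qji, TensorProduct.tmul_neg])
  let t := Algebra.TensorProduct.lift f g fun x y => by
    refine q_com f (q_com g ?_ ?_ y).symm (q_com g ?_ ?_ y).symm x <;> simp [f, g, ql_i, ql_j, Commute, SemiconjBy, qji, TensorProduct.neg_tmul, TensorProduct.tmul_neg]
  have tf : ∀ x, f x ∈ t.range := fun x => ⟨x ⊗ₜ 1, by simp [t]⟩
  have tg : ∀ x, g x ∈ t.range := fun x => ⟨1 ⊗ₜ x, by simp [t]⟩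
  have i1 := tf qi
  have j2 := tg qi
  have j1 := t.range.smul_mem (t.range.mul_mem (tf qj) (tg qi)) c⁻¹
  have i2 := t.range.smul_mem (t.range.mul_mem (tf qi) (tg qj)) a⁻¹
  have su : Function.Surjective t := by
    intro z
    suffices z ∈ t.range from this
    induction z with
    | zero => exact zero_mem _
    | add x y hx hy => exact add_mem hx hy
    | tmul x y =>
      rw [← cm]
      refine mul_mem (q_mem Algebra.TensorProduct.includeLeft t.range ?_ ?_ x) (q_mem Algebra.TensorProduct.includeRight t.range ?_ ?_ y)
      · simpa [f, ql_i] using i1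
      · simpa [f, g, ql_i, ql_j, qjj, Algebra.algebraMap_eq_smul_one, TensorProduct.smul_tmul', hc] using j1
      · simpa [f, g, ql_i, ql_j, qii, Algebra.algebraMap_eq_smul_one, TensorProduct.smul_tmul', ha] using i2
      · simpa [g, ql_i] using j2
  have bij : Function.Bijective t := ⟨(LinearMap.injective_iff_surjective_of_finrank_eq_finrank (f := t.toLinearMap) (by
    rw [Module.finrank_tensorProduct, Module.finrank_tensorProduct]; simp only [QuaternionAlgebra.finrank_eq_four])).2 su, su⟩
  exact br_i (AlgEquiv.ofBijective t bij)
end B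
section bc
variable {F K : Type} [Field F] [Field K]
def bc (φ : F →+* K) : B F →* B K := letI := φ.toAlgebra; bch F K
theorem bc_q (φ : F →+* K) (a b : F) : bc φ (br ℍ[F,a,b]) = br ℍ[K,φ a,φ b] := by
  letI := φ.toAlgebra
  have e : ∀ c : F, (1 : K) ⊗ₜ[F] algebraMap F ℍ[F,a,b] c = algebraMap K (K ⊗[F] ℍ[F,a,b]) (φ c) := fun c => by
    rw [Algebra.algebraMap_eq_smul_one, TensorProduct.tmul_smul, TensorProduct.smul_tmul', Algebra.smul_def, mul_one]; rfl
  let f : ℍ[K,φ a,φ b] →ₐ[K] K ⊗[F] ℍ[F,a,b] := ql (i := 1 ⊗ₜ qi) (j := 1 ⊗ₜ qj) (by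
      rw [Algebra.TensorProduct.tmul_mul_tmul, qii, mul_one, e]) (by rw [Algebra.TensorProduct.tmul_mul_tmul, qjj, mul_one, e]) (by simp [qji, TensorProduct.tmul_neg])
  have su : Function.Surjective f := by
    intro z
    suffices z ∈ f.range from this
    induction z with
    | zero => exact zero_mem _
    | add x y hx hy => exact add_mem hx hy
    | tmul x y =>
      have := q_mem Algebra.TensorProduct.includeRight (f.range.restrictScalars F) ⟨qi, by simp [f, ql_i]⟩ ⟨qj, by simp [f, ql_j]⟩ y
      have := f.range.smul_mem this x
      simpa [TensorProduct.smul_tmul'] using this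
  have bij : Function.Bijective f := ⟨(LinearMap.injective_iff_surjective_of_finrank_eq_finrank (f := f.toLinearMap) (by
    rw [Module.finrank_baseChange]; simp only [QuaternionAlgebra.finrank_eq_four])).2 su, su⟩
  exact br_i (AlgEquiv.ofBijective f bij).symm
end bc
section H
variable {F : Type} [Field F]
theorem q_one {x y : F} (h2 : (2:F) ≠ 0) (hx : x ≠ 0) (hy : y ≠ 0) : br ℍ[F,x,y^2] = (1 : B F) :=
  q_split (x := y) (y := 0) h2 hx (pow_ne_zero 2 hy) (by ring)
theorem q_mul' {a b c : F} (h2 : (2:F) ≠ 0) (ha : a ≠ 0) (hc : c ≠ 0) : (br ℍ[F,a,b*c] : B F) = br ℍ[F,a,b] * br ℍ[F,a,c] := by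
  rw [← q_mul ha hc, q_one h2 hc ha, mul_one]
theorem q_sq {a b : F} (h2 : (2:F) ≠ 0) (ha : a ≠ 0) (hb : b ≠ 0) : (br ℍ[F,a,b] * br ℍ[F,a,b] : B F) = 1 := by
  rw [← q_mul' h2 ha hb, ← pow_two, q_one h2 ha hb]
open Classical in
noncomputable def qu (h2 : (2:F) ≠ 0) (a b : F) : (B F)ˣ := if h : a ≠ 0 ∧ b ≠ 0 then ⟨br ℍ[F,a,b], br ℍ[F,a,b], q_sq h2 h.1 h.2, q_sq h2 h.1 h.2⟩ else 1
theorem qu_v (h2 : (2:F) ≠ 0) {a b : F} (ha : a ≠ 0) (hb : b ≠ 0) : (qu h2 a b : B F) = br ℍ[F,a,b] := by rw [qu, dif_pos ⟨ha, hb⟩]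
noncomputable def h (h2 : (2:F) ≠ 0) : K2 F →+ Additive (B F)ˣ := K2.lift (fun a b => Additive.ofMul (qu h2 a b))
  { zl := fun a => by simp [qu]
    zr := fun a => by simp [qu]
    ml := fun x y w hx hy hw => by
      rw [← ofMul_mul]; congr 1; ext
      rw [Units.val_mul, qu_v h2 (mul_ne_zero hx hy) hw, qu_v h2 hx hw, qu_v h2 hy hw, q_swap, q_mul' h2 hw hy, q_swap (a := w), q_swap (a := w)]
    mr := fun x y w hx hy hw => by
      rw [← ofMul_mul]; congr 1; ext
      simp only [Units.val_mul, qu_v h2, q_mul' h2, ne_eq, mul_ne_zero_iff, not_false_iff, hx, hy, hw, and_self]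
    s := fun x y hx hy e => by
      rw [← ofMul_one]; congr 1; ext
      rw [qu_v h2 hx hy, Units.val_one, q_split (x := 1) (y := 1) h2 hx hy (by linear_combination e)] }
noncomputable def H (h2 : (2:F) ≠ 0) (u : K2 F) : B F := ((h h2 u).toMul : (B F)ˣ)
variable (h2 : (2:F) ≠ 0)
theorem H_st {a b : F} (ha : a ≠ 0) (hb : b ≠ 0) : H h2 (st a b) = br ℍ[F,a,b] := by
  rw [H, h, K2.lift_st]; exact qu_v h2 ha hb
theorem H_add (u v) : H h2 (u + v) = H h2 u * H h2 v := by rw [H, map_add]; rfl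
theorem H_zero : H h2 0 = 1 := by rw [H, map_zero]; rfl
theorem H_two (u) : H h2 u * H h2 u = 1 := by
  induction u using K2.ind with
  | h0 => rw [H_zero, mul_one]
  | h1 x y hx hy => rw [H_st h2 hx hy, q_sq h2 hx hy]
  | hn x h =>
    have e : H h2 (-x) * H h2 x = 1 := by rw [← H_add, neg_add_cancel, H_zero]
    have e' : H h2 (-x) = H h2 x := by rw [← mul_one (H h2 (-x)), ← h, ← mul_assoc, e, one_mul]
    rw [e', h]
  | ha x y h h' => rw [H_add, mul_mul_mul_comm, h, h', mul_one]
theorem H_bc {K : Type} [Field K] (k2 : (2:K) ≠ 0) (φ : F →+* K) (u) : bc φ (H h2 u) = H k2 (K2.map φ u) := by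
  induction u using K2.ind with
  | h0 => simp [H_zero]
  | h1 x y hx hy => rw [K2.map_st, H_st h2 hx hy, H_st k2 (by simpa using hx) (by simpa using hy), bc_q]
  | hn x h =>
    have e : ∀ {G : Type} [Field G] (g2 : (2:G) ≠ 0) (y : K2 G), H g2 (-y) = H g2 y := fun g2 y => by
      rw [← mul_one (H g2 (-y)), ← H_two g2 y, ← mul_assoc, ← H_add, neg_add_cancel, H_zero, one_mul]
    rw [map_neg, e, e, h]
  | ha x y h h' => rw [H_add, map_mul, h, h', map_add, H_add]
end H
end Mk

namespace Mk
open scoped TensorProduct Quaternion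
variable {F : Type} [Field F]
theorem sqn {a b s : F} (h2 : (2:F) ≠ 0) (hs : s ≠ 0) (h : a = s ^ 2) : ∃ x y, b = x ^ 2 - a * y ^ 2 :=
  ⟨(b + 1) / 2, (b - 1) / (2 * s), by rw [h]; field_simp; ring⟩
theorem q_conic {a b : F} (h2 : (2:F) ≠ 0) (ha : a ≠ 0) (h : br ℍ[F,a,b] = (1 : B F)) : ∃ x y, b = x ^ 2 - a * y ^ 2 := by
  by_cases hz : ∃ d : ℍ[F,a,b], d ≠ 0 ∧ d.re ^ 2 - a * d.imI ^ 2 - b * (d.imJ ^ 2 - a * d.imK ^ 2) = 0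
  · obtain ⟨⟨w, x, y, z⟩, d0, hd⟩ := hz
    dsimp only at hd
    by_cases h0 : y ^ 2 - a * z ^ 2 = 0
    · have e : ∃ s, a = s ^ 2 := by
        by_cases hz : z = 0
        · have hy : y = 0 := by simpa [hz] using h0
          by_cases hx : x = 0
          · exact absurd (by ext <;> simp_all) d0
          · exact ⟨w / x, by rw [h0] at hd; field_simp; linear_combination -hd⟩
        · exact ⟨y / z, by field_simp; linear_combination -h0⟩
      obtain ⟨s, e⟩ := e
      exact sqn h2 (by rintro rfl; simp [ha] at e) e
    · refine ⟨(w * y + a * x * z) / (y ^ 2 - a * z ^ 2), (w * z + x * y) / (y ^ 2 - a * z ^ 2), ?_⟩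
      field_simp
      linear_combination (-(y ^ 2 - a * z ^ 2)) * hd
  · push Not at hz
    exfalso
    obtain ⟨p, q, hp, hq, ⟨e⟩⟩ := br_eq.1 h
    haveI : NeZero p := ⟨hp.ne'⟩
    have fr := e.toLinearEquiv.finrank_eq
    rw [Module.finrank_matrix, Module.finrank_matrix, QuaternionAlgebra.finrank_eq_four] at fr
    simp only [Fintype.card_fin, Module.finrank_self, mul_one] at fr
    obtain ⟨v, hv⟩ : ∃ v, (e (Matrix.single 0 0 1)).mulVec v ≠ 0 := by
      by_contra hc
      push Not at hc
      have : e (Matrix.single 0 0 1) = 0 := Matrix.ext_of_mulVec_single fun i => by rw [hc, Matrix.zero_mulVec]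
      rw [EmbeddingLike.map_eq_zero_iff] at this
      simpa using congrFun (congrFun this 0) 0
    let T : (Fin p → ℍ[F,a,b]) →ₗ[F] (Fin q → F) :=
      { toFun := fun d => (e (Matrix.of fun i j => if j = 0 then d i else 0)).mulVec v
        map_add' := fun d d' => by
          rw [← Matrix.add_mulVec, ← map_add]; congr 2; ext1 i j; simp only [Matrix.of_apply, Matrix.add_apply, Pi.add_apply]; split_ifs <;> simp
        map_smul' := fun c d => by
          rw [RingHom.id_apply, ← Matrix.smul_mulVec, ← map_smul]; congr 2; ext1 i j; simp only [Matrix.of_apply, Matrix.smul_apply, Pi.smul_apply]; split_ifs <;> simp }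
    have inj : Function.Injective T := by
      rw [injective_iff_map_eq_zero]
      intro d hd
      by_contra h0
      obtain ⟨i, hi⟩ := Function.ne_iff.1 h0
      have n0 := hz _ hi
      set n := (d i).re ^ 2 - a * (d i).imI ^ 2 - b * ((d i).imJ ^ 2 - a * (d i).imK ^ 2) with hn
      have e1 : star (d i) * d i = algebraMap F _ n := by ext <;> simp <;> (try rw [hn]) <;> ring
      have e2 : Matrix.single 0 i (star (d i)) * (Matrix.of fun i (j : Fin p) => if j = 0 then d i else 0) = n • Matrix.single (0 : Fin p) 0 (1 : ℍ[F,a,b]) := by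
        ext1 k j
        rw [Matrix.mul_apply, Matrix.smul_apply]
        by_cases hk : k = 0 <;> by_cases hj : j = 0
        · subst hk; subst hj
          rw [Finset.sum_eq_single i (fun x _ hx => by simp [Matrix.single, hx.symm]) (by simp)]
          simp [e1, Algebra.algebraMap_eq_smul_one]
        all_goals simp [Matrix.single, hk, hj, eq_comm (a := (0 : Fin p))]
      have e3 := congrArg (fun m : Matrix (Fin p) (Fin p) ℍ[F,a,b] => (e m).mulVec v) e2
      simp only [map_mul e, map_smul, ← Matrix.mulVec_mulVec] at e3
      rw [show (e (Matrix.of fun i j => if j = 0 then d i else 0)).mulVec v = 0 from hd, Matrix.mulVec_zero, Matrix.smul_mulVec] at e3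
      exact hv ((smul_eq_zero.1 e3.symm).resolve_left n0)
    have := LinearMap.finrank_le_finrank_of_injective inj
    rw [Module.finrank_pi_fintype] at this
    simp [QuaternionAlgebra.finrank_eq_four] at this
    nlinarith
theorem q_sym {a b : F} (h2 : (2:F) ≠ 0) (ha : a ≠ 0) (hb : b ≠ 0) (h : br ℍ[F,a,b] = (1 : B F)) : ∃ u, st a b = u + u := by
  obtain ⟨x, y, e⟩ := q_conic h2 ha h
  by_cases hx : x = 0
  · have hy : y ≠ 0 := by rintro rfl; simp [hx, hb] at e
    exact ⟨st a y, by rw [show b = -a * (y * y) by rw [e, hx]; ring, st_mul_right _ (neg_ne_zero.2 ha) (mul_ne_zero hy hy), st_mul_right _ hy hy, st_self_neg, zero_add]⟩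
  by_cases hy : y = 0
  · exact ⟨st a x, by rw [show b = x * x by rw [e, hy]; ring, st_mul_right _ hx hx]⟩
  have hs := inv_ne_zero hx
  have ht := mul_ne_zero hy hs
  have k : st (a * ((y * x⁻¹) * (y * x⁻¹))) (b * (x⁻¹ * x⁻¹)) = 0 := st_stein (by rw [e]; field_simp; ring)
  rw [st_mul_left _ ha (mul_ne_zero ht ht), st_mul_left _ ht ht, st_mul_right a hb (mul_ne_zero hs hs), st_mul_right a hs hs] at k
  exact ⟨-(st a x⁻¹ + st (y * x⁻¹) (b * (x⁻¹ * x⁻¹))), by linear_combination (norm := abel) k⟩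
end Mk

namespace Mk
open scoped TensorProduct Quaternion
section
variable {F : Type} [Field F]
variable (F) in
def DD : AddSubgroup (K2 F) where
  carrier := {u | ∃ w, u = w + w}
  zero_mem' := ⟨0, by simp⟩
  add_mem' := by rintro _ _ ⟨x, rfl⟩ ⟨y, rfl⟩; exact ⟨x + y, by abel⟩
  neg_mem' := by rintro _ ⟨x, rfl⟩; exact ⟨-x, by abel⟩
theorem D_map {K : Type} [Field K] (φ : F →+* K) {u : K2 F} (h : u ∈ DD F) : K2.map φ u ∈ DD K := by
  obtain ⟨w, rfl⟩ := h
  exact ⟨K2.map φ w, map_add _ _ _⟩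
variable (h2 : (2:F) ≠ 0)
theorem H_D {u : K2 F} (h : u ∈ DD F) : H h2 u = 1 := by
  obtain ⟨w, rfl⟩ := h
  rw [H_add, H_two]
theorem D_st {a b : F} (h2 : (2:F) ≠ 0) (ha : a ≠ 0) (hb : b ≠ 0) (h : H h2 (st a b) = 1) : st a b ∈ DD F := q_sym h2 ha hb (by rwa [H_st h2 ha hb] at h)
theorem D_n {a b x y : F} (h2 : (2:F) ≠ 0) (ha : a ≠ 0) (hb : b ≠ 0) (h : b = x ^ 2 - a * y ^ 2) : st a b ∈ DD F :=
  q_sym h2 ha hb (q_split h2 ha hb h)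
theorem H_of {u v : K2 F} (h : u - v ∈ DD F) : H h2 u = H h2 v := by
  rw [← sub_add_cancel u v, H_add, H_D h2 h, one_mul]
theorem D_of {u v : K2 F} (h : u - v ∈ DD F) (hv : v ∈ DD F) : u ∈ DD F := by
  rw [← sub_add_cancel u v]; exact add_mem h hv
theorem D_add (u : K2 F) : u + u ∈ DD F := ⟨u, rfl⟩
abbrev QA (a : F) := QuadraticAlgebra F a 0
theorem qaf {a : F} (h : ∀ s, a ≠ s ^ 2) : Fact (∀ r : F, r ^ 2 ≠ a + 0 * r) := ⟨fun r e => h r (by rw [e]; ring)⟩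
theorem fin2 {c V U : F} (h2 : (2:F) ≠ 0) (hc : c ≠ 0) (hV : V ≠ 0) (hU : U ≠ 0) (h : H h2 (st (-1) c + st V U) = 1) : st (-1) c + st V U ∈ DD F := by
  have n1 : (-1 : F) ≠ 0 := by simp
  by_cases hs : ∃ s, U = s ^ 2
  · obtain ⟨s, rfl⟩ := hs
    have e := D_n (x := s) (y := 0) h2 hV hU (by ring)
    refine add_mem (D_st h2 n1 hc ?_) e
    rwa [H_add, H_D h2 e, mul_one] at h
  push Not at hs
  haveI := qaf hs
  let φ := algebraMap F (QA U)
  have k2 : (2 : QA U) ≠ 0 := by have := (map_ne_zero φ).2 h2; rwa [map_ofNat] at this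
  have e := congrArg (bc φ) h
  have φU : φ U ≠ 0 := (map_ne_zero φ).2 hU
  rw [H_bc h2 k2, map_add, H_add, map_one, K2.map_st, K2.map_st, H_D k2 (D_n (x := QuadraticAlgebra.omega) (y := 0) k2 ((map_ne_zero φ).2 hV) φU (by
    rw [pow_two]; ext <;> simp [φ])), mul_one, map_neg, map_one, H_st k2 (by simp) (by simpa using hc)] at e
  obtain ⟨X, Y, e⟩ := q_conic k2 (by simp) e
  have e1 := congrArg QuadraticAlgebra.re e
  have e2 := congrArg QuadraticAlgebra.im e
  simp [φ, pow_two] at e1 e2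
  have e2 : X.re * X.im + Y.re * Y.im = 0 := by
    have : 2 * (X.re * X.im + Y.re * Y.im) = 0 := by linear_combination -e2
    simpa [h2] using this
  by_cases h0 : X.im = 0 ∧ Y.im = 0
  · have e := D_n (x := X.re) (y := Y.re) h2 n1 hc (by rw [e1, h0.1, h0.2]; ring)
    refine add_mem e (D_st h2 hV hU ?_)
    rwa [H_add, H_D h2 e, one_mul] at h
  obtain ⟨l, hl⟩ : ∃ l, X.re = - (l * Y.im) ∧ Y.re = l * X.im := by
    by_cases hx : X.im = 0
    · have hy : Y.im ≠ 0 := fun h => h0 ⟨hx, h⟩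
      exact ⟨-X.re / Y.im, by field_simp, by rw [hx, mul_zero]; simpa [hx, hy] using e2⟩
    · exact ⟨Y.re / X.im, by field_simp; linear_combination e2, by field_simp⟩
  have e1 : c = (X.im ^ 2 + Y.im ^ 2) * (l ^ 2 + U) := by rw [e1, hl.1, hl.2]; ring
  rw [e1] at hc
  have hn := left_ne_zero_of_mul hc
  have he := right_ne_zero_of_mul hc
  have d1 := D_n (x := X.im) (y := Y.im) h2 n1 hn (by ring)
  have d2 := D_n (x := l) (y := 1) h2 (neg_ne_zero.2 hU) he (by ring)
  rw [neg_eq_neg_one_mul, st_mul_left _ n1 hU] at d2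
  have k : (st (-1) c + st V U) - st U ((l ^ 2 + U) * V) ∈ DD F := by
    rw [e1, st_mul_right _ hn he, st_mul_right _ he hV, st_anti V U]
    convert sub_mem (add_mem d1 d2) (add_mem (D_add (st U (l ^ 2 + U))) (D_add (st U V))) using 1; abel
  exact D_of k (D_st h2 hU (mul_ne_zero he hV) (by rw [← H_of h2 k, h]))
end
def G (F : Type) [Field F] : ℕ → K2 F → Prop
  | 0, u => u ∈ DD F
  | n + 1, u => ∃ a b v, a ≠ 0 ∧ b ≠ 0 ∧ G F n v ∧ u = v + st a b
theorem G_map {F K : Type} [Field F] [Field K] (φ : F →+* K) (n) : ∀ u, G F n u → G K n (K2.map φ u) := by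
  induction n with
  | zero => exact fun u h => D_map φ h
  | succ n ih =>
    rintro _ ⟨a, b, v, ha, hb, hv, rfl⟩
    exact ⟨φ a, φ b, K2.map φ v, by simpa, by simpa, ih v hv, by rw [map_add, K2.map_st]⟩
theorem G_st {F : Type} [Field F] {a b : F} (ha : a ≠ 0) (hb : b ≠ 0) (u : K2 F) : (∃ n, G F n u) → ∃ n, G F n (u + st a b) := fun ⟨n, h⟩ => ⟨n + 1, a, b, u, ha, hb, h, rfl⟩
theorem G_all {F : Type} [Field F] (u : K2 F) : ∃ n, G F n u := by
  have : ∀ u v : K2 F, (∃ n, G F n v) → ∃ n, G F n (v + u) := by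
    intro u
    induction u using K2.ind with
    | h0 => simp
    | h1 x y hx hy => exact fun v => G_st hx hy v
    | ha x y h h' => exact fun v hv => by rw [← add_assoc]; exact h' _ (h _ hv)
    | hn x h =>
      intro v hv
      obtain ⟨n, hn⟩ := h _ hv
      refine ⟨n, ?_⟩
      have e : v + -x = v + x + -(x + x) := by abel
      rw [e]
      generalize v + x = w at hn
      clear hv e
      have d := neg_mem (D_add x)
      induction n generalizing w with
      | zero => exact add_mem hn d
      | succ n ih =>
        obtain ⟨a, b, z, ha, hb, hz, rfl⟩ := hn
        exact ⟨a, b, _, ha, hb, ih z hz, by abel⟩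
  have := this u 0 ⟨0, zero_mem _⟩
  rwa [zero_add] at this
theorem inj_n (n : ℕ) : ∀ (F : Type) [Field F] (h2 : (2:F) ≠ 0) (u : K2 F), G F n u → H h2 u = 1 → u ∈ DD F := by
  induction n with
  | zero => exact fun F _ h2 u h _ => h
  | succ n ih =>
    rintro F _ h2 _ ⟨a, b, v, ha, hb, hv, rfl⟩ hu
    by_cases hz : ∃ x y, b = x ^ 2 - a * y ^ 2
    · obtain ⟨x, y, e⟩ := hz
      have d := D_n h2 ha hb e
      exact add_mem (ih F h2 v hv (by rwa [H_add, H_D h2 d, mul_one] at hu)) d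
    have hs : ∀ s, a ≠ s ^ 2 := fun s e => hz (sqn h2 (by rintro rfl; simp [ha] at e) e)
    push Not at hz
    haveI := qaf hs
    let φ := algebraMap F (QA a)
    let σ := starRingEnd (QA a)
    have k2 : (2 : QA a) ≠ 0 := by have := (map_ne_zero φ).2 h2; rwa [map_ofNat] at this
    let Q : Qd (QA a) := ⟨σ, star_star, QuadraticAlgebra.omega, fun h => by simpa using congrArg QuadraticAlgebra.im h,
      by ext <;> simp [σ, starRingEnd_apply], k2, φ b, (map_ne_zero φ).2 hb, by ext <;> simp [σ, φ, starRingEnd_apply]⟩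
    have qF : ∀ x, x ∈ Q.F ↔ x.im = 0 := fun x => by
      rw [Qd.mem_F]
      constructor
      · intro h
        have := congrArg QuadraticAlgebra.im h
        simp [Q, σ, starRingEnd_apply] at this
        have : 2 * x.im = 0 := by linear_combination -this
        simpa [h2] using this
      · intro h
        ext <;> simp [Q, σ, h, starRingEnd_apply]
    let ψ : F →+* Q.F := φ.codRestrict Q.F fun x => (qF _).2 (by simp [φ])
    let χ : Q.F →+* F := { toFun := fun x => (x : QA a).re, map_one' := QuadraticAlgebra.re_one, map_zero' := by simp, map_add' := by simp,
                           map_mul' := fun x y => by simp [(qF _).1 x.2] }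
    have χψ : χ.comp ψ = RingHom.id F := by ext x; simp [χ, ψ, φ]
    have hN : Q.NN := fun x e => hz x.re x.im (by
      have := congrArg QuadraticAlgebra.re e
      simp [Q, σ, φ, starRingEnd_apply] at this
      linear_combination -this)
    haveI := Q.pid hN
    have aa : ψ a = Q.a := Subtype.ext (by ext <;> simp [ψ, φ, Qd.a, Q, pow_two])
    have bb : ψ b = Q.bF := rfl
    let j := Q.jF.comp ψ
    have j2 : (2 : Q.K) ≠ 0 := by have := (map_ne_zero j).2 h2; rwa [map_ofNat] at this
    have dK : K2.map j (st a b) ∈ DD Q.K := by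
      rw [K2.map_st]
      refine D_n (x := (Q.cn hN).y) (y := (Q.cn hN).t) j2 (by simpa) (by simpa) ?_
      have := (Q.cn hN).h
      rw [show j a = (Q.cn hN).ι Q.a from congrArg Q.jF aa]
      exact this.symm
    have Hα := congrArg (bc ψ) hu
    rw [map_one, H_bc h2 Q.twoF] at Hα
    set α := K2.map ψ (v + st a b) with hα
    obtain ⟨γ, hγ⟩ : K2.map Q.jF α ∈ DD Q.K := by
      rw [hα, K2.map_map, map_add]
      refine add_mem (ih Q.K j2 _ (G_map _ n _ hv) ?_) dK
      have := congrArg (bc j) hu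
      rwa [map_one, H_bc h2 j2, map_add, H_add, H_D j2 dK, mul_one] at this
    suffices α ∈ DD Q.F by
      have := D_map χ this
      rwa [hα, K2.map_map, χψ, K2.map_id] at this
    have T : ∀ z, K2.map Q.jF z = 0 → ∃ c, c ≠ 0 ∧ z = st (-1) c := fun z hz => torsion Q.twoF (Q.kr hz)
    obtain ⟨y, h | ⟨U, V, hU, hV, h⟩⟩ := Q.caseK hN (hγ.trans (two_nsmul γ).symm)
    · obtain ⟨c, hc, e⟩ := T (α - 2 • y) (by rw [map_sub, h, sub_self])
      have k : α - st (-1) c ∈ DD Q.F := by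
        rw [← e, two_nsmul]; convert D_add y using 1; abel
      exact D_of k (D_st Q.twoF (by simp) hc (by rw [← H_of Q.twoF k, Hα]))
    · obtain ⟨c, hc, e⟩ := T (α - (2 • y - st V U)) (by rw [map_sub, h, sub_self])
      have k : α - (st (-1) c + st V U) ∈ DD Q.F := by
        rw [← e, two_nsmul]; convert sub_mem (D_add y) (D_add (st V U)) using 1; abel
      exact D_of k (fin2 Q.twoF hc hV hU (by rw [← H_of Q.twoF k, Hα]))
theorem inj {F : Type} [Field F] (h2 : (2:F) ≠ 0) {u : K2 F} (h : H h2 u = 1) : u ∈ DD F := by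
  obtain ⟨n, hn⟩ := G_all u
  exact inj_n n F h2 u hn h
end Mk

namespace Mk
open scoped TensorProduct Quaternion
open CliffordAlgebra (ι)
theorem nma {R : Type*} [Ring R] (a b c : R) : -(a * b) * c = -(a * (b * c)) := by rw [neg_mul, mul_assoc]
section
variable {F V : Type} [Field F] [AddCommGroup V] [Module F V] {x y : F} (hx : x ≠ 0) (hy : y ≠ 0)
  (Q : QuadraticForm F (F × F × V)) (Q' : QuadraticForm F V) (h : ∀ s t v, Q (s, t, v) = x * s ^ 2 + y * t ^ 2 - x * y * Q' v)
theorem cl_br (hx : x ≠ 0) (hy : y ≠ 0) (h : ∀ s t v, Q (s, t, v) = x * s ^ 2 + y * t ^ 2 - x * y * Q' v) :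
    (br (CliffordAlgebra Q) : B F) = br ℍ[F,x,y] * br (CliffordAlgebra Q') := by
  have sw : ∀ u v, QuadraticMap.polar Q u v = 0 → ι Q v * ι Q u = -(ι Q u * ι Q v) := fun u v e => by
    have := CliffordAlgebra.ι_mul_ι_add_swap (Q := Q) v u
    rw [QuadraticMap.polar_comm, e, map_zero] at this
    exact eq_neg_of_add_eq_zero_left this
  let e0 := ι Q (1, 0, 0)
  let e1 := ι Q (0, 1, 0)
  let ev := fun v => ι Q (0, 0, v)
  have s10 : e1 * e0 = -(e0 * e1) := sw _ _ (by simp [QuadraticMap.polar, h])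
  have sv0 : ∀ v, ev v * e0 = -(e0 * ev v) := fun v => sw _ _ (by simp [QuadraticMap.polar, h])
  have sv1 : ∀ v, ev v * e1 = -(e1 * ev v) := fun v => sw _ _ (by simp [QuadraticMap.polar, h])
  have q0 : e0 * e0 = algebraMap F _ x := by rw [CliffordAlgebra.ι_sq_scalar, h]; simp
  have q1 : e1 * e1 = algebraMap F _ y := by rw [CliffordAlgebra.ι_sq_scalar, h]; simp
  have qv : ∀ v, ev v * ev v = algebraMap F _ (-(x * y) * Q' v) := fun v => by rw [CliffordAlgebra.ι_sq_scalar, h]; simp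
  let f : ℍ[F,x,y] →ₐ[F] CliffordAlgebra Q := ql q0 q1 s10
  have w2 : (e0 * e1) * (e0 * e1) = algebraMap F _ (-(x * y)) := by
    rw [mul_assoc, ← mul_assoc e1, s10, map_neg, map_mul, ← q0, ← q1]; noncomm_ring
  have w0 : (e0 * e1) * e0 = -(e0 * (e0 * e1)) := by rw [mul_assoc, s10]; noncomm_ring
  have w1 : (e0 * e1) * e1 = -(e1 * (e0 * e1)) := by rw [← mul_assoc e1, s10]; noncomm_ring
  have wv : ∀ v, ev v * (e0 * e1) = (e0 * e1) * ev v := fun v => by rw [← mul_assoc, sv0, neg_mul, mul_assoc, sv1]; noncomm_ring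
  have xy : -(x * y) ≠ 0 := neg_ne_zero.2 (mul_ne_zero hx hy)
  let g : CliffordAlgebra Q' →ₐ[F] CliffordAlgebra Q := CliffordAlgebra.lift Q'
    ⟨(-(x * y))⁻¹ • (LinearMap.mulLeft F (e0 * e1) ∘ₗ ι Q ∘ₗ LinearMap.inr F F (F × V) ∘ₗ LinearMap.inr F F V), fun v => by
      change ((-(x * y))⁻¹ • (e0 * e1 * ev v)) * ((-(x * y))⁻¹ • (e0 * e1 * ev v)) = _
      rw [smul_mul_smul_comm, mul_assoc, ← mul_assoc (ev v), wv, mul_assoc (e0 * e1), qv, ← mul_assoc, w2, ← map_mul, Algebra.smul_def, ← map_mul]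
      congr 1; field_simp⟩
  have gv : ∀ v, g (ι Q' v) = (-(x * y))⁻¹ • (e0 * e1 * ev v) := fun v => by simp only [g, CliffordAlgebra.lift_ι_apply]; rfl
  have fi : f qi = e0 := ql_i _ _ _
  have fj : f qj = e1 := ql_j _ _ _
  have cm : ∀ a b, Commute (f a) (g b) := fun a b => by
    induction b using CliffordAlgebra.induction with
    | algebraMap r => rw [AlgHom.commutes]; exact (Algebra.commutes _ _).symm
    | add b c hb hc => rw [map_add]; exact hb.add_right hc
    | mul b c hb hc => rw [map_mul g]; exact hb.mul_right hc
    | ι v =>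
      rw [gv]
      refine (q_com f ?_ ?_ a).smul_right _
      · rw [fi, Commute, SemiconjBy, mul_assoc (e0 * e1) (ev v), sv0, mul_neg, ← mul_assoc (e0 * e1) e0, w0, neg_mul, neg_neg, mul_assoc e0 (e0 * e1)]
      · rw [fj, Commute, SemiconjBy, mul_assoc (e0 * e1) (ev v), sv1, mul_neg, ← mul_assoc (e0 * e1) e1, w1, neg_mul, neg_neg, mul_assoc e1 (e0 * e1)]
  let κ : ℍ[F,x,y] := qi * qj
  have k2 : κ * κ = algebraMap F _ (-(x * y)) := by simp only [κ]; rw [mul_assoc, ← mul_assoc qj, qji, map_neg, map_mul, ← qii (b := y), ← qjj (a := x)]; noncomm_ring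
  have k0 : κ * qi = -(qi * κ) := by simp only [κ]; rw [mul_assoc, qji]; noncomm_ring
  have k1 : κ * qj = -(qj * κ) := by simp only [κ]; rw [← mul_assoc qj, qji]; noncomm_ring
  let i1 : ℍ[F,x,y] →ₐ[F] ℍ[F,x,y] ⊗[F] CliffordAlgebra Q' := Algebra.TensorProduct.includeLeft
  let i2 : CliffordAlgebra Q' →ₐ[F] ℍ[F,x,y] ⊗[F] CliffordAlgebra Q' := Algebra.TensorProduct.includeRight
  have ic : ∀ a b, i2 b * i1 a = i1 a * i2 b := fun a b => by simp [i1, i2]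
  let p : CliffordAlgebra Q →ₐ[F] ℍ[F,x,y] ⊗[F] CliffordAlgebra Q' := CliffordAlgebra.lift Q
    ⟨(LinearMap.toSpanSingleton F _ (i1 qi)) ∘ₗ LinearMap.fst F F (F × V) + ((LinearMap.toSpanSingleton F _ (i1 qj)) ∘ₗ LinearMap.fst F F V
      + LinearMap.mulLeft F (i1 κ) ∘ₗ i2.toLinearMap ∘ₗ ι Q' ∘ₗ LinearMap.snd F F V) ∘ₗ LinearMap.snd F F (F × V), fun ⟨s, t, v⟩ => by
      change (s • i1 qi + (t • i1 qj + i1 κ * i2 (ι Q' v))) * (s • i1 qi + (t • i1 qj + i1 κ * i2 (ι Q' v))) = _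
      have a1 : i1 qi * i1 qi = algebraMap F _ x := by rw [← map_mul, qii, AlgHom.commutes]
      have a2 : i1 qj * i1 qj = algebraMap F _ y := by rw [← map_mul, qjj, AlgHom.commutes]
      have a3 : i1 qj * i1 qi = -(i1 qi * i1 qj) := by rw [← map_mul, qji, map_neg, map_mul i1]
      have a4 : (i1 κ * i2 (ι Q' v)) * (i1 κ * i2 (ι Q' v)) = algebraMap F _ (-(x * y) * Q' v) := by
        rw [mul_assoc, ← mul_assoc (i2 _), ic, mul_assoc (i1 κ), ← map_mul i2, CliffordAlgebra.ι_sq_scalar, ← mul_assoc, ← map_mul i1, k2, AlgHom.commutes, AlgHom.commutes, map_mul]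
      have a5 : (i1 κ * i2 (ι Q' v)) * i1 qi = -(i1 qi * (i1 κ * i2 (ι Q' v))) := by
        rw [mul_assoc, ic, ← mul_assoc, ← map_mul i1, k0, map_neg, map_mul i1]; exact nma _ _ _
      have a6 : (i1 κ * i2 (ι Q' v)) * i1 qj = -(i1 qj * (i1 κ * i2 (ι Q' v))) := by
        rw [mul_assoc, ic, ← mul_assoc, ← map_mul i1, k1, map_neg, map_mul i1]; exact nma _ _ _
      rw [h]
      generalize i1 κ * i2 (ι Q' v) = z at *
      simp only [add_mul, mul_add, smul_mul_assoc, mul_smul_comm, a1, a2, a3, a4, a5, a6]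
      rw [show x * s ^ 2 + y * t ^ 2 - x * y * Q' v = s * (s * x) + t * (t * y) + -(x * y) * Q' v by ring, map_add, map_add, map_mul _ s, map_mul _ s, map_mul _ t, map_mul _ t]
      simp only [← Algebra.smul_def]
      module⟩
  have pv : ∀ s t v, p (ι Q (s, t, v)) = s • i1 qi + (t • i1 qj + i1 κ * i2 (ι Q' v)) := fun s t v => by
    simp only [p, CliffordAlgebra.lift_ι_apply]; rfl
  let t := Algebra.TensorProduct.lift f g cm
  have ti : ∀ a, t (i1 a) = f a := fun a => by simp [t, i1]
  have ti2 : ∀ a, t (i2 a) = g a := fun a => by simp [t, i2]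
  refine br_i (AlgEquiv.ofAlgHom p t ?_ ?_)
  · have p0 : p e0 = i1 qi := by rw [pv]; simp
    have p1 : p e1 = i1 qj := by rw [pv]; simp
    have pe : ∀ v, p (ev v) = i1 κ * i2 (ι Q' v) := fun v => by rw [pv]; simp
    refine Algebra.TensorProduct.ext ?_ ?_
    · apply QuaternionAlgebra.hom_ext
      · change p (t (i1 qi)) = i1 qi; rw [ti, fi, p0]
      · change p (t (i1 qj)) = i1 qj; rw [ti, fj, p1]
    · apply CliffordAlgebra.hom_ext
      ext v
      change p (t (i2 (ι Q' v))) = i2 (ι Q' v)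
      rw [ti2, gv, map_smul, map_mul, map_mul, p0, p1, pe, ← map_mul i1, ← mul_assoc, ← map_mul i1, k2, AlgHom.commutes, ← Algebra.smul_def, inv_smul_smul₀ xy]
  · apply CliffordAlgebra.hom_ext
    refine LinearMap.ext fun ⟨s, u, v⟩ => ?_
    change t (p (ι Q (s, u, v))) = ι Q (s, u, v)
    rw [pv, map_add, map_add, map_smul, map_smul, map_mul, ti, ti, ti, ti2, fi, fj, gv, map_mul, fi, fj, mul_smul_comm, ← mul_assoc, w2, ← Algebra.smul_def, inv_smul_smul₀ xy,
      ← map_smul, ← map_smul, ← map_add, ← map_add]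
    simp
end
end Mk

namespace Mk
open scoped Quaternion
section
variable {F : Type} [Field F]
noncomputable def xi : F → List F → K2 F
  | c, x :: y :: l => st (c * x) (c * y) + xi (-(c * x * y)⁻¹) l
  | _, _ => 0
def dl : List F → F
  | x :: y :: l => -(x * y) * dl l
  | _ => 1
theorem two_ind {P : List F → Prop} (h0 : P []) (h : ∀ x y l, x ≠ 0 → y ≠ 0 → Even l.length → (∀ z ∈ l, z ≠ 0) → P l → P (x :: y :: l)) :
    ∀ l : List F, Even l.length → (∀ z ∈ l, z ≠ 0) → P l
  | [], _, _ => h0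
  | [x], e, _ => by simp at e
  | x :: y :: l, e, n => by
    have e' : Even l.length := by simpa [Nat.even_add_one] using e
    have n' : ∀ z ∈ l, z ≠ 0 := fun z hz => n z (by simp [hz])
    exact h x y l (n x (by simp)) (n y (by simp)) e' n' (two_ind h0 h l e' n')
theorem dl_ne (l : List F) (he : Even l.length) (hl : ∀ z ∈ l, z ≠ 0) : dl l ≠ 0 := by
  refine two_ind (P := fun l => dl l ≠ 0) (by simp [dl]) (fun x y l hx hy _ _ h => ?_) l he hl
  simp [dl, hx, hy, h]
theorem dl_prod (l : List F) (he : Even l.length) (hl : ∀ z ∈ l, z ≠ 0) : dl l = (-1) ^ (l.length / 2) * l.prod := by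
  refine two_ind (P := fun l => dl l = (-1) ^ (l.length / 2) * l.prod) (by simp [dl]) (fun x y l hx hy _ _ h => ?_) l he hl
  rw [dl, h]
  simp only [List.length_cons, List.prod_cons]
  rw [show (l.length + 1 + 1) / 2 = l.length / 2 + 1 by lia, pow_succ]; ring
theorem cl_iso {ι κ : Type} [Fintype ι] [Fintype κ] {d : ι → F} {e : κ → F} (h : FormIsom F d e) :
    (br (CliffordAlgebra (diagQF F d)) : B F) = br (CliffordAlgebra (diagQF F e)) :=
  br_i (CliffordAlgebra.equivOfIsometry h.some)
theorem cl_nil (V : Type) [AddCommGroup V] [Module F V] [Subsingleton V] (Q : QuadraticForm F V) : (br (CliffordAlgebra Q) : B F) = 1 := by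
  rw [← br_one]
  refine br_i (AlgEquiv.ofAlgHom (CliffordAlgebra.lift Q ⟨0, fun m => by simp [Subsingleton.elim m 0]⟩) (Algebra.ofId F _) ?_ ?_)
  · ext
  · apply CliffordAlgebra.hom_ext
    ext v
    simp [Subsingleton.elim v 0]
theorem cl_xi (h2 : (2:F) ≠ 0) (l : List F) (he : Even l.length) (hl : ∀ z ∈ l, z ≠ 0) :
    ∀ c : F, c ≠ 0 → br (CliffordAlgebra (diagQF F (fun i : Fin l.length => c * l.get i))) = H h2 (xi c l) := by
  refine two_ind (P := fun l => ∀ c : F, c ≠ 0 → br (CliffordAlgebra (diagQF F (fun i : Fin l.length => c * l.get i))) = H h2 (xi c l))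
    (fun c hc => ?_) (fun x y l hx hy _ _ ih c hc => ?_) l he hl
  · rw [xi, H_zero]
    haveI : Subsingleton (Fin ([] : List F).length → F) := inferInstanceAs (Subsingleton (Fin 0 → F))
    · exact cl_nil _ _
    all_goals simp
  · have hx' := mul_ne_zero hc hx
    have hy' := mul_ne_zero hc hy
    rw [xi, H_add, H_st h2 hx' hy', ← ih (-(c * x * y)⁻¹) (neg_ne_zero.2 (inv_ne_zero (mul_ne_zero hx' hy)))]
    let E : (F × F × (Fin l.length → F)) ≃ₗ[F] (Fin (l.length + 1 + 1) → F) :=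
      (LinearEquiv.prodCongr (LinearEquiv.refl F F) (Fin.consLinearEquiv F (fun _ : Fin (l.length + 1) => F))).trans (Fin.consLinearEquiv F (fun _ : Fin (l.length + 1 + 1) => F))
    let Q := diagQF F (fun i : Fin (l.length + 1 + 1) => c * (x :: y :: l).get i)
    rw [← cl_br (Q.comp E.toLinearMap) _ hx' hy']
    · exact (br_i (CliffordAlgebra.equivOfIsometry ⟨E, fun m => rfl⟩)).symm
    · intro s t v
      change Q (Fin.cons s (Fin.cons t v : Fin (l.length + 1) → F) : Fin (l.length + 1 + 1) → F) = _
      simp only [Q, diagQF, QuadraticMap.weightedSumSquares_apply, Fin.sum_univ_succ (n := l.length + 1), Fin.sum_univ_succ (n := l.length), Fin.cons_zero, Fin.cons_succ, smul_eq_mul, Finset.mul_sum]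
      rw [← add_assoc, sub_eq_add_neg, ← Finset.sum_neg_distrib]
      congr 1
      · simp; ring
      · refine Finset.sum_congr rfl fun i _ => ?_
        simp; field_simp
theorem st_scale {w a : F} (hw : w ≠ 0) (ha : a ≠ 0) : st w (w * a) = st w (-a) := by
  rw [st_mul_right w hw ha, st_self, neg_eq_neg_one_mul a, st_mul_right w (by simp) ha]
theorem D_sq {a b : F} (t : F) (hb : b ≠ 0) (ht : t ≠ 0) : st (b * t ^ 2) a - st b a ∈ DD F := by
  rw [st_mul_left a hb (pow_ne_zero 2 ht), add_sub_cancel_left, sq, st_mul_left a ht ht]; exact D_add _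
theorem D_sq' {a b : F} (t : F) (hb : b ≠ 0) (ht : t ≠ 0) : st a (b * t ^ 2) - st a b ∈ DD F := by
  rw [st_mul_right a hb (pow_ne_zero 2 ht), add_sub_cancel_left, sq, st_mul_right a ht ht]; exact D_add _
theorem xi_c (l : List F) (he : Even l.length) (hl : ∀ z ∈ l, z ≠ 0) :
    ∀ c e : F, c ≠ 0 → e ≠ 0 → xi (c * e) l - xi c l - st e (dl l) ∈ DD F := by
  refine two_ind (P := fun l => ∀ c e : F, c ≠ 0 → e ≠ 0 → xi (c * e) l - xi c l - st e (dl l) ∈ DD F)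
    (fun c e hc he => by simp [xi, dl, st_one_right]) (fun x y l hx hy el nl ih c e hc he => ?_) l he hl
  have hx' := mul_ne_zero hc hx
  have hy' := mul_ne_zero hc hy
  have n1 : (-1 : F) ≠ 0 := by simp
  have i1 := ih (-(c * x * y)⁻¹) e⁻¹ (neg_ne_zero.2 (inv_ne_zero (mul_ne_zero hx' hy))) (inv_ne_zero he)
  rw [show -(c * x * y)⁻¹ * e⁻¹ = -(c * e * x * y)⁻¹ by field_simp, st_inv_left] at i1
  simp only [xi, dl]
  rw [show c * e * x = e * (c * x) by ring, show c * e * y = e * (c * y) by ring, st_mul_left _ he hx', st_mul_right _ he hy', st_mul_right _ he hy',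
    st_mul_right e (neg_ne_zero.2 (mul_ne_zero hx hy)) (dl_ne l el nl), neg_eq_neg_one_mul (x * y), st_mul_right e n1 (mul_ne_zero hx hy), st_mul_right e hx hy, st_self,
    st_mul_right e hc hy, st_anti (c * x) e, st_mul_right e hc hx]
  have a1 := D_add (-st e (dl l) - st e x)
  convert add_mem i1 a1 using 1
  rw [show e * (c * x) * y = c * e * x * y by ring]
  abel
theorem xi_two {s1 s2 t : F} (l : List F) (he : Even l.length) (hl : ∀ z ∈ l, z ≠ 0) (h1 : s1 ≠ 0) (h2 : s2 ≠ 0) (h : -(s1 * s2) * dl l = t ^ 2) :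
    xi 1 (s1 :: s2 :: l) - xi 1 l - st (-s1) (dl l) ∈ DD F := by
  have hd := dl_ne l he hl
  have n1 : (-1 : F) ≠ 0 := by simp
  have ht : t ≠ 0 := fun e => by rw [e] at h; simp [h1, h2, hd] at h
  have i1 := xi_c l he hl 1 (-(s1 * s2)⁻¹) one_ne_zero (neg_ne_zero.2 (inv_ne_zero (mul_ne_zero h1 h2)))
  rw [one_mul] at i1
  have e1 : -(s1 * s2)⁻¹ = dl l * (t⁻¹) ^ 2 := by rw [inv_pow, ← h]; field_simp
  have e2 : s2 = (s1 * -dl l) * (t / s1 / dl l) ^ 2 := by rw [div_pow, div_pow, ← h]; field_simp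
  have i2 := D_sq (a := dl l) t⁻¹ hd (inv_ne_zero ht)
  rw [← e1] at i2
  have i3 := D_sq' (a := s1) (b := s1 * -dl l) (t / s1 / dl l) (mul_ne_zero h1 (neg_ne_zero.2 hd)) (by simp [*])
  rw [← e2, st_scale h1 (neg_ne_zero.2 hd), neg_neg] at i3
  rw [st_self, st_anti (dl l) (-1)] at i2
  simp only [xi, one_mul]
  rw [neg_eq_neg_one_mul s1, st_mul_left _ n1 h1]
  convert add_mem (add_mem (add_mem i1 i2) i3) (D_add (-st (-1) (dl l))) using 1
  abel
def NN (l : List F) : Prop := Even l.length ∧ (∀ z ∈ l, z ≠ 0) ∧ (∀ c, c ≠ 0 → xi c l ∈ DD F) ∧ ∃ t, dl l = t ^ 2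
theorem NN_nil : NN ([] : List F) := ⟨by simp, by simp, fun c _ => by simp [xi, zero_mem], 1, by simp [dl]⟩
theorem NN_hyp {l : List F} (h : NN l) : NN (1 :: -1 :: l) := by
  obtain ⟨a, b, c, t, d⟩ := h
  refine ⟨by simpa [Nat.even_add_one] using a, by simpa using b, fun e he => ?_, t, by rw [dl, d]; ring⟩
  rw [xi, mul_one, mul_neg_one, st_self_neg, zero_add]
  exact c _ (by simpa using he)
theorem NN_pf {l : List F} (h : NN l) {c a b e : F} (hc : c ≠ 0) (ha : a ≠ 0) (hb : b ≠ 0) (he : e ≠ 0) :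
    NN (c :: c * a :: c * b :: c * b * a :: c * e :: c * e * a :: c * b * e :: c * b * e * a :: l) := by
  obtain ⟨k1, k2, k3, t, k4⟩ := h
  refine ⟨by simpa [Nat.even_add_one] using k1, by simp [*]; exact k2, fun γ hγ => ?_, c ^ 4 * a ^ 2 * b ^ 2 * e ^ 2 * t, by simp only [dl]; rw [k4]; ring⟩
  simp only [xi]
  have hn := neg_ne_zero.2 ha
  simp only [← mul_assoc]
  have z1 : γ * c ≠ 0 := by simp [*]
  generalize e2 : (-(γ * c * c * a)⁻¹) = γ2
  have y2 : γ2 ≠ 0 := by rw [← e2]; simp [*]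
  generalize e3 : (-(γ2 * c * b * c * b * a)⁻¹) = γ3
  have y3 : γ3 ≠ 0 := by rw [← e3]; simp [*]
  generalize e4 : (-(γ3 * c * e * c * e * a)⁻¹) = γ4
  have y4 : γ4 ≠ 0 := by rw [← e4]; simp [*]
  have w2 : γ2 * c * b ≠ 0 := by simp [*]
  have w3 : γ3 * c * e ≠ 0 := by simp [*]
  have w4 : γ4 * c * b * e ≠ 0 := by simp [*]
  rw [st_scale z1 ha, st_scale w2 ha, st_scale w3 ha, st_scale w4 ha]
  refine D_of (v := xi (-(γ4 * c * b * e * c * b * e * a)⁻¹) l) ?_ (k3 _ (by simp [*]))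
  have := D_sq (a := -a) (b := 1) (c * b * e / (c * a * c * e)  * c) one_ne_zero (by simp [*])
  rw [st_one_left, show 1 * (c * b * e / (c * a * c * e)  * c) ^ 2 = γ * c * (γ2 * c * b) * ((γ3 * c * e) * (γ4 * c * b * e)) by
    rw [← e4, ← e2]; field_simp, st_mul_left _ (mul_ne_zero z1 w2) (mul_ne_zero w3 w4), st_mul_left _ z1 w2, st_mul_left _ w3 w4] at this
  convert this using 1
  abel
end
end Mk

namespace Mk
open scoped Quaternion
section
variable {F : Type} [Field F] {ι κ ι' κ' : Type} [Fintype ι] [Fintype κ] [Fintype ι'] [Fintype κ']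
theorem dq_apply (d : ι → F) (v : ι → F) : diagQF F d v = ∑ i, d i * (v i * v i) := by
  simp [diagQF, QuadraticMap.weightedSumSquares_apply]
theorem fi_re {d : ι → F} {e : κ → F} (f : ι ≃ κ) (h : ∀ i, e (f i) = d i) : FormIsom F d e := by
  refine ⟨⟨LinearEquiv.funCongrLeft F F f.symm, fun v => ?_⟩⟩
  change diagQF F e (fun j => v (f.symm j)) = _
  rw [dq_apply, dq_apply, ← f.sum_comp]
  simp [h]
theorem fi_ms {d : ι → F} {e : κ → F} (h : Finset.univ.val.map d = Finset.univ.val.map e) : FormIsom F d e := by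
  classical
  have (c : F) : Fintype.card {a // d a = c} = Fintype.card {b // e b = c} := by
    have := congrArg (Multiset.count c) h
    rw [Multiset.count_map, Multiset.count_map] at this
    rw [Fintype.card_subtype, Fintype.card_subtype]
    simp only [eq_comm (b := c)]
    exact this
  exact fi_re (Equiv.ofFiberEquiv fun c => Fintype.equivOfCardEq (this c)) (Equiv.ofFiberEquiv_map _)
theorem fi_sum {d : ι → F} {e : κ → F} {d' : ι' → F} {e' : κ' → F} (h : FormIsom F d e) (h' : FormIsom F d' e') :
    FormIsom F (Sum.elim d d') (Sum.elim e e') := by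
  obtain ⟨f⟩ := h
  obtain ⟨f'⟩ := h'
  refine ⟨⟨(LinearEquiv.sumArrowLequivProdArrow ι ι' F F).trans ((LinearEquiv.prodCongr f.toLinearEquiv f'.toLinearEquiv).trans (LinearEquiv.sumArrowLequivProdArrow κ κ' F F).symm), fun v => ?_⟩⟩
  change diagQF F (Sum.elim e e') (Sum.elim (f (fun i => v (Sum.inl i))) (f' (fun i => v (Sum.inr i)))) = _
  have a := f.map_app (fun i => v (Sum.inl i))
  have b := f'.map_app (fun i => v (Sum.inr i))
  rw [dq_apply] at a b ⊢
  rw [dq_apply] at a b ⊢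
  rw [Fintype.sum_sum_type, Fintype.sum_sum_type]
  simp only [Sum.elim_inl, Sum.elim_inr]
  rw [a, b]
theorem fi_det (h2 : (2:F) ≠ 0) {d : ι → F} {e : κ → F} (h : FormIsom F d e) : Fintype.card ι = Fintype.card κ ∧ ∃ t, ∏ i, d i = t ^ 2 * ∏ i, e i := by
  classical
  have hc : Fintype.card ι = Fintype.card κ := by
    obtain ⟨f⟩ := h
    simpa using f.toLinearEquiv.finrank_eq
  refine ⟨hc, ?_⟩
  let g := Fintype.equivOfCardEq hc
  have h' : FormIsom F d (e ∘ g) := h.trans (fi_re g.symm (by simp))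
  obtain ⟨f⟩ := h'
  haveI : Invertible (2 : F) := invertibleOfNonzero h2
  have key (w : ι → F) : QuadraticForm.discr' (diagQF F w) = ∏ i, w i := by
    rw [QuadraticForm.discr', ← Matrix.det_diagonal]
    congr 1
    ext i j
    rw [QuadraticForm.toMatrix', LinearMap.toMatrix₂'_apply, Matrix.diagonal_apply]
    refine mul_left_cancel₀ h2 ((?_ : _ = QuadraticMap.polar (diagQF F w) (Pi.single i 1) (Pi.single j 1)).trans ?_)
    · have := LinearMap.congr_fun₂ (QuadraticMap.two_nsmul_associated F (diagQF F w)) (Pi.single i 1) (Pi.single j 1)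
      rw [← QuadraticMap.polarBilin_apply_apply, ← this]; simp [two_mul, two_nsmul]
    rw [QuadraticMap.polar]
    simp only [dq_apply, ← Finset.sum_sub_distrib, Pi.add_apply]
    rw [Finset.sum_eq_single i]
    · by_cases hij : i = j
      · subst hij; simp; ring
      · simp [hij]
    · intro b _ hb; simp [hb, Pi.single_apply]
    · simp
  refine ⟨(LinearMap.toMatrix' (f.toLinearEquiv : (ι → F) →ₗ[F] ι → F)).det, ?_⟩
  rw [← key, ← g.prod_comp e, show ∏ i, e (g i) = ∏ i, (e ∘ g) i from rfl, ← key, sq, ← QuadraticForm.discr'_comp]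
  congr 1
  ext v
  exact (f.map_app v).symm
theorem fi_two {x y z w α β γ δ : F} (hd : α * δ - β * γ ≠ 0) (h : ∀ s t, z * (α * s + β * t) ^ 2 + w * (γ * s + δ * t) ^ 2 = x * s ^ 2 + y * t ^ 2) :
    FormIsom F ![x, y] ![z, w] := by
  refine ⟨⟨Matrix.toLinearEquiv' !![α, β; γ, δ] ((Matrix.isUnit_iff_isUnit_det _).2 (by rw [Matrix.det_fin_two_of]; exact hd.isUnit)).invertible, fun v => ?_⟩⟩
  change diagQF F ![z, w] (Matrix.mulVec !![α, β; γ, δ] v) = _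
  rw [dq_apply, dq_apply, Fin.sum_univ_two, Fin.sum_univ_two]
  simp [Matrix.mulVec, dotProduct, Fin.sum_univ_two]
  linear_combination h (v 0) (v 1)
end
end Mk

namespace Mk
section
variable {F : Type} [Field F]
def Iso (M N : Multiset F) : Prop := FormIsom F M.toList.get N.toList.get
theorem uv_get (l : List F) : Finset.univ.val.map l.get = (l : Multiset F) := by rw [Fin.univ_val_map, List.ofFn_get]
theorem uv_fm (M : Multiset F) : Finset.univ.val.map M.toList.get = M := by rw [uv_get, Multiset.coe_toList]
theorem iso_iff {ι κ : Type} [Fintype ι] [Fintype κ] {d : ι → F} {e : κ → F} {M N : Multiset F} (h : Finset.univ.val.map d = M) (h' : Finset.univ.val.map e = N) :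
    FormIsom F d e ↔ Iso M N :=
  have a : FormIsom F d M.toList.get := fi_ms (by rw [h, uv_fm])
  have b : FormIsom F e N.toList.get := fi_ms (by rw [h', uv_fm])
  ⟨fun q => (a.symm.trans q).trans b, fun q => (a.trans q).trans b.symm⟩
theorem uv_sum {ι κ : Type} [Fintype ι] [Fintype κ] (d : ι → F) (e : κ → F) :
    Finset.univ.val.map (Sum.elim d e) = Finset.univ.val.map d + Finset.univ.val.map e := by
  change Multiset.map _ (Multiset.disjSum _ _) = _; simp [Multiset.disjSum]
theorem iso_refl (M : Multiset F) : Iso M M := QuadraticMap.Equivalent.refl _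
theorem iso_symm {M N : Multiset F} (h : Iso M N) : Iso N M := QuadraticMap.Equivalent.symm h
theorem iso_trans {M N P : Multiset F} (h : Iso M N) (h' : Iso N P) : Iso M P := QuadraticMap.Equivalent.trans h h'
theorem iso_add {M N M' N' : Multiset F} (h : Iso M N) (h' : Iso M' N') : Iso (M + M') (N + N') :=
  (iso_iff (by rw [uv_sum, uv_fm, uv_fm]) (by rw [uv_sum, uv_fm, uv_fm])).1 (fi_sum h h')
theorem iso_two {x y z w α β γ δ : F} (hd : α * δ - β * γ ≠ 0) (h : ∀ s t, z * (α * s + β * t) ^ 2 + w * (γ * s + δ * t) ^ 2 = x * s ^ 2 + y * t ^ 2) :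
    Iso {x, y} {z, w} := (iso_iff (by rw [Fin.univ_val_map]; simp; rfl) (by rw [Fin.univ_val_map]; simp; rfl)).1 (fi_two hd h)
variable (F) in
def vm : Multiset Fˣ →+ Multiset F := Multiset.mapAddMonoidHom Units.val
variable (F) in
def hyp : Multiset Fˣ := {1, -1}
def pf (p : Fˣ × (Fin 3 → Fˣ)) : Multiset Fˣ := Finset.univ.val.map fun S : Finset (Fin 3) => p.1 * ∏ u ∈ S, p.2 u
def ss (n : ℕ) (L : List (Fˣ × (Fin 3 → Fˣ))) : Multiset Fˣ := n • hyp F + (L.map pf).sum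
theorem ss_add (n n' : ℕ) (L L' : List (Fˣ × (Fin 3 → Fˣ))) : ss n L + ss n' L' = ss (n + n') (L ++ L') := by
  simp only [ss, List.map_append, List.sum_append, add_smul]; abel
theorem ss_zero : ss 0 ([] : List (Fˣ × (Fin 3 → Fˣ))) = 0 := by simp [ss]
def RR (M N : Multiset Fˣ) : Prop := ∃ n L n' L', Iso (vm F (M + ss n L)) (vm F (N + ss n' L'))
theorem rr_of {M N : Multiset Fˣ} (h : Iso (vm F M) (vm F N)) : RR M N := ⟨0, [], 0, [], by simpa [ss_zero] using h⟩
variable (F) in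
def cn : AddCon (Multiset Fˣ) where
  r := RR
  iseqv := ⟨fun M => rr_of (iso_refl _), fun ⟨a, b, c, d, h⟩ => ⟨c, d, a, b, iso_symm h⟩, by
    rintro M N P ⟨a, b, c, d, h⟩ ⟨a', b', c', d', h'⟩
    refine ⟨a + a', b ++ b', c + c', d ++ d', ?_⟩
    rw [← ss_add, ← ss_add]
    have h1 := iso_add h (iso_refl (vm F (ss a' b')))
    have h2 := iso_add h' (iso_refl (vm F (ss c d)))
    rw [← map_add, ← map_add] at h1 h2
    refine iso_trans ?_ (iso_trans h1 (iso_trans ?_ (iso_trans h2 ?_)))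
    · rw [add_assoc]; exact iso_refl _
    · rw [add_assoc, add_assoc, add_comm (ss c d)]; exact iso_refl _
    · rw [add_assoc, add_comm (ss c' d')]; exact iso_refl _⟩
  add' := by
    rintro M N P Q ⟨a, b, c, d, h⟩ ⟨a', b', c', d', h'⟩
    refine ⟨a + a', b ++ b', c + c', d ++ d', ?_⟩
    rw [← ss_add, ← ss_add, add_add_add_comm, add_add_add_comm N, map_add, map_add (vm F) (N + _)]
    exact iso_add h h'
theorem neg_iso (h2 : (2:F) ≠ 0) (M : Multiset Fˣ) : Iso (vm F (M + M.map (- ·))) (vm F (M.card • hyp F)) := by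
  induction M using Multiset.induction with
  | empty => simpa using iso_refl _
  | cons x M ih =>
    have : Iso (vm F {x, -x}) (vm F (hyp F)) := by
      refine iso_two (α := (1 + x) / 2) (β := (1 - x) / 2) (γ := (1 - x) / 2) (δ := (1 + x) / 2) ?_ fun s t => ?_
      · convert x.ne_zero using 1; field_simp; ring
      · simp; field_simp; ring
    rw [Multiset.map_cons, Multiset.card_cons, add_smul, one_smul, map_add (vm F) (_ • _)]
    have h := iso_add ih this
    rw [← map_add] at h
    convert h using 2
    rw [Multiset.insert_eq_cons, ← Multiset.singleton_add, ← Multiset.singleton_add (-x), ← Multiset.singleton_add x]; abel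
variable (F) in
def W := (cn F).Quotient
instance : AddCommMonoid (W F) := inferInstanceAs (AddCommMonoid (cn F).Quotient)
variable (F) in
def mw : Multiset Fˣ →+ W F := (cn F).mk'
theorem mw_iso {M N : Multiset Fˣ} (h : Iso (vm F M) (vm F N)) : mw F M = mw F N := (AddCon.eq _).2 (rr_of h)
theorem mw_ss (n L) : mw F (ss n L) = 0 := by
  rw [← map_zero (mw F)]
  refine (AddCon.eq (cn F)).2 ⟨0, [], n, L, ?_⟩
  rw [ss_zero, zero_add, add_zero]; exact iso_refl _
theorem mw_neg (h2 : (2:F) ≠ 0) (M : Multiset Fˣ) : mw F (M.map (- ·)) + mw F M = 0 := by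
  rw [add_comm, ← map_add, mw_iso (neg_iso h2 M)]
  have := mw_ss (F := F) M.card []
  rwa [ss, List.map_nil, List.sum_nil, add_zero] at this
theorem pf_neg (p : Fˣ × (Fin 3 → Fˣ)) : (pf p).map (- ·) = pf (-p.1, p.2) := by simp [pf, neg_mul]
theorem ss_neg (L : List (Fˣ × (Fin 3 → Fˣ))) : ((L.map pf).sum).map (- ·) = ((L.map fun p => (-p.1, p.2)).map pf).sum := by
  induction L with
  | nil => simp
  | cons p L ih => simp [ih, pf_neg]
theorem mw_zero (h2 : (2:F) ≠ 0) {M : Multiset Fˣ} (h : mw F M = 0) : ∃ (n n' : ℕ) (L : _), Iso (vm F (M + n • hyp F)) (vm F (ss n' L)) := by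
  obtain ⟨a, b, c, d, h⟩ := (AddCon.eq (cn F)).1 (h.trans (map_zero (mw F)).symm)
  let P := (b.map pf).sum
  have h1 := iso_add h (iso_refl (vm F (P.map (- ·))))
  rw [← map_add, ← map_add, zero_add] at h1
  refine ⟨a + P.card, c, d ++ (b.map fun p => (-p.1, p.2)), ?_⟩
  refine iso_trans ?_ (iso_trans h1 ?_)
  · have := iso_add (iso_refl (vm F (M + a • hyp F))) (iso_symm (neg_iso h2 P))
    rw [← map_add, ← map_add] at this
    convert this using 2
    · rw [add_smul]; abel
    · simp only [ss, P]; abel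
  · convert iso_refl _ using 2
    simp only [ss, P]
    rw [ss_neg, List.map_append, List.sum_append]; abel
noncomputable instance [h2 : Fact ((2:F) ≠ 0)] : AddCommGroup (W F) :=
  have ex : ∀ x : W F, ∃ y, y + x = 0 := fun x => by
    obtain ⟨M, rfl⟩ := AddCon.mk'_surjective x
    exact ⟨_, mw_neg h2.1 M⟩
  letI : Neg (W F) := ⟨fun x => (ex x).choose⟩
  { (inferInstance : AddCommMonoid (W F)) with
    neg := fun x => (ex x).choose
    neg_add_cancel := fun x => (ex x).choose_spec
    zsmul := zsmulRec }
end
end Mk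

namespace Mk
section
variable {F : Type} [Field F]
open Classical in
noncomputable def bk (x : F) : W F := if h : x = 0 then 0 else mw F {Units.mk0 x h}
theorem bk_u (x : Fˣ) : bk (x : F) = mw F {x} := by rw [bk, dif_neg x.ne_zero, Units.mk0_val]
theorem mw_sum (M : Multiset Fˣ) : mw F M = ((vm F M).map bk).sum := by
  induction M using Multiset.induction with
  | empty => simp
  | cons x M ih => rw [← Multiset.singleton_add, map_add, map_add, Multiset.map_add, Multiset.sum_add, ih]; simp [vm, bk_u]
theorem bk_two {x y z w : F} (hx : x ≠ 0) (hy : y ≠ 0) (hz : z ≠ 0) (hw : w ≠ 0) (h : Iso {x, y} {z, w}) : bk x + bk y = bk z + bk w := by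
  have := mw_iso (M := {Units.mk0 x hx, Units.mk0 y hy}) (N := {Units.mk0 z hz, Units.mk0 w hw}) h
  rw [mw_sum, mw_sum] at this
  simpa [vm] using this
theorem bk_add {x y : F} (hx : x ≠ 0) (hy : y ≠ 0) (h : x + y ≠ 0) : bk x + bk y = bk (x + y) + bk (x * y * (x + y)) :=
  (bk_two h (by simp [*]) hx hy (iso_two (α := 1) (β := y) (γ := 1) (δ := -x) (by convert neg_ne_zero.2 h using 1; ring) fun s t => by ring)).symm
variable [h2 : Fact ((2:F) ≠ 0)]
theorem bk_sq {x t : F} (hx : x ≠ 0) (ht : t ≠ 0) : bk (x * t ^ 2) = bk x :=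
  add_right_cancel (bk_two (y := 1) (w := 1) (by simp [*]) one_ne_zero hx one_ne_zero (iso_two (α := t) (β := 0) (γ := 0) (δ := 1) (by simpa) fun s t => by ring))
theorem bk_neg (x : F) : bk (-x) = -bk x := by
  by_cases hx : x = 0
  · simp [hx, bk]
  have := mw_neg h2.1 {Units.mk0 x hx}
  rw [mw_sum, mw_sum] at this
  exact eq_neg_of_add_eq_zero_left (by simpa [vm] using this)
theorem uf3 : (Finset.univ : Finset (Finset (Fin 3))).val = (({∅, {0}, {1}, {0, 1}, {2}, {0, 2}, {1, 2}, {0, 1, 2}} : Multiset (Finset (Fin 3)))) := by decide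
theorem bk_pf {c a b e : F} (hc : c ≠ 0) (ha : a ≠ 0) (hb : b ≠ 0) (he : e ≠ 0) :
    bk c + bk (c * a) + bk (c * b) + bk (c * (a * b)) + bk (c * e) + bk (c * (a * e)) + bk (c * (b * e)) + bk (c * (a * (b * e))) = 0 := by
  have := mw_ss (F := F) 0 [(Units.mk0 c hc, ![Units.mk0 a ha, Units.mk0 b hb, Units.mk0 e he])]
  rw [mw_sum, ss, zero_smul, zero_add, List.map_singleton, List.sum_singleton, pf, uf3] at this
  simpa [vm, add_assoc] using this
open Classical in
noncomputable def s2 (a b : F) : W F := if a = 0 ∨ b = 0 then 0 else bk 1 - bk a - bk b + bk (a * b)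
theorem s2_eq {a b : F} (ha : a ≠ 0) (hb : b ≠ 0) : s2 a b = bk 1 - bk a - bk b + bk (a * b) := if_neg (by simp [*])
theorem s2_comm (a b : F) : s2 a b = s2 b a := by
  by_cases ha : a = 0 <;> by_cases hb : b = 0 <;> simp [s2, ha, hb, mul_comm a, sub_right_comm]
theorem s2_mul {x y w : F} (hx : x ≠ 0) (hy : y ≠ 0) (hw : w ≠ 0) : s2 (x * y) w = s2 x w + s2 y w := by
  have := bk_pf (one_ne_zero) (neg_ne_zero.2 hx) (neg_ne_zero.2 hy) (neg_ne_zero.2 hw)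
  simp only [one_mul, neg_mul_neg, mul_neg, neg_mul, neg_neg, bk_neg] at this
  rw [s2_eq (mul_ne_zero hx hy) hw, s2_eq hx hw, s2_eq hy hw, mul_assoc]
  linear_combination (norm := abel) -this
theorem s2_sym : IsSym (s2 : F → F → W F) where
  zl y := by simp [s2]
  zr y := by simp [s2]
  ml x y w hx hy hw := s2_mul hx hy hw
  mr x y w hx hy hw := by rw [s2_comm, s2_mul hx hy hw, s2_comm x, s2_comm y]
  s x y hx hy h := by
    have := bk_add hx hy (by rw [h]; exact one_ne_zero)
    rw [h, mul_one] at this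
    rw [s2_eq hx hy]; linear_combination (norm := abel) -this
noncomputable def sK : K2 F →+ W F := K2.lift s2 s2_sym
theorem sK_st {a b : F} (ha : a ≠ 0) (hb : b ≠ 0) : sK (st a b) = bk 1 - bk a - bk b + bk (a * b) := by rw [sK, K2.lift_st, s2_eq ha hb]
theorem sK_two (u : K2 F) : sK u + sK u = 0 := by
  induction u using K2.ind with
  | h0 => simp
  | h1 x y hx hy =>
    have := bk_pf (one_ne_zero) (one_ne_zero) (neg_ne_zero.2 hx) (neg_ne_zero.2 hy)
    simp only [one_mul, neg_mul_neg, bk_neg] at this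
    rw [sK_st hx hy, ← this]; abel
  | hn x h => rw [map_neg, ← neg_add, h, neg_zero]
  | ha x y h h' => rw [map_add, add_add_add_comm, h, h', add_zero]
theorem sK_D {u : K2 F} (h : u ∈ DD F) : sK u = 0 := by
  obtain ⟨w, rfl⟩ := h
  rw [map_add, sK_two]
theorem bk_sc {e a b : F} (he : e ≠ 0) (ha : a ≠ 0) (hb : b ≠ 0) : bk e - bk (e * a) - bk (e * b) + bk (e * (a * b)) = sK (st a b) := by
  have := bk_pf (one_ne_zero) (neg_ne_zero.2 he) (neg_ne_zero.2 ha) (neg_ne_zero.2 hb)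
  simp only [one_mul, neg_mul_neg, mul_neg, neg_mul, neg_neg, bk_neg] at this
  rw [sK_st ha hb]
  linear_combination (norm := abel) -this
theorem bk_l (l : List F) (he : Even l.length) (hl : ∀ z ∈ l, z ≠ 0) :
    ∀ e c : F, e ≠ 0 → c ≠ 0 → (l.map fun z => bk (e * c * z)).sum = bk e - bk (e * dl l) - sK (xi c l) := by
  refine two_ind (P := fun l => ∀ e c : F, e ≠ 0 → c ≠ 0 → (l.map fun z => bk (e * c * z)).sum = bk e - bk (e * dl l) - sK (xi c l))
    (fun e c he hc => by simp [xi, dl]) (fun x y l hx hy el nl ih e c he hc => ?_) l he hl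
  have hx' := mul_ne_zero hc hx
  have hy' := mul_ne_zero hc hy
  have hd := dl_ne l el nl
  have i1 := ih (e * -((c * x) * (c * y))) (-(c * x * y)⁻¹) (by simp [*]) (by simp [*])
  have e1 : e * -((c * x) * (c * y)) * -(c * x * y)⁻¹ = e * c := by field_simp
  rw [e1] at i1
  have e2 : e * -((c * x) * (c * y)) * dl l = e * (-(x * y) * dl l) * c ^ 2 := by ring
  rw [e2, bk_sq (by simp [*]) hc] at i1
  have i2 := bk_sc he hx' hy'
  simp only [List.map_cons, List.sum_cons, xi, dl, map_add]
  rw [i1, ← i2, mul_neg, bk_neg, mul_assoc e c x, mul_assoc e c y]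
  abel
theorem mw_l {M : Multiset Fˣ} {l : List F} {t : F} (hM : vm F M = l) (he : Even l.length) (hl : ∀ z ∈ l, z ≠ 0) (hd : dl l = t ^ 2) (hx : xi 1 l ∈ DD F) : mw F M = 0 := by
  have ht : t ≠ 0 := fun e => dl_ne l he hl (by rw [hd, e]; simp)
  have := bk_l l he hl 1 1 one_ne_zero one_ne_zero
  rw [sK_D hx, hd, bk_sq one_ne_zero ht] at this
  rw [mw_sum, hM]
  simpa using this
end
end Mk

namespace Mk
open scoped Quaternion
section
variable {F : Type} [Field F]
theorem uv_hyp (n : ℕ) : Finset.univ.val.map (hypForm F n) = n • ({1, -1} : Multiset F) := by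
  induction n with
  | zero => rfl
  | succ n ih =>
    rw [Fin.univ_val_map] at ih ⊢
    change ((List.ofFn (n := 2 * n + 1 + 1) (hypForm F (n + 1)) : List F) : Multiset F) = _
    rw [List.ofFn_succ, List.ofFn_succ, add_smul, one_smul, ← ih, add_comm (Multiset.ofList _)]
    have : (fun i : Fin (2 * n) => hypForm F (n + 1) i.succ.succ) = hypForm F n := by
      ext i; simp [hypForm, add_assoc]
    change _ ::ₘ _ ::ₘ ((List.ofFn (fun i : Fin (2 * n) => hypForm F (n + 1) i.succ.succ) : List F) : Multiset F) = _
    rw [this]; simp [hypForm]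
def pg (p : F × (Fin 3 → F)) : Multiset F := Finset.univ.val.map fun S : Finset (Fin 3) => p.1 * ∏ u ∈ S, p.2 u
theorem uv_pf (t : ℕ) (p : Fin t → F × (Fin 3 → F)) :
    Finset.univ.val.map (fun q : Fin t × Finset (Fin 3) => (p q.1).1 * ∏ u ∈ q.2, (p q.1).2 u) = (Finset.univ.val.map fun s => pg (p s)).sum := by
  rw [← Finset.univ_product_univ, Finset.product_val]
  simp only [SProd.sprod, Multiset.product]
  rw [Multiset.map_bind]
  simp only [Multiset.map_map, Multiset.bind, Multiset.join, pg]; rfl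
theorem NN_ms (T : Multiset (F × (Fin 3 → F))) (h : ∀ p ∈ T, p.1 ≠ 0 ∧ ∀ u, p.2 u ≠ 0) : ∃ L : List F, NN L ∧ (L : Multiset F) = (T.map pg).sum := by
  induction T using Multiset.induction with
  | empty => exact ⟨[], NN_nil, rfl⟩
  | cons p T ih =>
    obtain ⟨L, hL, e⟩ := ih fun p hp => h p (by simp [hp])
    obtain ⟨h1, h3⟩ := h p (by simp)
    refine ⟨_, NN_pf hL h1 (h3 0) (h3 1) (h3 2), ?_⟩
    rw [Multiset.map_cons, Multiset.sum_cons, ← e, pg, uf3]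
    simp only [← Multiset.cons_coe, Multiset.insert_eq_cons, Multiset.map_cons, Multiset.map_singleton, Multiset.cons_add, Multiset.singleton_add]
    simp [mul_assoc, mul_comm, mul_left_comm]
theorem NN_h {L : List F} (h : NN L) (n : ℕ) : ∃ L' : List F, NN L' ∧ (L' : Multiset F) = L + n • ({1, -1} : Multiset F) := by
  induction n with
  | zero => exact ⟨L, h, by simp⟩
  | succ n ih =>
    obtain ⟨L', h', e⟩ := ih
    refine ⟨_, NN_hyp h', ?_⟩
    rw [add_smul, one_smul, ← add_assoc, ← e, add_comm]; rfl
theorem hl (l : List F) (he : Even l.length) (hl : ∀ z ∈ l, z ≠ 0) (n : ℕ) :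
    ∃ l' : List F, Even l'.length ∧ (∀ z ∈ l', z ≠ 0) ∧ xi 1 l' = xi 1 l ∧ dl l' = dl l ∧ (l' : Multiset F) = l + n • ({1, -1} : Multiset F) := by
  induction n with
  | zero => exact ⟨l, he, hl, rfl, rfl, by simp⟩
  | succ n ih =>
    obtain ⟨l', a, b, c, d, e⟩ := ih
    refine ⟨1 :: -1 :: l', by simpa [Nat.even_add_one] using a, by simpa using b, ?_, by simp [dl, d], ?_⟩
    · simp [xi, st_one_left, c]
    · rw [add_smul, one_smul, ← add_assoc, ← e, add_comm]; rfl
theorem cl_l (h2 : (2:F) ≠ 0) {ι : Type} [Fintype ι] {d : ι → F} {l : List F} (h : Finset.univ.val.map d = l) (he : Even l.length) (hl : ∀ z ∈ l, z ≠ 0) :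
    br (CliffordAlgebra (diagQF F d)) = H h2 (xi 1 l) := by
  rw [← cl_xi h2 l he hl 1 one_ne_zero]
  refine cl_iso (fi_ms ?_)
  simp only [one_mul]
  rw [h]; exact (uv_get l).symm
theorem fi_l (h2 : (2:F) ≠ 0) {ι κ : Type} [Fintype ι] [Fintype κ] {d : ι → F} {e : κ → F} {l l' : List F} (h : Finset.univ.val.map d = l) (h' : Finset.univ.val.map e = l')
    (he : Even l.length) (hl : ∀ z ∈ l, z ≠ 0) (he' : Even l'.length) (hl' : ∀ z ∈ l', z ≠ 0) (q : FormIsom F d e) : ∃ t, dl l = t ^ 2 * dl l' := by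
  obtain ⟨a, t, b⟩ := fi_det h2 q
  refine ⟨t, ?_⟩
  have c1 : Fintype.card ι = l.length := by simpa using congrArg Multiset.card h
  have c2 : Fintype.card κ = l'.length := by simpa using congrArg Multiset.card h'
  have p1 : ∏ i, d i = l.prod := by rw [Finset.prod, h, Multiset.prod_coe]
  have p2 : ∏ i, e i = l'.prod := by rw [Finset.prod, h', Multiset.prod_coe]
  rw [dl_prod l he hl, dl_prod l' he' hl', ← p1, ← p2, ← c1, ← c2, a, b]; ring
theorem H_eq (h2 : (2:F) ≠ 0) {l : List F} {s1 s2 t : F} (he : Even l.length) (hl : ∀ z ∈ l, z ≠ 0) (h1 : s1 ≠ 0) (h3 : s2 ≠ 0) (h : -(s1 * s2) * dl l = t ^ 2) :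
    H h2 (xi 1 (s1 :: s2 :: l)) = 1 ↔ H h2 (xi 1 l) = br ℍ[F,-s1,dl l] := by
  have := H_of h2 (show xi 1 (s1 :: s2 :: l) - (xi 1 l + st (-s1) (dl l)) ∈ DD F by rw [← sub_sub]; exact xi_two l he hl h1 h3 h)
  rw [this, H_add, ← H_st h2 (neg_ne_zero.2 h1) (dl_ne l he hl)]
  have k := H_two h2 (st (-s1) (dl l))
  constructor
  · intro h; rw [← mul_one (H h2 (xi 1 l)), ← k, ← mul_assoc, h, one_mul]
  · intro h; rw [h, k]
theorem fin8 (hchar : ringChar F ≠ 2) (m : ℕ) (hm : 4 ≤ m) (heven : Even m) (d : Fin m → F) (hreg : ∀ t, d t ≠ 0) :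
    isIneighbor F 3 d 2 ↔ ∃ a : F, a ≠ 0 ∧ brauerEquiv F (CliffordAlgebra (diagQF F d)) (ℍ[F, a, (-1 : F) ^ (m * (m - 1) / 2) * ∏ t, d t]) := by
  have h2 : (2:F) ≠ 0 := Ring.two_ne_zero hchar
  haveI : Fact ((2:F) ≠ 0) := ⟨h2⟩
  let l := List.ofFn d
  have hu : Finset.univ.val.map d = l := Fin.univ_val_map d
  have he : Even l.length := by simpa [l] using heven
  have hl0 : ∀ z ∈ l, z ≠ 0 := fun z hz => by obtain ⟨i, rfl⟩ := (List.mem_ofFn' _ _).1 hz; exact hreg i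
  have hD : (-1 : F) ^ (m * (m - 1) / 2) * ∏ t, d t = dl l := by
    rw [dl_prod l he hl0, List.prod_ofFn, List.length_ofFn]
    congr 1
    obtain ⟨j, rfl⟩ := heven
    obtain ⟨i, rfl⟩ : ∃ i, j = i + 1 := ⟨j - 1, by lia⟩
    have : (i + 1 + (i + 1)) * (i + 1 + (i + 1) - 1) / 2 = (i + 1) + 2 * (i * (i + 1)) := by
      rw [show i + 1 + (i + 1) - 1 = 2 * i + 1 by lia, show (i + 1 + (i + 1)) * (2 * i + 1) = ((i + 1) + 2 * (i * (i + 1))) * 2 by ring, Nat.mul_div_cancel _ (by norm_num)]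
    rw [this, pow_add, pow_mul (-1 : F) 2]
    rw [show (i + 1 + (i + 1)) / 2 = i + 1 by lia]; simp
  have hd := dl_ne l he hl0
  generalize ((-1 : F) ^ (m * (m - 1) / 2) * ∏ t, d t) = E at hD ⊢
  subst hD
  simp only [← br_eq]
  rw [cl_l h2 hu he hl0]
  have key (σ : Fin 2 → F) : Finset.univ.val.map (Sum.elim d σ) = ((σ 0 :: σ 1 :: l : List F) : Multiset F) := by
    rw [uv_sum, hu, Fin.univ_val_map, List.ofFn_succ, List.ofFn_succ, List.ofFn_zero, add_comm]; rfl
  have kn (σ : Fin 2 → F) (hσ : ∀ t, σ t ≠ 0) : Even (σ 0 :: σ 1 :: l).length ∧ ∀ z ∈ (σ 0 :: σ 1 :: l), z ≠ 0 :=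
    ⟨by simpa [Nat.even_add_one] using he, by simpa [hσ 0, hσ 1] using hl0⟩
  constructor
  · rintro ⟨-, σ, hσ, t, c, a, hc, ha, A, C, q⟩
    obtain ⟨n1, n2⟩ := kn σ hσ
    obtain ⟨L0, a1, a2, a3, a4, a5⟩ := hl _ n1 n2 A
    obtain ⟨L1, b1, b2⟩ := NN_ms (Finset.univ.val.map fun s : Fin t => (c s, a s)) (by simpa using fun s => ⟨hc s, ha s⟩)
    obtain ⟨L2, ⟨c1, c2, c3, T, c4⟩, c5⟩ := NN_h b1 C
    have u0 := (uv_sum (Sum.elim d σ) (hypForm F A)).trans (by rw [key, uv_hyp, ← a5])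
    have u1 := (uv_sum (fun p : Fin t × Finset (Fin 3) => c p.1 * ∏ u ∈ p.2, a p.1 u) (hypForm F C)).trans
      (by rw [uv_pf t fun s => (c s, a s), uv_hyp, show (Finset.univ.val.map fun s : Fin t => pg (c s, a s)).sum = L1 by rw [b2, Multiset.map_map]; rfl, ← c5])
    obtain ⟨T', hT⟩ := fi_l h2 u0 u1 a1 a2 c1 c2 q
    have hH := cl_iso q
    rw [cl_l h2 u0 a1 a2, cl_l h2 u1 c1 c2, H_D h2 (c3 1 one_ne_zero), a3] at hH
    refine ⟨-σ 0, neg_ne_zero.2 (hσ 0), (H_eq h2 he hl0 (hσ 0) (hσ 1) (t := T' * T) ?_).1 hH⟩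
    rw [mul_pow, ← c4, ← hT, a4]; rfl
  · rintro ⟨a, ha, h⟩
    let σ : Fin 2 → F := ![-a, a * dl l]
    have hσ : ∀ t, σ t ≠ 0 := by rw [Fin.forall_fin_two]; simp [σ, ha, hd]
    refine ⟨by lia, σ, hσ, ?_⟩
    obtain ⟨n1, n2⟩ := kn σ hσ
    have ht : -(σ 0 * σ 1) * dl l = (a * dl l) ^ 2 := by simp [σ]; ring
    have hx := inj h2 ((H_eq h2 he hl0 (hσ 0) (hσ 1) ht).2 (by rw [show -σ 0 = a by simp [σ]]; exact h))
    have hr : ∀ i, Sum.elim d σ i ≠ 0 := by rintro (i | i); exacts [hreg i, hσ i]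
    let M : Multiset Fˣ := Finset.univ.val.map fun i => Units.mk0 (Sum.elim d σ i) (hr i)
    have hM : vm F M = Finset.univ.val.map (Sum.elim d σ) := by simp [vm, M, Multiset.map_map, Function.comp_def]
    obtain ⟨n, n', L, hI⟩ := mw_zero h2 (mw_l (hM.trans (key σ)) n1 n2 (t := a * dl l) (by rw [dl, ht]) hx)
    have hh : vm F (hyp F) = {1, -1} := by simp [vm, hyp]
    refine ⟨L.length, fun s => (L.get s).1, fun s u => (L.get s).2 u, fun s => Units.ne_zero _, fun s u => Units.ne_zero _, n, n', ?_⟩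
    refine (iso_iff ?_ ?_).2 hI
    · rw [uv_sum, uv_hyp, map_add, map_nsmul, hh, hM]
    · rw [uv_sum, uv_hyp, ss, map_add, map_nsmul, hh, add_comm]
      congr 1
      rw [uv_pf L.length fun s => (((L.get s).1 : F), fun u => ((L.get s).2 u : F)), map_list_sum, Fin.univ_val_map, Multiset.sum_coe]
      congr 1
      apply List.ext_get
      · simp
      · intro i h1 h2; simp [pg, pf, vm]
end
end Mk

/-- **Proposition (I³-neighbors of complementary dimension 2).**  Over a field `k` of
characteristic ≠ 2, an even-dimensional quadratic form `q` of dimension ≥ 4 is an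
`I³`-neighbor of complementary dimension 2 if and only if the Witt invariant `c(q)`
(the Brauer class of the Clifford algebra `C(q)`) equals the class of the quaternion
algebra `(a, d_± q / k)` for some `a ∈ k^×`, where
`d_± q = (-1)^{(dim q)(dim q - 1)/2}·det q` is the signed determinant of `q`. -/
theorem statement8 (k : Type) [Field k] (hchar : ringChar k ≠ 2)
    (m : ℕ) (hm : 4 ≤ m) (heven : Even m) (d : Fin m → k) (hreg : ∀ t, d t ≠ 0) :
    isIneighbor k 3 d 2 ↔
      ∃ a : k, a ≠ 0 ∧
        brauerEquiv k (CliffordAlgebra (diagQF k d))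
          (ℍ[k, a, (-1 : k) ^ (m * (m - 1) / 2) * ∏ t, d t]) := by
  exact Mk.fin8 hchar m hm heven d hreg
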